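/- Assume P is a uniformly elliptic i.i.d. probability measure on Ω satisfying condition (𝒫) (with d ≥ 4). Then there is a constant C < ∞ such that, for all large enough n ∈ ℕ and all x, y, z, w ∈ ℤ^d with ‖x−y‖₁ = 1 and ‖z−w‖₁ = 1: (1) ℙ^z(X_n = x) ≤ C n^{−d/2}; (2) |ℙ^z(X_n = x) − ℙ^z(X_{n+1} = y)| ≤ C n^{−(d+1)/2}; (3) |ℙ^z(X_n = x) − ℙ^w(X_{n+1} = x)| ≤ C n^{−(d+1)/2}. Moreover, for every ε > 0 there is C < ∞ such that for every n and every partition Π_n^{(ε)} of ℤ^d into cubes of side length n^ε, Σ_{Δ∈Π_n^{(ε)}} Σ_{x∈Δ, x↔n} [max_{y∈Δ} ℙ^0(X_n = y) − ℙ^0(X_n = x)] ≤ C n^{−1/2 + 3dε}. -/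

import Mathlib

open MeasureTheory Filter
open scoped ENNReal

noncomputable section

namespace RWRE

/-- sites of the lattice `ℤ^d`. -/
abbrev Site (d : ℕ) := Fin d → ℤ

/-- index set for the `2d` nearest-neighbour steps: `(i, true) ↦ e_i`, `(i, false) ↦ -e_i`. -/
abbrev StepIdx (d : ℕ) := Fin d × Bool

/-- the signed unit vector corresponding to a step index. -/
def stepVec {d : ℕ} (s : StepIdx d) : Site d :=
  fun j => if j = s.1 then (if s.2 then 1 else -1) else 0

/-- probability vectors on the `2d` nearest-neighbour steps. -/
abbrev EnvAt (d : ℕ) := {p : StepIdx d → ℝ // (∀ s, 0 ≤ p s) ∧ ∑ s, p s = 1}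

/-- the space of environments `Ω = (M_d)^{ℤ^d}`. -/
abbrev Env (d : ℕ) := Site d → EnvAt d

/-- the space of trajectories. -/
abbrev Path (d : ℕ) := ℕ → Site d

/-- the shift of the environment by `x`. -/
def shift {d : ℕ} (x : Site d) (ω : Env d) : Env d := fun y => ω (x + y)

/-- transition probability in environment `ω` from site `y` by increment `v`. -/
def envP {d : ℕ} (ω : Env d) (y v : Site d) : ℝ≥0∞ :=
  ∑ s : StepIdx d, if v = stepVec s then ENNReal.ofReal ((ω y).1 s) else 0

/-- `μ` is the quenched law of the walk started at `x` in the environment `ω`: a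
probability measure on path space whose cylinder probabilities are the products of
the transition probabilities of `ω`. -/
def IsQuenched {d : ℕ} (ω : Env d) (x : Site d) (μ : Measure (Path d)) : Prop :=
  IsProbabilityMeasure μ ∧
    ∀ (n : ℕ) (γ : ℕ → Site d),
      μ {f | ∀ i ≤ n, f i = γ i} =
        (if γ 0 = x then 1 else 0) *
          ∏ i ∈ Finset.range n, envP ω (γ i) (γ (i + 1) - γ i)

/-- `Pq` is a measurable family of quenched laws. -/
def IsQuenchedFamily {d : ℕ} (Pq : Env d → Site d → Measure (Path d)) : Prop :=
  (∀ ω x, IsQuenched ω x (Pq ω x)) ∧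
    ∀ (x : Site d) (A : Set (Path d)), MeasurableSet A →
      Measurable fun ω => Pq ω x A

/-- the annealed probability `ℙ^x(A) = ∫ P_ω^x(A) dP(ω)` of a path event. -/
def ann {d : ℕ} (P : Measure (Env d)) (Pq : Env d → Site d → Measure (Path d))
    (x : Site d) (A : Set (Path d)) : ℝ≥0∞ :=
  ∫⁻ ω, Pq ω x A ∂P

/-- the annealed expectation `𝔼^x[g]` of a real path functional. -/
def annE {d : ℕ} (P : Measure (Env d)) (Pq : Env d → Site d → Measure (Path d))
    (x : Site d) (g : Path d → ℝ) : ℝ :=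
  ∫ ω, (∫ f, g f ∂(Pq ω x)) ∂P

/-- `P` is an i.i.d. measure on the space of environments: its finite-dimensional
marginals are products of a fixed single-site probability measure. -/
def IsIID {d : ℕ} (P : Measure (Env d)) : Prop :=
  ∃ ν : Measure (EnvAt d), IsProbabilityMeasure ν ∧
    ∀ (s : Finset (Site d)) (B : Site d → Set (EnvAt d)),
      (∀ x, MeasurableSet (B x)) →
        P {ω | ∀ x ∈ s, ω x ∈ B x} = ∏ x ∈ s, ν (B x)

/-- uniform ellipticity of `P`. -/
def UniformlyElliptic {d : ℕ} (P : Measure (Env d)) : Prop :=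
  ∃ η : ℝ, 0 < η ∧ ∀ s : StepIdx d, P {ω : Env d | (ω 0).1 s < η} = 0

/-- a lattice point, viewed as a real vector. -/
def toR {d : ℕ} (x : Site d) : Fin d → ℝ := fun i => (x i : ℝ)

/-- inner product of a lattice point with a real direction. -/
def dotR {d : ℕ} (x : Site d) (ℓ : Fin d → ℝ) : ℝ := ∑ i, (x i : ℝ) * ℓ i

/-- the euclidean norm of a real vector. -/
def norm2R {d : ℕ} (ℓ : Fin d → ℝ) : ℝ := Real.sqrt (∑ i, ℓ i ^ 2)

/-- the event `{T_L^{(-ℓ)} < T_L^{(ℓ)}}` that the walk reaches level `L` in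
direction `-ℓ` strictly before reaching level `L` in direction `ℓ`. -/
def backtrackEvent {d : ℕ} (ℓ : Fin d → ℝ) (L : ℝ) : Set (Path d) :=
  {f | ∃ n, L ≤ dotR (f n) (-ℓ) ∧ ∀ m ≤ n, dotR (f m) ℓ < L}

/-- condition `(T_γ)` in the direction `ℓ₀`. -/
def CondTAt {d : ℕ} (P : Measure (Env d)) (Pq : Env d → Site d → Measure (Path d))
    (γ : ℝ) (ℓ₀ : Fin d → ℝ) : Prop :=
  ∃ ε : ℝ, 0 < ε ∧ ∀ ℓ : Fin d → ℝ, norm2R ℓ = 1 → norm2R (ℓ - ℓ₀) < ε →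
    ∃ C : ℝ, ∀ L : ℝ, 0 < L →
      ann P Pq 0 (backtrackEvent ℓ L) ≤ ENNReal.ofReal (C * Real.exp (-(L ^ γ)))

/-- condition `(T_γ)` in some direction. -/
def CondT {d : ℕ} (P : Measure (Env d)) (Pq : Env d → Site d → Measure (Path d))
    (γ : ℝ) : Prop :=
  ∃ ℓ₀ : Fin d → ℝ, norm2R ℓ₀ = 1 ∧ CondTAt P Pq γ ℓ₀

/-- condition `(𝒫)`: condition `(T_γ)` holds for some `γ ∈ (0,1)` in some direction. -/
def CondP {d : ℕ} (P : Measure (Env d)) (Pq : Env d → Site d → Measure (Path d)) : Prop :=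
  ∃ γ : ℝ, 0 < γ ∧ γ < 1 ∧ CondT P Pq γ

/-- condition `(𝒫)` in a given direction. -/
def CondPAt {d : ℕ} (P : Measure (Env d)) (Pq : Env d → Site d → Measure (Path d))
    (ℓ₀ : Fin d → ℝ) : Prop :=
  ∃ γ : ℝ, 0 < γ ∧ γ < 1 ∧ CondTAt P Pq γ ℓ₀

/-- `Q` is invariant with respect to the point of view of the particle. -/
def InvariantPOV {d : ℕ} (Q : Measure (Env d)) : Prop :=
  ∀ g : Env d → ℝ, Measurable g → (∃ C : ℝ, ∀ ω, |g ω| ≤ C) →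
    ∫ ω, (∑ s : StepIdx d, (ω 0).1 s * g (shift (stepVec s) ω)) ∂Q = ∫ ω, g ω ∂Q

/-- superpolynomial decay: `g N = N^{-ξ(1)}`. -/
def Superpoly (g : ℕ → ℝ) : Prop :=
  ∀ k : ℕ, Tendsto (fun N : ℕ => (N : ℝ) ^ k * g N) atTop (nhds 0)

/-- the first coordinate `⟨x, e₁⟩` of a lattice point. -/
def firstCoord {d : ℕ} (x : Fin d → ℤ) : ℤ := if h : 0 < d then x ⟨0, h⟩ else 0

/-- the first coordinate `⟨ℓ, e₁⟩` of a real vector. -/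
def firstCoordR {d : ℕ} (ℓ : Fin d → ℝ) : ℝ := if h : 0 < d then ℓ ⟨0, h⟩ else 0

/-- the first standard basis vector, as a real direction. -/
def e1R (d : ℕ) : Fin d → ℝ := fun i => if (i : ℕ) = 0 then 1 else 0

/-- `R_k(N) = ⌊exp((log log N)^{k+1})⌋`. -/
def Rk (k N : ℕ) : ℕ := ⌊Real.exp (Real.log (Real.log (N : ℝ)) ^ (k + 1))⌋₊

/-- the `ℓ¹`-norm of a lattice point. -/
def norm1 {d : ℕ} (x : Site d) : ℤ := ∑ i, |x i|

/-- the parallelogram `𝒫(z,N)` (relative to the asymptotic direction `ϑ`). -/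
def para {d : ℕ} (ϑ : Fin d → ℝ) (z : Site d) (N : ℕ) : Set (Site d) :=
  {x | |firstCoord (x - z)| < (N : ℤ) ^ 2 ∧
    ∀ i, |((x - z) i : ℝ) - (firstCoord (x - z) : ℝ) / firstCoordR ϑ * ϑ i|
      < (N : ℝ) * (Rk 5 N : ℝ)}

/-- the middle third `𝒫̃(z,N)` of the parallelogram. -/
def paraMid {d : ℕ} (ϑ : Fin d → ℝ) (z : Site d) (N : ℕ) : Set (Site d) :=
  {x | 3 * |firstCoord (x - z)| < (N : ℤ) ^ 2 ∧
    ∀ i, 3 * |((x - z) i : ℝ) - (firstCoord (x - z) : ℝ) / firstCoordR ϑ * ϑ i|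
      < (N : ℝ) * (Rk 5 N : ℝ)}

/-- the boundary `∂𝒫(z,N)`. -/
def paraBdry {d : ℕ} (ϑ : Fin d → ℝ) (z : Site d) (N : ℕ) : Set (Site d) :=
  {x | x ∉ para ϑ z N ∧ ∃ y ∈ para ϑ z N, norm1 (x - y) = 1}

/-- the right boundary `∂⁺𝒫(z,N)`. -/
def paraBdryPlus {d : ℕ} (ϑ : Fin d → ℝ) (z : Site d) (N : ℕ) : Set (Site d) :=
  {x | x ∈ paraBdry ϑ z N ∧ firstCoord (x - z) = (N : ℤ) ^ 2}

/-- the walk hits the set `A`. -/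
def hits {d : ℕ} (A : Set (Site d)) (f : Path d) : Prop := ∃ n, f n ∈ A

/-- the hitting time `T_A` of a set of sites. -/
def hitTime {d : ℕ} (A : Set (Site d)) (f : Path d) : ℕ := sInf {n | f n ∈ A}

/-- the hyperplane `H_M = {x : ⟨x,e₁⟩ = M}`. -/
def hyper {d : ℕ} (M : ℤ) : Set (Site d) := {x | firstCoord x = M}

/-- the event that the walk hits `A`, at a time belonging to `I`, and in a point of `Δ`. -/
def exitEvent {d : ℕ} (A Δ : Set (Site d)) (I : Set ℕ) : Set (Path d) :=
  {f | hits A f ∧ f (hitTime A f) ∈ Δ ∧ hitTime A f ∈ I}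

/-- the `d`-dimensional cube with corner `a` and side length `L`. -/
def cube {d : ℕ} (a : Site d) (L : ℕ) : Set (Site d) :=
  {x | ∀ i, a i ≤ x i ∧ x i < a i + (L : ℤ)}

/-- the same cube, as a finite set. -/
def cubeF {d : ℕ} (a : Site d) (L : ℕ) : Finset (Site d) :=
  Fintype.piFinset fun i => Finset.Ico (a i) (a i + (L : ℤ))

/-- a `(d-1)`-dimensional cube of side length `L` inside the hyperplane `H_m`. -/
def cubeHyp {d : ℕ} (m : ℤ) (a : Site d) (L : ℕ) : Set (Site d) :=
  {x | firstCoord x = m ∧ ∀ i : Fin d, (i : ℕ) ≠ 0 → a i ≤ x i ∧ x i < a i + (L : ℤ)}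

/-- the time interval `[t, t + L)`. -/
def interval (t L : ℕ) : Set ℕ := {n | t ≤ n ∧ n < t + L}

/-- `S` is the set of corners of a partition of `ℤ^d` into cubes of side length `L`. -/
def IsCubePartition {d : ℕ} (L : ℕ) (S : Set (Site d)) : Prop :=
  (∀ x : Site d, ∃ a ∈ S, x ∈ cube a L) ∧
    ∀ a ∈ S, ∀ b ∈ S, a ≠ b → Disjoint (cube a L) (cube b L)

/-- `t` is a regeneration time of the path `f` in direction `e₁`. -/
def IsRegen {d : ℕ} (f : Path d) (t : ℕ) : Prop :=
  (∀ s < t, firstCoord (f s) < firstCoord (f t)) ∧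
    firstCoord (f t) < firstCoord (f (t + 1)) ∧
    ∀ s, t + 1 < s → firstCoord (f (t + 1)) < firstCoord (f s)

/-- the `k`-th regeneration time `τ_k` (with the convention `τ₀ = 0`). -/
def regTime {d : ℕ} (f : Path d) : ℕ → ℕ
  | 0 => 0
  | k + 1 => sInf {t | regTime f k < t ∧ IsRegen f t}

/-- the event `B_N` that each of the first `N²` regeneration gaps is at most `R(N)`. -/
def BN {d : ℕ} (N : ℕ) : Set (Path d) :=
  {f | ∀ k, 1 ≤ k → k ≤ N ^ 2 → regTime f k - regTime f (k - 1) ≤ Rk 1 N}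

/-- `ϑ` is the asymptotic direction `lim Xₙ/‖Xₙ‖₂` of the walk, annealed a.s. -/
def DirSpeed {d : ℕ} (P : Measure (Env d)) (Pq : Env d → Site d → Measure (Path d))
    (ϑ : Fin d → ℝ) : Prop :=
  ann P Pq 0 {f | ¬ Tendsto (fun n => fun i => toR (f n) i / norm2R (toR (f n)))
    atTop (nhds ϑ)} = 0

/-- the σ-algebra generated by the environment in the half space `⟨z,e₁⟩ ≤ m`. -/
def sigmaUpTo (d : ℕ) (m : ℤ) : MeasurableSpace (Env d) :=
  MeasurableSpace.comap
    (fun ω => (fun z : {z : Site d // firstCoord z ≤ m} => ω z.1)) inferInstance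

/-! ### Finite paths and their quenched weights -/

/-- Total displacement of a list of steps. -/
def disp {d : ℕ} (l : List (StepIdx d)) : Site d := (l.map stepVec).sum

@[simp] lemma disp_nil {d : ℕ} : disp ([] : List (StepIdx d)) = 0 := rfl

@[simp] lemma disp_cons {d : ℕ} (s : StepIdx d) (l : List (StepIdx d)) :
    disp (s :: l) = stepVec s + disp l := by simp [disp]

@[simp] lemma disp_append {d : ℕ} (l₁ l₂ : List (StepIdx d)) :
    disp (l₁ ++ l₂) = disp l₁ + disp l₂ := by simp [disp]

lemma disp_take_add_drop {d : ℕ} (l : List (StepIdx d)) (i : ℕ) :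
    disp (l.take i) + disp (l.drop i) = disp l := by
  rw [← disp_append, List.take_append_drop]

/-- Quenched probability of following the steps of a list. -/
def wt {d : ℕ} (ω : Env d) : Site d → List (StepIdx d) → ℝ≥0∞
  | _, [] => 1
  | x, s :: l => ENNReal.ofReal ((ω x).1 s) * wt ω (x + stepVec s) l

@[simp] lemma wt_nil {d : ℕ} (ω : Env d) (x : Site d) : wt ω x [] = 1 := rfl

lemma wt_cons {d : ℕ} (ω : Env d) (x : Site d) (s : StepIdx d) (l : List (StepIdx d)) :
    wt ω x (s :: l) = ENNReal.ofReal ((ω x).1 s) * wt ω (x + stepVec s) l := rfl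

lemma wt_append {d : ℕ} (ω : Env d) (x : Site d) (l₁ l₂ : List (StepIdx d)) :
    wt ω x (l₁ ++ l₂) = wt ω x l₁ * wt ω (x + disp l₁) l₂ := by
  induction l₁ generalizing x with
  | nil => simp
  | cons s l ih => simp [wt_cons, ih, mul_assoc, add_assoc]

lemma sum_env {d : ℕ} (ω : Env d) (x : Site d) :
    ∑ s, ENNReal.ofReal ((ω x).1 s) = 1 := by
  rw [← ENNReal.ofReal_sum_of_nonneg (fun s _ => (ω x).2.1 s), (ω x).2.2, ENNReal.ofReal_one]

lemma env_le_one {d : ℕ} (ω : Env d) (x : Site d) (s : StepIdx d) :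
    ENNReal.ofReal ((ω x).1 s) ≤ 1 := by
  rw [← sum_env ω x]
  exact Finset.single_le_sum (f := fun s => ENNReal.ofReal ((ω x).1 s))
    (fun _ _ => zero_le) (Finset.mem_univ s)

lemma wt_le_one {d : ℕ} (ω : Env d) (x : Site d) (l : List (StepIdx d)) : wt ω x l ≤ 1 := by
  induction l generalizing x with
  | nil => simp
  | cons s l ih =>
    rw [wt_cons]; exact mul_le_one' (env_le_one ω x s) (ih _)

/-- Quenched weighted sum of a functional of finite paths. -/
def qw {d : ℕ} (ω : Env d) (x : Site d) (F : List (StepIdx d) → ℝ≥0∞) : ℝ≥0∞ :=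
  ∑' l, wt ω x l * F l

/-- Indicator function with values in `ℝ≥0∞`. -/
def ind {α : Type*} (T : Set α) : α → ℝ≥0∞ := T.indicator 1

@[simp] lemma ind_of_mem {α : Type*} {T : Set α} {a : α} (h : a ∈ T) : ind T a = 1 := by
  simp [ind, h]

@[simp] lemma ind_of_notMem {α : Type*} {T : Set α} {a : α} (h : a ∉ T) : ind T a = 0 := by
  simp [ind, h]

lemma ind_le_one {α : Type*} (T : Set α) (a : α) : ind T a ≤ 1 := by
  by_cases h : a ∈ T <;> simp [h]

lemma ind_mono {α β : Type*} {T : Set α} {T' : Set β} {a : α} {b : β} (h : a ∈ T → b ∈ T') :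
    ind T a ≤ ind T' b := by
  by_cases ha : a ∈ T
  · simp [ha, h ha]
  · simp [ha]

/-- Sum of a functional over the prefixes of a list. -/
def cnt {d : ℕ} (F : List (StepIdx d) → ℝ≥0∞) (l : List (StepIdx d)) : ℝ≥0∞ :=
  ∑ k ∈ Finset.range (l.length + 1), F (l.take k)

lemma cnt_cons {d : ℕ} (F : List (StepIdx d) → ℝ≥0∞) (s : StepIdx d) (l : List (StepIdx d)) :
    cnt F (s :: l) = F [] + cnt (fun l => F (s :: l)) l := by
  unfold cnt
  rw [List.length_cons, Finset.sum_range_succ']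
  simp [add_comm]

lemma tsum_list {α : Type*} [Fintype α] (f : List α → ℝ≥0∞) :
    ∑' l, f l = f [] + ∑ s, ∑' l, f (s :: l) := by
  classical
  have hinj : Function.Injective fun p : α × List α => p.1 :: p.2 := by
    rintro ⟨a, l⟩ ⟨b, m⟩ h
    simpa using h
  rw [ENNReal.tsum_eq_add_tsum_ite []]
  congr 1
  rw [← hinj.tsum_eq, ENNReal.tsum_prod', tsum_fintype]
  · simp
  · intro l hl
    cases l with
    | nil => simp at hl
    | cons a l => exact ⟨(a, l), rfl⟩

lemma qw_step {d : ℕ} (ω : Env d) (x : Site d) (F : List (StepIdx d) → ℝ≥0∞) :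
    qw ω x F = F [] + ∑ s, ENNReal.ofReal ((ω x).1 s) *
      qw ω (x + stepVec s) (fun l => F (s :: l)) := by
  unfold qw
  rw [tsum_list]
  simp only [wt_nil, one_mul]
  congr 1
  refine Finset.sum_congr rfl fun s _ => ?_
  rw [← ENNReal.tsum_mul_left]
  simp [wt_cons, mul_assoc]

/-- Expectation over the paths with a given number of steps. -/
def avg {d : ℕ} (ω : Env d) : Site d → ℕ → (List (StepIdx d) → ℝ≥0∞) → ℝ≥0∞
  | _, 0, F => F []
  | x, H + 1, F => ∑ s, ENNReal.ofReal ((ω x).1 s) * avg ω (x + stepVec s) H (fun l => F (s :: l))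

lemma avg_mono {d : ℕ} (ω : Env d) (x : Site d) (H : ℕ) {F G : List (StepIdx d) → ℝ≥0∞}
    (h : ∀ l, l.length = H → F l ≤ G l) : avg ω x H F ≤ avg ω x H G := by
  induction H generalizing x F G with
  | zero => exact h [] rfl
  | succ H ih =>
    unfold avg
    gcongr with s
    exact ih _ fun l hl => h _ (by simp [hl])

lemma avg_const_add {d : ℕ} (ω : Env d) (x : Site d) (H : ℕ) (c : ℝ≥0∞)
    (F : List (StepIdx d) → ℝ≥0∞) :
    avg ω x H (fun l => c + F l) = c + avg ω x H F := by
  induction H generalizing x F with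
  | zero => rfl
  | succ H ih =>
    simp only [avg, ih, mul_add, Finset.sum_add_distrib, ← Finset.sum_mul, sum_env, one_mul]

lemma avg_cnt {d : ℕ} (ω : Env d) (x : Site d) (H : ℕ) (F : List (StepIdx d) → ℝ≥0∞) :
    avg ω x H (cnt F) = qw ω x (fun l => if l.length ≤ H then F l else 0) := by
  induction H generalizing x F with
  | zero =>
    rw [qw_step]
    simp [avg, cnt, qw]
  | succ H ih =>
    rw [qw_step]
    have : avg ω x (H + 1) (cnt F) = ∑ s, ENNReal.ofReal ((ω x).1 s) *
        (F [] + avg ω (x + stepVec s) H (cnt fun l => F (s :: l))) := by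
      rw [avg]
      simp only [cnt_cons, avg_const_add]
    rw [this]
    simp only [mul_add, Finset.sum_add_distrib, ← Finset.sum_mul, sum_env, one_mul, ih]
    simp

lemma qw_mono {d : ℕ} (ω : Env d) (x : Site d) {F G : List (StepIdx d) → ℝ≥0∞}
    (h : ∀ l, F l ≤ G l) : qw ω x F ≤ qw ω x G :=
  ENNReal.tsum_le_tsum fun l => by gcongr; exact h l

/-- Comparison of prefix counts at a fixed length. -/
lemma qw_compare_at {d : ℕ} (ω : Env d) (x : Site d) (H : ℕ) {F G : List (StepIdx d) → ℝ≥0∞}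
    (h : ∀ l, l.length = H → cnt F l ≤ cnt G l) :
    qw ω x (fun l => if l.length ≤ H then F l else 0) ≤ qw ω x G := by
  rw [← avg_cnt]
  refine (avg_mono ω x H h).trans ?_
  rw [avg_cnt]
  exact qw_mono ω x fun l => by split_ifs <;> simp

lemma qw_eq_iSup {d : ℕ} (ω : Env d) (x : Site d) (F : List (StepIdx d) → ℝ≥0∞) :
    qw ω x F = ⨆ H : ℕ, qw ω x (fun l => if l.length ≤ H then F l else 0) := by
  apply le_antisymm
  · unfold qw
    rw [ENNReal.tsum_eq_iSup_sum]
    refine iSup_le fun S => ?_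
    obtain ⟨H, hH⟩ := (S.image List.length).bddAbove
    refine le_iSup_of_le H ?_
    refine le_trans (le_of_eq ?_) (ENNReal.sum_le_tsum S)
    refine Finset.sum_congr rfl fun l hl => ?_
    have : l.length ≤ H := hH (by simpa using ⟨l, hl, rfl⟩)
    simp [this]
  · exact iSup_le fun H => qw_mono ω x fun l => by split_ifs <;> simp

/-- Comparison of prefix counts. -/
lemma qw_compare {d : ℕ} (ω : Env d) (x : Site d) {F G : List (StepIdx d) → ℝ≥0∞}
    (h : ∀ l, cnt F l ≤ cnt G l) : qw ω x F ≤ qw ω x G := by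
  rw [qw_eq_iSup]
  exact iSup_le fun H => qw_compare_at ω x H fun l _ => h l

lemma qw_ind_nil {d : ℕ} (ω : Env d) (x : Site d) (c : ℝ≥0∞) :
    qw ω x (fun l => c * ind {[]} l) = c := by
  unfold qw
  rw [tsum_eq_single []]
  · simp
  · intro l hl; simp [hl]

lemma cnt_ind_nil {d : ℕ} (c : ℝ≥0∞) (l : List (StepIdx d)) :
    cnt (fun l => c * ind {[]} l) l = c := by
  unfold cnt
  rw [Finset.sum_eq_single 0]
  · simp
  · intro k hk hk0
    have : l.take k ≠ [] := by
      intro h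
      rw [List.take_eq_nil_iff] at h
      rcases h with h | h
      · exact hk0 h
      · subst h; simp at hk; omega
    simp [this]
  · simp

lemma qw_le_of_cnt_le {d : ℕ} (ω : Env d) (x : Site d) {F : List (StepIdx d) → ℝ≥0∞} {c : ℝ≥0∞}
    (h : ∀ l, cnt F l ≤ c) : qw ω x F ≤ c := by
  refine (qw_compare ω x (G := fun l => c * ind {[]} l) fun l => ?_).trans (qw_ind_nil ω x c).le
  rw [cnt_ind_nil]; exact h l

lemma le_qw_of_le_cnt {d : ℕ} (ω : Env d) (x : Site d) (H : ℕ) {F : List (StepIdx d) → ℝ≥0∞}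
    {c : ℝ≥0∞} (h : ∀ l, l.length = H → c ≤ cnt F l) : c ≤ qw ω x F := by
  refine le_trans ?_ (qw_compare_at ω x H (F := fun l => c * ind {[]} l) (G := F) fun l hl => ?_)
  · refine (qw_ind_nil ω x c).symm.le.trans (qw_mono ω x fun l => ?_)
    by_cases hl : l = [] <;> simp [hl]
  · rw [cnt_ind_nil]; exact h l hl

lemma qw_add {d : ℕ} (ω : Env d) (x : Site d) (F G : List (StepIdx d) → ℝ≥0∞) :
    qw ω x (fun l => F l + G l) = qw ω x F + qw ω x G := by
  simp only [qw, mul_add, ENNReal.tsum_add]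

lemma qw_tsum {d : ℕ} {ι : Type*} (ω : Env d) (x : Site d) (F : ι → List (StepIdx d) → ℝ≥0∞) :
    qw ω x (fun l => ∑' i, F i l) = ∑' i, qw ω x (F i) := by
  simp only [qw, ← ENNReal.tsum_mul_left]
  exact ENNReal.tsum_comm

lemma qw_const_mul {d : ℕ} (ω : Env d) (x : Site d) (c : ℝ≥0∞) (F : List (StepIdx d) → ℝ≥0∞) :
    qw ω x (fun l => c * F l) = c * qw ω x F := by
  simp only [qw, ← ENNReal.tsum_mul_left, mul_left_comm]

/-- Sum of the quenched weights of a set of finite paths. -/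
def qs {d : ℕ} (ω : Env d) (x : Site d) (T : Set (List (StepIdx d))) : ℝ≥0∞ := qw ω x (ind T)

lemma qs_mono {d : ℕ} (ω : Env d) (x : Site d) {T T' : Set (List (StepIdx d))} (h : T ⊆ T') :
    qs ω x T ≤ qs ω x T' := qw_mono ω x fun _ => ind_mono fun hl => h hl

/-- Members of `T` none of whose proper prefixes lies in `T`. -/
def first {d : ℕ} (T : Set (List (StepIdx d))) : Set (List (StepIdx d)) :=
  {l | l ∈ T ∧ ∀ k < l.length, l.take k ∉ T}

lemma first_subset {d : ℕ} (T : Set (List (StepIdx d))) : first T ⊆ T := fun _ h => h.1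

lemma exists_take_mem_first {d : ℕ} {T : Set (List (StepIdx d))} {l : List (StepIdx d)} {k : ℕ}
    (h : l.take k ∈ T) : ∃ i ≤ k, l.take i ∈ first T := by
  classical
  have hex : ∃ i, l.take i ∈ T := ⟨k, h⟩
  refine ⟨Nat.find hex, Nat.find_min' hex h, Nat.find_spec hex, fun j hj => ?_⟩
  have hj' : j < Nat.find hex := lt_of_lt_of_le hj (by simp)
  have := Nat.find_min hex hj'
  rwa [List.take_take, min_eq_left hj'.le]

lemma first_take_unique {d : ℕ} {T : Set (List (StepIdx d))} {l : List (StepIdx d)} {i j : ℕ}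
    (hi : i ≤ l.length) (hj : j ≤ l.length) (h₁ : l.take i ∈ first T) (h₂ : l.take j ∈ first T) :
    i = j := by
  by_contra hne
  rcases lt_or_gt_of_ne hne with h | h
  · have := h₂.2 i (by simp; omega)
    rw [List.take_take, min_eq_left h.le] at this
    exact this h₁.1
  · have := h₁.2 j (by simp; omega)
    rw [List.take_take, min_eq_left h.le] at this
    exact this h₂.1

lemma cnt_first_le_one {d : ℕ} (T : Set (List (StepIdx d))) (l : List (StepIdx d)) :
    cnt (ind (first T)) l ≤ 1 := by
  classical
  unfold cnt
  by_cases h : ∃ k ∈ Finset.range (l.length + 1), l.take k ∈ first T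
  · obtain ⟨k, hk, hT⟩ := h
    rw [Finset.sum_eq_single_of_mem k hk]
    · exact ind_le_one _ _
    · intro j hj hne
      apply ind_of_notMem
      intro hjT
      exact hne (first_take_unique (by simp at hj; omega) (by simp at hk; omega) hjT hT)
  · push Not at h
    rw [Finset.sum_eq_zero fun k hk => ind_of_notMem (h k hk)]
    exact zero_le

lemma le_cnt {d : ℕ} (F : List (StepIdx d) → ℝ≥0∞) {l : List (StepIdx d)} {k : ℕ}
    (hk : k ≤ l.length) : F (l.take k) ≤ cnt F l :=
  Finset.single_le_sum (f := fun k => F (l.take k)) (fun _ _ => zero_le) (by simp; omega)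

lemma one_le_cnt_first {d : ℕ} {T : Set (List (StepIdx d))} {l : List (StepIdx d)} {k : ℕ}
    (hk : k ≤ l.length) (h : l.take k ∈ T) : 1 ≤ cnt (ind (first T)) l := by
  obtain ⟨i, hik, hi⟩ := exists_take_mem_first h
  exact (ind_of_mem hi).symm.le.trans (le_cnt _ (hik.trans hk))

/-- Quenched probability that some prefix of the walk lies in `T`. -/
def pr {d : ℕ} (ω : Env d) (x : Site d) (T : Set (List (StepIdx d))) : ℝ≥0∞ := qs ω x (first T)

lemma pr_le_one {d : ℕ} (ω : Env d) (x : Site d) (T : Set (List (StepIdx d))) : pr ω x T ≤ 1 :=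
  qw_le_of_cnt_le ω x fun l => cnt_first_le_one T l

/-- If a prefix in `T` forces a unit contribution to `cnt G`, then `pr T ≤ qw G`. -/
lemma pr_le_qw {d : ℕ} (ω : Env d) (x : Site d) {T : Set (List (StepIdx d))}
    {G : List (StepIdx d) → ℝ≥0∞} (h : ∀ l ∈ T, 1 ≤ cnt G l) : pr ω x T ≤ qw ω x G := by
  refine qw_compare ω x fun l => ?_
  by_cases hl : ∃ k ≤ l.length, l.take k ∈ T
  · obtain ⟨k, hk, hkT⟩ := hl
    refine (cnt_first_le_one T l).trans ((h _ hkT).trans ?_)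
    unfold cnt
    have : (l.take k).length = k := by simp [hk]
    rw [this]
    calc _ = ∑ j ∈ Finset.range (k + 1), G (l.take j) := by
          refine Finset.sum_congr rfl fun j hj => ?_
          rw [List.take_take, min_eq_left (by simp at hj; omega)]
      _ ≤ _ := Finset.sum_le_sum_of_subset (by
          intro j; simp only [Finset.mem_range]; omega)
  · push Not at hl
    unfold cnt
    rw [Finset.sum_eq_zero]
    · exact zero_le
    · intro k hk
      exact ind_of_notMem fun hmem => hl k (by simp at hk; omega) hmem.1

/-- Monotonicity of `pr`: each member of the first set has a prefix in the second one. -/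
lemma pr_le_pr {d : ℕ} (ω : Env d) (x : Site d) {T T' : Set (List (StepIdx d))}
    (h : ∀ l ∈ T, ∃ k ≤ l.length, l.take k ∈ T') : pr ω x T ≤ pr ω x T' :=
  pr_le_qw ω x fun l hl => by
    obtain ⟨k, hk, hkT⟩ := h l hl
    exact one_le_cnt_first hk hkT

lemma pr_mono {d : ℕ} (ω : Env d) (x : Site d) {T T' : Set (List (StepIdx d))}
    (h : T ⊆ T') : pr ω x T ≤ pr ω x T' :=
  pr_le_pr ω x fun l hl => ⟨l.length, le_rfl, by simpa using h hl⟩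

lemma pr_le_qs {d : ℕ} (ω : Env d) (x : Site d) (T : Set (List (StepIdx d))) :
    pr ω x T ≤ qs ω x T := qs_mono ω x (first_subset T)

lemma cnt_tsum {d : ℕ} {ι : Type*} (F : ι → List (StepIdx d) → ℝ≥0∞) (l : List (StepIdx d)) :
    cnt (fun l => ∑' i, F i l) l = ∑' i, cnt (F i) l := by
  simp only [cnt]
  exact (Summable.tsum_finsetSum fun _ _ => ENNReal.summable).symm

/-- Countable union bound along prefixes. -/
lemma pr_le_tsum {d : ℕ} {ι : Type*} (ω : Env d) (x : Site d) {T : Set (List (StepIdx d))}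
    (T' : ι → Set (List (StepIdx d)))
    (h : ∀ l ∈ T, ∃ i, ∃ k ≤ l.length, l.take k ∈ T' i) :
    pr ω x T ≤ ∑' i, pr ω x (T' i) := by
  unfold pr qs
  rw [← qw_tsum]
  refine pr_le_qw ω x fun l hl => ?_
  obtain ⟨i, k, hk, hkT⟩ := h l hl
  rw [cnt_tsum]
  exact (one_le_cnt_first hk hkT).trans (ENNReal.le_tsum i)

lemma pr_union_le {d : ℕ} (ω : Env d) (x : Site d) {T T₁ T₂ : Set (List (StepIdx d))}
    (h : ∀ l ∈ T, (∃ k ≤ l.length, l.take k ∈ T₁) ∨ (∃ k ≤ l.length, l.take k ∈ T₂)) :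
    pr ω x T ≤ pr ω x T₁ + pr ω x T₂ := by
  have := pr_le_tsum ω x (T := T) (fun b : Bool => if b then T₁ else T₂) (by
    intro l hl
    rcases h l hl with h | h
    · exact ⟨true, by simpa using h⟩
    · exact ⟨false, by simpa using h⟩)
  rw [tsum_fintype] at this
  simpa using this

/-- If each path of length `H` has a prefix in `T₁` or `T₂`, their probabilities sum to one. -/
lemma one_le_pr_add {d : ℕ} (ω : Env d) (x : Site d) (H : ℕ) {T₁ T₂ : Set (List (StepIdx d))}
    (h : ∀ l : List (StepIdx d), l.length = H → (∃ k ≤ l.length, l.take k ∈ T₁) ∨ (∃ k ≤ l.length, l.take k ∈ T₂)) :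
    1 ≤ pr ω x T₁ + pr ω x T₂ := by
  unfold pr qs
  rw [← qw_add]
  refine le_qw_of_le_cnt ω x H fun l hl => ?_
  have : cnt (fun l => ind (first T₁) l + ind (first T₂) l) l
      = cnt (ind (first T₁)) l + cnt (ind (first T₂)) l := by
    simp only [cnt, Finset.sum_add_distrib]
  rw [this]
  rcases h l hl with ⟨k, hk, h⟩ | ⟨k, hk, h⟩
  · exact (one_le_cnt_first hk h).trans le_self_add
  · exact (one_le_cnt_first hk h).trans le_add_self

/-! ### Concatenation -/

/-- Splittings of lists correspond to pairs of lists. -/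
lemma tsum_splits {α : Type*} (G : List α → List α → ℝ≥0∞) :
    ∑' l : List α, ∑ i ∈ Finset.range (l.length + 1), G (l.take i) (l.drop i)
      = ∑' l₁, ∑' l₂, G l₁ l₂ := by
  let e : List α × List α ≃ (Σ l : List α, Fin (l.length + 1)) :=
    { toFun := fun p => ⟨p.1 ++ p.2, ⟨p.1.length, by simp⟩⟩
      invFun := fun q => (q.1.take q.2, q.1.drop q.2)
      left_inv := by rintro ⟨a, b⟩; simp
      right_inv := by
        rintro ⟨l, i, hi⟩
        simp only
        refine Sigma.ext (by simp) ?_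
        have hl : (l.take i ++ l.drop i).length + 1 = l.length + 1 := by
          rw [List.take_append_drop]
        rw [Fin.heq_ext_iff hl]
        simp; omega }
  rw [← ENNReal.tsum_prod, ← (e.symm).tsum_eq, ENNReal.tsum_sigma']
  refine tsum_congr fun l => ?_
  rw [tsum_fintype, Finset.sum_range]
  rfl

/-- Paths which split into a member of `T₁` followed by a member of `T₂`. -/
def cat {d : ℕ} (T₁ : Set (List (StepIdx d))) (T₂ : List (StepIdx d) → Set (List (StepIdx d))) :
    Set (List (StepIdx d)) :=
  {l | ∃ i ≤ l.length, l.take i ∈ T₁ ∧ l.drop i ∈ T₂ (l.take i)}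

lemma mem_cat {d : ℕ} {T₁ : Set (List (StepIdx d))}
    {T₂ : List (StepIdx d) → Set (List (StepIdx d))} {l₁ l₂ : List (StepIdx d)}
    (h₁ : l₁ ∈ T₁) (h₂ : l₂ ∈ T₂ l₁) : l₁ ++ l₂ ∈ cat T₁ T₂ :=
  ⟨l₁.length, by simp, by simpa using ⟨h₁, h₂⟩⟩

lemma ind_cat_le {d : ℕ} (T₁ : Set (List (StepIdx d)))
    (T₂ : List (StepIdx d) → Set (List (StepIdx d))) (l : List (StepIdx d)) :
    ind (cat T₁ T₂) l ≤ ∑ i ∈ Finset.range (l.length + 1),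
      ind T₁ (l.take i) * ind (T₂ (l.take i)) (l.drop i) := by
  by_cases h : l ∈ cat T₁ T₂
  · obtain ⟨i, hi, h₁, h₂⟩ := h
    refine le_trans ?_ (Finset.single_le_sum
      (f := fun i => ind T₁ (l.take i) * ind (T₂ (l.take i)) (l.drop i))
      (fun _ _ => zero_le) (Finset.mem_range.2 (Nat.lt_succ_of_le hi)))
    simp only [ind_of_mem h₁, ind_of_mem h₂, one_mul]
    exact ind_le_one _ _
  · simp [h]

lemma qs_cat_le {d : ℕ} (ω : Env d) (x : Site d) (T₁ : Set (List (StepIdx d)))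
    (T₂ : List (StepIdx d) → Set (List (StepIdx d))) :
    qs ω x (cat T₁ T₂) ≤ ∑' l₁, wt ω x l₁ * ind T₁ l₁ * qs ω (x + disp l₁) (T₂ l₁) := by
  have h₁ : qs ω x (cat T₁ T₂) ≤ ∑' l : List (StepIdx d), ∑ i ∈ Finset.range (l.length + 1),
      (fun l₁ l₂ => wt ω x (l₁ ++ l₂) * (ind T₁ l₁ * ind (T₂ l₁) l₂)) (l.take i) (l.drop i) := by
    refine ENNReal.tsum_le_tsum fun l => ?_
    simp only [List.take_append_drop]
    rw [← Finset.mul_sum]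
    gcongr
    exact ind_cat_le T₁ T₂ l
  refine h₁.trans (le_of_eq ?_)
  rw [tsum_splits fun l₁ l₂ => wt ω x (l₁ ++ l₂) * (ind T₁ l₁ * ind (T₂ l₁) l₂)]
  refine tsum_congr fun l₁ => ?_
  rw [qs, qw, ← ENNReal.tsum_mul_left]
  refine tsum_congr fun l₂ => ?_
  rw [wt_append]; ring

/-- Paths ending at displacement `y`. -/
def hit {d : ℕ} (Y : Set (Site d)) : Set (List (StepIdx d)) := {l | disp l ∈ Y}

/-- A path whose first visit to some `y ∈ Y` is followed by a member of `T' y`. -/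
lemma pr_le_visit {d : ℕ} (ω : Env d) (x : Site d) {T : Set (List (StepIdx d))}
    (Y : Set (Site d)) (T' : Site d → Set (List (StepIdx d)))
    (h : ∀ l ∈ T, ∃ y ∈ Y, ∃ i j, i ≤ j ∧ j ≤ l.length ∧ l.take i ∈ first (hit {y}) ∧
      (l.take j).drop i ∈ T' y) :
    pr ω x T ≤ ∑' y, ind Y y * pr ω (x + y) (T' y) := by
  have h₁ : pr ω x T ≤ ∑' y : Site d, ind Y y * qs ω x (cat (first (hit {y}))
      (fun _ => first (T' y))) := by
    unfold qs
    simp only [← qw_const_mul]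
    rw [← qw_tsum]
    refine pr_le_qw ω x fun l hl => ?_
    obtain ⟨y, hy, i, j, hij, hj, hi, hT⟩ := h l hl
    rw [cnt_tsum]
    refine le_trans ?_ (ENNReal.le_tsum y)
    have hT' : ((l.take j).drop i).take (j - i) ∈ T' y := by
      rwa [List.take_of_length_le (by simp; omega)]
    obtain ⟨k, hk, hkT⟩ := exists_take_mem_first (T := T' y) (l := (l.take j).drop i) (k := j - i) hT'
    refine le_trans ?_ (le_cnt _ (k := i + k) (by omega))
    rw [ind_of_mem hy, one_mul, ind_of_mem]
    refine ⟨i, by simp; omega, ?_, ?_⟩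
    · rwa [List.take_take, min_eq_left (by omega)]
    · have : (l.take (i + k)).drop i = ((l.take j).drop i).take k := by
        rw [List.drop_take, List.drop_take, List.take_take]
        congr 1; omega
      rwa [this]
  refine h₁.trans (ENNReal.tsum_le_tsum fun y => ?_)
  gcongr
  refine (qs_cat_le ω x _ _).trans ?_
  calc _ = ∑' l₁, wt ω x l₁ * ind (first (hit {y})) l₁ * pr ω (x + y) (T' y) := by
        refine tsum_congr fun l₁ => ?_
        by_cases hl : l₁ ∈ first (hit {y})
        · have : disp l₁ = y := hl.1
          rw [this]; rfl
        · simp [hl]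
    _ = pr ω x (hit {y}) * pr ω (x + y) (T' y) := by rw [ENNReal.tsum_mul_right]; rfl
    _ ≤ _ := by
      calc _ ≤ 1 * pr ω (x + y) (T' y) := by gcongr; exact pr_le_one _ _ _
        _ = _ := one_mul _

/-! ### Annealed weights -/

/-- The consequences of the i.i.d. and ellipticity assumptions that are used below. -/
structure Good {d : ℕ} (P : Measure (Env d)) (η : ℝ) : Prop where
  prob : IsProbabilityMeasure P
  pos : 0 < η
  indep : ∀ (A B : Set (Site d)) (f g : Env d → ℝ≥0∞), Measurable f → Measurable g →
    DependsOn f A → DependsOn g B → Disjoint A B →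
    ∫⁻ ω, f ω * g ω ∂P = (∫⁻ ω, f ω ∂P) * ∫⁻ ω, g ω ∂P
  inv : ∀ (x : Site d) (f : Env d → ℝ≥0∞), Measurable f →
    ∫⁻ ω, f (shift x ω) ∂P = ∫⁻ ω, f ω ∂P
  ell : ∀ᵐ ω ∂P, ∀ x s, η ≤ (ω x).1 s

lemma measurable_shift {d : ℕ} (x : Site d) : Measurable (shift x : Env d → Env d) :=
  measurable_pi_lambda _ fun y => measurable_pi_apply (x + y)

lemma measurable_of_dependsOn {d : ℕ} {A : Set (Site d)} {f : Env d → ℝ≥0∞} (hf : Measurable f)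
    (h : DependsOn f A) (ω₀ : Env d) :
    Measurable[⨆ x ∈ A, MeasurableSpace.comap (fun ω : Env d => ω x) inferInstance] f := by
  classical
  let u : Env d → Env d := fun ω x => if x ∈ A then ω x else ω₀ x
  have hu : f = f ∘ u := by
    funext ω
    exact h fun x hx => by simp [u, hx]
  rw [hu]
  refine hf.comp ?_
  refine @measurable_pi_lambda _ _ _ (_) _ _ fun x => ?_
  by_cases hx : x ∈ A
  · simp only [u, hx, if_true]
    have h1 : MeasurableSpace.comap (fun ω : Env d => ω x) inferInstance ≤
      ⨆ x ∈ A, MeasurableSpace.comap (fun ω : Env d => ω x) inferInstance :=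
        le_iSup₂_of_le x hx le_rfl
    exact (comap_measurable (fun ω : Env d => ω x)).mono h1 le_rfl
  · simp only [u, hx, if_false]
    exact @measurable_const _ _ (_) (_) _

lemma good_of_isIID {d : ℕ} {P : Measure (Env d)} [IsProbabilityMeasure P] (hIID : IsIID P)
    (hUE : UniformlyElliptic P) : ∃ η, Good P η := by
  obtain ⟨ν, hν, hP⟩ := hIID
  obtain ⟨η, hη, hell⟩ := hUE
  have hPe : P = Measure.infinitePi (fun _ : Site d => ν) := by
    refine Measure.eq_infinitePi _ fun s t ht => ?_
    rw [← hP s t ht]; rfl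
  have hmarg : ∀ (x : Site d) (B : Set (EnvAt d)), MeasurableSet B →
      P ((fun ω : Env d => ω x) ⁻¹' B) = ν B := by
    intro x B hB
    have := hP {x} (fun _ => B) (fun _ => hB)
    simp only [Finset.mem_singleton, forall_eq, Finset.prod_singleton] at this
    exact this
  have hshift : ∀ x : Site d, P.map (shift x) = P := by
    intro x
    conv_rhs => rw [hPe]
    refine Measure.eq_infinitePi _ fun s t ht => ?_
    rw [Measure.map_apply (measurable_shift x) (MeasurableSet.pi s.countable_toSet fun i _ => ht i)]
    classical
    have := hP (s.image (x + ·)) (fun y => t (y - x)) (fun y => ht _)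
    rw [Finset.prod_image (by intro a _ b _ h; simpa using h)] at this
    simp only [add_sub_cancel_left] at this
    rw [← this]
    congr 1
    ext ω
    constructor
    · intro h y hy
      obtain ⟨i, hi, rfl⟩ := Finset.mem_image.1 hy
      rw [add_sub_cancel_left]
      exact h i hi
    · intro h i hi
      have := h (x + i) (Finset.mem_image_of_mem _ hi)
      rwa [add_sub_cancel_left] at this
  refine ⟨η, inferInstance, hη, ?_, ?_, ?_⟩
  · intro A B f g hf hg hfA hgB hAB
    obtain ⟨ω₀⟩ : Nonempty (Env d) := P.nonempty_of_neZero
    have hi : ProbabilityTheory.iIndepFun (fun (x : Site d) (ω : Env d) => ω x) P := by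
      rw [ProbabilityTheory.iIndepFun_iff_measure_inter_preimage_eq_mul]
      intro S sets hsets
      classical
      have := hP S (fun x => if x ∈ S then sets x else Set.univ) (by
        intro x
        split_ifs with h
        · exact hsets x h
        · exact MeasurableSet.univ)
      have e1 : (⋂ i ∈ S, (fun ω : Env d => ω i) ⁻¹' sets i)
          = {ω | ∀ x ∈ S, ω x ∈ if x ∈ S then sets x else Set.univ} := by
        ext ω
        simp only [Set.mem_iInter, Set.mem_preimage, Set.mem_ofPred_eq]
        exact forall₂_congr fun x hx => by simp [hx]
      rw [e1, this]
      refine Finset.prod_congr rfl fun x hx => ?_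
      rw [hmarg x _ (hsets x hx)]
      simp [hx]
    have hle : ∀ x : Site d, MeasurableSpace.comap (fun ω : Env d => ω x) inferInstance
        ≤ (inferInstance : MeasurableSpace (Env d)) :=
      fun x => (measurable_pi_apply x).comap_le
    have hind := ProbabilityTheory.indep_iSup_of_disjoint hle
      (ProbabilityTheory.iIndepFun.iIndep hi) hAB
    exact ProbabilityTheory.lintegral_mul_eq_lintegral_mul_lintegral_of_independent_measurableSpace
      (iSup₂_le fun x _ => hle x) (iSup₂_le fun x _ => hle x) hind
      (measurable_of_dependsOn hf hfA ω₀) (measurable_of_dependsOn hg hgB ω₀)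
  · intro x f hf
    conv_rhs => rw [← hshift x, lintegral_map hf (measurable_shift x)]
  · rw [ae_all_iff]; intro x
    rw [ae_all_iff]; intro s
    have hm : MeasurableSet {p : EnvAt d | p.1 s < η} :=
      measurableSet_lt ((measurable_pi_apply s).comp measurable_subtype_coe) measurable_const
    have h0 : ν {p : EnvAt d | p.1 s < η} = 0 := by
      rw [← hmarg 0 _ hm]; exact hell s
    rw [ae_iff]
    simp only [not_le]
    rw [← h0, ← hmarg x _ hm]; rfl

lemma wt_shift {d : ℕ} (x y : Site d) (ω : Env d) (l : List (StepIdx d)) :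
    wt (shift x ω) y l = wt ω (x + y) l := by
  induction l generalizing y with
  | nil => rfl
  | cons s l ih => rw [wt_cons, wt_cons, ih, add_assoc]; rfl

lemma qw_shift {d : ℕ} (x y : Site d) (ω : Env d) (F : List (StepIdx d) → ℝ≥0∞) :
    qw (shift x ω) y F = qw ω (x + y) F := by simp only [qw, wt_shift]

lemma measurable_wt {d : ℕ} (x : Site d) (l : List (StepIdx d)) :
    Measurable fun ω : Env d => wt ω x l := by
  induction l generalizing x with
  | nil => exact measurable_const
  | cons s l ih =>
    simp only [wt_cons]
    refine Measurable.mul ?_ (ih _)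
    exact ENNReal.measurable_ofReal.comp
      ((measurable_pi_apply s).comp (measurable_subtype_coe.comp (measurable_pi_apply x)))

lemma measurable_qw {d : ℕ} (x : Site d) (F : List (StepIdx d) → ℝ≥0∞) :
    Measurable fun ω : Env d => qw ω x F :=
  Measurable.tsum fun l => (measurable_wt x l).mul_const _

lemma measurable_pr {d : ℕ} (x : Site d) (T : Set (List (StepIdx d))) :
    Measurable fun ω : Env d => pr ω x T := measurable_qw x _

/-- The sites from which a path steps. -/
def sites {d : ℕ} (x : Site d) (l : List (StepIdx d)) : Set (Site d) :=
  {y | ∃ i < l.length, y = x + disp (l.take i)}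

lemma wt_congr {d : ℕ} {ω ω' : Env d} (x : Site d) (l : List (StepIdx d))
    (h : ∀ y ∈ sites x l, ω y = ω' y) : wt ω x l = wt ω' x l := by
  induction l generalizing x with
  | nil => rfl
  | cons s l ih =>
    rw [wt_cons, wt_cons, h x ⟨0, by simp, by simp⟩, ih]
    rintro y ⟨i, hi, rfl⟩
    exact h _ ⟨i + 1, by simpa using hi, by simp [add_assoc]⟩

lemma dependsOn_wt {d : ℕ} (x : Site d) (l : List (StepIdx d)) :
    DependsOn (fun ω : Env d => wt ω x l) (sites x l) := fun _ _ h => wt_congr x l h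

/-- Annealed weight of a finite path. -/
def aw {d : ℕ} (P : Measure (Env d)) (l : List (StepIdx d)) : ℝ≥0∞ := ∫⁻ ω, wt ω 0 l ∂P

/-- Annealed weighted sum of a functional of finite paths. -/
def an {d : ℕ} (P : Measure (Env d)) (F : List (StepIdx d) → ℝ≥0∞) : ℝ≥0∞ := ∑' l, aw P l * F l

/-- Annealed probability that some prefix of the walk lies in `T`. -/
def apr {d : ℕ} (P : Measure (Env d)) (T : Set (List (StepIdx d))) : ℝ≥0∞ := an P (ind (first T))

namespace Good
variable {d : ℕ} {P : Measure (Env d)} {η : ℝ}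

lemma lintegral_wt (hG : Good P η) (x : Site d) (l : List (StepIdx d)) :
    ∫⁻ ω, wt ω x l ∂P = aw P l := by
  rw [aw, ← hG.inv x _ (measurable_wt 0 l)]
  simp [wt_shift]

lemma lintegral_qw (hG : Good P η) (x : Site d) (F : List (StepIdx d) → ℝ≥0∞) :
    ∫⁻ ω, qw ω x F ∂P = an P F := by
  unfold qw an
  rw [lintegral_tsum fun l => ((measurable_wt x l).mul_const _).aemeasurable]
  refine tsum_congr fun l => ?_
  rw [lintegral_mul_const _ (measurable_wt x l), hG.lintegral_wt]

lemma lintegral_pr (hG : Good P η) (x : Site d) (T : Set (List (StepIdx d))) :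
    ∫⁻ ω, pr ω x T ∂P = apr P T := hG.lintegral_qw x _

lemma aw_append (hG : Good P η) {l₁ l₂ : List (StepIdx d)}
    (h : Disjoint (sites 0 l₁) (sites (disp l₁) l₂)) :
    aw P (l₁ ++ l₂) = aw P l₁ * aw P l₂ := by
  rw [← hG.lintegral_wt (disp l₁) l₂, aw, aw, ← hG.indep _ _ _ _ (measurable_wt 0 l₁)
    (measurable_wt (disp l₁) l₂) (dependsOn_wt _ _) (dependsOn_wt _ _) h]
  simp [wt_append]

lemma apr_le_one (hG : Good P η) (T : Set (List (StepIdx d))) : apr P T ≤ 1 := by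
  have := hG.prob
  rw [← hG.lintegral_pr 0]
  refine (lintegral_mono fun ω => pr_le_one ω 0 T).trans ?_
  simp

lemma an_compare (hG : Good P η) {F G : List (StepIdx d) → ℝ≥0∞}
    (h : ∀ l, cnt F l ≤ cnt G l) : an P F ≤ an P G := by
  rw [← hG.lintegral_qw 0, ← hG.lintegral_qw 0]
  exact lintegral_mono fun ω => qw_compare ω 0 h

lemma apr_mono (hG : Good P η) {T T' : Set (List (StepIdx d))} (h : T ⊆ T') :
    apr P T ≤ apr P T' := by
  rw [← hG.lintegral_pr 0, ← hG.lintegral_pr 0]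
  exact lintegral_mono fun ω => pr_mono ω 0 h

lemma apr_union_le (hG : Good P η) {T T₁ T₂ : Set (List (StepIdx d))}
    (h : ∀ l ∈ T, (∃ k ≤ l.length, l.take k ∈ T₁) ∨ (∃ k ≤ l.length, l.take k ∈ T₂)) :
    apr P T ≤ apr P T₁ + apr P T₂ := by
  rw [← hG.lintegral_pr 0, ← hG.lintegral_pr 0, ← hG.lintegral_pr 0,
    ← lintegral_add_left (measurable_pr _ _)]
  exact lintegral_mono fun ω => pr_union_le ω 0 h

lemma apr_le_tsum (hG : Good P η) {ι : Type*} [Countable ι] {T : Set (List (StepIdx d))}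
    (T' : ι → Set (List (StepIdx d)))
    (h : ∀ l ∈ T, ∃ i, ∃ k ≤ l.length, l.take k ∈ T' i) :
    apr P T ≤ ∑' i, apr P (T' i) := by
  simp only [← hG.lintegral_pr 0]
  rw [← lintegral_tsum fun i => (measurable_pr _ _).aemeasurable]
  exact lintegral_mono fun ω => pr_le_tsum ω 0 T' h

lemma apr_le_visit (hG : Good P η) {T : Set (List (StepIdx d))}
    (Y : Set (Site d)) (T' : Site d → Set (List (StepIdx d)))
    (h : ∀ l ∈ T, ∃ y ∈ Y, ∃ i j, i ≤ j ∧ j ≤ l.length ∧ l.take i ∈ first (hit {y}) ∧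
      (l.take j).drop i ∈ T' y) :
    apr P T ≤ ∑' y, ind Y y * apr P (T' y) := by
  calc apr P T = ∫⁻ ω, pr ω 0 T ∂P := (hG.lintegral_pr 0 T).symm
    _ ≤ ∫⁻ ω, ∑' y, ind Y y * pr ω (0 + y) (T' y) ∂P :=
      lintegral_mono fun ω => pr_le_visit ω 0 Y T' h
    _ = _ := by
      rw [lintegral_tsum fun y => ((measurable_pr _ _).const_mul _).aemeasurable]
      refine tsum_congr fun y => ?_
      rw [lintegral_const_mul _ (measurable_pr _ _), hG.lintegral_pr]

/-- Visit bound with a finite set of starting points and a common estimate. -/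
lemma apr_le_card_mul (hG : Good P η) {T : Set (List (StepIdx d))}
    (Y : Finset (Site d)) (T' : Site d → Set (List (StepIdx d))) (c : ℝ≥0∞)
    (hc : ∀ y ∈ Y, apr P (T' y) ≤ c)
    (h : ∀ l ∈ T, ∃ y ∈ Y, ∃ i j, i ≤ j ∧ j ≤ l.length ∧ l.take i ∈ first (hit {y}) ∧
      (l.take j).drop i ∈ T' y) :
    apr P T ≤ Y.card * c := by
  refine (hG.apr_le_visit (Y : Set (Site d)) T' h).trans ?_
  rw [tsum_eq_sum (s := Y)]
  · rw [← nsmul_eq_mul]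
    refine Finset.sum_le_card_nsmul _ _ _ fun y hy => ?_
    rw [ind_of_mem (by simpa using hy), one_mul]
    exact hc y hy
  · intro y hy
    rw [ind_of_notMem (by simpa using hy), zero_mul]

end Good

/-! ### Link with the quenched laws on trajectories -/

lemma stepVec_injective {d : ℕ} : Function.Injective (stepVec : StepIdx d → Site d) := by
  rintro ⟨i, b⟩ ⟨j, c⟩ h
  have h1 := congrFun h i
  have h2 := congrFun h j
  simp only [stepVec] at h1 h2
  by_cases hij : i = j
  · subst hij
    cases b <;> cases c <;> simp_all
  · have : ¬ j = i := fun h => hij h.symm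
    cases b <;> simp_all

lemma envP_stepVec {d : ℕ} (ω : Env d) (y : Site d) (s : StepIdx d) :
    envP ω y (stepVec s) = ENNReal.ofReal ((ω y).1 s) := by
  unfold envP
  rw [Finset.sum_eq_single s]
  · simp
  · intro t _ hts
    rw [if_neg]
    intro h
    exact hts (stepVec_injective h).symm
  · simp

/-- Trajectories which start by following the steps of `l`. -/
def cyl {d : ℕ} (x : Site d) (l : List (StepIdx d)) : Set (Path d) :=
  {f | ∀ i ≤ l.length, f i = x + disp (l.take i)}

lemma prod_envP {d : ℕ} (ω : Env d) (x : Site d) (l : List (StepIdx d)) :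
    ∏ i ∈ Finset.range l.length, envP ω (x + disp (l.take i))
      ((x + disp (l.take (i + 1))) - (x + disp (l.take i))) = wt ω x l := by
  induction l generalizing x with
  | nil => simp
  | cons s l ih =>
    rw [List.length_cons, Finset.prod_range_succ', wt_cons, ← ih, mul_comm]
    congr 1
    · simp [envP_stepVec]
    · refine Finset.prod_congr rfl fun i _ => ?_
      simp [add_assoc]

lemma measure_cyl {d : ℕ} {ω : Env d} {x : Site d} {μ : Measure (Path d)}
    (h : IsQuenched ω x μ) (l : List (StepIdx d)) : μ (cyl x l) = wt ω x l := by
  have := h.2 l.length fun i => x + disp (l.take i)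
  rw [prod_envP] at this
  simpa [cyl] using this

lemma measurableSet_cyl {d : ℕ} (x : Site d) (l : List (StepIdx d)) :
    MeasurableSet (cyl x l) := by
  have : cyl x l = ⋂ i ∈ Finset.range (l.length + 1), {f : Path d | f i = x + disp (l.take i)} := by
    ext f; simp [cyl]
  rw [this]
  refine Finset.measurableSet_biInter _ fun i _ => ?_
  exact measurable_pi_apply i (measurableSet_singleton _)

lemma eq_of_disp_take {d : ℕ} {l l' : List (StepIdx d)} {n : ℕ} (hn : n ≤ l.length)
    (hn' : n ≤ l'.length) (h : ∀ i ≤ n, disp (l.take i) = disp (l'.take i)) :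
    l.take n = l'.take n := by
  induction n with
  | zero => simp
  | succ n ih =>
    have h1 := ih (by omega) (by omega) fun i hi => h i (by omega)
    have h2 := h (n + 1) le_rfl
    rw [List.take_succ_eq_append_getElem (by omega), List.take_succ_eq_append_getElem (by omega)]
      at h2 ⊢
    rw [h1]
    rw [h1] at h2
    simp only [disp_append, add_right_inj, disp_cons, disp_nil, add_zero] at h2
    rw [stepVec_injective h2]

/-- A prefix-free family of cylinders contained in an event. -/
lemma pr_le_measure {d : ℕ} {ω : Env d} {x : Site d} {μ : Measure (Path d)}
    (h : IsQuenched ω x μ) (T : Set (List (StepIdx d))) (A : Set (Path d))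
    (hA : ∀ l ∈ first T, cyl x l ⊆ A) : pr ω x T ≤ μ A := by
  have e : pr ω x T = ∑' l : first T, μ (cyl x l.1) := by
    simp only [measure_cyl h]
    rw [tsum_subtype (first T) (fun l => wt ω x l)]
    refine tsum_congr fun l => ?_
    by_cases hl : l ∈ first T <;> simp [hl]
  rw [e, ← measure_iUnion]
  · exact measure_mono (Set.iUnion_subset fun l => hA l.1 l.2)
  · intro a b hab
    rw [Function.onFun, Set.disjoint_left]
    intro f hfa hfb
    apply hab
    rcases le_total a.1.length b.1.length with hle | hle
    · have e1 := eq_of_disp_take (l := a.1) (l' := b.1) (n := a.1.length) le_rfl hle fun i hi => by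
        have := (hfa i hi).symm.trans (hfb i (hi.trans hle))
        exact add_left_cancel this
      rw [List.take_length] at e1
      have : b.1.take b.1.length ∈ first T := by rw [List.take_length]; exact b.2
      have h3 := first_take_unique hle le_rfl (e1 ▸ a.2) this
      rw [h3, List.take_length] at e1
      exact Subtype.ext e1
    · have e1 := eq_of_disp_take (l := b.1) (l' := a.1) (n := b.1.length) le_rfl hle fun i hi => by
        have := (hfb i hi).symm.trans (hfa i (hi.trans hle))
        exact add_left_cancel this
      rw [List.take_length] at e1
      have : a.1.take a.1.length ∈ first T := by rw [List.take_length]; exact a.2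
      have h3 := first_take_unique hle le_rfl (e1 ▸ b.2) this
      rw [h3, List.take_length] at e1
      exact Subtype.ext e1.symm
  · exact fun l => measurableSet_cyl x l.1

lemma first_length_eq {d : ℕ} (n : ℕ) (Y : Set (Site d)) :
    first {l : List (StepIdx d) | l.length = n ∧ disp l ∈ Y}
      = {l | l.length = n ∧ disp l ∈ Y} := by
  refine Set.Subset.antisymm (first_subset _) fun l hl => ⟨hl, fun k hk h => ?_⟩
  have h1 := h.1
  have h2 := hl.1
  simp at h1; omega

lemma measure_eval {d : ℕ} {ω : Env d} {x : Site d} {μ : Measure (Path d)}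
    (h : IsQuenched ω x μ) (n : ℕ) (y : Site d) :
    μ {f | f n = y} = qs ω x {l | l.length = n ∧ disp l = y - x} := by
  have := h.1
  have hm : MeasurableSet {f : Path d | f n = y} :=
    measurable_pi_apply n (measurableSet_singleton _)
  have h1 : pr ω x {l | l.length = n ∧ disp l ∈ ({y - x} : Set (Site d))} ≤ μ {f | f n = y} := by
    refine pr_le_measure h _ _ fun l hl f hf => ?_
    have := hf l.length le_rfl
    have h2 : disp l = y - x := hl.1.2
    rw [List.take_length, h2, hl.1.1] at this
    simpa using this
  have h2 : pr ω x {l | l.length = n ∧ disp l ∈ ({y - x} : Set (Site d))ᶜ}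
      ≤ μ {f | f n = y}ᶜ := by
    refine pr_le_measure h _ _ fun l hl f hf => ?_
    have := hf l.length le_rfl
    have h2 : disp l ≠ y - x := hl.1.2
    rw [List.take_length, hl.1.1] at this
    simp only [Set.mem_compl_iff, Set.mem_ofPred_eq]
    intro h3
    apply h2
    rw [← h3, this]; simp
  have h3 := one_le_pr_add ω x n (T₁ := {l | l.length = n ∧ disp l ∈ ({y - x} : Set (Site d))})
    (T₂ := {l | l.length = n ∧ disp l ∈ ({y - x} : Set (Site d))ᶜ}) (by
      intro l hl
      by_cases hd : disp l = y - x
      · exact Or.inl ⟨l.length, le_rfl, by simpa using ⟨hl, hd⟩⟩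
      · exact Or.inr ⟨l.length, le_rfl, by simpa using ⟨hl, hd⟩⟩)
  have h4 : μ {f | f n = y} + μ {f | f n = y}ᶜ = 1 := prob_add_prob_compl hm
  have e : pr ω x {l | l.length = n ∧ disp l ∈ ({y - x} : Set (Site d))}
      = qs ω x {l | l.length = n ∧ disp l = y - x} := by
    rw [pr, first_length_eq]; rfl
  rw [← e]
  refine le_antisymm ?_ h1
  have h5 : μ {f | f n = y} + μ {f | f n = y}ᶜ ≤
      pr ω x {l | l.length = n ∧ disp l ∈ ({y - x} : Set (Site d))} + μ {f | f n = y}ᶜ := by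
    rw [h4]; exact h3.trans (by gcongr)
  exact (ENNReal.add_le_add_iff_right (measure_ne_top _ _)).1 h5

lemma ann_eval {d : ℕ} {P : Measure (Env d)} {η : ℝ} (hG : Good P η)
    {Pq : Env d → Site d → Measure (Path d)} (hPq : IsQuenchedFamily Pq) (n : ℕ) (x y : Site d) :
    ann P Pq x {f | f n = y} = an P (ind {l | l.length = n ∧ disp l = y - x}) := by
  rw [← hG.lintegral_qw x]
  exact lintegral_congr fun ω => measure_eval (hPq.1 ω x) n y

/-- Paths which reach level `-L` in direction `ℓ` without having reached level `L`. -/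
def back {d : ℕ} (ℓ : Fin d → ℝ) (L : ℝ) : Set (List (StepIdx d)) :=
  {l | dotR (disp l) ℓ ≤ -L ∧ ∀ k ≤ l.length, dotR (disp (l.take k)) ℓ < L}

lemma apr_back_le {d : ℕ} {P : Measure (Env d)} {η : ℝ} (hG : Good P η)
    {Pq : Env d → Site d → Measure (Path d)} (hPq : IsQuenchedFamily Pq) (ℓ : Fin d → ℝ) (L : ℝ) :
    apr P (back ℓ L) ≤ ann P Pq 0 (backtrackEvent ℓ L) := by
  rw [← hG.lintegral_pr 0]
  refine lintegral_mono fun ω => pr_le_measure (hPq.1 ω 0) _ _ fun l hl f hf => ?_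
  refine ⟨l.length, ?_, fun m hm => ?_⟩
  · have h1 := hl.1.1
    have h2 := hf l.length le_rfl
    rw [List.take_length, zero_add] at h2
    rw [h2]
    have : dotR (disp l) (-ℓ) = - dotR (disp l) ℓ := by simp [dotR]
    rw [this]; linarith
  · have h2 := hf m hm
    rw [zero_add] at h2
    rw [h2]
    exact hl.1.2 m hm

/-! ### Real estimates -/

lemma exists_pow_le_exp (k : ℕ) {c γ : ℝ} (hc : 0 < c) (hγ : 0 < γ) :
    ∃ C : ℝ, 0 < C ∧ ∀ x : ℝ, 1 ≤ x → x ^ k ≤ C * Real.exp (c * x ^ γ) := by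
  obtain ⟨m, hm⟩ := exists_nat_ge ((k : ℝ) / γ)
  refine ⟨(m.factorial : ℝ) / c ^ m, by positivity, fun x hx => ?_⟩
  have h1 : (c * x ^ γ) ^ m / m.factorial ≤ Real.exp (c * x ^ γ) :=
    Real.pow_div_factorial_le_exp _ (by positivity) m
  have h2 : x ^ k ≤ (x ^ γ) ^ m := by
    rw [← Real.rpow_natCast, ← Real.rpow_natCast, ← Real.rpow_mul (by linarith)]
    apply Real.rpow_le_rpow_of_exponent_le hx
    rw [div_le_iff₀ hγ] at hm
    linarith
  calc x ^ k ≤ (x ^ γ) ^ m := h2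
    _ = (m.factorial : ℝ) / c ^ m * ((c * x ^ γ) ^ m / m.factorial) := by
      rw [mul_pow]; field_simp
    _ ≤ _ := by gcongr

lemma exists_tsum_tail_le (K : ℝ) (k : ℕ) {c γ : ℝ} (hK : 0 ≤ K) (hc : 0 < c) (hγ : 0 < γ) :
    ∃ C : ℝ, 0 < C ∧ ∀ R : ℝ, 1 ≤ R → ∑' N : ℕ, (if R ≤ N then
      ENNReal.ofReal (K * (2 * N + 1) ^ k * Real.exp (-(c * (N : ℝ) ^ γ))) else 0)
        ≤ ENNReal.ofReal (C * Real.exp (-(c / 2 * R ^ γ))) := by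
  obtain ⟨C₀, hC₀, h₀⟩ := exists_pow_le_exp (k + 2) (half_pos hc) hγ
  have hs : Summable fun N : ℕ => K * 3 ^ k * C₀ * (1 / (N : ℝ) ^ 2) :=
    (Real.summable_one_div_nat_pow.2 (by norm_num)).mul_left _
  refine ⟨(∑' N : ℕ, K * 3 ^ k * C₀ * (1 / (N : ℝ) ^ 2)) + 1, by positivity, fun R hR => ?_⟩
  have key : ∀ N : ℕ, (if R ≤ N then
      ENNReal.ofReal (K * (2 * N + 1) ^ k * Real.exp (-(c * (N : ℝ) ^ γ))) else 0)
      ≤ ENNReal.ofReal (K * 3 ^ k * C₀ * (1 / (N : ℝ) ^ 2)) *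
        ENNReal.ofReal (Real.exp (-(c / 2 * R ^ γ))) := by
    intro N
    split_ifs with hN
    · rw [← ENNReal.ofReal_mul (by positivity)]
      apply ENNReal.ofReal_le_ofReal
      have hN1 : (1 : ℝ) ≤ N := hR.trans hN
      have e1 : Real.exp (-(c * (N : ℝ) ^ γ))
          = Real.exp (-(c / 2 * (N : ℝ) ^ γ)) * Real.exp (-(c / 2 * (N : ℝ) ^ γ)) := by
        rw [← Real.exp_add]; congr 1; ring
      have e2 : Real.exp (-(c / 2 * (N : ℝ) ^ γ)) ≤ Real.exp (-(c / 2 * R ^ γ)) := by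
        gcongr
      have e3 : (N : ℝ) ^ k * Real.exp (-(c / 2 * (N : ℝ) ^ γ)) ≤ C₀ * (1 / (N : ℝ) ^ 2) := by
        have := h₀ N hN1
        rw [Real.exp_neg, mul_one_div, le_div_iff₀ (by positivity), mul_assoc, mul_comm,
          mul_assoc, inv_mul_le_iff₀ (Real.exp_pos _), ← pow_add, add_comm 2 k, mul_comm]
        exact this
      calc K * (2 * N + 1) ^ k * Real.exp (-(c * (N : ℝ) ^ γ))
          ≤ K * (3 * N) ^ k * Real.exp (-(c * (N : ℝ) ^ γ)) := by gcongr; linarith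
        _ = K * 3 ^ k * (N ^ k * Real.exp (-(c / 2 * (N : ℝ) ^ γ))) *
            Real.exp (-(c / 2 * (N : ℝ) ^ γ)) := by rw [e1, mul_pow]; ring
        _ ≤ K * 3 ^ k * (C₀ * (1 / (N : ℝ) ^ 2)) * Real.exp (-(c / 2 * R ^ γ)) := by gcongr
        _ = _ := by ring
    · exact zero_le
  refine (ENNReal.tsum_le_tsum key).trans ?_
  rw [ENNReal.tsum_mul_right, ← ENNReal.ofReal_tsum_of_nonneg (fun N => by positivity) hs,
    ← ENNReal.ofReal_mul (tsum_nonneg fun N => by positivity)]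
  apply ENNReal.ofReal_le_ofReal
  gcongr
  linarith

lemma exists_first_argmax (f : ℕ → ℝ) (j : ℕ) :
    ∃ i ≤ j, (∀ k ≤ j, f k ≤ f i) ∧ ∀ k < i, f k < f i := by
  classical
  obtain ⟨m, hm, hmax⟩ := Finset.exists_max_image (Finset.range (j + 1)) f ⟨0, by simp⟩
  have hex : ∃ i, i ≤ j ∧ ∀ k ≤ j, f k ≤ f i :=
    ⟨m, by simp at hm; omega, fun k hk => hmax k (by simp; omega)⟩
  obtain ⟨h1, h2⟩ := Nat.find_spec hex
  refine ⟨Nat.find hex, h1, h2, fun k hk => ?_⟩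
  have := Nat.find_min hex hk
  push Not at this
  obtain ⟨i, hi, hlt⟩ := this (by omega)
  exact hlt.trans_le (h2 i hi)

/-! ### Lattice norms and levels -/

/-- The `ℓ¹`-norm as a real number. -/
def nr {d : ℕ} (v : Site d) : ℝ := ∑ i, |(v i : ℝ)|

lemma nr_nonneg {d : ℕ} (v : Site d) : 0 ≤ nr v := Finset.sum_nonneg fun _ _ => abs_nonneg _

@[simp] lemma nr_zero {d : ℕ} : nr (0 : Site d) = 0 := by simp [nr]

lemma nr_add {d : ℕ} (v w : Site d) : nr (v + w) ≤ nr v + nr w := by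
  unfold nr
  rw [← Finset.sum_add_distrib]
  exact Finset.sum_le_sum fun i _ => by simpa using abs_add_le (v i : ℝ) (w i : ℝ)

@[simp] lemma nr_neg {d : ℕ} (v : Site d) : nr (-v) = nr v := by simp [nr]

lemma nr_eq_natCast {d : ℕ} (v : Site d) : nr v = ((∑ i, (v i).natAbs : ℕ) : ℝ) := by
  unfold nr
  push_cast
  exact Finset.sum_congr rfl fun i _ => by simp [Nat.cast_natAbs]

lemma abs_le_nr {d : ℕ} (v : Site d) (i : Fin d) : |(v i : ℝ)| ≤ nr v :=
  Finset.single_le_sum (f := fun i => |(v i : ℝ)|) (fun _ _ => abs_nonneg _) (Finset.mem_univ i)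

lemma exists_nr_le {d : ℕ} (hd : 0 < d) (v : Site d) : ∃ i, nr v ≤ d * |(v i : ℝ)| := by
  obtain ⟨i, _, hi⟩ := Finset.exists_max_image Finset.univ (fun i => |(v i : ℝ)|)
    ⟨⟨0, hd⟩, Finset.mem_univ _⟩
  refine ⟨i, ?_⟩
  have := Finset.sum_le_card_nsmul Finset.univ (fun i => |(v i : ℝ)|) _ hi
  simpa [nr] using this

@[simp] lemma dotR_zero {d : ℕ} (ℓ : Fin d → ℝ) : dotR (0 : Site d) ℓ = 0 := by simp [dotR]

lemma dotR_add {d : ℕ} (v w : Site d) (ℓ : Fin d → ℝ) : dotR (v + w) ℓ = dotR v ℓ + dotR w ℓ := by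
  simp [dotR, add_mul, Finset.sum_add_distrib]

lemma dotR_sub {d : ℕ} (v w : Site d) (ℓ : Fin d → ℝ) : dotR (v - w) ℓ = dotR v ℓ - dotR w ℓ := by
  simp [dotR, sub_mul, Finset.sum_sub_distrib]

lemma dotR_neg {d : ℕ} (v : Site d) (ℓ : Fin d → ℝ) : dotR (-v) ℓ = - dotR v ℓ := by
  simp [dotR]

lemma nr_stepVec {d : ℕ} (s : StepIdx d) : nr (stepVec s) = 1 := by
  unfold nr
  rw [Finset.sum_eq_single s.1]
  · by_cases h : s.2 <;> simp [stepVec, h]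
  · intro i _ hi; simp [stepVec, hi]
  · simp

lemma nr_disp_le {d : ℕ} (l : List (StepIdx d)) : nr (disp l) ≤ l.length := by
  induction l with
  | nil => simp
  | cons s l ih =>
    rw [disp_cons, List.length_cons]
    refine (nr_add _ _).trans ?_
    rw [nr_stepVec]; push_cast; linarith

/-- The box `[-N, N]^d`. -/
def box (d N : ℕ) : Finset (Site d) := Fintype.piFinset fun _ => Finset.Icc (-(N : ℤ)) N

lemma card_box (d N : ℕ) : (box d N).card = (2 * N + 1) ^ d := by
  simp only [box, Fintype.card_piFinset, Int.card_Icc, Finset.prod_const, Finset.card_univ,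
    Fintype.card_fin]
  congr 1; omega

lemma mem_box {d N : ℕ} {v : Site d} : v ∈ box d N ↔ ∀ i, |(v i : ℝ)| ≤ N := by
  simp only [box, Fintype.mem_piFinset, Finset.mem_Icc]
  refine forall_congr' fun i => ?_
  rw [abs_le]
  constructor
  · rintro ⟨h1, h2⟩; exact ⟨by exact_mod_cast h1, by exact_mod_cast h2⟩
  · rintro ⟨h1, h2⟩; exact ⟨by exact_mod_cast h1, by exact_mod_cast h2⟩

lemma mem_box_of_nr_le {d N : ℕ} {v : Site d} (h : nr v ≤ N) : v ∈ box d N :=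
  mem_box.2 fun i => (abs_le_nr v i).trans h

/-! ### The cone estimate -/

/-- Paths ending at distance at least `R`, at a point whose level is too small. -/
def bl {d : ℕ} (ℓ : Fin d → ℝ) (κ R : ℝ) : Set (List (StepIdx d)) :=
  {l | R ≤ nr (disp l) ∧ dotR (disp l) ℓ < κ * nr (disp l)}

/-- Stretched exponential backtracking estimates in a neighbourhood of a direction. -/
def TG {d : ℕ} (P : Measure (Env d)) (ℓ₀ : Fin d → ℝ) (γ : ℝ) : Prop :=
  ∃ a : ℝ, 0 < a ∧ ∀ ℓ : Fin d → ℝ, (∀ i, |ℓ i - ℓ₀ i| ≤ a) → ∃ C c : ℝ, 0 < C ∧ 0 < c ∧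
    ∀ L : ℝ, 0 < L → apr P (back ℓ L) ≤ ENNReal.ofReal (C * Real.exp (-(c * L ^ γ)))

/-- Stretched exponential bound for leaving a cone, with opening `κ`. -/
def Cone {d : ℕ} (P : Measure (Env d)) (ℓ₀ : Fin d → ℝ) (γ κ : ℝ) : Prop :=
  0 < κ ∧ κ ≤ 1 ∧ ∃ C c : ℝ, 0 < C ∧ 0 < c ∧ ∀ R : ℝ, 1 ≤ R →
    apr P (bl ℓ₀ κ R) ≤ ENNReal.ofReal (C * Real.exp (-(c * R ^ γ)))

lemma back_smul {d : ℕ} (ℓ : Fin d → ℝ) (L r : ℝ) (hr : 0 < r) :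
    back (r • ℓ) (r * L) = back ℓ L := by
  have h : ∀ v : Site d, dotR v (r • ℓ) = r * dotR v ℓ := by
    intro v; simp only [dotR, Finset.mul_sum, Pi.smul_apply, smul_eq_mul]
    exact Finset.sum_congr rfl fun i _ => by ring
  ext l
  simp only [back, Set.mem_ofPred_eq, h, ← mul_neg]
  rw [mul_le_mul_iff_right₀ hr]
  refine and_congr_right fun _ => forall₂_congr fun k _ => ?_
  exact mul_lt_mul_iff_right₀ hr

lemma norm2R_smul {d : ℕ} (ℓ : Fin d → ℝ) (r : ℝ) (hr : 0 ≤ r) :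
    norm2R (r • ℓ) = r * norm2R ℓ := by
  unfold norm2R
  simp only [Pi.smul_apply, smul_eq_mul, mul_pow, ← Finset.mul_sum]
  rw [Real.sqrt_mul (by positivity), Real.sqrt_sq hr]

lemma continuous_norm2R {d : ℕ} : Continuous (norm2R : (Fin d → ℝ) → ℝ) := by
  unfold norm2R; fun_prop

lemma tg_of_condTAt {d : ℕ} {P : Measure (Env d)} {η : ℝ} (hG : Good P η)
    {Pq : Env d → Site d → Measure (Path d)} (hPq : IsQuenchedFamily Pq) {γ : ℝ}
    {ℓ₀ : Fin d → ℝ} (h₀ : norm2R ℓ₀ = 1) (hT : CondTAt P Pq γ ℓ₀) : TG P ℓ₀ γ := by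
  obtain ⟨ε, hε, hT⟩ := hT
  have hcont : ContinuousAt (fun ℓ : Fin d → ℝ => norm2R ((norm2R ℓ)⁻¹ • ℓ - ℓ₀)) ℓ₀ := by
    have h1 : ContinuousAt (fun ℓ : Fin d → ℝ => (norm2R ℓ)⁻¹ • ℓ - ℓ₀) ℓ₀ :=
      ((continuous_norm2R.continuousAt.inv₀ (by rw [h₀]; norm_num)).smul continuousAt_id).sub
        continuousAt_const
    exact continuous_norm2R.continuousAt.comp h1
  have hz : norm2R ((norm2R ℓ₀)⁻¹ • ℓ₀ - ℓ₀) = 0 := by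
    rw [h₀]; simp [norm2R]
  have hn : {ℓ : Fin d → ℝ | norm2R ((norm2R ℓ)⁻¹ • ℓ - ℓ₀) < ε ∧ 0 < norm2R ℓ} ∈ nhds ℓ₀ := by
    refine Filter.inter_mem (hcont.eventually_lt continuousAt_const (by rw [hz]; exact hε)) ?_
    exact continuousAt_const.eventually_lt continuous_norm2R.continuousAt (by rw [h₀]; norm_num)
  obtain ⟨a, ha, hball⟩ := Metric.nhds_basis_closedBall.mem_iff.1 hn
  refine ⟨a, ha, fun ℓ hℓ => ?_⟩
  have hm : ℓ ∈ Metric.closedBall ℓ₀ a := by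
    rw [Metric.mem_closedBall, dist_pi_le_iff ha.le]
    intro i; rw [Real.dist_eq]; exact hℓ i
  obtain ⟨h1, h2⟩ := hball hm
  set r := norm2R ℓ with hr
  obtain ⟨C, hC⟩ := hT (r⁻¹ • ℓ) (by rw [norm2R_smul _ _ (by positivity), ← hr]; field_simp) h1
  refine ⟨|C| + 1, (r⁻¹) ^ γ, by positivity, by positivity, fun L hL => ?_⟩
  have e : back ℓ L = back (r⁻¹ • ℓ) (r⁻¹ * L) := (back_smul ℓ L r⁻¹ (by positivity)).symm
  rw [e]
  refine (apr_back_le hG hPq _ _).trans ((hC _ (by positivity)).trans ?_)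
  apply ENNReal.ofReal_le_ofReal
  rw [Real.mul_rpow (by positivity) hL.le]
  gcongr
  exact (le_abs_self C).trans (by linarith)

/-- Paths staying in `Y` which drop by `D` in direction `ℓ`. -/
def drops {d : ℕ} (ℓ : Fin d → ℝ) (Y : Set (Site d)) (D : ℝ) : Set (List (StepIdx d)) :=
  {l | ∃ i j, i ≤ j ∧ j ≤ l.length ∧ (∀ k ≤ j, disp (l.take k) ∈ Y) ∧
    D ≤ dotR (disp (l.take i)) ℓ - dotR (disp (l.take j)) ℓ}

lemma disp_drop_take {d : ℕ} (l : List (StepIdx d)) {i k : ℕ} (h : i ≤ k) :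
    disp ((l.take k).drop i) = disp (l.take k) - disp (l.take i) := by
  have := disp_take_add_drop (l.take k) i
  rw [List.take_take, min_eq_left h] at this
  rw [← this]; simp

lemma take_drop_take {α : Type*} (l : List α) {i j k : ℕ} (h : k ≤ j - i) :
    ((l.take j).drop i).take k = (l.take (i + k)).drop i := by
  rw [List.drop_take, List.drop_take, List.take_take]
  congr 1; omega

lemma take_mem_first_hit {d : ℕ} {l : List (StepIdx d)} {i : ℕ}
    (h : ∀ k < i, disp (l.take k) ≠ disp (l.take i)) :
    l.take i ∈ first (hit {disp (l.take i)}) := by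
  refine ⟨rfl, fun k hk hmem => ?_⟩
  have hk' : k < i := lt_of_lt_of_le hk (by simp)
  rw [List.take_take, min_eq_left hk'.le] at hmem
  exact h k hk' hmem

lemma Good.apr_drops_le {d : ℕ} {P : Measure (Env d)} {η : ℝ} (hG : Good P η) (ℓ : Fin d → ℝ)
    (Y : Finset (Site d)) (D : ℝ) (hD : 0 < D) :
    apr P (drops ℓ (Y : Set (Site d)) D) ≤ Y.card * apr P (back ℓ D) := by
  refine hG.apr_le_card_mul Y (fun _ => back ℓ D) _ (fun _ _ => le_rfl) fun l hl => ?_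
  obtain ⟨i, j, hij, hj, hY, hdrop⟩ := hl
  obtain ⟨m, hmj, hmax, hlt⟩ := exists_first_argmax (fun k => dotR (disp (l.take k)) ℓ) j
  refine ⟨disp (l.take m), hY m hmj, m, j, hmj, hj, ?_, ?_, ?_⟩
  · exact take_mem_first_hit fun k hk h => (hlt k hk).ne (by simp only [h])
  · rw [disp_drop_take l hmj, dotR_sub]
    have := hmax i hij
    linarith
  · intro k hk
    have hk' : k ≤ j - m := by simpa [hj] using hk
    rw [take_drop_take l hk', disp_drop_take l (by omega), dotR_sub]
    have := hmax (m + k) (by omega)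
    linarith

/-- The directions `ℓ₀` and `ℓ₀ ± a e_i`. -/
def tilt {d : ℕ} (ℓ₀ : Fin d → ℝ) (a : ℝ) (o : Option (StepIdx d)) : Fin d → ℝ :=
  match o with
  | none => ℓ₀
  | some s => fun i => ℓ₀ i + a * (stepVec s i : ℝ)

lemma tilt_close {d : ℕ} (ℓ₀ : Fin d → ℝ) {a : ℝ} (ha : 0 ≤ a) (o : Option (StepIdx d))
    (i : Fin d) : |tilt ℓ₀ a o i - ℓ₀ i| ≤ a := by
  cases o with
  | none => simpa [tilt] using ha
  | some s =>
    have : |(stepVec s i : ℝ)| ≤ 1 := (abs_le_nr _ i).trans (nr_stepVec s).le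
    simp only [tilt, add_sub_cancel_left, abs_mul, abs_of_nonneg ha]
    nlinarith

lemma exists_tilt_le {d : ℕ} (hd : 0 < d) (ℓ₀ : Fin d → ℝ) {a : ℝ} (ha : 0 ≤ a) (v : Site d) :
    ∃ o, dotR v (tilt ℓ₀ a o) ≤ dotR v ℓ₀ - a / d * nr v := by
  obtain ⟨i, hi⟩ := exists_nr_le hd v
  have hd' : (0 : ℝ) < d := by exact_mod_cast hd
  have key : ∀ b : Bool, dotR v (tilt ℓ₀ a (some (i, b)))
      = dotR v ℓ₀ + a * ((if b then 1 else -1) * (v i : ℝ)) := by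
    intro b
    simp only [dotR, tilt, mul_add, Finset.sum_add_distrib]
    congr 1
    rw [Finset.sum_eq_single i]
    · cases b <;> simp [stepVec, mul_comm]
    · intro j _ hj; simp [stepVec, hj]
    · simp
  have h2 : a / d * nr v ≤ a * |(v i : ℝ)| := by
    rw [div_mul_eq_mul_div, div_le_iff₀ hd']
    nlinarith
  rcases le_total 0 (v i : ℝ) with h | h
  · refine ⟨some (i, false), ?_⟩
    rw [key]; rw [abs_of_nonneg h] at h2
    simp; linarith
  · refine ⟨some (i, true), ?_⟩
    rw [key]; rw [abs_of_nonpos h] at h2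
    simp; linarith

lemma bl_drops {d : ℕ} (hd : 0 < d) (ℓ₀ : Fin d → ℝ) {a κ : ℝ} (ha : 0 < a) (ha1 : a ≤ 1)
    (hκ : κ = a / (2 * d)) {R : ℝ} (hR : 1 ≤ R) {l : List (StepIdx d)} (hl : l ∈ bl ℓ₀ κ R) :
    ∃ (N : ℕ) (o : Option (StepIdx d)), R ≤ N ∧
      l ∈ drops (tilt ℓ₀ a o) (box d N : Set (Site d)) (κ ^ 2 / 2 * N) := by
  have hd' : (1 : ℝ) ≤ d := by exact_mod_cast hd
  have hκ0 : 0 < κ := by rw [hκ]; positivity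
  have hκ1 : κ ≤ 1 := by rw [hκ, div_le_one (by positivity)]; linarith
  have hκ2 : a / d = 2 * κ := by rw [hκ]; field_simp
  obtain ⟨m, hm, hmax, -⟩ := exists_first_argmax (fun k => nr (disp (l.take k))) l.length
  set z := disp (l.take m) with hz
  set v := disp l with hv
  have hvz : nr v ≤ nr z := by
    have := hmax l.length le_rfl
    simpa [List.take_length] using this
  obtain ⟨hl1, hl2⟩ := hl
  set N := ∑ i, (z i).natAbs with hN
  have hNz : nr z = N := nr_eq_natCast z
  have hbox : ∀ k ≤ l.length, disp (l.take k) ∈ (box d N : Set (Site d)) := fun k hk => by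
    have := hmax k hk
    exact mem_box_of_nr_le (by rw [← hNz]; exact this)
  have hNpos : (1 : ℝ) ≤ N := by rw [← hNz]; linarith
  have hκN : κ ^ 2 / 2 * N ≤ κ * N / 2 := by
    have : κ * κ ≤ κ * 1 := by gcongr
    nlinarith
  have hfull : l.take l.length = l := List.take_length
  by_cases hzb : dotR z ℓ₀ < κ * nr z
  · obtain ⟨o, ho⟩ := exists_tilt_le hd ℓ₀ ha.le z
    refine ⟨N, o, by rw [← hNz]; linarith, 0, m, Nat.zero_le _, hm,
      fun k hk => hbox k (hk.trans hm), ?_⟩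
    rw [hκ2] at ho
    simp only [List.take_zero, disp_nil, dotR_zero, ← hz]
    nlinarith
  · push Not at hzb
    by_cases hvs : κ * N / 2 ≤ nr v
    · obtain ⟨o, ho⟩ := exists_tilt_le hd ℓ₀ ha.le v
      refine ⟨N, o, by rw [← hNz]; linarith, 0, l.length, Nat.zero_le _, le_rfl, hbox, ?_⟩
      rw [hκ2] at ho
      simp only [List.take_zero, disp_nil, dotR_zero, hfull, ← hv]
      nlinarith
    · push Not at hvs
      refine ⟨N, none, by rw [← hNz]; linarith, m, l.length, hm, le_rfl, hbox, ?_⟩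
      simp only [hfull, ← hv, ← hz, tilt]
      rw [hNz] at hzb
      nlinarith

lemma cone_of_tg {d : ℕ} (hd : 0 < d) {P : Measure (Env d)} {η : ℝ} (hG : Good P η)
    {ℓ₀ : Fin d → ℝ} {γ : ℝ} (hγ : 0 < γ) (hT : TG P ℓ₀ γ) : ∃ κ, Cone P ℓ₀ γ κ := by
  obtain ⟨a₀, ha₀, hT⟩ := hT
  set a := min a₀ 1 with hadef
  have ha : 0 < a := by positivity
  have ha1 : a ≤ 1 := min_le_right _ _
  have hd' : (1 : ℝ) ≤ d := by exact_mod_cast hd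
  set κ := a / (2 * d) with hκ
  have hκ0 : 0 < κ := by positivity
  have hκ1 : κ ≤ 1 := by rw [hκ, div_le_one (by positivity)]; linarith
  choose C c hC hc hb using fun o : Option (StepIdx d) => hT (tilt ℓ₀ a o)
    fun i => (tilt_close ℓ₀ ha.le o i).trans (min_le_left _ _)
  obtain ⟨o₁, -, ho₁⟩ := Finset.exists_min_image Finset.univ c ⟨none, Finset.mem_univ _⟩
  set c₁ := c o₁ * (κ ^ 2 / 2) ^ γ with hc₁
  have hc₁0 : 0 < c₁ := mul_pos (hc o₁) (by positivity)
  set K := ∑ o, C o with hK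
  have hK0 : 0 ≤ K := Finset.sum_nonneg fun o _ => (hC o).le
  obtain ⟨C', hC', hsum⟩ := exists_tsum_tail_le (K * Fintype.card (Option (StepIdx d))) d
    (by positivity) hc₁0 hγ
  refine ⟨κ, hκ0, hκ1, C', c₁ / 2, hC', half_pos hc₁0, fun R hR => ?_⟩
  refine le_trans ?_ (hsum R hR)
  refine (hG.apr_le_tsum (ι := ℕ × Option (StepIdx d))
    (fun p => if R ≤ p.1 then drops (tilt ℓ₀ a p.2) (box d p.1 : Set (Site d)) (κ ^ 2 / 2 * p.1)
      else ∅) fun l hl => ?_).trans ?_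
  · obtain ⟨N, o, hN, h⟩ := bl_drops hd ℓ₀ ha ha1 hκ hR hl
    exact ⟨(N, o), l.length, le_rfl, by simpa [hN, List.take_length] using h⟩
  · rw [ENNReal.tsum_prod']
    refine ENNReal.tsum_le_tsum fun N => ?_
    simp only
    split_ifs with hN
    · have hN0 : (0 : ℝ) < N := by linarith
      rw [tsum_fintype]
      have : ∀ o ∈ Finset.univ, apr P (drops (tilt ℓ₀ a o) (box d N : Set (Site d))
          (κ ^ 2 / 2 * N)) ≤ ENNReal.ofReal (K * (2 * N + 1) ^ d *
            Real.exp (-(c₁ * (N : ℝ) ^ γ))) := by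
        intro o _
        refine (hG.apr_drops_le _ _ _ (by positivity)).trans ?_
        calc _ ≤ ((box d N).card : ℝ≥0∞) * ENNReal.ofReal (K * Real.exp (-(c₁ * (N : ℝ) ^ γ))) := by
              gcongr
              refine (hb o _ (by positivity)).trans (ENNReal.ofReal_le_ofReal ?_)
              rw [Real.mul_rpow (by positivity) hN0.le]
              gcongr ?_ * Real.exp (-?_)
              · exact Finset.single_le_sum (fun o _ => (hC o).le) (Finset.mem_univ o)
              · rw [hc₁, mul_assoc]
                gcongr
                exact ho₁ o (Finset.mem_univ o)
          _ = _ := by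
              rw [card_box, ← ENNReal.ofReal_natCast, ← ENNReal.ofReal_mul (by positivity)]
              congr 1; push_cast; ring
      refine (Finset.sum_le_card_nsmul _ _ _ this).trans (le_of_eq ?_)
      rw [nsmul_eq_mul, ← ENNReal.ofReal_natCast, ← ENNReal.ofReal_mul (by positivity)]
      congr 1; rw [Finset.card_univ]; ring
    · simp [apr, an, first]

/-! ### Quenched hitting probabilities -/

open Classical in
/-- Probability to hit `T` within `N` steps, before leaving `I`. -/
def hp {d : ℕ} (ω : Env d) (I T : Set (Site d)) : ℕ → Site d → ℝ
  | 0, y => if y ∈ T then 1 else 0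
  | N + 1, y => if y ∈ T then 1 else if y ∈ I then
      ∑ s, (ω y).1 s * hp ω I T N (y + stepVec s) else 0

lemma hp_of_mem {d : ℕ} (ω : Env d) {I T : Set (Site d)} (N : ℕ) {y : Site d} (h : y ∈ T) :
    hp ω I T N y = 1 := by
  cases N <;> simp [hp, h]

lemma hp_of_notMem {d : ℕ} (ω : Env d) {I T : Set (Site d)} (N : ℕ) {y : Site d} (h : y ∉ T)
    (h' : y ∉ I) : hp ω I T N y = 0 := by
  cases N <;> simp [hp, h, h']

lemma hp_zero {d : ℕ} (ω : Env d) {I T : Set (Site d)} {y : Site d} (h : y ∉ T) :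
    hp ω I T 0 y = 0 := by simp [hp, h]

lemma hp_succ {d : ℕ} (ω : Env d) {I T : Set (Site d)} (N : ℕ) {y : Site d} (h : y ∉ T)
    (h' : y ∈ I) : hp ω I T (N + 1) y = ∑ s, (ω y).1 s * hp ω I T N (y + stepVec s) := by
  simp [hp, h, h']

lemma hp_nonneg {d : ℕ} (ω : Env d) (I T : Set (Site d)) (N : ℕ) (y : Site d) :
    0 ≤ hp ω I T N y := by
  induction N generalizing y with
  | zero => unfold hp; split_ifs <;> norm_num
  | succ N ih =>
    unfold hp
    split_ifs
    · norm_num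
    · exact Finset.sum_nonneg fun s _ => mul_nonneg ((ω y).2.1 s) (ih _)
    · norm_num

lemma sum_env_mul_le {d : ℕ} (ω : Env d) (y : Site d) {f : StepIdx d → ℝ} {c : ℝ}
    (h : ∀ s, f s ≤ c) : ∑ s, (ω y).1 s * f s ≤ c := by
  calc ∑ s, (ω y).1 s * f s ≤ ∑ s, (ω y).1 s * c :=
        Finset.sum_le_sum fun s _ => mul_le_mul_of_nonneg_left (h s) ((ω y).2.1 s)
    _ = c := by rw [← Finset.sum_mul, (ω y).2.2, one_mul]

lemma hp_le_one {d : ℕ} (ω : Env d) (I T : Set (Site d)) (N : ℕ) (y : Site d) :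
    hp ω I T N y ≤ 1 := by
  induction N generalizing y with
  | zero => unfold hp; split_ifs <;> norm_num
  | succ N ih =>
    unfold hp
    split_ifs
    · norm_num
    · exact sum_env_mul_le ω y fun s => ih _
    · norm_num

/-- Comparison of a hitting probability with an exit problem from a smaller region. -/
lemma hp_le_exit {d : ℕ} (ω : Env d) {I T I' T' : Set (Site d)} {a b : ℝ} (hb : 0 ≤ b)
    (hab : b ≤ a) (hI : I' ⊆ I) (hIT : Disjoint I' T) (hIT' : Disjoint I' T')
    (ha : ∀ N, ∀ y ∈ I', ∀ s, y + stepVec s ∈ T' → hp ω I T N (y + stepVec s) ≤ a)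
    (hb' : ∀ N, ∀ y ∈ I', ∀ s, y + stepVec s ∉ T' → y + stepVec s ∉ I' →
      hp ω I T N (y + stepVec s) ≤ b) (N : ℕ) {y : Site d} (hy : y ∈ I') :
    hp ω I T N y ≤ b + (a - b) * hp ω I' T' N y := by
  induction N generalizing y with
  | zero =>
    rw [hp_zero ω (Set.disjoint_left.1 hIT hy)]
    have := mul_nonneg (sub_nonneg.2 hab) (hp_nonneg ω I' T' 0 y)
    linarith
  | succ N ih =>
    rw [hp_succ ω N (Set.disjoint_left.1 hIT hy) (hI hy),
      hp_succ ω N (Set.disjoint_left.1 hIT' hy) hy]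
    have key : ∀ s, hp ω I T N (y + stepVec s) ≤ b + (a - b) * hp ω I' T' N (y + stepVec s) := by
      intro s
      by_cases h1 : y + stepVec s ∈ T'
      · rw [hp_of_mem ω N h1]; have := ha N y hy s h1; linarith
      · by_cases h2 : y + stepVec s ∈ I'
        · exact ih h2
        · rw [hp_of_notMem ω N h1 h2]; have := hb' N y hy s h1 h2; linarith
    calc ∑ s, (ω y).1 s * hp ω I T N (y + stepVec s)
        ≤ ∑ s, (ω y).1 s * (b + (a - b) * hp ω I' T' N (y + stepVec s)) :=
          Finset.sum_le_sum fun s _ => mul_le_mul_of_nonneg_left (key s) ((ω y).2.1 s)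
      _ = b + (a - b) * ∑ s, (ω y).1 s * hp ω I' T' N (y + stepVec s) := by
        simp only [mul_add, Finset.sum_add_distrib, ← Finset.sum_mul, (ω y).2.2, one_mul,
          Finset.mul_sum]
        congr 1
        exact Finset.sum_congr rfl fun s _ => by ring

/-- Going straight out of the region gives a uniform bound away from one. -/
lemma hp_le_straight {d : ℕ} {ω : Env d} {η : ℝ} (hη : 0 ≤ η) (hell : ∀ x s, η ≤ (ω x).1 s)
    {I T : Set (Site d)} (e : StepIdx d) (k : ℕ) (N : ℕ) {y : Site d}
    (hT : ∀ j ≤ k, y + j • stepVec e ∉ T) (hI : y + k • stepVec e ∉ I) :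
    hp ω I T N y ≤ 1 - η ^ k := by
  have hη1 : η ≤ 1 := by
    have h1 := hell y e
    have h2 := Finset.single_le_sum (f := (ω y).1) (fun s _ => (ω y).2.1 s) (Finset.mem_univ e)
    rw [(ω y).2.2] at h2
    linarith
  induction k generalizing N y with
  | zero =>
    have h1 := hT 0 le_rfl
    simp only [zero_smul, add_zero] at h1 hI
    rw [hp_of_notMem ω N h1 hI]; simp
  | succ k ih =>
    have hk1 : η ^ (k + 1) ≤ 1 := pow_le_one₀ hη hη1
    have hyT : y ∉ T := by simpa using hT 0 (Nat.zero_le _)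
    by_cases hyI : y ∈ I
    · cases N with
      | zero => rw [hp_zero ω hyT]; linarith
      | succ N =>
        rw [hp_succ ω N hyT hyI]
        have h1 : hp ω I T N (y + stepVec e) ≤ 1 - η ^ k := by
          refine ih N (fun j hj => ?_) ?_
          · have := hT (j + 1) (by omega)
            rwa [add_smul, one_smul, add_comm (j • stepVec e), ← add_assoc] at this
          · rwa [add_smul, one_smul, add_comm (k • stepVec e), ← add_assoc] at hI
        have h2 : ∑ s, (ω y).1 s * (1 - hp ω I T N (y + stepVec s)) ≥ η ^ (k + 1) := by
          have h3 := Finset.single_le_sum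
            (f := fun s => (ω y).1 s * (1 - hp ω I T N (y + stepVec s)))
            (fun s _ => mul_nonneg ((ω y).2.1 s) (sub_nonneg.2 (hp_le_one ω I T N _)))
            (Finset.mem_univ e)
          refine le_trans ?_ h3
          rw [pow_succ, mul_comm]
          exact mul_le_mul (hell y e) (by linarith) (by positivity) ((ω y).2.1 e)
        simp only [mul_sub, mul_one, Finset.sum_sub_distrib, (ω y).2.2] at h2
        linarith
    · rw [hp_of_notMem ω N hyT hyI]; linarith

/-- Paths from `x` which hit `T` for the first time, all earlier points being in `I`. -/
def fam {d : ℕ} (I T : Set (Site d)) (x : Site d) : Set (List (StepIdx d)) :=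
  {l | x + disp l ∈ T ∧ ∀ k < l.length, x + disp (l.take k) ∉ T ∧ x + disp (l.take k) ∈ I}

lemma cons_mem_fam {d : ℕ} {I T : Set (Site d)} {x : Site d} {s : StepIdx d}
    {l : List (StepIdx d)} :
    s :: l ∈ fam I T x ↔ (x ∉ T ∧ x ∈ I) ∧ l ∈ fam I T (x + stepVec s) := by
  constructor
  · rintro ⟨h1, h2⟩
    refine ⟨by simpa using h2 0 (by simp), by simpa [add_assoc] using h1, fun k hk => ?_⟩
    have := h2 (k + 1) (by simpa using hk)
    simpa [add_assoc] using this
  · rintro ⟨h1, h2, h3⟩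
    refine ⟨by simpa [add_assoc] using h2, fun k hk => ?_⟩
    cases k with
    | zero => simpa using h1
    | succ k =>
      have := h3 k (by simpa using hk)
      simpa [add_assoc] using this

lemma qw_fam {d : ℕ} (ω : Env d) (I T : Set (Site d)) (N : ℕ) (x : Site d) :
    qw ω x (fun l => if l.length ≤ N then ind (fam I T x) l else 0)
      = ENNReal.ofReal (hp ω I T N x) := by
  induction N generalizing x with
  | zero =>
    rw [qw_step]
    have : ∀ s : StepIdx d, qw ω (x + stepVec s) (fun l => if (s :: l).length ≤ 0 then
        ind (fam I T x) (s :: l) else 0) = 0 := fun s => by simp [qw]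
    simp only [this, mul_zero, Finset.sum_const_zero, add_zero]
    by_cases h : x ∈ T
    · rw [hp_of_mem ω 0 h]; simp [fam, h]
    · rw [hp_zero ω h]; simp [fam, h]
  | succ N ih =>
    rw [qw_step]
    by_cases hT : x ∈ T
    · rw [hp_of_mem ω _ hT]
      have : ∀ (s : StepIdx d) l, ind (fam I T x) (s :: l) = 0 := fun s l =>
        ind_of_notMem fun h => (cons_mem_fam.1 h).1.1 hT
      simp only [this]
      simp [qw, fam, hT]
    · have h0 : ind (fam I T x) [] = 0 := ind_of_notMem fun h => hT (by simpa using h.1)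
      by_cases hI : x ∈ I
      · rw [hp_succ ω N hT hI, ENNReal.ofReal_sum_of_nonneg
          fun s _ => mul_nonneg ((ω x).2.1 s) (hp_nonneg ω I T N _)]
        simp only [List.length_nil, Nat.zero_le, if_true, h0, zero_add]
        refine Finset.sum_congr rfl fun s _ => ?_
        rw [ENNReal.ofReal_mul ((ω x).2.1 s), ← ih]
        congr 2
        funext l
        simp only [List.length_cons, add_le_add_iff_right]
        congr 1
        by_cases hl : l ∈ fam I T (x + stepVec s)
        · rw [ind_of_mem hl, ind_of_mem (cons_mem_fam.2 ⟨⟨hT, hI⟩, hl⟩)]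
        · rw [ind_of_notMem hl, ind_of_notMem fun h => hl (cons_mem_fam.1 h).2]
      · rw [hp_of_notMem ω _ hT hI]
        have : ∀ (s : StepIdx d) l, ind (fam I T x) (s :: l) = 0 := fun s l =>
          ind_of_notMem fun h => hI (cons_mem_fam.1 h).1.2
        simp [this, h0, qw]

lemma hp_le_pr {d : ℕ} (ω : Env d) (I T : Set (Site d)) (N : ℕ) (x : Site d) :
    ENNReal.ofReal (hp ω I T N x) ≤ pr ω x {l | x + disp l ∈ T} := by
  rw [← qw_fam]
  refine qw_mono ω x fun l => ?_
  split_ifs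
  · refine ind_mono fun hl => ⟨hl.1, fun k hk h => (hl.2 k hk).1 h⟩
  · exact zero_le

lemma qs_fam_le {d : ℕ} (ω : Env d) (I T : Set (Site d)) (x : Site d) {c : ℝ}
    (h : ∀ N, hp ω I T N x ≤ c) : qs ω x (fam I T x) ≤ ENNReal.ofReal c := by
  rw [qs, qw_eq_iSup]
  refine iSup_le fun N => ?_
  rw [qw_fam]
  exact ENNReal.ofReal_le_ofReal (h N)

lemma measurable_hp {d : ℕ} (I T : Set (Site d)) (N : ℕ) (y : Site d) :
    Measurable fun ω : Env d => hp ω I T N y := by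
  induction N generalizing y with
  | zero => unfold hp; split_ifs <;> exact measurable_const
  | succ N ih =>
    unfold hp
    split_ifs
    · exact measurable_const
    · exact Finset.measurable_sum _ fun s _ => Measurable.mul
        ((measurable_pi_apply s).comp (measurable_subtype_coe.comp (measurable_pi_apply y))) (ih _)
    · exact measurable_const

lemma dependsOn_hp {d : ℕ} (I T : Set (Site d)) (N : ℕ) (y : Site d) :
    DependsOn (fun ω : Env d => hp ω I T N y) I := by
  intro ω ω' h
  simp only
  induction N generalizing y with
  | zero => simp [hp]
  | succ N ih =>
    unfold hp
    split_ifs with h1 h2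
    · rfl
    · rw [h y h2]
      exact Finset.sum_congr rfl fun s _ => by rw [ih]
    · rfl

/-! ### A one-dimensional comparison principle -/

lemma one_dim_comparison {m : ℕ} {A v r : ℕ → ℝ} (hr : ∀ j, 0 < r j) (hA0 : A 0 ≤ 1)
    (hAm : A (m + 1) = 0) (hApos : ∀ j, 0 ≤ A j) (hv0 : ∀ j, 0 ≤ v j)
    (hvr : ∀ j, 1 ≤ j → j ≤ m → v j < r j * (1 - v j))
    (hA : ∀ j, 1 ≤ j → j ≤ m →
      A j ≤ A (j + 1) + (max (A (j - 1)) (A (j + 1)) - A (j + 1)) * v j) {n : ℕ} (hn : n ≤ m + 1) :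
    A n ≤ ∑ k ∈ Finset.Ico n (m + 2), ∏ i ∈ Finset.range k, r (i + 1) := by
  set g : ℕ → ℝ := fun k => ∏ i ∈ Finset.range k, r (i + 1) with hg
  have hgpos : ∀ k, 0 < g k := fun k => Finset.prod_pos fun i _ => hr _
  set h : ℕ → ℝ := fun j => ∑ k ∈ Finset.Ico j (m + 2), g k with hh
  have hstep : ∀ j ≤ m + 1, h j = g j + h (j + 1) := fun j hj => by
    simp only [hh]
    rw [Finset.sum_eq_sum_Ico_succ_bot (by omega)]
  have hpos : ∀ j ≤ m + 1, 0 < h j := fun j hj => by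
    rw [hstep j hj]
    have : 0 ≤ h (j + 1) := Finset.sum_nonneg fun k _ => (hgpos k).le
    have := hgpos j
    linarith
  obtain ⟨j, hj, hmax⟩ := Finset.exists_max_image (Finset.range (m + 2)) (fun j => A j / h j)
    ⟨0, by simp⟩
  have hj' : j ≤ m + 1 := by simp at hj; omega
  set t := A j / h j with ht
  have htnn : 0 ≤ t := div_nonneg (hApos j) (hpos j hj').le
  have hle : ∀ i ≤ m + 1, A i ≤ t * h i := fun i hi => by
    have := hmax i (by simp; omega)
    rwa [div_le_iff₀ (hpos i hi)] at this
  have hAj : A j = t * h j := by rw [ht]; field_simp [(hpos j hj').ne']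
  have ht1 : t ≤ 1 := by
    by_contra hlt
    push Not at hlt
    have htpos : 0 < t := by linarith
    rcases Nat.eq_zero_or_pos j with h0 | h0
    · have h1 : 1 ≤ h 0 := by
        rw [hstep 0 (by omega)]
        have : 0 ≤ h (0 + 1) := Finset.sum_nonneg fun k _ => (hgpos k).le
        have hg0 : g 0 = 1 := by simp [hg]
        linarith
      rw [h0] at hAj
      nlinarith
    · rcases hj'.eq_or_lt with h1 | h1
      · rw [h1, hAm] at hAj
        have := hpos (m + 1) le_rfl
        have : 0 < t * h (m + 1) := by positivity
        linarith
      · have hjm : j ≤ m := by omega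
        have h2 := hA j h0 hjm
        have h3 := hvr j h0 hjm
        have hu := hle (j + 1) (by omega)
        have hd' := hle (j - 1) (by omega)
        have e1 := hstep j hj'
        have e2 := hstep (j - 1) (by omega)
        rw [Nat.sub_add_cancel h0] at e2
        have egj : g j = r j * g (j - 1) := by
          obtain ⟨i, rfl⟩ : ∃ i, j = i + 1 := ⟨j - 1, by omega⟩
          simp only [hg, Finset.prod_range_succ, Nat.add_sub_cancel]
          ring
        have hgj := hgpos j
        have hgj1 := hgpos (j - 1)
        have hv1 : v j < 1 := by
          by_contra hc
          push Not at hc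
          have := mul_nonpos_of_nonneg_of_nonpos (hr j).le (by linarith : 1 - v j ≤ 0)
          linarith
        rcases le_total (A (j - 1)) (A (j + 1)) with hc | hc
        · rw [max_eq_right hc] at h2
          have : t * h j = t * g j + t * h (j + 1) := by rw [e1]; ring
          have : 0 < t * g j := by positivity
          nlinarith
        · rw [max_eq_left hc] at h2
          have h4 : A j ≤ (1 - v j) * (t * h (j + 1)) + v j * (t * h (j - 1)) := by
            have := mul_le_mul_of_nonneg_left hu (by linarith : 0 ≤ 1 - v j)
            have := mul_le_mul_of_nonneg_left hd' (hv0 j)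
            nlinarith
          have h5 : v j * g (j - 1) < g j * (1 - v j) := by
            rw [egj]; nlinarith
          have h6 : t * (v j * g (j - 1)) < t * (g j * (1 - v j)) :=
            mul_lt_mul_of_pos_left h5 htpos
          rw [hAj, e2, e1] at h4
          nlinarith
  calc A n ≤ t * h n := hle n hn
    _ ≤ 1 * h n := by have := hpos n hn; gcongr
    _ = _ := one_mul _

/-! ### Improving the backtracking exponent -/

/-- Part of a box lying strictly between two levels. -/
def strip {d : ℕ} (ℓ : Fin d → ℝ) (M : ℕ) (a b : ℝ) : Set (Site d) :=
  {y | y ∈ box d M ∧ a < dotR y ℓ ∧ dotR y ℓ < b}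

/-- Half space below a level. -/
def below {d : ℕ} (ℓ : Fin d → ℝ) (a : ℝ) : Set (Site d) := {y | dotR y ℓ ≤ a}

/-- Some site close to level `c` has a sizeable probability to backtrack by `ρ`
before advancing by `ρ`. -/
def badLevel {d : ℕ} (ℓ : Fin d → ℝ) (M : ℕ) (ρ t c : ℝ) : Set (Env d) :=
  {ω | ∃ y ∈ box d M, |dotR y ℓ - c| ≤ 2 ∧
    ∃ N, 1 / 8 < hp ω (strip ℓ M (c - ρ) (min (c + ρ) t)) (below ℓ (c - ρ)) N y}

lemma dotR_nsmul {d : ℕ} (k : ℕ) (v : Site d) (ℓ : Fin d → ℝ) :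
    dotR (k • v) ℓ = k * dotR v ℓ := by
  simp only [dotR, Finset.mul_sum, Pi.smul_apply, nsmul_eq_mul]
  exact Finset.sum_congr rfl fun i _ => by push_cast; ring

lemma prod_ite_le {r : ℕ → ℝ} {B : Set ℕ} {b : ℝ} (hb : 1 ≤ b) {n k m : ℕ} (hnk : n ≤ k)
    (hr : ∀ j, 0 < r j) (hr1 : ∀ j, j ∉ B → r j ≤ 1 / 4) (hr2 : ∀ j ∈ B, r j ≤ 1 / 4 * b)
    (s : Finset ℕ) (hs : ∀ j, 1 ≤ j → j ≤ k → j ∈ B → j ∈ s) (hm : s.card ≤ m) :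
    ∏ i ∈ Finset.range k, r (i + 1) ≤ (1 / 4) ^ n * b ^ m := by
  classical
  calc ∏ i ∈ Finset.range k, r (i + 1)
      ≤ ∏ i ∈ Finset.range k, ((1 / 4) * if i + 1 ∈ s then b else 1) := by
        refine Finset.prod_le_prod (fun i _ => (hr _).le) fun i hi => ?_
        rw [Finset.mem_range] at hi
        by_cases h : i + 1 ∈ B
        · rw [if_pos (hs _ (by omega) (by omega) h)]; exact hr2 _ h
        · refine (hr1 _ h).trans ?_
          split_ifs <;> linarith
    _ = (1 / 4) ^ k * b ^ ((Finset.range k).filter (fun i => i + 1 ∈ s)).card := by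
        rw [Finset.prod_mul_distrib, Finset.prod_ite, Finset.prod_const, Finset.prod_const,
          Finset.prod_const_one, mul_one, Finset.card_range]
    _ ≤ (1 / 4) ^ n * b ^ m := by
        have hc : ((Finset.range k).filter (fun i => i + 1 ∈ s)).card ≤ s.card :=
          Finset.card_le_card_of_injOn (fun i => i + 1) (fun i hi => by simp at hi; exact hi.2)
            (fun i _ j _ h => by simpa using h)
        refine mul_le_mul ?_ (pow_le_pow_right₀ hb (hc.trans hm)) (by positivity) (by positivity)
        exact pow_le_pow_of_le_one (by norm_num) (by norm_num) hnk

lemma hp_le_of_few_bad {d : ℕ} {ω : Env d} {η : ℝ} (hη : 0 < η) (hell : ∀ x s, η ≤ (ω x).1 s)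
    {ℓ : Fin d → ℝ} (h2 : ∀ s, |dotR (stepVec s) ℓ| ≤ 2) {e : StepIdx d} {δ : ℝ}
    (he : δ ≤ dotR (stepVec e) ℓ) {ρ : ℝ} (hρ : 4 < ρ) {k : ℕ} (hδ : 0 < δ)
    (hk : ρ + 2 ≤ k * δ) {n : ℕ} (M m : ℕ) (s : Finset ℕ) (hs : s.card ≤ m)
    (hbad : ∀ j, 1 ≤ j → j ≤ 2 * n → ω ∈ badLevel ℓ M ρ (n * ρ) ((j - n) * ρ) → j ∈ s) (N : ℕ) :
    hp ω (strip ℓ M (-(n * ρ)) (n * ρ)) (below ℓ (-(n * ρ))) N 0 ≤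
      (n + 2) * ((1 / 4) ^ n * (4 * (η ^ k)⁻¹) ^ m) := by
  classical
  have hη1 : η ≤ 1 := by
    have h1 := hell 0 e
    have h2 := Finset.single_le_sum (f := (ω 0).1) (fun s _ => (ω 0).2.1 s) (Finset.mem_univ e)
    rw [(ω 0).2.2] at h2
    linarith
  have hηk : 0 < η ^ k := by positivity
  have hηk1 : η ^ k ≤ 1 := pow_le_one₀ hη.le hη1
  have hinv : 1 ≤ (η ^ k)⁻¹ := (one_le_inv₀ hηk).2 hηk1
  set I := strip ℓ M (-(n * ρ)) (n * ρ) with hI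
  set T := below ℓ (-(n * ρ)) with hT
  set c : ℕ → ℝ := fun j => (j - n) * ρ with hc
  have hc1 : ∀ j, c (j + 1) = c j + ρ := fun j => by simp only [hc]; push_cast; ring
  have hc1' : ∀ j, 1 ≤ j → c (j - 1) = c j - ρ := fun j hj => by
    simp only [hc]; rw [Nat.cast_sub hj]; push_cast; ring
  have hc0 : ∀ j, -(n * ρ) ≤ c j := fun j => by
    simp only [hc]
    have : (0 : ℝ) ≤ j * ρ := by positivity
    linarith
  have hcge : ∀ j, 1 ≤ j → -(n * ρ) + ρ ≤ c j := fun j hj => by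
    have := hc0 (j - 1); rw [hc1' j hj] at this; linarith
  set B : Set ℕ := {j | j ≤ 2 * n ∧ ω ∈ badLevel ℓ M ρ (n * ρ) (c j)} with hB
  set A : ℕ → ℝ := fun j => ⨆ p : ℕ × {y : Site d // |dotR y ℓ - c j| ≤ 2},
    hp ω I T p.1 p.2.1 with hA
  set v : ℕ → ℝ := fun j => if j ∈ B then 1 - η ^ k else 1 / 8 with hv
  set r : ℕ → ℝ := fun j => if j ∈ B then (η ^ k)⁻¹ else 1 / 4 with hr
  have hApos : ∀ j, 0 ≤ A j := fun j => Real.iSup_nonneg fun p => hp_nonneg _ _ _ _ _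
  have hAle : ∀ j N y, |dotR y ℓ - c j| ≤ 2 → hp ω I T N y ≤ A j := fun j N y hy =>
    le_ciSup (f := fun p : ℕ × {y : Site d // |dotR y ℓ - c j| ≤ 2} => hp ω I T p.1 p.2.1)
      ⟨1, by rintro _ ⟨p, rfl⟩; exact hp_le_one _ _ _ _ _⟩ (N, ⟨y, hy⟩)
  have key := one_dim_comparison (m := 2 * n) (A := A) (v := v) (r := r) (n := n) ?_ ?_ ?_ hApos ?_
    ?_ ?_ (by omega)
  · have h0 : hp ω I T N 0 ≤ A n := hAle n N 0 (by simp [hc, dotR_zero])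
    refine h0.trans (key.trans ?_)
    have hterm : ∀ i ∈ Finset.Ico n (2 * n + 2), ∏ j ∈ Finset.range i, r (j + 1) ≤
        (1 / 4) ^ n * (4 * (η ^ k)⁻¹) ^ m := fun i hi => by
      refine prod_ite_le (B := B) (by linarith) (Finset.mem_Ico.1 hi).1 ?_ ?_ ?_ s ?_ hs
      · intro j; simp only [hr]; split_ifs <;> positivity
      · intro j hj; simp only [hr, if_neg hj]; exact le_rfl
      · intro j hj; simp only [hr, if_pos hj]; linarith
      · exact fun j hj1 _ hj => hbad j hj1 hj.1 hj.2
    refine (Finset.sum_le_card_nsmul _ _ _ hterm).trans (le_of_eq ?_)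
    rw [Nat.card_Ico, nsmul_eq_mul, show 2 * n + 2 - n = n + 2 by omega]
    push_cast; ring
  · intro j; simp only [hr]; split_ifs <;> positivity
  · exact Real.iSup_le (fun p => hp_le_one _ _ _ _ _) zero_le_one
  · refine le_antisymm (Real.iSup_le (fun p => ?_) le_rfl) (hApos _)
    obtain ⟨N, y, hy⟩ := p
    rw [abs_le] at hy
    have h3 : c (2 * n + 1) = n * ρ + ρ := by simp only [hc]; push_cast; ring
    rw [h3] at hy
    have hnρ : 0 ≤ (n : ℝ) * ρ := by positivity
    rw [hp_of_notMem]
    · simp only [hT, below, Set.mem_ofPred_eq]; linarith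
    · simp only [hI, strip, Set.mem_ofPred_eq]; rintro ⟨_, _, h⟩; linarith
  · intro j; simp only [hv]; split_ifs <;> linarith
  · intro j _ _; simp only [hv, hr]; split_ifs
    · rw [sub_sub_cancel, inv_mul_cancel₀ hηk.ne']; linarith
    · norm_num
  · intro j hj1 hj2
    have hv0 : 0 ≤ v j := by simp only [hv]; split_ifs <;> linarith
    have hrhs : 0 ≤ A (j + 1) + (max (A (j - 1)) (A (j + 1)) - A (j + 1)) * v j :=
      add_nonneg (hApos _) (mul_nonneg (sub_nonneg.2 (le_max_right _ _)) hv0)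
    refine Real.iSup_le (fun p => ?_) hrhs
    obtain ⟨N, y, hy⟩ := p
    dsimp only
    have hy' := abs_le.1 hy
    have hcj := hcge j hj1
    set I' := strip ℓ M (c j - ρ) (min (c j + ρ) (n * ρ)) with hI'
    set T' := below ℓ (c j - ρ) with hT'
    by_cases hyI : y ∈ I
    swap
    · rw [hp_of_notMem _ _ _ hyI]
      · exact hrhs
      · simp only [hT, below, Set.mem_ofPred_eq]; linarith
    have hyI' : y ∈ I' := ⟨hyI.1, by linarith, lt_min (by linarith) hyI.2.2⟩
    have hII' : I' ⊆ I := fun z hz => ⟨hz.1, by have := hz.2.1; linarith,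
      lt_of_lt_of_le hz.2.2 (min_le_right _ _)⟩
    have h := hp_le_exit ω (I := I) (T := T) (I' := I') (T' := T') (a := max (A (j - 1)) (A (j + 1)))
      (b := A (j + 1)) (hApos _) (le_max_right _ _) hII' ?_ ?_ ?_ ?_ N hyI'
    · refine h.trans ?_
      gcongr
      · exact sub_nonneg.2 (le_max_right _ _)
      simp only [hv]
      split_ifs with hjB
      · refine hp_le_straight hη.le hell e k N (fun i hi => ?_) ?_
        · simp only [hT', below, Set.mem_ofPred_eq, dotR_add, dotR_nsmul]
          have : 0 ≤ (i : ℝ) * dotR (stepVec e) ℓ := by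
            have := hδ.le.trans he; positivity
          linarith
        · simp only [hI', strip, Set.mem_ofPred_eq, dotR_add, dotR_nsmul]
          rintro ⟨_, _, h3⟩
          have h4 := lt_of_lt_of_le h3 (min_le_left _ _)
          have : (k : ℝ) * δ ≤ (k : ℝ) * dotR (stepVec e) ℓ := by gcongr
          linarith
      · by_contra! h3
        exact hjB ⟨hj2, y, hyI.1, hy, N, h3⟩
    · exact Set.disjoint_left.2 fun z hz hzT => by
        have h3 := hz.2.1
        have h4 : dotR z ℓ ≤ _ := hzT
        linarith
    · exact Set.disjoint_left.2 fun z hz hzT => by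
        have h3 := hz.2.1
        have h4 : dotR z ℓ ≤ _ := hzT
        linarith
    · intro N z hz s hzs
      refine (hAle (j - 1) N _ ?_).trans (le_max_left _ _)
      have h3 := hz.2.1
      have h4 : dotR _ ℓ ≤ _ := hzs
      have h5 := abs_le.1 (h2 s)
      rw [hc1' j hj1, abs_le]
      rw [dotR_add] at h4 ⊢
      constructor <;> linarith
    · intro N z hz s hzT hzI
      have h4 : ¬ dotR (z + stepVec s) ℓ ≤ c j - ρ := hzT
      have h5 := abs_le.1 (h2 s)
      by_cases h6 : z + stepVec s ∈ I
      · have h7 : c j + ρ ≤ dotR (z + stepVec s) ℓ := by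
          by_contra! h7
          exact hzI ⟨h6.1, by linarith, lt_min h7 h6.2.2⟩
        refine hAle (j + 1) N _ ?_
        have h8 := lt_of_lt_of_le hz.2.2 (min_le_left _ _)
        rw [hc1 j, abs_le]
        rw [dotR_add] at h7 ⊢
        constructor <;> linarith
      · rw [hp_of_notMem _ _ _ h6]
        · exact hApos _
        · simp only [hT, below, Set.mem_ofPred_eq]; push Not at h4 ⊢; linarith

lemma Good.lintegral_prod_le {d : ℕ} {P : Measure (Env d)} {η : ℝ} (hG : Good P η)
    {ι : Type*} [DecidableEq ι] (s : Finset ι) (S : ι → Set (Site d)) (f : ι → Env d → ℝ≥0∞)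
    (hf : ∀ j ∈ s, Measurable (f j)) (hS : ∀ j ∈ s, DependsOn (f j) (S j))
    (hdisj : ∀ i ∈ s, ∀ j ∈ s, i ≠ j → Disjoint (S i) (S j)) {a : ℝ≥0∞}
    (ha : ∀ j ∈ s, ∫⁻ ω, f j ω ∂P ≤ a) : ∫⁻ ω, ∏ j ∈ s, f j ω ∂P ≤ a ^ s.card := by
  have := hG.prob
  induction s using Finset.induction_on with
  | empty => simp
  | insert i s hi ih =>
    simp only [Finset.prod_insert hi, Finset.card_insert_of_notMem hi]
    rw [hG.indep (S i) (⋃ j ∈ s, S j) _ _ (hf i (by simp))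
      (Finset.measurable_prod _ fun j hj => hf j (by simp [hj])) (hS i (by simp)) ?_ ?_, pow_succ,
      mul_comm]
    · exact mul_le_mul' (ih (fun j hj => hf j (by simp [hj])) (fun j hj => hS j (by simp [hj]))
        (fun j hj k hk => hdisj j (by simp [hj]) k (by simp [hk])) fun j hj => ha j (by simp [hj]))
        (ha i (by simp))
    · intro ω ω' h
      refine Finset.prod_congr rfl fun j hj => hS j (by simp [hj]) fun x hx => h x ?_
      simp only [Set.mem_iUnion]
      exact ⟨j, hj, hx⟩
    · simp only [Set.disjoint_iUnion_right]
      intro j hj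
      exact hdisj i (by simp) j (by simp [hj]) (by rintro rfl; exact hi hj)

open Classical in
/-- Large deviation bound for the number of occurrences of independent events. -/
lemma Good.measure_card_ge_le {d : ℕ} {P : Measure (Env d)} {η : ℝ} (hG : Good P η)
    (s : Finset ℕ) (S : ℕ → Set (Site d)) (E : ℕ → Set (Env d))
    (hE : ∀ j ∈ s, MeasurableSet (E j))
    (hS : ∀ j ∈ s, ∀ ω ω' : Env d, (∀ x ∈ S j, ω x = ω' x) → ω ∈ E j → ω' ∈ E j)
    (hdisj : ∀ i ∈ s, ∀ j ∈ s, i ≠ j → Disjoint (S i) (S j)) {p : ℝ≥0∞}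
    (hp : ∀ j ∈ s, P (E j) ≤ p) (m : ℕ) :
    17 ^ m * P {ω | m ≤ (s.filter fun j => ω ∈ E j).card} ≤ (1 + 16 * p) ^ s.card := by
  have := hG.prob
  set f : ℕ → Env d → ℝ≥0∞ := fun j ω => 1 + (E j).indicator (fun _ => 16) ω with hf
  have hfm : ∀ j ∈ s, Measurable (f j) := fun j hj =>
    Measurable.const_add (measurable_const.indicator (hE j hj)) 1
  have h1 := hG.lintegral_prod_le s S f hfm ?_ hdisj (a := 1 + 16 * p) ?_
  · refine le_trans ?_ h1
    have h2 := mul_meas_ge_le_lintegral (μ := P)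
      (Finset.measurable_prod s fun j hj => hfm j hj) (17 ^ m)
    refine le_trans (mul_le_mul' le_rfl (measure_mono fun ω hω => ?_)) h2
    simp only [Set.mem_ofPred_eq] at hω ⊢
    have h3 : ∀ j, f j ω = if ω ∈ E j then 17 else 1 := fun j => by
      simp only [hf, Set.indicator_apply]; split_ifs <;> norm_num
    simp only [h3]
    rw [Finset.prod_ite, Finset.prod_const, Finset.prod_const_one, mul_one]
    exact pow_le_pow_right₀ (by norm_num) hω
  · intro j hj ω ω' h
    have : ω ∈ E j ↔ ω' ∈ E j := ⟨hS j hj ω ω' h, hS j hj ω' ω fun x hx => (h x hx).symm⟩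
    simp only [hf, Set.indicator_apply, this]
  · intro j hj
    simp only [hf]
    rw [lintegral_add_left measurable_const, lintegral_indicator (hE j hj)]
    simp only [lintegral_const, measure_univ, mul_one, Measure.restrict_apply_univ]
    gcongr
    exact hp j hj

lemma measurableSet_badLevel {d : ℕ} (ℓ : Fin d → ℝ) (M : ℕ) (ρ t c : ℝ) :
    MeasurableSet (badLevel ℓ M ρ t c : Set (Env d)) := by
  have : (badLevel ℓ M ρ t c : Set (Env d)) = ⋃ y ∈ box d M, ⋃ (_ : |dotR y ℓ - c| ≤ 2), ⋃ N,
      {ω | 1 / 8 < hp ω (strip ℓ M (c - ρ) (min (c + ρ) t)) (below ℓ (c - ρ)) N y} := by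
    ext ω
    simp only [badLevel, Set.mem_ofPred_eq, Set.mem_iUnion, exists_prop]
  rw [this]
  refine Finset.measurableSet_biUnion _ fun y _ => MeasurableSet.iUnion fun _ =>
    MeasurableSet.iUnion fun N => measurableSet_lt measurable_const (measurable_hp _ _ _ _)

lemma measure_badLevel_le {d : ℕ} {P : Measure (Env d)} {η : ℝ} (hG : Good P η)
    {ℓ : Fin d → ℝ} (hℓ : ∀ v, |dotR v ℓ| ≤ 2 * nr v) (M : ℕ) {κ ρ : ℝ} (hκ : 0 < κ)
    (hρ : 4 < ρ) (t c : ℝ) :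
    P (badLevel ℓ M ρ t c) ≤ (box d M).card * (8 * apr P (bl ℓ κ (ρ / 4))) := by
  set T : Site d → Set (List (StepIdx d)) := fun y => {l | y + disp l ∈ below ℓ (c - ρ)} with hT
  have hsub : (badLevel ℓ M ρ t c : Set (Env d)) ⊆ ⋃ y ∈ (box d M).filter
      (fun y => |dotR y ℓ - c| ≤ 2), {ω | ENNReal.ofReal (1 / 8) ≤ pr ω y (T y)} := by
    rintro ω ⟨y, hy, hyc, N, h⟩
    simp only [Set.mem_iUnion, Finset.mem_filter]
    exact ⟨y, ⟨hy, hyc⟩, (ENNReal.ofReal_le_ofReal h.le).trans (hp_le_pr ω _ _ N y)⟩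
  refine (measure_mono hsub).trans ((measure_biUnion_finset_le _ _).trans ?_)
  have hb : ∀ y ∈ (box d M).filter (fun y => |dotR y ℓ - c| ≤ 2),
      P {ω | ENNReal.ofReal (1 / 8) ≤ pr ω y (T y)} ≤ 8 * apr P (bl ℓ κ (ρ / 4)) := by
    intro y hy
    have hyc := abs_le.1 (Finset.mem_filter.1 hy).2
    have h1 := mul_meas_ge_le_lintegral (μ := P) (measurable_pr (d := d) y (T y))
      (ENNReal.ofReal (1 / 8))
    rw [hG.lintegral_pr] at h1
    have h2 : apr P (T y) ≤ apr P (bl ℓ κ (ρ / 4)) := hG.apr_mono fun l hl => by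
      have h3 : dotR (y + disp l) ℓ ≤ c - ρ := hl
      rw [dotR_add] at h3
      have h4 := abs_le.1 (hℓ (disp l))
      have h5 := nr_nonneg (disp l)
      refine ⟨by linarith, ?_⟩
      have : 0 ≤ κ * nr (disp l) := by positivity
      linarith
    calc P {ω | ENNReal.ofReal (1 / 8) ≤ pr ω y (T y)}
        = 8 * (ENNReal.ofReal (1 / 8) * P {ω | ENNReal.ofReal (1 / 8) ≤ pr ω y (T y)}) := by
          rw [← mul_assoc, show (8 : ℝ≥0∞) = ENNReal.ofReal 8 by simp,
            ← ENNReal.ofReal_mul (by norm_num)]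
          norm_num
      _ ≤ 8 * apr P (bl ℓ κ (ρ / 4)) := by gcongr; exact h1.trans h2
  refine (Finset.sum_le_card_nsmul _ _ _ hb).trans ?_
  rw [nsmul_eq_mul]
  gcongr
  exact Finset.filter_subset _ _

lemma apr_back_le_fam {d : ℕ} {P : Measure (Env d)} {η : ℝ} (hG : Good P η)
    {ℓ : Fin d → ℝ} {M : ℕ} {κ L : ℝ} (hκ : 0 < κ) (hL : L ≤ κ * M) :
    apr P (back ℓ L) ≤ apr P (bl ℓ κ M) +
      ∫⁻ ω, qs ω 0 (fam (strip ℓ M (-L) L) (below ℓ (-L)) 0) ∂P := by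
  classical
  set I := strip ℓ M (-L) L with hI
  set T := below ℓ (-L) with hT
  rw [← hG.lintegral_pr 0, ← hG.lintegral_pr 0, ← lintegral_add_left (measurable_pr _ _)]
  refine lintegral_mono fun ω => ?_
  change _ ≤ qw ω 0 (ind (first (bl ℓ κ M))) + qw ω 0 (ind (fam I T 0))
  rw [← qw_add]
  refine pr_le_qw ω 0 fun l hl => ?_
  by_cases hb : ∃ k ≤ l.length, l.take k ∈ bl ℓ κ M
  · obtain ⟨k, hk, hkb⟩ := hb
    obtain ⟨i, hi, hif⟩ := exists_take_mem_first hkb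
    refine le_trans ?_ (le_cnt _ (hi.trans hk))
    rw [ind_of_mem hif]
    exact le_self_add
  · push Not at hb
    have hex : ∃ k, k ≤ l.length ∧ disp (l.take k) ∈ T := ⟨l.length, le_rfl, by rw [List.take_length]; exact hl.1⟩
    have hk := Nat.find_spec hex
    set k := Nat.find hex
    refine le_trans ?_ (le_cnt _ hk.1)
    have hm : l.take k ∈ fam I T 0 := by
      refine ⟨by simpa using hk.2, fun i hi => ?_⟩
      rw [List.length_take, min_eq_left hk.1] at hi
      rw [List.take_take, min_eq_left hi.le, zero_add]
      have hiT : disp (l.take i) ∉ T := fun h => Nat.find_min hex hi ⟨hi.le.trans hk.1, h⟩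
      have hiT' : ¬ dotR (disp (l.take i)) ℓ ≤ -L := hiT
      have hiL := hl.2 i (hi.le.trans hk.1)
      refine ⟨hiT, ?_, not_le.1 hiT', hiL⟩
      refine mem_box_of_nr_le ?_
      by_contra! hM
      refine hb i (hi.le.trans hk.1) ⟨hM.le, hiL.trans_le (hL.trans ?_)⟩
      gcongr
    rw [ind_of_mem hm]
    exact le_add_self

lemma lintegral_qs_fam_le {d : ℕ} {P : Measure (Env d)} {η : ℝ} (hG : Good P η)
    {ℓ : Fin d → ℝ} (h2 : ∀ s, |dotR (stepVec s) ℓ| ≤ 2) {e : StepIdx d} {δ : ℝ}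
    (he : δ ≤ dotR (stepVec e) ℓ) {ρ : ℝ} (hρ : 4 < ρ) {k : ℕ} (hδ : 0 < δ)
    (hk : ρ + 2 ≤ k * δ) {n : ℕ} (hn : 0 < n) (M m : ℕ)
    (hp : ∀ c, P (badLevel ℓ M ρ (n * ρ) c) ≤ ENNReal.ofReal (1 / (16 * n))) :
    ∫⁻ ω, qs ω 0 (fam (strip ℓ M (-(n * ρ)) (n * ρ)) (below ℓ (-(n * ρ))) 0) ∂P ≤
      ENNReal.ofReal ((n + 2) * ((1 / 4) ^ n * (4 * (η ^ k)⁻¹) ^ (2 * m)) + 6 / 17 ^ m) := by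
  classical
  have := hG.prob
  have hη := hG.pos
  set I := strip ℓ M (-(n * ρ)) (n * ρ) with hI
  set T := below ℓ (-(n * ρ)) with hT
  set E : ℕ → ℕ → Set (Env d) := fun b i =>
    badLevel ℓ M ρ (n * ρ) (((2 * i + 1 + b : ℕ) - n) * ρ) with hE
  set F : ℕ → Set (Env d) := fun b => {ω | m ≤ ((Finset.range n).filter fun i => ω ∈ E b i).card}
    with hF
  have hFle : ∀ b, P (F b) ≤ ENNReal.ofReal (3 / 17 ^ m) := fun b => by
    have h1 := hG.measure_card_ge_le (Finset.range n)
      (fun i => strip ℓ M ((((2 * i + 1 + b : ℕ) - n) * ρ) - ρ)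
        (min ((((2 * i + 1 + b : ℕ) - n) * ρ) + ρ) (n * ρ))) (E b)
      (fun j _ => measurableSet_badLevel _ _ _ _ _) ?_ ?_ (fun j _ => hp _) m
    · have h3 : (1 + 16 * ENNReal.ofReal (1 / (16 * n))) ^ (Finset.range n).card
          ≤ ENNReal.ofReal 3 := by
        rw [show (16 : ℝ≥0∞) = ENNReal.ofReal 16 by simp, ← ENNReal.ofReal_mul (by norm_num),
          ← ENNReal.ofReal_one, ← ENNReal.ofReal_add (by norm_num) (by positivity),
          ← ENNReal.ofReal_pow (by positivity), Finset.card_range]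
        refine ENNReal.ofReal_le_ofReal ?_
        have hn' : (0 : ℝ) < n := by exact_mod_cast hn
        calc (1 + 16 * (1 / (16 * (n : ℝ)))) ^ n ≤ (Real.exp (1 / n)) ^ n := by
              gcongr
              rw [show 16 * (1 / (16 * (n : ℝ))) = 1 / n by field_simp, add_comm]
              exact Real.add_one_le_exp _
          _ = Real.exp 1 := by rw [← Real.exp_nat_mul]; congr 1; field_simp
          _ ≤ 3 := by have := Real.exp_one_lt_d9; linarith
      rw [ENNReal.ofReal_div_of_pos (by positivity),
        ENNReal.le_div_iff_mul_le (Or.inl (by simp)) (Or.inl (by simp)), mul_comm]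
      refine le_trans ?_ (h1.trans h3)
      rw [ENNReal.ofReal_pow (by norm_num)]
      simp [hF]
    · rintro j _ ω ω' h ⟨y, hy, hyc, N, hN⟩
      refine ⟨y, hy, hyc, N, ?_⟩
      have h' := dependsOn_hp (strip ℓ M _ _)
        (below ℓ ((((2 * j + 1 + b : ℕ) - n) * ρ) - ρ)) N y h
      exact hN.trans_eq h'
    · have key : ∀ i j : ℕ, i < j → Disjoint
          (strip ℓ M ((((2 * i + 1 + b : ℕ) - n) * ρ) - ρ)
            (min ((((2 * i + 1 + b : ℕ) - n) * ρ) + ρ) (n * ρ)))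
          (strip ℓ M ((((2 * j + 1 + b : ℕ) - n) * ρ) - ρ)
            (min ((((2 * j + 1 + b : ℕ) - n) * ρ) + ρ) (n * ρ))) := fun i j hij => by
        refine Set.disjoint_left.2 fun x hx hx' => ?_
        have h3 := hx.2.2.trans_le (min_le_left _ _)
        have h4 := hx'.2.1
        have h5 : (i : ℝ) + 1 ≤ j := by exact_mod_cast hij
        push_cast at h3 h4
        nlinarith
      intro i _ j _ hij
      rcases lt_or_gt_of_ne hij with h | h
      · exact key i j h
      · exact (key j i h).symm
  set a := ((n : ℝ) + 2) * ((1 / 4) ^ n * (4 * (η ^ k)⁻¹) ^ (2 * m)) with ha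
  have ha0 : 0 ≤ a := by positivity
  have hFm : ∀ b, MeasurableSet (F b) := fun b => by
    have : Measurable fun ω : Env d => ∑ i ∈ Finset.range n, (E b i).indicator (fun _ => 1) ω :=
      Finset.measurable_sum _ fun i _ => measurable_const.indicator (measurableSet_badLevel _ _ _ _ _)
    have h := this (measurableSet_Ici (a := m))
    convert h using 1
    ext ω
    simp only [hF, Set.mem_ofPred_eq, Set.mem_preimage, Set.mem_Ici, Finset.card_filter,
      Set.indicator_apply]
  have hpt : ∀ᵐ ω ∂P, qs ω 0 (fam I T 0) ≤ ENNReal.ofReal a +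
      ((F 0).indicator (fun _ => 1) ω + (F 1).indicator (fun _ => 1) ω) := by
    filter_upwards [hG.ell] with ω hω
    by_cases h0 : ω ∈ F 0
    · rw [Set.indicator_of_mem h0]
      have := qs_fam_le ω I T 0 fun N => hp_le_one ω I T N 0
      rw [ENNReal.ofReal_one] at this
      exact this.trans (le_trans le_self_add le_add_self)
    by_cases h1 : ω ∈ F 1
    · rw [Set.indicator_of_mem h1]
      have := qs_fam_le ω I T 0 fun N => hp_le_one ω I T N 0
      rw [ENNReal.ofReal_one] at this
      exact this.trans (le_trans le_add_self le_add_self)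
    refine le_trans ?_ le_self_add
    refine qs_fam_le ω I T 0 fun N => ?_
    refine hp_le_of_few_bad hη hω h2 he hρ hδ hk M (2 * m)
      (((Finset.range n).filter fun i => ω ∈ E 0 i).image (fun i => 2 * i + 1 + 0) ∪
        ((Finset.range n).filter fun i => ω ∈ E 1 i).image (fun i => 2 * i + 1 + 1)) ?_ ?_ N
    · refine (Finset.card_union_le _ _).trans ?_
      simp only [hF, Set.mem_ofPred_eq, not_le] at h0 h1
      have h3 := (Finset.card_image_le (s := (Finset.range n).filter fun i => ω ∈ E 0 i)
        (f := fun i => 2 * i + 1 + 0))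
      have h4 := (Finset.card_image_le (s := (Finset.range n).filter fun i => ω ∈ E 1 i)
        (f := fun i => 2 * i + 1 + 1))
      omega
    · intro j hj1 hj2 hj
      simp only [Finset.mem_union, Finset.mem_image, Finset.mem_filter, Finset.mem_range]
      rcases Nat.even_or_odd j with ⟨i, rfl⟩ | ⟨i, rfl⟩
      · right
        obtain ⟨i, rfl⟩ : ∃ i', i = i' + 1 := ⟨i - 1, by omega⟩
        refine ⟨i, ⟨by omega, ?_⟩, by ring⟩
        simp only [hE]
        rwa [show 2 * i + 1 + 1 = i + 1 + (i + 1) by ring]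
      · left
        exact ⟨i, ⟨by omega, hj⟩, rfl⟩
  refine (lintegral_mono_ae hpt).trans ?_
  rw [lintegral_add_left measurable_const, lintegral_add_left (measurable_const.indicator (hFm 0)),
    lintegral_indicator (hFm 0), lintegral_indicator (hFm 1)]
  simp only [lintegral_const, measure_univ, mul_one, Measure.restrict_apply_univ, one_mul]
  rw [ENNReal.ofReal_add ha0 (by positivity), show (6 : ℝ) / 17 ^ m = 3 / 17 ^ m + 3 / 17 ^ m by ring,
    ENNReal.ofReal_add (by positivity) (by positivity)]
  gcongr
  · exact hFle 0
  · exact hFle 1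

lemma few_bad_numeric {η b : ℝ} (hη : 0 < η) (hη1 : η ≤ 1) (k₁ : ℕ)
    (hb : Real.log 4 + k₁ * -Real.log η ≤ b) {K : ℕ} (hK1 : 1 ≤ K) (hK : 4 * b + 2 ≤ K) :
    (((K ^ 19 : ℕ) : ℝ) + 2) * ((1 / 4) ^ (K ^ 19) * (4 * (η ^ (k₁ * K))⁻¹) ^ (2 * K ^ 15)) ≤
      2 * Real.exp (-((K : ℝ) ^ 15)) := by
  have hK1' : (1 : ℝ) ≤ K := by exact_mod_cast hK1
  have hl4 : 0 ≤ Real.log 4 := Real.log_nonneg (by norm_num)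
  have hlη : 0 ≤ -Real.log η := by have := Real.log_nonpos hη.le hη1; linarith
  have h1 : (((K ^ 19 : ℕ) : ℝ) + 2) * (1 / 4) ^ (K ^ 19) ≤
      2 * Real.exp (-((K : ℝ) ^ 19 * (1 / 2))) := by
    set n := K ^ 19 with hn
    have h3 : (n : ℝ) + 2 ≤ 2 * 2 ^ n := by
      have : n + 2 ≤ 2 * 2 ^ n := by
        have := Nat.lt_two_pow_self (n := n)
        have : 1 ≤ 2 ^ n := Nat.one_le_two_pow
        omega
      exact_mod_cast this
    have h4 : (1 / 2 : ℝ) ≤ Real.exp (-(1 / 2)) := by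
      have := Real.add_one_le_exp (-(1 / 2) : ℝ); linarith
    calc ((n : ℝ) + 2) * (1 / 4) ^ n ≤ 2 * 2 ^ n * (1 / 4) ^ n := by gcongr
      _ = 2 * (1 / 2) ^ n := by rw [mul_assoc, ← mul_pow]; norm_num
      _ ≤ 2 * Real.exp (-(1 / 2)) ^ n := by gcongr
      _ = _ := by rw [← Real.exp_nat_mul, hn]; push_cast; ring_nf
  have h2 : (4 * (η ^ (k₁ * K))⁻¹) ^ (2 * K ^ 15) ≤ Real.exp (2 * b * (K : ℝ) ^ 16) := by
    have h5 : 4 * (η ^ (k₁ * K))⁻¹ ≤ Real.exp (b * K) := by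
      have e1 : (4 : ℝ) = Real.exp (Real.log 4) := (Real.exp_log (by norm_num)).symm
      have e2 : (η ^ (k₁ * K))⁻¹ = Real.exp (k₁ * K * -Real.log η) := by
        rw [mul_neg, Real.exp_neg]
        congr 1
        rw [show ((k₁ : ℝ) * K) = ((k₁ * K : ℕ) : ℝ) by push_cast; ring, Real.exp_nat_mul,
          Real.exp_log hη]
      rw [e1, e2, ← Real.exp_add]
      apply Real.exp_le_exp.2
      rw [e1, Real.log_exp]
      nlinarith
    calc (4 * (η ^ (k₁ * K))⁻¹) ^ (2 * K ^ 15) ≤ Real.exp (b * K) ^ (2 * K ^ 15) := by gcongr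
      _ = _ := by rw [← Real.exp_nat_mul]; push_cast; ring_nf
  have hb0 : 0 ≤ b := le_trans (by positivity) hb
  calc _ = ((((K ^ 19 : ℕ) : ℝ) + 2) * (1 / 4) ^ (K ^ 19)) *
        (4 * (η ^ (k₁ * K))⁻¹) ^ (2 * K ^ 15) := by ring
    _ ≤ 2 * Real.exp (-((K : ℝ) ^ 19 * (1 / 2))) * Real.exp (2 * b * (K : ℝ) ^ 16) := by gcongr
    _ = 2 * Real.exp (-((K : ℝ) ^ 19 * (1 / 2)) + 2 * b * (K : ℝ) ^ 16) := by
      rw [mul_assoc, ← Real.exp_add]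
    _ ≤ 2 * Real.exp (-((K : ℝ) ^ 15)) := by
      gcongr
      have e1 : (K : ℝ) ^ 19 * (1 / 2) ≥ (K : ℝ) ^ 16 * (2 * b + 1) := by
        have : (K : ℝ) ≤ K ^ 3 := le_self_pow₀ hK1' (by norm_num)
        calc (K : ℝ) ^ 16 * (2 * b + 1) ≤ (K : ℝ) ^ 16 * (K ^ 3 * (1 / 2)) := by
              gcongr; linarith
          _ = (K : ℝ) ^ 19 * (1 / 2) := by ring
      have e2 : (K : ℝ) ^ 15 ≤ K ^ 16 := pow_le_pow_right₀ hK1' (by norm_num)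
      linarith

lemma apr_back_improve {d : ℕ} {P : Measure (Env d)} {η : ℝ} (hG : Good P η)
    {ℓ : Fin d → ℝ} (hℓ : ∀ v, |dotR v ℓ| ≤ 2 * nr v) {e : StepIdx d} {δ : ℝ}
    (he : δ ≤ dotR (stepVec e) ℓ) (hδ : 0 < δ) {κ γ C c : ℝ} (hκ : 0 < κ) (hγ : 0 < γ)
    (hC : 0 < C) (hc : 0 < c) (hb : ∀ R : ℝ, 1 ≤ R →
      apr P (bl ℓ κ R) ≤ ENNReal.ofReal (C * Real.exp (-(c * R ^ γ)))) :
    ∃ C' c' : ℝ, 0 < C' ∧ 0 < c' ∧ ∀ L : ℝ, 0 < L →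
      apr P (back ℓ L) ≤ ENNReal.ofReal (C' * Real.exp (-(c' * L ^ (3 / 4 : ℝ)))) := by
  have hprob := hG.prob
  have hη := hG.pos
  have hη1 : η ≤ 1 := by
    obtain ⟨ω, hω⟩ := hG.ell.exists
    have h2 := Finset.single_le_sum (f := (ω 0).1) (fun s _ => (ω 0).2.1 s) (Finset.mem_univ e)
    rw [(ω 0).2.2] at h2
    linarith [hω 0 e]
  have h2 : ∀ s, |dotR (stepVec s) ℓ| ≤ 2 := fun s => by
    have := hℓ (stepVec s); rw [nr_stepVec] at this; linarith
  obtain ⟨q, hq⟩ := exists_nat_ge (max 21 (15 / γ))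
  have hq21 : 21 ≤ q := by exact_mod_cast (le_max_left _ _).trans hq
  have hqγ : 15 ≤ q * γ := by
    have := (le_max_right _ _).trans hq
    rwa [div_le_iff₀ hγ] at this
  obtain ⟨C₁, hC₁, hexp⟩ := exists_pow_le_exp (20 + q * d)
    (c := c * (1 / 4) ^ γ) (by positivity) hγ
  obtain ⟨k₁, hk₁⟩ := exists_nat_ge ((2 ^ 20 + 2) / δ)
  obtain ⟨b, hb'⟩ : ∃ b, Real.log 4 + k₁ * -Real.log η = b := ⟨_, rfl⟩
  obtain ⟨K₀, hK₀⟩ := exists_nat_ge (max (max 5 (2 ^ 20 / κ)) (max (128 * 3 ^ d * C * C₁) (4 * b + 2)))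
  set c' := min c 1 / 2 ^ 15 with hc'
  have hc'0 : 0 < c' := by positivity
  refine ⟨C + 8 + Real.exp (c' * ((K₀ : ℝ) ^ 20) ^ (3 / 4 : ℝ)), c', by positivity, hc'0,
    fun L hL => ?_⟩
  set K := ⌊L ^ (1 / 20 : ℝ)⌋₊ with hK
  have hL20 : (L ^ (1 / 20 : ℝ)) ^ 20 = L := by
    rw [← Real.rpow_natCast, ← Real.rpow_mul hL.le]; norm_num
  have hLK : L < ((K : ℝ) + 1) ^ 20 := by
    rw [← hL20]
    exact pow_lt_pow_left₀ (Nat.lt_floor_add_one _) (by positivity) (by norm_num)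
  have hKL : (K : ℝ) ^ 20 ≤ L := by
    rw [← hL20]
    exact pow_le_pow_left₀ (by positivity) (Nat.floor_le (by positivity)) _
  by_cases hKK : K₀ ≤ K
  swap
  · refine (hG.apr_le_one _).trans ?_
    rw [← ENNReal.ofReal_one]
    refine ENNReal.ofReal_le_ofReal ?_
    have hKK' : (K : ℝ) + 1 ≤ K₀ := by exact_mod_cast not_le.1 hKK
    have : L ≤ (K₀ : ℝ) ^ 20 := hLK.le.trans (pow_le_pow_left₀ (by positivity) hKK' _)
    have h3 : L ^ (3 / 4 : ℝ) ≤ ((K₀ : ℝ) ^ 20) ^ (3 / 4 : ℝ) :=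
      Real.rpow_le_rpow hL.le this (by norm_num)
    calc 1 = Real.exp (c' * L ^ (3 / 4 : ℝ)) * Real.exp (-(c' * L ^ (3 / 4 : ℝ))) := by
          rw [← Real.exp_add]; simp
      _ ≤ _ := by
        gcongr
        have : Real.exp (c' * L ^ (3 / 4 : ℝ)) ≤ Real.exp (c' * ((K₀ : ℝ) ^ 20) ^ (3 / 4 : ℝ)) := by
          gcongr
        linarith
  have hKr : max (max 5 (2 ^ 20 / κ)) (max (128 * 3 ^ d * C * C₁) (4 * b + 2)) ≤ (K : ℝ) :=
    hK₀.trans (by exact_mod_cast hKK)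
  simp only [max_le_iff] at hKr
  obtain ⟨⟨hK5, hKκ⟩, hKC, hKb⟩ := hKr
  have hK1 : (1 : ℝ) ≤ K := by linarith
  have hK1n : 1 ≤ K := by exact_mod_cast hK1
  have hL2K : L ≤ 2 ^ 20 * (K : ℝ) ^ 20 := by
    rw [← mul_pow]; exact hLK.le.trans (pow_le_pow_left₀ (by positivity) (by linarith) _)
  set n := K ^ 19 with hn
  have hnpos : 0 < n := by positivity
  have hnr : (n : ℝ) = (K : ℝ) ^ 19 := by rw [hn]; push_cast; ring
  set ρ := L / n with hρ
  have hnρ : n * ρ = L := by rw [hρ]; field_simp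
  have hρK : (K : ℝ) ≤ ρ := by
    rw [hρ, le_div_iff₀ (by positivity), hnr]; linarith [show (K : ℝ) * K ^ 19 = K ^ 20 by ring]
  have hρK' : ρ ≤ 2 ^ 20 * K := by
    rw [hρ, div_le_iff₀ (by positivity), hnr]
    linarith [show (2 : ℝ) ^ 20 * K * K ^ 19 = 2 ^ 20 * K ^ 20 by ring]
  set M := K ^ q with hM
  have hMr : (M : ℝ) = (K : ℝ) ^ q := by rw [hM]; push_cast; ring
  have hM1 : (1 : ℝ) ≤ M := by rw [hMr]; exact one_le_pow₀ hK1
  have hMκ : L ≤ κ * M := by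
    rw [div_le_iff₀ hκ] at hKκ
    calc L ≤ 2 ^ 20 * (K : ℝ) ^ 20 := hL2K
      _ ≤ K * κ * (K : ℝ) ^ 20 := by gcongr
      _ = κ * (K : ℝ) ^ 21 := by ring
      _ ≤ κ * M := by rw [hMr]; gcongr
  have hbad : ∀ t, P (badLevel ℓ M ρ (n * ρ) t) ≤ ENNReal.ofReal (1 / (16 * n)) := fun t => by
    refine (measure_badLevel_le hG hℓ M hκ (by linarith) _ _).trans ?_
    have h3 := hb (ρ / 4) (by linarith)
    calc ((box d M).card : ℝ≥0∞) * (8 * apr P (bl ℓ κ (ρ / 4)))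
        ≤ ENNReal.ofReal ((3 * M) ^ d) *
          (ENNReal.ofReal 8 * ENNReal.ofReal (C * Real.exp (-(c * (ρ / 4) ^ γ)))) := by
          gcongr
          · rw [← ENNReal.ofReal_natCast, card_box]
            apply ENNReal.ofReal_le_ofReal
            push_cast
            gcongr
            linarith
          · simp
      _ = ENNReal.ofReal ((3 * M) ^ d * (8 * (C * Real.exp (-(c * (ρ / 4) ^ γ))))) := by
          rw [← ENNReal.ofReal_mul (by norm_num), ← ENNReal.ofReal_mul (by positivity)]
      _ ≤ ENNReal.ofReal (1 / (16 * n)) := by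
          apply ENNReal.ofReal_le_ofReal
          have h4 : Real.exp (-(c * (ρ / 4) ^ γ)) ≤ C₁ / (K : ℝ) ^ (20 + q * d) := by
            have h5 := hexp K hK1
            rw [Real.exp_neg, inv_eq_one_div, div_le_div_iff₀ (Real.exp_pos _) (by positivity),
              one_mul]
            refine h5.trans (mul_le_mul_of_nonneg_left (Real.exp_le_exp.2 ?_) hC₁.le)
            rw [mul_assoc, ← Real.mul_rpow (by norm_num) (by positivity)]
            gcongr
            linarith
          calc (3 * (M : ℝ)) ^ d * (8 * (C * Real.exp (-(c * (ρ / 4) ^ γ))))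
              ≤ (3 * (M : ℝ)) ^ d * (8 * (C * (C₁ / (K : ℝ) ^ (20 + q * d)))) := by gcongr
            _ = 8 * 3 ^ d * C * C₁ / (K : ℝ) ^ 20 := by
              rw [hMr, mul_pow, ← pow_mul, pow_add]; field_simp
            _ ≤ 1 / (16 * n) := by
              rw [hnr, div_le_div_iff₀ (by positivity) (by positivity)]
              calc 8 * 3 ^ d * C * C₁ * (16 * (K : ℝ) ^ 19)
                  = (128 * 3 ^ d * C * C₁) * (K : ℝ) ^ 19 := by ring
                _ ≤ K * (K : ℝ) ^ 19 := by gcongr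
                _ = 1 * (K : ℝ) ^ 20 := by ring
  have hfam := lintegral_qs_fam_le hG h2 he (ρ := ρ) (by linarith) (k := k₁ * K) hδ ?_ hnpos M
    (K ^ 15) hbad
  · rw [hnρ] at hfam
    refine (apr_back_le_fam hG hκ hMκ).trans ((add_le_add (hb M hM1) hfam).trans ?_)
    rw [← ENNReal.ofReal_add (by positivity) (by positivity)]
    apply ENNReal.ofReal_le_ofReal
    have hK15 : c' * L ^ (3 / 4 : ℝ) ≤ min c 1 * (K : ℝ) ^ 15 := by
      have h5 : L ^ (3 / 4 : ℝ) ≤ 2 ^ 15 * (K : ℝ) ^ 15 := by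
        calc L ^ (3 / 4 : ℝ) ≤ ((2 * (K : ℝ)) ^ 20) ^ (3 / 4 : ℝ) := by
              rw [← mul_pow] at hL2K
              exact Real.rpow_le_rpow hL.le hL2K (by norm_num)
          _ = (2 * (K : ℝ)) ^ 15 := by
              rw [← Real.rpow_natCast, ← Real.rpow_natCast, ← Real.rpow_mul (by positivity)]
              norm_num
          _ = _ := by rw [mul_pow]
      calc c' * L ^ (3 / 4 : ℝ) ≤ c' * (2 ^ 15 * (K : ℝ) ^ 15) := by gcongr
        _ = min c 1 * (K : ℝ) ^ 15 := by rw [hc']; ring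
    set E := Real.exp (-(c' * L ^ (3 / 4 : ℝ))) with hE
    have t1 : Real.exp (-(c * (M : ℝ) ^ γ)) ≤ E := by
      refine Real.exp_le_exp.2 (neg_le_neg (hK15.trans ?_))
      have : (K : ℝ) ^ 15 ≤ (M : ℝ) ^ γ := by
        rw [hMr, ← Real.rpow_natCast, ← Real.rpow_natCast, ← Real.rpow_mul (by positivity)]
        exact Real.rpow_le_rpow_of_exponent_le hK1 (by simpa using hqγ)
      exact mul_le_mul (min_le_left _ _) this (by positivity) hc.le
    have t0 : Real.exp (-((K : ℝ) ^ 15)) ≤ E := by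
      refine Real.exp_le_exp.2 (neg_le_neg (hK15.trans ?_))
      calc min c 1 * (K : ℝ) ^ 15 ≤ 1 * (K : ℝ) ^ 15 := by gcongr; exact min_le_right _ _
        _ = _ := one_mul _
    have t2 := few_bad_numeric hη hη1 k₁ hb'.le hK1n hKb
    have t3 : (6 : ℝ) / 17 ^ (K ^ 15) ≤ 6 * Real.exp (-((K : ℝ) ^ 15)) := by
      rw [div_eq_mul_inv, Real.exp_neg]
      gcongr
      calc Real.exp ((K : ℝ) ^ 15) = Real.exp 1 ^ (K ^ 15) := by
            rw [← Real.exp_nat_mul]; push_cast; ring_nf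
        _ ≤ 17 ^ (K ^ 15) := by
            gcongr
            have := Real.exp_one_lt_d9; linarith
    have hE0 : 0 < E := Real.exp_pos _
    have hx : 0 ≤ Real.exp (c' * ((K₀ : ℝ) ^ 20) ^ (3 / 4 : ℝ)) * E := by positivity
    have t1' : C * Real.exp (-(c * (M : ℝ) ^ γ)) ≤ C * E := by gcongr
    calc _ ≤ C * E + (2 * E + 6 * E) := by linarith
      _ ≤ _ := by linarith
  · have : (2 ^ 20 + 2) ≤ k₁ * δ := by rwa [div_le_iff₀ hδ] at hk₁
    push_cast
    nlinarith

lemma abs_dotR_le {d : ℕ} {ℓ : Fin d → ℝ} {a : ℝ} (h : ∀ i, |ℓ i| ≤ a) (v : Site d) :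
    |dotR v ℓ| ≤ a * nr v := by
  rw [dotR, nr, Finset.mul_sum]
  refine (Finset.abs_sum_le_sum_abs _ _).trans (Finset.sum_le_sum fun i _ => ?_)
  rw [abs_mul, mul_comm]
  gcongr
  exact h i

lemma abs_le_norm2R {d : ℕ} (ℓ : Fin d → ℝ) (i : Fin d) : |ℓ i| ≤ norm2R ℓ :=
  Real.abs_le_sqrt (Finset.single_le_sum (f := fun i => ℓ i ^ 2) (fun i _ => sq_nonneg _)
    (Finset.mem_univ i))

lemma dotR_stepVec {d : ℕ} (ℓ : Fin d → ℝ) (i : Fin d) (b : Bool) :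
    dotR (stepVec (i, b)) ℓ = if b then ℓ i else -ℓ i := by
  rw [dotR, Finset.sum_eq_single i]
  · cases b <;> simp [stepVec]
  · intro j _ hj; simp [stepVec, hj]
  · simp

lemma exists_step_pos {d : ℕ} {ℓ₀ : Fin d → ℝ} (h : norm2R ℓ₀ = 1) :
    ∃ e : StepIdx d, 0 < dotR (stepVec e) ℓ₀ := by
  obtain ⟨i, hi⟩ : ∃ i, ℓ₀ i ≠ 0 := by
    by_contra! h0
    simp [norm2R, h0] at h
  rcases lt_or_gt_of_ne hi with h | h
  · exact ⟨(i, false), by simpa [dotR_stepVec] using h⟩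
  · exact ⟨(i, true), by simpa [dotR_stepVec] using h⟩

lemma cone_improve {d : ℕ} (hd : 0 < d) {P : Measure (Env d)} {η : ℝ} (hG : Good P η)
    {ℓ₀ : Fin d → ℝ} (h₀ : norm2R ℓ₀ = 1) {γ κ : ℝ} (hγ : 0 < γ) (hcone : Cone P ℓ₀ γ κ) :
    ∃ κ', Cone P ℓ₀ (3 / 4) κ' := by
  refine cone_of_tg hd hG (by norm_num) ?_
  obtain ⟨hκ, hκ1, C, c, hC, hc, hb⟩ := hcone
  obtain ⟨⟨i, b⟩, he⟩ := exists_step_pos h₀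
  set δ := dotR (stepVec (i, b)) ℓ₀ with hδ
  refine ⟨min (κ / 2) (δ / 2), by positivity, fun ℓ hℓ => ?_⟩
  have hℓ2 : ∀ i, |ℓ i| ≤ 2 := fun j => by
    have h1 := hℓ j
    have h2 := abs_le_norm2R ℓ₀ j
    have h3 := abs_sub_abs_le_abs_sub (ℓ j) (ℓ₀ j)
    have h4 := min_le_left (κ / 2) (δ / 2)
    linarith
  have hdot : ∀ v, |dotR v ℓ - dotR v ℓ₀| ≤ min (κ / 2) (δ / 2) * nr v := fun v => by
    have h1 : dotR v ℓ - dotR v ℓ₀ = dotR v (ℓ - ℓ₀) := by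
      simp only [dotR, Pi.sub_apply, mul_sub, Finset.sum_sub_distrib]
    rw [h1]
    exact abs_dotR_le hℓ v
  refine apr_back_improve hG (abs_dotR_le hℓ2) (e := (i, b)) (δ := δ / 2) ?_ (by positivity)
    (κ := κ / 2) (by positivity) hγ hC hc fun R hR => (hG.apr_mono fun l hl => ?_).trans (hb R hR)
  · have h1 := hdot (stepVec (i, b))
    rw [nr_stepVec, mul_one] at h1
    have h4 := min_le_right (κ / 2) (δ / 2)
    have h2 := (abs_le.1 h1).1
    linarith
  · refine ⟨hl.1, ?_⟩
    have h1 := (abs_le.1 (hdot (disp l))).1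
    have h2 : dotR (disp l) ℓ < κ / 2 * nr (disp l) := hl.2
    have h3 : min (κ / 2) (δ / 2) * nr (disp l) ≤ κ / 2 * nr (disp l) :=
      mul_le_mul_of_nonneg_right (min_le_left _ _) (nr_nonneg _)
    linarith

/-! ### Confinement of the walk to a finite set -/

/-- Paths from `x` that leave `Q` without returning to `x`. -/
def esc {d : ℕ} (Q : Set (Site d)) (x : Site d) : Set (List (StepIdx d)) :=
  {l | x + disp l ∉ Q ∧ ∀ k, 1 ≤ k → k ≤ l.length → disp (l.take k) ≠ 0}

/-- Paths from `x` with `t` steps that stay in `Q`. -/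
def stay {d : ℕ} (Q : Set (Site d)) (x : Site d) (t : ℕ) : Set (List (StepIdx d)) :=
  {l | l.length = t ∧ ∀ k ≤ l.length, x + disp (l.take k) ∈ Q}

/-- First-return loops inside `Q` based at `x`. -/
def retLoop {d : ℕ} (Q : Set (Site d)) (x : Site d) : Set (List (StepIdx d)) :=
  {l | l ≠ [] ∧ disp l = 0 ∧ (∀ k ≤ l.length, x + disp (l.take k) ∈ Q) ∧
    ∀ k, 1 ≤ k → k < l.length → disp (l.take k) ≠ 0}

lemma qs_retLoop_add_le {d : ℕ} (ω : Env d) (Q : Set (Site d)) (x : Site d) :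
    qs ω x (retLoop Q x) + pr ω x (esc Q x) ≤ 1 := by
  refine le_trans ?_ (pr_le_one ω x (retLoop Q x ∪ esc Q x))
  unfold pr qs
  rw [← qw_add]
  refine qw_mono ω x fun l => ?_
  by_cases h₁ : l ∈ retLoop Q x
  · have h₂ : l ∉ first (esc Q x) := by
      rintro ⟨⟨h, -⟩, -⟩
      have := h₁.2.2.1 l.length le_rfl
      rw [List.take_length] at this
      exact h this
    rw [ind_of_mem h₁, ind_of_notMem h₂, add_zero, ind_of_mem]
    refine ⟨Or.inl h₁, fun k hk => ?_⟩
    rintro (h | h)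
    · refine h₁.2.2.2 k ?_ hk h.2.1
      rcases Nat.eq_zero_or_pos k with rfl | h0
      · exact absurd (by simp) h.1
      · exact h0
    · exact h.1 (h₁.2.2.1 k hk.le)
  · rw [ind_of_notMem h₁, zero_add]
    refine ind_mono fun h₂ => ⟨Or.inr h₂.1, fun k hk => ?_⟩
    rintro (h | h)
    · refine h₂.1.2 k ?_ hk.le h.2.1
      rcases Nat.eq_zero_or_pos k with rfl | h0
      · exact absurd (by simp) h.1
      · exact h0
    · exact h₂.2 k hk h

/-- Paths from `x₀` ending at their visit number `j` (from zero) to `x`, inside `Q`. -/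
def visits {d : ℕ} (Q : Set (Site d)) (x₀ x : Site d) (j : ℕ) : Set (List (StepIdx d)) :=
  {l | x₀ + disp l = x ∧ (∀ k ≤ l.length, x₀ + disp (l.take k) ∈ Q) ∧
    ((Finset.range l.length).filter fun i => x₀ + disp (l.take i) = x).card = j}

lemma visits_succ_subset {d : ℕ} (Q : Set (Site d)) (x₀ x : Site d) (j : ℕ) :
    visits Q x₀ x (j + 1) ⊆ cat (visits Q x₀ x j) fun _ => retLoop Q x := by
  rintro l ⟨hx, hQ, hj⟩
  set S := (Finset.range l.length).filter fun i => x₀ + disp (l.take i) = x with hS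
  have hne : S.Nonempty := Finset.card_pos.1 (by omega)
  set i := S.max' hne with hi
  have hiS : i ∈ S := S.max'_mem hne
  have hil : i < l.length ∧ x₀ + disp (l.take i) = x := by simpa [hS] using hiS
  have hmax : ∀ k ∈ S, k ≤ i := fun k hk => S.le_max' k hk
  have hdisp : ∀ k, i + k ≤ l.length → x₀ + disp (l.take (i + k)) = x + disp ((l.drop i).take k) := by
    intro k hk
    rw [List.take_add, disp_append, ← add_assoc, hil.2]
  refine ⟨i, hil.1.le, ⟨hil.2, fun k hk => ?_, ?_⟩, ?_, ?_, ?_, ?_⟩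
  · simp only [List.length_take] at hk
    rw [List.take_take, min_eq_left (by omega)]
    exact hQ k (by omega)
  · have : S.erase i = (Finset.range (l.take i).length).filter
        fun k => x₀ + disp ((l.take i).take k) = x := by
      ext k
      simp only [Finset.mem_erase, hS, Finset.mem_filter, Finset.mem_range, List.length_take]
      constructor
      · rintro ⟨h1, h2, h3⟩
        have := hmax k (by simp [hS, h2, h3])
        refine ⟨by omega, ?_⟩
        rw [List.take_take, min_eq_left (by omega)]; exact h3
      · rintro ⟨h1, h2⟩
        rw [List.take_take, min_eq_left (by omega)] at h2
        exact ⟨by omega, by omega, h2⟩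
    rw [← this, Finset.card_erase_of_mem hiS, hj]; rfl
  · intro h
    have := congrArg List.length h
    simp at this; omega
  · have := disp_take_add_drop l i
    have h2 : x₀ + (disp (l.take i) + disp (l.drop i)) = x := by rw [this, hx]
    rw [← add_assoc, hil.2] at h2
    simpa using h2
  · intro k hk
    simp only [List.length_drop] at hk
    rw [← hdisp k (by omega)]
    exact hQ _ (by omega)
  · intro k hk hk' h0
    simp only [List.length_drop] at hk'
    have := hdisp k (by omega)
    rw [h0, add_zero] at this
    have := hmax (i + k) (by simp only [hS, Finset.mem_filter, Finset.mem_range]; exact ⟨by omega, this⟩)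
    omega

lemma qs_visits_le {d : ℕ} (ω : Env d) (Q : Set (Site d)) (x₀ x : Site d) {p : ℝ≥0∞}
    (hp : p ≤ pr ω x (esc Q x)) (j : ℕ) : qs ω x₀ (visits Q x₀ x j) ≤ (1 - p) ^ j := by
  have hret : qs ω x (retLoop Q x) ≤ 1 - p := by
    refine ENNReal.le_sub_of_add_le_right ?_ ((add_le_add_right hp _).trans (qs_retLoop_add_le ω Q x))
    exact ne_top_of_le_ne_top ENNReal.one_ne_top (hp.trans (pr_le_one ω x _))
  induction j with
  | zero =>
    rw [pow_zero]
    refine le_trans (qw_mono ω x₀ fun l => ?_) (pr_le_one ω x₀ (hit {x - x₀}))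
    refine ind_mono fun h => ⟨?_, fun k hk hk' => ?_⟩
    · exact eq_sub_of_add_eq' h.1
    · have h0 := h.2.2
      rw [Finset.card_eq_zero, Finset.filter_eq_empty_iff] at h0
      refine h0 (Finset.mem_range.2 hk) ?_
      have : disp (l.take k) = x - x₀ := hk'
      rw [this]; abel
  | succ j ih =>
    refine (qs_mono ω x₀ (visits_succ_subset Q x₀ x j)).trans ((qs_cat_le _ _ _ _).trans ?_)
    calc _ ≤ ∑' l₁, wt ω x₀ l₁ * ind (visits Q x₀ x j) l₁ * (1 - p) := by
          refine ENNReal.tsum_le_tsum fun l₁ => ?_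
          by_cases h : l₁ ∈ visits Q x₀ x j
          · rw [h.1]; gcongr
          · simp [h]
      _ = qs ω x₀ (visits Q x₀ x j) * (1 - p) := by rw [ENNReal.tsum_mul_right]; rfl
      _ ≤ _ := by rw [pow_succ]; gcongr

/-- Escape probabilities control the probability of staying in a finite set. -/
lemma qs_stay_le {d : ℕ} (ω : Env d) (Q : Finset (Site d)) (x₀ : Site d) {p : ℝ≥0∞}
    (hp : ∀ x ∈ Q, p ≤ pr ω x (esc Q x)) {j t : ℕ} (hj : Q.card * j ≤ t) :
    qs ω x₀ (stay Q x₀ t) ≤ Q.card * (1 - p) ^ j := by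
  have h1 : qs ω x₀ (stay Q x₀ t) = pr ω x₀ (stay Q x₀ t) := by
    unfold pr; congr 1
    refine Set.Subset.antisymm (fun l hl => ⟨hl, fun k hk h => ?_⟩) (first_subset _)
    have := h.1
    simp only [List.length_take] at this
    have := hl.1
    omega
  rw [h1]
  calc _ ≤ qw ω x₀ (fun l => ∑' x : Q, ind (visits Q x₀ x j) l) := by
        refine pr_le_qw ω x₀ fun l hl => ?_
        obtain ⟨y, hy, hcard⟩ := Finset.exists_lt_card_fiber_of_mul_lt_card_of_maps_to
          (s := Finset.range (t + 1)) (t := Q) (f := fun k => x₀ + disp (l.take k)) (n := j)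
          (fun k hk => hl.2 k (by rw [hl.1]; simp at hk; omega)) (by simp; omega)
        let pp : ℕ → Prop := fun k => x₀ + disp (l.take k) = y
        classical
        have hcount : j < Nat.count pp (t + 1) := by
          rw [Nat.count_eq_card_filter_range]; convert hcard
        have hn := Nat.nth_lt_of_lt_count hcount
        have hmem : pp (Nat.nth pp j) := by
          refine Nat.nth_mem _ fun hf => ?_
          refine hcount.trans_le ?_
          rw [Nat.count_eq_card_filter_range]
          exact Finset.card_le_card fun k hk => by simpa using (Finset.mem_filter.1 hk).2
        have hc : Nat.count pp (Nat.nth pp j) = j := by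
          refine Nat.count_nth fun hf => ?_
          refine hcount.trans_le ?_
          rw [Nat.count_eq_card_filter_range]
          exact Finset.card_le_card fun k hk => by simpa using (Finset.mem_filter.1 hk).2
        set i := Nat.nth pp j with hi
        have hil : i ≤ l.length := by rw [hl.1]; omega
        have hv : l.take i ∈ visits Q x₀ y j := by
          refine ⟨hmem, fun k hk => ?_, ?_⟩
          · simp only [List.length_take] at hk
            rw [List.take_take, min_eq_left (by omega)]
            exact hl.2 k (by omega)
          · rw [← hc, Nat.count_eq_card_filter_range]
            have hlen : (l.take i).length = i := by simp [hil]
            rw [hlen]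
            congr 1
            refine Finset.filter_congr fun k hk => ?_
            rw [List.take_take, min_eq_left (by simp at hk; omega)]
        refine le_trans ?_ (le_cnt _ hil)
        refine le_trans ?_ (ENNReal.le_tsum (⟨y, hy⟩ : Q))
        simp [hv]
    _ = ∑' x : Q, qs ω x₀ (visits Q x₀ x j) := qw_tsum _ _ _
    _ ≤ ∑' x : Q, (1 - p) ^ j :=
        ENNReal.tsum_le_tsum fun x => qs_visits_le ω Q x₀ x (hp x x.2) j
    _ = _ := by simp

lemma wt_mul_pr_le {d : ℕ} (ω : Env d) (x : Site d) (l₁ : List (StepIdx d))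
    {T₂ T : Set (List (StepIdx d))} (h : ∀ l ∈ T₂, l₁ ++ l ∈ T) :
    wt ω x l₁ * pr ω (x + disp l₁) T₂ ≤ pr ω x T := by
  refine le_trans ?_ (pr_mono ω x (T := (fun l => l₁ ++ l) '' T₂) ?_)
  · have hinj : Function.Injective fun l : List (StepIdx d) => l₁ ++ l :=
      fun a b h => List.append_cancel_left h
    refine le_trans ?_ (ENNReal.tsum_comp_le_tsum_of_injective hinj _)
    unfold pr qs qw
    rw [← ENNReal.tsum_mul_left]
    refine ENNReal.tsum_le_tsum fun l => ?_
    rw [← mul_assoc, ← wt_append]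
    gcongr
    refine ind_mono fun hl => ⟨⟨l, hl.1, rfl⟩, ?_⟩
    rintro k hk ⟨m, hm, hmk⟩
    have hlen := congrArg List.length hmk
    simp only [List.length_append, List.length_take] at hlen hk
    have : k = l₁.length + m.length := by omega
    subst this
    rw [List.take_length_add_append] at hmk
    have := hinj hmk
    exact hl.2 m.length (by omega) (this ▸ hm)
  · rintro _ ⟨l, hl, rfl⟩; exact h l hl

lemma pr_of_nil_mem {d : ℕ} (ω : Env d) (x : Site d) {T : Set (List (StepIdx d))} (h : [] ∈ T) :
    pr ω x T = 1 := by
  refine le_antisymm (pr_le_one ω x T) ?_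
  have h0 : [] ∈ first T := ⟨h, by simp⟩
  refine le_trans ?_ (ENNReal.le_tsum ([] : List (StepIdx d)))
  simp [h0]

lemma wt_le_pr {d : ℕ} (ω : Env d) (x : Site d) {l : List (StepIdx d)}
    {T : Set (List (StepIdx d))} (h : l ∈ T) : wt ω x l ≤ pr ω x T := by
  have := wt_mul_pr_le ω x l (T₂ := {[]}) (T := T) (by simpa using h)
  rwa [pr_of_nil_mem _ _ (Set.mem_singleton _), mul_one] at this

lemma pow_le_wt {d : ℕ} {ω : Env d} {η : ℝ} (h : ∀ x s, η ≤ (ω x).1 s) (x : Site d)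
    (l : List (StepIdx d)) : ENNReal.ofReal η ^ l.length ≤ wt ω x l := by
  induction l generalizing x with
  | nil => simp
  | cons s l ih =>
    rw [wt_cons, List.length_cons, pow_succ']
    gcongr
    · exact h x s
    · exact ih _

lemma disp_replicate {d : ℕ} (k : ℕ) (s : StepIdx d) :
    disp (List.replicate k s) = k • stepVec s := by
  simp [disp]

/-- In an elliptic environment the walk leaves every finite set. -/
lemma one_le_pr_exit {d : ℕ} (hd : 0 < d) {ω : Env d} {η : ℝ} (hη : 0 < η)
    (h : ∀ x s, η ≤ (ω x).1 s) (Q : Finset (Site d)) (x₀ : Site d) :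
    1 ≤ pr ω x₀ {l | x₀ + disp l ∉ Q} := by
  let i₀ : Fin d := ⟨0, hd⟩
  obtain ⟨b, hb⟩ := (Q.image fun y => y i₀).bddAbove
  obtain ⟨a, ha⟩ := (Q.image fun y => y i₀).bddBelow
  have hb' : ∀ y ∈ Q, y i₀ ≤ b := fun y hy => hb (by simpa using ⟨y, hy, rfl⟩)
  have ha' : ∀ y ∈ Q, a ≤ y i₀ := fun y hy => ha (by simpa using ⟨y, hy, rfl⟩)
  let e : StepIdx d := (i₀, true)
  let K : ℕ := (b - a).toNat + 1
  have hstep : ∀ k : ℕ, (disp (List.replicate k e)) i₀ = k := by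
    intro k; rw [disp_replicate]; simp [stepVec, e]
  set p : ℝ≥0∞ := ENNReal.ofReal η ^ K with hp
  have hp0 : p ≠ 0 := by
    simp [hp, hη]
  have hesc : ∀ x ∈ Q, p ≤ pr ω x (esc Q x) := by
    intro x hx
    have h1 := pow_le_wt h x (List.replicate K e)
    rw [List.length_replicate] at h1
    refine h1.trans (wt_le_pr ω x ⟨fun hQ => ?_, fun k hk hk' h0 => ?_⟩)
    · have := hb' _ hQ
      have h2 := ha' x hx
      rw [Pi.add_apply, hstep] at this
      simp only [K] at this
      push_cast at this
      have := Int.self_le_toNat (b - a)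
      omega
    · simp only [List.length_replicate] at hk'
      rw [List.take_replicate, min_eq_left hk'] at h0
      have := hstep k
      rw [h0] at this
      simp at this; omega
  have hbound : ∀ j : ℕ, 1 ≤ pr ω x₀ {l | x₀ + disp l ∉ Q} + Q.card * (1 - p) ^ j := by
    intro j
    refine (one_le_pr_add ω x₀ (Q.card * j) (T₁ := {l | x₀ + disp l ∉ Q})
      (T₂ := stay Q x₀ (Q.card * j)) fun l hl => ?_).trans
      (add_le_add_right ((pr_le_qs ω x₀ _).trans (qs_stay_le ω Q x₀ hesc le_rfl)) _)
    by_cases hst : ∃ k ≤ l.length, x₀ + disp (l.take k) ∉ Q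
    · exact Or.inl hst
    · push Not at hst
      exact Or.inr ⟨l.length, le_rfl, by rw [List.take_length]; exact ⟨hl, hst⟩⟩
  have hlim : Tendsto (fun j : ℕ => pr ω x₀ {l | x₀ + disp l ∉ Q} + Q.card * (1 - p) ^ j) atTop
      (nhds (pr ω x₀ {l | x₀ + disp l ∉ Q} + Q.card * 0)) := by
    refine Tendsto.add tendsto_const_nhds (ENNReal.Tendsto.const_mul ?_ (Or.inr (by simp)))
    refine ENNReal.tendsto_pow_atTop_nhds_zero_of_lt_one ?_
    exact ENNReal.sub_lt_self ENNReal.one_ne_top one_ne_zero hp0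
  have := ge_of_tendsto' hlim hbound
  simpa using this

/-! ### Regular paths -/

/-- Paths ending with a backtracking or slow piece of size at least `R`. -/
def viol {d : ℕ} (ℓ : Fin d → ℝ) (κ R : ℝ) : Set (List (StepIdx d)) :=
  {l | ∃ i ≤ l.length, l.drop i ∈ bl ℓ κ R}

/-- Paths without backtracking or slow pieces of size at least `R`. -/
def reg {d : ℕ} (ℓ : Fin d → ℝ) (κ R : ℝ) : Set (List (StepIdx d)) :=
  {l | ∀ k ≤ l.length, l.take k ∉ viol ℓ κ R}

/-- The alternative satisfied by every piece of a regular path. -/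
lemma reg_piece {d : ℕ} {ℓ : Fin d → ℝ} {κ R : ℝ} {l : List (StepIdx d)} (h : l ∈ reg ℓ κ R)
    {i k : ℕ} (hik : i ≤ k) (hk : k ≤ l.length) :
    nr (disp (l.take k) - disp (l.take i)) < R ∨
      κ * nr (disp (l.take k) - disp (l.take i)) ≤ dotR (disp (l.take k) - disp (l.take i)) ℓ := by
  have := h k hk
  simp only [viol, Set.mem_ofPred_eq, not_exists, not_and] at this
  have := this i (by simp; omega)
  rw [bl, Set.mem_ofPred_eq, disp_drop_take l hik] at this
  by_contra! hc
  exact this ⟨hc.1, hc.2⟩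

/-- A regular path visits few sites in a slab. -/
lemma card_visited_le {d : ℕ} {ℓ : Fin d → ℝ} {κ : ℝ} (hκ : 0 < κ) {R : ℕ} (hR : 1 ≤ κ * R)
    {l : List (StepIdx d)} (h : l ∈ reg ℓ κ R) (a : ℝ) (n : ℕ) (S : Finset (Site d))
    (hS : ∀ y ∈ S, (∃ k ≤ l.length, disp (l.take k) = y) ∧ a ≤ dotR y ℓ ∧ dotR y ℓ < a + n) :
    S.card ≤ n * (2 * R + 1) ^ d := by
  classical
  have hmaps : ∀ y ∈ S, ⌊dotR y ℓ - a⌋₊ ∈ Finset.range n := by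
    intro y hy
    have := hS y hy
    rw [Finset.mem_range, Nat.floor_lt (by linarith)]
    linarith
  have := Finset.card_le_mul_card_image_of_maps_to (s := S) (t := Finset.range n) hmaps
    ((2 * R + 1) ^ d) ?_
  · rwa [Finset.card_range, mul_comm] at this
  intro m _
  rcases (S.filter fun y => ⌊dotR y ℓ - a⌋₊ = m).eq_empty_or_nonempty with h0 | ⟨y₀, hy₀⟩
  · rw [h0]; simp
  rw [← card_box, ← Finset.card_image_of_injective (box d R) (add_right_injective y₀)]
  refine Finset.card_le_card fun y hy => ?_
  simp only [Finset.mem_filter] at hy hy₀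
  have hfl : |dotR y ℓ - dotR y₀ ℓ| < 1 := by
    have h1 := Nat.floor_le (a := dotR y ℓ - a) (by linarith [hS y hy.1])
    have h2 := Nat.lt_floor_add_one (dotR y ℓ - a)
    have h3 := Nat.floor_le (a := dotR y₀ ℓ - a) (by linarith [hS y₀ hy₀.1])
    have h4 := Nat.lt_floor_add_one (dotR y₀ ℓ - a)
    rw [hy.2] at h1 h2
    rw [hy₀.2] at h3 h4
    rw [abs_lt]; constructor <;> linarith
  have key : ∀ u v : Site d, (∃ i k, i ≤ k ∧ k ≤ l.length ∧ disp (l.take i) = u ∧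
      disp (l.take k) = v) → |dotR v ℓ - dotR u ℓ| < 1 → nr (v - u) < R := by
    rintro u v ⟨i, k, hik, hk, rfl, rfl⟩ h1
    rcases reg_piece h hik hk with h2 | h2
    · exact h2
    · by_contra! h3
      rw [dotR_sub] at h2
      have := (abs_lt.1 h1).2
      nlinarith
  have hn : nr (y - y₀) < R := by
    obtain ⟨⟨k, hk, hk'⟩, -⟩ := hS y hy.1
    obtain ⟨⟨i, hi, hi'⟩, -⟩ := hS y₀ hy₀.1
    rcases le_total i k with hik | hik
    · exact key _ _ ⟨i, k, hik, hk, hi', hk'⟩ hfl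
    · have := key _ _ ⟨k, i, hik, hi, hk', hi'⟩ (by rwa [abs_sub_comm])
      rwa [← nr_neg, neg_sub] at this
  rw [Finset.mem_image]
  exact ⟨y - y₀, mem_box_of_nr_le hn.le, by abel⟩

/-! ### Many walkers cannot all be stopped by a single site -/

lemma reg_level_ge {d : ℕ} {ℓ : Fin d → ℝ} (hℓ : ∀ i, |ℓ i| ≤ 1) {κ R : ℝ} (hκ : 0 < κ)
    {l : List (StepIdx d)} (h : l ∈ reg ℓ κ R) (hR : 0 ≤ R) : -R ≤ dotR (disp l) ℓ := by
  have := reg_piece h (Nat.zero_le l.length) le_rfl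
  simp only [List.take_length, List.take_zero, disp_nil, sub_zero] at this
  have h1 := abs_dotR_le hℓ (disp l)
  have h2 := nr_nonneg (disp l)
  rcases this with h3 | h3
  · linarith [neg_le_of_abs_le h1]
  · nlinarith

lemma reg_nr_le {d : ℕ} {ℓ : Fin d → ℝ} {κ R N M : ℝ} (hκ : 0 < κ) {l : List (StepIdx d)}
    (h : l ∈ reg ℓ κ R) (hl : dotR (disp l) ℓ ≤ M) (hN : R ≤ N) (hM : M ≤ κ * N) :
    nr (disp l) ≤ N := by
  have := reg_piece h (Nat.zero_le l.length) le_rfl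
  simp only [List.take_length, List.take_zero, disp_nil, sub_zero] at this
  rcases this with h3 | h3
  · linarith
  · by_contra! hc
    nlinarith

/-- Paths from `y` ending above level `L`. -/
def goT {d : ℕ} (ℓ : Fin d → ℝ) (L : ℝ) (y : Site d) : Set (List (StepIdx d)) :=
  {l | L ≤ dotR (y + disp l) ℓ}

/-- Paths from `y` ending in `G` or with a violation. -/
def badT {d : ℕ} (ℓ : Fin d → ℝ) (κ R : ℝ) (G : Set (Site d)) (y : Site d) :
    Set (List (StepIdx d)) := {l | y + disp l ∈ G} ∪ viol ℓ κ R

/-- Paths from `y` stopped by `G` or by a violation before reaching level `L`. -/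
def meet {d : ℕ} (ℓ : Fin d → ℝ) (κ R L : ℝ) (G : Set (Site d)) (y : Site d) :
    Set (List (StepIdx d)) := first (goT ℓ L y ∪ badT ℓ κ R G y) ∩ badT ℓ κ R G y

/-- Paths from `y` reaching level `L` without visiting the origin. -/
def succT {d : ℕ} (ℓ : Fin d → ℝ) (L : ℝ) (y : Site d) : Set (List (StepIdx d)) :=
  {l | L ≤ dotR (y + disp l) ℓ ∧ ∀ k ≤ l.length, y + disp (l.take k) ≠ 0}

lemma one_le_pr_goT {d : ℕ} (hd : 0 < d) {ω : Env d} {η : ℝ} (hη : 0 < η)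
    (h : ∀ x s, η ≤ (ω x).1 s) {ℓ : Fin d → ℝ} {κ R L : ℝ} (hκ : 0 < κ) (G : Set (Site d))
    {y : Site d} (hy : 0 ≤ dotR y ℓ) :
    1 ≤ pr ω y (goT ℓ L y ∪ badT ℓ κ R G y) := by
  obtain ⟨N, hN⟩ := exists_nat_ge (max R (L / κ))
  have hN1 : R ≤ N := (le_max_left _ _).trans hN
  have hN2 : L ≤ κ * N := by
    have := (le_max_right _ _).trans hN
    rwa [div_le_iff₀' hκ] at this
  refine (one_le_pr_exit hd hη h ((box d N).image fun v => y + v) y).trans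
    (pr_le_pr ω y fun l hl => ?_)
  by_contra! hc
  have hreg : l ∈ reg ℓ κ R := fun k hk hv => hc k hk (Or.inr (Or.inr hv))
  have hlev : dotR (disp l) ℓ ≤ L := by
    have := hc l.length le_rfl
    rw [List.take_length] at this
    have : ¬ L ≤ dotR (y + disp l) ℓ := fun h' => this (Or.inl h')
    rw [dotR_add] at this
    linarith
  refine hl ?_
  rw [Finset.mem_image]
  exact ⟨disp l, mem_box_of_nr_le (reg_nr_le hκ hreg hlev hN1 hN2), rfl⟩

lemma one_le_succT_add {d : ℕ} (hd : 0 < d) {ω : Env d} {η : ℝ} (hη : 0 < η)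
    (h : ∀ x s, η ≤ (ω x).1 s) {ℓ : Fin d → ℝ} {κ R L : ℝ} (hκ : 0 < κ) {G : Set (Site d)}
    (hG : 0 ∈ G) {y : Site d} (hy : 0 ≤ dotR y ℓ) :
    1 ≤ pr ω y (succT ℓ L y) + qs ω y (meet ℓ κ R L G y) := by
  refine (one_le_pr_goT hd hη h (R := R) (L := L) hκ G hy).trans ?_
  unfold pr qs
  rw [← qw_add]
  refine qw_mono ω y fun l => ?_
  by_cases hl : l ∈ first (goT ℓ L y ∪ badT ℓ κ R G y)
  · by_cases hb : l ∈ badT ℓ κ R G y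
    · rw [ind_of_mem (T := meet ℓ κ R L G y) ⟨hl, hb⟩]
      exact (ind_le_one _ _).trans le_add_self
    · refine le_add_right (ind_mono fun _ => ⟨⟨?_, ?_⟩, ?_⟩)
      · exact hl.1.resolve_right hb
      · intro k hk h0
        rcases hk.lt_or_eq with hk' | rfl
        · exact hl.2 k hk' (Or.inr (Or.inl (by rw [Set.mem_ofPred_eq, h0]; exact hG)))
        · rw [List.take_length] at h0
          exact hb (Or.inl (by rw [Set.mem_ofPred_eq, h0]; exact hG))
      · intro k hk hs
        exact hl.2 k hk (Or.inl hs.1)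
  · simp [hl]

/-- The departure sites of a path, as a finite set. -/
def sitesF {d : ℕ} (y : Site d) (l : List (StepIdx d)) : Finset (Site d) :=
  (Finset.range l.length).image fun i => y + disp (l.take i)

lemma coe_sitesF {d : ℕ} (y : Site d) (l : List (StepIdx d)) : (sitesF y l : Set (Site d)) = sites y l := by
  ext z
  simp [sitesF, sites, eq_comm]

lemma meet_of_take {d : ℕ} {ℓ : Fin d → ℝ} {κ R L : ℝ} {G : Set (Site d)} {y : Site d}
    {l : List (StepIdx d)} (hl : l ∈ meet ℓ κ R L G y) {k : ℕ} (hk : k < l.length) :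
    l.take k ∈ reg ℓ κ R ∧ dotR (y + disp (l.take k)) ℓ < L ∧ y + disp (l.take k) ∉ G := by
  refine ⟨fun i hi hv => ?_, ?_, ?_⟩
  · simp only [List.length_take] at hi
    rw [List.take_take, min_eq_left (by omega)] at hv
    exact hl.1.2 i (by omega) (Or.inr (Or.inr hv))
  · by_contra! h
    exact hl.1.2 k hk (Or.inl h)
  · intro h
    exact hl.1.2 k hk (Or.inr (Or.inl h))

lemma card_sitesF_meet_le {d : ℕ} {ℓ : Fin d → ℝ} (hℓ : ∀ i, |ℓ i| ≤ 1) {κ : ℝ} (hκ : 0 < κ)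
    {R L : ℕ} (hR : 1 ≤ κ * R) {G : Set (Site d)} {y : Site d} (hy : 0 ≤ dotR y ℓ)
    {l : List (StepIdx d)} (hl : l ∈ meet ℓ κ R L G y) :
    (sitesF y l).card ≤ (R + L) * (2 * R + 1) ^ d := by
  rcases Nat.eq_zero_or_pos l.length with h0 | h0
  · simp [sitesF, h0]
  have hreg := (meet_of_take hl (k := l.length - 1) (by omega)).1
  have himg : sitesF y l =
      ((Finset.range l.length).image fun i => disp (l.take i)).image fun v => y + v := by
    rw [Finset.image_image]; rfl
  rw [himg]
  refine Finset.card_image_le.trans (card_visited_le hκ hR hreg (-R) (R + L) _ fun v hv => ?_)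
  obtain ⟨i, hi, rfl⟩ := Finset.mem_image.1 hv
  rw [Finset.mem_range] at hi
  refine ⟨⟨i, by simp; omega, by rw [List.take_take, min_eq_left (by omega)]⟩, ?_, ?_⟩
  · exact reg_level_ge hℓ hκ (meet_of_take hl hi).1 (by positivity)
  · have := (meet_of_take hl hi).2.1
    rw [dotR_add] at this
    push_cast
    linarith

lemma an_meet_le_apr {d : ℕ} (P : Measure (Env d)) (ℓ : Fin d → ℝ) (κ R L : ℝ) (G : Set (Site d))
    (y : Site d) : an P (ind (meet ℓ κ R L G y)) ≤ apr P (meet ℓ κ R L G y) := by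
  refine ENNReal.tsum_le_tsum fun l => ?_
  gcongr
  exact ind_mono fun h => ⟨h, fun k hk hmem => h.1.2 k hk (Or.inr hmem.2)⟩

/-- Regular paths from `y` ending in `G`. -/
def con {d : ℕ} (ℓ : Fin d → ℝ) (κ R : ℝ) (G : Set (Site d)) (y : Site d) :
    Set (List (StepIdx d)) := {l | l ∈ reg ℓ κ R ∧ y + disp l ∈ G}

lemma Good.apr_meet_le {d : ℕ} {P : Measure (Env d)} {η : ℝ} (hG : Good P η) {ℓ : Fin d → ℝ}
    {κ : ℝ} (hκ : 0 < κ) {R L N : ℕ} (hR : 0 < R) (hRN : R ≤ N) (hLN : (L : ℝ) ≤ κ * N)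
    (G : Set (Site d)) {y : Site d} (hy : 0 ≤ dotR y ℓ) :
    an P (ind (meet ℓ κ R L G y)) ≤
      apr P (con ℓ κ R G y) + (2 * N + 1 : ℕ) ^ d * apr P (bl ℓ κ R) := by
  refine (an_meet_le_apr P ℓ κ R L G y).trans ?_
  refine (hG.apr_union_le (T₁ := con ℓ κ R G y) (T₂ := meet ℓ κ R L G y ∩ viol ℓ κ R)
    fun l hl => ?_).trans ?_
  · by_cases hv : l ∈ viol ℓ κ R
    · exact Or.inr ⟨l.length, le_rfl, by rw [List.take_length]; exact ⟨hl, hv⟩⟩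
    · refine Or.inl ⟨l.length, le_rfl, ?_⟩
      rw [List.take_length]
      refine ⟨fun k hk => ?_, hl.2.resolve_right hv⟩
      rcases hk.lt_or_eq with hk' | rfl
      · have := (meet_of_take hl hk').1 k (by simp [hk])
        rwa [List.take_take, min_self] at this
      · rwa [List.take_length]
  · gcongr
    have := hG.apr_le_card_mul (T := meet ℓ κ R L G y ∩ viol ℓ κ R) (box d N)
      (fun _ => bl ℓ κ R) (apr P (bl ℓ κ R)) (fun _ _ => le_rfl) ?_
    · rw [card_box] at this
      exact_mod_cast this
    rintro l ⟨hl, i, hi, hbl⟩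
    have hil : i < l.length := by
      refine lt_of_le_of_ne hi ?_
      rintro rfl
      have := hbl.1
      simp [nr_zero] at this
      omega
    have hy' : disp (l.take i) ∈ box d N := by
      refine mem_box_of_nr_le (reg_nr_le (M := L) hκ (meet_of_take hl hil).1 ?_ (by exact_mod_cast hRN) hLN)
      have := (meet_of_take hl hil).2.1
      rw [dotR_add] at this
      linarith
    obtain ⟨j, hj, hjf⟩ := exists_take_mem_first (T := hit {disp (l.take i)}) (l := l) (k := i)
      (by rfl)
    refine ⟨_, hy', j, l.length, by omega, le_rfl, hjf, ?_⟩
    have hdj : disp (l.take j) = disp (l.take i) := hjf.1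
    have : disp (l.drop j) = disp (l.drop i) := by
      have h1 := disp_take_add_drop l i
      have h2 := disp_take_add_drop l j
      rw [hdj] at h2
      exact add_left_cancel (h2.trans h1.symm)
    rw [List.take_length, bl, Set.mem_ofPred_eq, this]
    exact hbl

lemma Good.an_le_of_cnt_le {d : ℕ} {P : Measure (Env d)} {η : ℝ} (hG : Good P η)
    {F : List (StepIdx d) → ℝ≥0∞} {c : ℝ≥0∞} (h : ∀ l, cnt F l ≤ c) : an P F ≤ c := by
  have := hG.prob
  rw [← hG.lintegral_qw 0]
  refine (lintegral_mono fun ω => qw_le_of_cnt_le ω 0 h).trans ?_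
  simp

lemma an_tsum {d : ℕ} {ι : Type*} (P : Measure (Env d)) (F : ι → List (StepIdx d) → ℝ≥0∞) :
    an P (fun l => ∑' i, F i l) = ∑' i, an P (F i) := by
  simp only [an, ← ENNReal.tsum_mul_left]
  exact ENNReal.tsum_comm

lemma Good.sum_apr_con_le {d : ℕ} {P : Measure (Env d)} {η : ℝ} (hG : Good P η) {ℓ : Fin d → ℝ}
    {κ : ℝ} (hκ : 0 < κ) {R : ℕ} (hR : 1 ≤ κ * R) (D : Finset (Site d)) (b : ℝ) (n : ℕ)
    (hD : ∀ y ∈ D, b < dotR y ℓ ∧ dotR y ℓ ≤ b + n) (z : Site d) :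
    ∑ y ∈ D, apr P (con ℓ κ R {z} y) ≤ (n * (2 * R + 1) ^ d : ℕ) := by
  classical
  have h1 : ∑ y ∈ D, apr P (con ℓ κ R {z} y) =
      an P (fun l => ∑' y : D, ind (first (con ℓ κ R {z} y)) l) := by
    rw [an_tsum, tsum_fintype, ← Finset.sum_coe_sort]; rfl
  rw [h1]
  refine hG.an_le_of_cnt_le fun l => ?_
  rw [cnt_tsum, tsum_fintype, Finset.sum_coe_sort D fun y => cnt (ind (first (con ℓ κ R {z} y))) l]
  let S := D.filter fun y => ∃ k ≤ l.length, l.take k ∈ con ℓ κ R {z} y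
  have h2 : ∑ y ∈ D, cnt (ind (first (con ℓ κ R {z} y))) l ≤ ∑ y ∈ S, 1 := by
    rw [Finset.sum_filter]
    refine Finset.sum_le_sum fun y _ => ?_
    split_ifs with h
    · exact cnt_first_le_one _ _
    · push Not at h
      refine le_of_eq (Finset.sum_eq_zero fun k hk => ind_of_notMem fun h' => ?_)
      exact h k (by simp at hk; omega) h'.1
  refine h2.trans ?_
  rw [Finset.sum_const, nsmul_eq_mul, mul_one]
  norm_cast
  let I := (Finset.range (l.length + 1)).filter fun k => l.take k ∈ reg ℓ κ (R : ℝ)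
  rcases I.eq_empty_or_nonempty with hI | hI
  · have : S = ∅ := by
      rw [Finset.filter_eq_empty_iff]
      rintro y - ⟨k, hk, hk'⟩
      have : k ∈ I := by simp [I, hk'.1]; omega
      simp [hI] at this
    simp [this]
  have hmem := I.max'_mem hI
  set k₀ := I.max' hI
  have hk₀ : k₀ ≤ l.length ∧ l.take k₀ ∈ reg ℓ κ (R : ℝ) := by
    simpa [I, Nat.lt_succ_iff] using hmem
  rw [← Finset.card_image_of_injective S (f := fun y => z - y) (sub_right_injective)]
  refine card_visited_le hκ hR hk₀.2 (dotR z ℓ - b - n) n _ fun v hv => ?_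
  obtain ⟨y, hy, rfl⟩ := Finset.mem_image.1 hv
  obtain ⟨hyD, k, hk, hkc⟩ := Finset.mem_filter.1 hy
  have hkk : k ≤ k₀ := I.le_max' k (by simp [I, hkc.1]; omega)
  refine ⟨⟨k, by simp; omega, ?_⟩, ?_, ?_⟩
  · rw [List.take_take, min_eq_left hkk]
    have : y + disp (l.take k) = z := hkc.2
    exact eq_sub_of_add_eq' this
  · rw [dotR_sub]; linarith [hD y hyD]
  · rw [dotR_sub]; linarith [hD y hyD]

/-- Some starting point in a large set is unlikely to be stopped. -/
lemma Good.exists_an_meet_le {d : ℕ} {P : Measure (Env d)} {η : ℝ} (hG : Good P η)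
    {ℓ : Fin d → ℝ} {κ : ℝ} (hκ : 0 < κ) {R L N : ℕ} (hR : 1 ≤ κ * R) (hRN : R ≤ N)
    (hLN : (L : ℝ) ≤ κ * N) (D : Finset (Site d)) {b : ℝ} (hb : 0 ≤ b) (n : ℕ)
    (hD : ∀ y ∈ D, b < dotR y ℓ ∧ dotR y ℓ ≤ b + n)
    (hbl : (2 * N + 1 : ℕ) ^ d * apr P (bl ℓ κ R) ≤ 1 / 4)
    (G : Finset (Site d)) (hcard : 4 * (G.card * (n * (2 * R + 1) ^ d)) < D.card) :
    ∃ y ∈ D, an P (ind (meet ℓ κ R L G y)) ≤ 1 / 2 := by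
  classical
  by_contra! hc
  have hR0 : 0 < R := by
    rcases Nat.eq_zero_or_pos R with rfl | h
    · simp at hR; linarith
    · exact h
  have h1 : ∀ y ∈ D, 1 / 4 ≤ apr P (con ℓ κ R G y) := by
    intro y hy
    have h2 := (hc y hy).le.trans (hG.apr_meet_le hκ hR0 hRN hLN G (by linarith [hD y hy]))
    have h3 : (1 / 4 : ℝ≥0∞) + 1 / 4 ≤ apr P (con ℓ κ R G y) + 1 / 4 := by
      refine le_trans (le_of_eq ?_) (h2.trans (by gcongr))
      rw [← ENNReal.toReal_eq_toReal_iff' (by simp) (by simp), ENNReal.toReal_add (by simp) (by simp)]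
      norm_num
    exact (ENNReal.add_le_add_iff_right (by simp)).1 h3
  have h2 : ∀ y ∈ D, apr P (con ℓ κ R G y) ≤ ∑ z ∈ G, apr P (con ℓ κ R {z} y) := by
    intro y _
    rw [← Finset.sum_coe_sort, ← tsum_fintype (L := .unconditional _)]
    refine hG.apr_le_tsum (fun z : G => con ℓ κ R {(z : Site d)} y) fun l hl => ?_
    exact ⟨⟨_, hl.2⟩, l.length, le_rfl, by rw [List.take_length]; exact ⟨hl.1, rfl⟩⟩
  have h3 : (D.card : ℝ≥0∞) * (1 / 4) ≤ (G.card * (n * (2 * R + 1) ^ d) : ℕ) :=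
    calc (D.card : ℝ≥0∞) * (1 / 4) = ∑ y ∈ D, (1 / 4 : ℝ≥0∞) := by simp
      _ ≤ ∑ y ∈ D, ∑ z ∈ G, apr P (con ℓ κ R {z} y) :=
        Finset.sum_le_sum fun y hy => (h1 y hy).trans (h2 y hy)
      _ = ∑ z ∈ G, ∑ y ∈ D, apr P (con ℓ κ R {z} y) := Finset.sum_comm
      _ ≤ ∑ z ∈ G, ((n * (2 * R + 1) ^ d : ℕ) : ℝ≥0∞) :=
        Finset.sum_le_sum fun z _ => hG.sum_apr_con_le hκ hR D b n hD z
      _ = _ := by simp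
  have h4 : (D.card : ℝ≥0∞) ≤ (4 * (G.card * (n * (2 * R + 1) ^ d)) : ℕ) := by
    calc (D.card : ℝ≥0∞) = 4 * (D.card * (1 / 4)) := by
          rw [mul_left_comm, one_div, ENNReal.mul_inv_cancel (by norm_num) (by norm_num), mul_one]
      _ ≤ 4 * ((G.card * (n * (2 * R + 1) ^ d) : ℕ) : ℝ≥0∞) := by gcongr
      _ = _ := by push_cast; ring
  have h5 : D.card ≤ 4 * (G.card * (n * (2 * R + 1) ^ d)) := by exact_mod_cast h4
  omega

/-- The environments in which no walker started in `D` is likely to succeed. -/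
def trapped {d : ℕ} (ℓ : Fin d → ℝ) (L : ℝ) (D : Finset (Site d)) : Set (Env d) :=
  {ω | ∀ y ∈ D, pr ω y (succT ℓ L y) ≤ 1 / 4}

lemma measurableSet_trapped {d : ℕ} (ℓ : Fin d → ℝ) (L : ℝ) (D : Finset (Site d)) :
    MeasurableSet (trapped ℓ L D) := by
  have : trapped ℓ L D = ⋂ y ∈ D, {ω | pr ω y (succT ℓ L y) ≤ 1 / 4} := by
    ext ω; simp [trapped]
  rw [this]
  exact Finset.measurableSet_biInter _ fun y _ => measurableSet_le (measurable_pr _ _) measurable_const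

lemma Good.lintegral_trapped_le {d : ℕ} (hd : 0 < d) {P : Measure (Env d)} {η : ℝ} (hG : Good P η)
    {ℓ : Fin d → ℝ} {κ R L : ℝ} (hκ : 0 < κ) (D : Finset (Site d)) (hD : ∀ y ∈ D, 0 ≤ dotR y ℓ)
    {s m : ℕ} (hs : ∀ G : Finset (Site d), ∀ y ∈ D, ∀ l ∈ meet ℓ κ R L G y, (sitesF y l).card ≤ s)
    (hex : ∀ G : Finset (Site d), G.card ≤ 1 + m * s →
      ∃ y ∈ D, an P (ind (meet ℓ κ R L G y)) ≤ 1 / 2)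
    (j : ℕ) (hj : j ≤ m) (G : Finset (Site d)) (h0 : 0 ∈ G) (hcard : G.card ≤ 1 + (m - j) * s)
    (g : Env d → ℝ≥0∞) (hg : Measurable g) (hgG : DependsOn g (G : Set (Site d))) :
    ∫⁻ ω, g ω * ind (trapped ℓ L D) ω ∂P ≤ (2 / 3) ^ j * ∫⁻ ω, g ω ∂P := by
  classical
  have hmeas : Measurable (ind (trapped ℓ L D)) :=
    measurable_one.indicator (measurableSet_trapped ℓ L D)
  induction j generalizing G g with
  | zero =>
    rw [pow_zero, one_mul]
    exact lintegral_mono fun ω => mul_le_of_le_one_right' (ind_le_one _ _)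
  | succ j ih =>
    obtain ⟨y, hy, hay⟩ := hex G (hcard.trans (by gcongr; omega))
    have hpt : ∀ᵐ ω ∂P, g ω * ind (trapped ℓ L D) ω ≤
        4 / 3 * ∑' l, ind (meet ℓ κ R L G y) l * ((g ω * wt ω y l) * ind (trapped ℓ L D) ω) := by
      filter_upwards [hG.ell] with ω hω
      by_cases hA : ω ∈ trapped ℓ L D
      swap
      · simp [hA]
      have h1 := one_le_succT_add hd hG.pos hω (R := R) (L := L) (G := (G : Set (Site d))) hκ
        (by simpa using h0) (hD y hy)
      have h2 : 3 / 4 ≤ qs ω y (meet ℓ κ R L G y) := by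
        have h3 : (1 / 4 : ℝ≥0∞) + 3 / 4 ≤ 1 / 4 + qs ω y (meet ℓ κ R L G y) := by
          refine le_trans (le_of_eq ?_) (h1.trans (add_le_add_left (hA y hy) _))
          rw [← ENNReal.toReal_eq_toReal_iff' (by simp [ENNReal.div_eq_top]) (by simp),
            ENNReal.toReal_add (by simp) (by simp [ENNReal.div_eq_top])]
          norm_num
        exact (ENNReal.add_le_add_iff_left (by simp)).1 h3
      have h4 : ∑' l, ind (meet ℓ κ R L G y) l * ((g ω * wt ω y l) * ind (trapped ℓ L D) ω) =
          g ω * qs ω y (meet ℓ κ R L G y) := by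
        unfold qs qw
        rw [← ENNReal.tsum_mul_left]
        refine tsum_congr fun l => ?_
        rw [ind_of_mem hA]; ring
      rw [h4, ind_of_mem hA, mul_one]
      calc g ω = 4 / 3 * (g ω * (3 / 4)) := by
            have : (4 / 3 * (3 / 4) : ℝ≥0∞) = 1 := by
              rw [← ENNReal.toReal_eq_toReal_iff'
                (ENNReal.mul_ne_top (by simp [ENNReal.div_eq_top]) (by simp [ENNReal.div_eq_top]))
                (by simp)]
              norm_num
            rw [mul_left_comm, this, mul_one]
        _ ≤ _ := by gcongr
    calc _ ≤ ∫⁻ ω, 4 / 3 * ∑' l, ind (meet ℓ κ R L G y) l *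
            ((g ω * wt ω y l) * ind (trapped ℓ L D) ω) ∂P := lintegral_mono_ae hpt
      _ = 4 / 3 * ∑' l, ind (meet ℓ κ R L G y) l *
            ∫⁻ ω, (g ω * wt ω y l) * ind (trapped ℓ L D) ω ∂P := by
          have hm : ∀ l, Measurable fun ω => (g ω * wt ω y l) * ind (trapped ℓ L D) ω :=
            fun l => (hg.mul (measurable_wt y l)).mul hmeas
          rw [lintegral_const_mul _ (Measurable.tsum fun l => (hm l).const_mul _),
            lintegral_tsum fun l => ((hm l).const_mul _).aemeasurable]
          congr 1
          exact tsum_congr fun l => lintegral_const_mul _ (hm l)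
      _ ≤ 4 / 3 * ∑' l, (aw P l * ind (meet ℓ κ R L G y) l) * ((2 / 3) ^ j * ∫⁻ ω, g ω ∂P) := by
          refine mul_le_mul_right (ENNReal.tsum_le_tsum fun l => ?_) _
          by_cases hl : l ∈ meet ℓ κ R L G y
          swap
          · simp [hl]
          have hdisj : Disjoint (G : Set (Site d)) (sites y l) := by
            rw [Set.disjoint_right]
            rintro _ ⟨i, hi, rfl⟩
            exact (meet_of_take hl hi).2.2
          have h1 := ih (by omega) (G ∪ sitesF y l) (by simp [h0]) ?_ (fun ω => g ω * wt ω y l)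
            (hg.mul (measurable_wt y l)) ?_
          · rw [hG.indep _ _ _ _ hg (measurable_wt y l) hgG (dependsOn_wt y l) hdisj,
              hG.lintegral_wt] at h1
            rw [ind_of_mem hl, one_mul, mul_one]
            refine h1.trans (le_of_eq ?_)
            ring
          · refine (Finset.card_union_le _ _).trans ?_
            have := hs G y hy l hl
            have h2 : m - j = (m - (j + 1)) + 1 := by omega
            rw [h2, add_mul]
            omega
          · intro ω ω' hω
            have e1 : g ω = g ω' := hgG fun x hx => hω x (by simp only [Finset.coe_union]; exact Or.inl hx)
            have e2 : wt ω y l = wt ω' y l := dependsOn_wt y l fun x hx =>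
              hω x (by rw [Finset.coe_union, coe_sitesF]; exact Or.inr hx)
            simp only [e1, e2]
      _ = 4 / 3 * (an P (ind (meet ℓ κ R L G y)) * ((2 / 3) ^ j * ∫⁻ ω, g ω ∂P)) := by
          rw [ENNReal.tsum_mul_right]; rfl
      _ ≤ 4 / 3 * (1 / 2 * ((2 / 3) ^ j * ∫⁻ ω, g ω ∂P)) := by gcongr
      _ = _ := by
          have : (4 / 3 * (1 / 2) : ℝ≥0∞) = 2 / 3 := by
            rw [← ENNReal.toReal_eq_toReal_iff'
              (ENNReal.mul_ne_top (by simp [ENNReal.div_eq_top]) (by simp))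
              (by simp [ENNReal.div_eq_top])]
            norm_num
          rw [← mul_assoc, this, pow_succ', mul_assoc]

lemma Good.measure_trapped_le {d : ℕ} (hd : 0 < d) {P : Measure (Env d)} {η : ℝ} (hG : Good P η)
    {ℓ : Fin d → ℝ} (hℓ : ∀ i, |ℓ i| ≤ 1) {κ : ℝ} (hκ : 0 < κ) {R L N : ℕ} (hR : 1 ≤ κ * R)
    (hRN : R ≤ N) (hLN : (L : ℝ) ≤ κ * N) (D : Finset (Site d)) {b : ℝ} (hb : 0 ≤ b) (n : ℕ)
    (hD : ∀ y ∈ D, b < dotR y ℓ ∧ dotR y ℓ ≤ b + n)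
    (hbl : (2 * N + 1 : ℕ) ^ d * apr P (bl ℓ κ R) ≤ 1 / 4) (m : ℕ)
    (hcard : 4 * ((1 + m * ((R + L) * (2 * R + 1) ^ d)) * (n * (2 * R + 1) ^ d)) < D.card) :
    P (trapped ℓ L D) ≤ (2 / 3) ^ m := by
  have := hG.prob
  have hD0 : ∀ y ∈ D, 0 ≤ dotR y ℓ := fun y hy => by linarith [hD y hy]
  have h1 := hG.lintegral_trapped_le hd (ℓ := ℓ) (κ := κ) (R := R) (L := L) hκ D hD0
    (s := (R + L) * (2 * R + 1) ^ d) (m := m)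
    (fun G y hy l hl => card_sitesF_meet_le hℓ hκ hR (hD0 y hy) hl)
    (fun G hGc => hG.exists_an_meet_le hκ hR hRN hLN D hb n hD hbl G
      (lt_of_le_of_lt (by gcongr) hcard)) m le_rfl {0} (by simp) (by simp) (fun _ => 1)
    measurable_const (fun _ _ _ => rfl)
  simpa [ind, lintegral_indicator_one (measurableSet_trapped ℓ L D)] using h1

/-! ### Escaping from a finite set -/

lemma exists_disp_eq {d : ℕ} (y : Site d) : ∃ l : List (StepIdx d), disp l = y ∧
    (l.length : ℝ) = nr y := by
  have hdisp : ∀ (L : List (Fin d)) (f : Fin d → List (StepIdx d)),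
      disp (L.flatMap f) = (L.map fun i => disp (f i)).sum := by
    intro L f
    induction L with
    | nil => simp
    | cons a L ih => simp [ih]
  refine ⟨(List.finRange d).flatMap fun i => List.replicate (y i).natAbs (i, decide (0 ≤ y i)),
    ?_, ?_⟩
  · rw [hdisp, ← Fin.sum_univ_def]
    funext j
    rw [Finset.sum_apply, Finset.sum_eq_single j]
    · rw [disp_replicate]
      by_cases h : 0 ≤ y j
      · simp [stepVec, h]
      · have h1 : |y j| = -y j := abs_of_neg (by omega)
        simp [stepVec, h, h1]
    · intro i _ hij
      rw [disp_replicate]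
      simp [stepVec, hij.symm]
    · simp
  · rw [nr_eq_natCast, List.length_flatMap, Fin.sum_univ_def]
    simp

lemma disp_take_ne_zero {d : ℕ} {l : List (StepIdx d)} (h : (l.length : ℝ) = nr (disp l)) {k : ℕ}
    (hk : 1 ≤ k) (hk' : k ≤ l.length) : disp (l.take k) ≠ 0 := by
  intro h0
  have h1 := disp_take_add_drop l k
  rw [h0, zero_add] at h1
  have h2 := nr_disp_le (l.drop k)
  rw [h1, ← h, List.length_drop, Nat.cast_sub hk'] at h2
  have : (1 : ℝ) ≤ k := by exact_mod_cast hk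
  linarith

/-- Comparison of events up to an almost sure exit. -/
lemma pr_le_of_exit {d : ℕ} (ω : Env d) (x : Site d) {E T T' : Set (List (StepIdx d))}
    (hE : 1 ≤ pr ω x E)
    (h₁ : ∀ l ∈ first E, ∀ k ≤ l.length, l.take k ∈ T → ∃ i ≤ l.length, l.take i ∈ T')
    (h₂ : ∀ l ∈ T, ∀ k ≤ l.length, l.take k ∈ E → l.take k ∈ T') : pr ω x T ≤ pr ω x T' := by
  let E₀ : Set (List (StepIdx d)) := {l | l ∈ first E ∧ ∀ i ≤ l.length, l.take i ∉ T'}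
  let E₁ : Set (List (StepIdx d)) := {l | l ∈ first E ∧ ∃ i ≤ l.length, l.take i ∈ T'}
  have hE₁ : qs ω x E₁ ≤ pr ω x T' := by
    refine le_trans (qw_mono ω x fun l => ?_) (pr_le_pr ω x (T := E₁) fun l hl => hl.2)
    exact ind_mono fun hl => ⟨hl, fun k hk hk' => hl.1.2 k hk hk'.1.1⟩
  have h3 : 1 ≤ pr ω x T' + qs ω x E₀ := by
    refine hE.trans (le_trans ?_ (add_le_add_left hE₁ _))
    unfold pr qs
    rw [← qw_add]
    refine qw_mono ω x fun l => ?_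
    by_cases hl : l ∈ first E
    · by_cases hT : ∃ i ≤ l.length, l.take i ∈ T'
      · rw [ind_of_mem (T := E₁) ⟨hl, hT⟩]
        exact (ind_le_one _ _).trans le_self_add
      · push Not at hT
        rw [ind_of_mem (T := E₀) ⟨hl, hT⟩]
        exact (ind_le_one _ _).trans le_add_self
    · simp [hl]
  have h4 : pr ω x T + qs ω x E₀ ≤ 1 := by
    refine le_trans ?_ (pr_le_one ω x (first T ∪ E₀))
    unfold pr qs
    rw [← qw_add]
    refine qw_mono ω x fun l => ?_
    by_cases hl : l ∈ first T
    · have hl0 : l ∉ E₀ := by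
        rintro ⟨h, h'⟩
        obtain ⟨i, hi, hi'⟩ := h₁ l h l.length le_rfl (by rw [List.take_length]; exact hl.1)
        exact h' i hi hi'
      rw [ind_of_mem hl, ind_of_notMem hl0, add_zero, ind_of_mem]
      refine ⟨Or.inl hl, fun k hk => ?_⟩
      rintro (h | h)
      · exact hl.2 k hk h.1
      · refine h.2 (l.take k).length le_rfl ?_
        rw [List.take_length]
        exact h₂ l hl.1 k hk.le h.1.1
    · rw [ind_of_notMem hl, zero_add]
      refine ind_mono fun h => ⟨Or.inr h, fun k hk => ?_⟩
      rintro (h' | h')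
      · obtain ⟨i, hi, hi'⟩ := h₁ l h.1 k hk.le h'.1
        exact h.2 i hi hi'
      · exact h.1.2 k hk h'.1.1
  have h5 : qs ω x E₀ ≠ ⊤ := ne_top_of_le_ne_top ENNReal.one_ne_top (le_add_self.trans h4)
  exact (ENNReal.add_le_add_iff_right h5).1 (h4.trans h3)

lemma pr_return_le {d : ℕ} (ω : Env d) (x : Site d) {ℓ : Fin d → ℝ} {κ L : ℝ} (hκ : 0 < κ)
    (hL : 0 < L) (hℓ : ∀ i, |ℓ i| ≤ 1) (Q : Set (Site d)) (y : Site d) {a : ℝ≥0∞}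
    (hQ : ∀ z ∈ Q, pr ω z (bl ℓ κ L) ≤ a) :
    pr ω x {l | (∃ i ≤ l.length, x + disp (l.take i) ∈ Q ∧ L ≤ dotR (y + disp (l.take i)) ℓ) ∧
      y + disp l = 0} ≤ a := by
  let T₁ : Set (List (StepIdx d)) := {l | x + disp l ∈ Q ∧ L ≤ dotR (y + disp l) ℓ}
  calc _ ≤ qs ω x (cat (first T₁) fun _ => first (bl ℓ κ L)) := by
        refine pr_le_qw ω x ?_
        rintro l ⟨⟨i, hi, hiQ, hiL⟩, hl0⟩
        obtain ⟨i', hi', hf⟩ := exists_take_mem_first (T := T₁) (l := l) (k := i) ⟨hiQ, hiL⟩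
        have hbl : l.drop i' ∈ bl ℓ κ L := by
          have h1 := disp_take_add_drop l i'
          have h2 : L ≤ dotR (y + disp (l.take i')) ℓ := hf.1.2
          have h3 : disp (l.drop i') = -(y + disp (l.take i')) := by
            rw [eq_neg_iff_add_eq_zero, add_comm, add_assoc, h1, hl0]
          have h4 := abs_dotR_le hℓ (disp (l.drop i'))
          rw [h3, dotR_neg, abs_neg, one_mul, ← h3] at h4
          have h5 := le_abs_self (dotR (y + disp (l.take i')) ℓ)
          refine ⟨by linarith, ?_⟩
          rw [h3, dotR_neg, ← h3]
          nlinarith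
        have hd : (l.drop i').take (l.drop i').length ∈ bl ℓ κ L := by
          rwa [List.take_length]
        obtain ⟨j, hj, hjf⟩ := exists_take_mem_first hd
        rw [List.length_drop] at hj
        have hmem : l.take (i' + j) ∈ cat (first T₁) fun _ => first (bl ℓ κ L) := by
          rw [List.take_add]
          exact mem_cat hf hjf
        exact (ind_of_mem hmem).symm.le.trans (le_cnt _ (by omega))
    _ ≤ ∑' l₁, wt ω x l₁ * ind (first T₁) l₁ * pr ω (x + disp l₁) (bl ℓ κ L) := qs_cat_le _ _ _ _
    _ ≤ ∑' l₁, wt ω x l₁ * ind (first T₁) l₁ * a := by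
        refine ENNReal.tsum_le_tsum fun l₁ => ?_
        by_cases h : l₁ ∈ first T₁
        · gcongr; exact hQ _ h.1.1
        · simp [h]
    _ = pr ω x T₁ * a := by rw [ENNReal.tsum_mul_right]; rfl
    _ ≤ a := mul_le_of_le_one_left' (pr_le_one _ _ _)

lemma le_pr_esc {d : ℕ} (hd : 0 < d) {ω : Env d} {η : ℝ} (hη : 0 < η)
    (h : ∀ x s, η ≤ (ω x).1 s) {ℓ : Fin d → ℝ} (hℓ : ∀ i, |ℓ i| ≤ 1) {κ L : ℝ} (hκ : 0 < κ)
    (hL : 0 < L) (Q : Finset (Site d)) (x y : Site d)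
    (hy : 1 / 4 ≤ pr ω (x + y) (succT ℓ L y)) (hQ : ∀ z ∈ Q, pr ω z (bl ℓ κ L) ≤ 1 / 8)
    {K : ℕ} (hK : nr y ≤ K) (hη1 : η ≤ 1) :
    ENNReal.ofReal (η ^ K / 8) ≤ pr ω x (esc Q x) := by
  obtain ⟨l₁, hl₁, hlen⟩ := exists_disp_eq y
  let U : Set (List (StepIdx d)) :=
    {l | x + y + disp l ∉ Q ∧ ∀ k ≤ l.length, y + disp (l.take k) ≠ 0}
  let Ret : Set (List (StepIdx d)) :=
    {l | (∃ i ≤ l.length, x + y + disp (l.take i) ∈ Q ∧ L ≤ dotR (y + disp (l.take i)) ℓ) ∧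
      y + disp l = 0}
  have h1 : pr ω (x + y) (succT ℓ L y) ≤ pr ω (x + y) (U ∪ Ret) := by
    refine pr_le_of_exit ω (x + y) (one_le_pr_exit hd hη h Q (x + y)) ?_ ?_
    · intro l hl k hk hs
      by_cases h0 : ∃ j ≤ l.length, y + disp (l.take j) = 0
      · obtain ⟨j, hj, hj0⟩ := h0
        by_cases hU : ∃ i ≤ l.length, l.take i ∈ U
        · obtain ⟨i, hi, hiU⟩ := hU
          exact ⟨i, hi, Or.inl hiU⟩
        have hkj : k < j := by
          by_contra! hjk
          have := hs.2 j (by simp; omega)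
          rw [List.take_take, min_eq_left hjk] at this
          exact this hj0
        refine ⟨j, hj, Or.inr ⟨⟨k, by simp; omega, ?_, ?_⟩, hj0⟩⟩
        · rw [List.take_take, min_eq_left hkj.le]
          have := hl.2 k (by omega)
          simpa using this
        · rw [List.take_take, min_eq_left hkj.le]
          exact hs.1
      · push Not at h0
        exact ⟨l.length, le_rfl, Or.inl (by rw [List.take_length]; exact ⟨hl.1, h0⟩)⟩
    · intro l hl k hk hE
      refine Or.inl ⟨hE, fun i hi => ?_⟩
      simp only [List.length_take] at hi
      rw [List.take_take, min_eq_left (by omega)]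
      exact hl.2 i (by omega)
  have h2 : pr ω (x + y) (U ∪ Ret) ≤ pr ω (x + y) U + 1 / 8 := by
    refine (pr_union_le ω (x + y) (T₁ := U) (T₂ := Ret) fun l hl => ?_).trans
      (add_le_add_right (pr_return_le ω (x + y) hκ hL hℓ Q y hQ) _)
    rcases hl with hl | hl
    · exact Or.inl ⟨l.length, le_rfl, by rwa [List.take_length]⟩
    · exact Or.inr ⟨l.length, le_rfl, by rwa [List.take_length]⟩
  have h3 : 1 / 8 ≤ pr ω (x + y) U := by
    have : (1 / 8 : ℝ≥0∞) + 1 / 8 ≤ pr ω (x + y) U + 1 / 8 := by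
      refine le_trans (le_of_eq ?_) (hy.trans (h1.trans h2))
      rw [← ENNReal.toReal_eq_toReal_iff' (by simp) (by simp), ENNReal.toReal_add (by simp) (by simp)]
      norm_num
    exact (ENNReal.add_le_add_iff_right (by simp)).1 this
  have h4 := wt_mul_pr_le ω x l₁ (T₂ := U) (T := esc Q x) ?_
  · rw [hl₁] at h4
    refine le_trans ?_ h4
    refine le_trans ?_ (mul_le_mul' (pow_le_wt h x l₁) h3)
    rw [div_eq_mul_one_div, ENNReal.ofReal_mul (by positivity), ENNReal.ofReal_pow hη.le]
    refine mul_le_mul' ?_ ?_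
    · refine pow_le_pow_right_of_le_one' ?_ (by rw [← hlen] at hK; exact_mod_cast hK)
      rw [← ENNReal.ofReal_one]; exact ENNReal.ofReal_le_ofReal hη1
    · rw [ENNReal.ofReal_div_of_pos (by norm_num)]; simp
  · rintro l ⟨hlQ, hl0⟩
    refine ⟨by rwa [disp_append, hl₁, ← add_assoc], fun k hk hk' => ?_⟩
    rcases le_total k l₁.length with hkl | hkl
    · rw [List.take_append_of_le_length hkl]
      exact disp_take_ne_zero (by rw [hl₁, hlen]) hk hkl
    · obtain ⟨j, rfl⟩ := Nat.exists_eq_add_of_le hkl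
      rw [List.take_length_add_append, disp_append, hl₁]
      exact hl0 j (by simp at hk'; omega)

/-- A cube of starting points ahead of the origin. -/
def ahead {d : ℕ} (ℓ : Fin d → ℝ) (r : ℕ) : Finset (Site d) :=
  (box d r).image fun v => (fun i => ⌊(4 * d * r : ℝ) * ℓ i⌋) + v

lemma card_ahead {d : ℕ} (ℓ : Fin d → ℝ) (r : ℕ) : (ahead ℓ r).card = (2 * r + 1) ^ d := by
  rw [ahead, Finset.card_image_of_injective _ (add_right_injective _), card_box]

lemma dotR_ahead {d : ℕ} (hd : 0 < d) {ℓ : Fin d → ℝ} (h2 : norm2R ℓ = 1) {r : ℕ} (hr : 1 ≤ r)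
    {y : Site d} (hy : y ∈ ahead ℓ r) :
    (d * r : ℝ) < dotR y ℓ ∧ dotR y ℓ ≤ d * r + (6 * d * r : ℕ) ∧ nr y ≤ (6 * d ^ 2 * r : ℕ) := by
  have hℓ : ∀ i, |ℓ i| ≤ 1 := fun i => h2 ▸ abs_le_norm2R ℓ i
  have hsq : ∑ i, ℓ i ^ 2 = 1 := by
    have := congrArg (· ^ 2) h2
    simp only [norm2R] at this
    rwa [Real.sq_sqrt (Finset.sum_nonneg fun i _ => sq_nonneg _), one_pow] at this
  obtain ⟨v, hv, rfl⟩ := Finset.mem_image.1 hy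
  rw [mem_box] at hv
  have hd1 : (1 : ℝ) ≤ d := by exact_mod_cast hd
  have hr1 : (1 : ℝ) ≤ r := by exact_mod_cast hr
  have hi : ∀ i, |(((fun i => ⌊(4 * d * r : ℝ) * ℓ i⌋) + v : Site d) i : ℝ) - 4 * d * r * ℓ i|
      ≤ r + 1 := by
    intro i
    have h1 := Int.floor_le ((4 * d * r : ℝ) * ℓ i)
    have h3 := Int.lt_floor_add_one ((4 * d * r : ℝ) * ℓ i)
    have := abs_le.1 (hv i)
    simp only [Pi.add_apply]
    push_cast
    rw [abs_le]; constructor <;> linarith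
  set y : Site d := (fun i => ⌊(4 * d * r : ℝ) * ℓ i⌋) + v
  have hdot : |dotR y ℓ - 4 * d * r| ≤ d * (r + 1) := by
    have : dotR y ℓ - 4 * d * r = ∑ i, ((y i : ℝ) - 4 * d * r * ℓ i) * ℓ i := by
      have h1 : ∀ i, ((y i : ℝ) - 4 * d * r * ℓ i) * ℓ i = y i * ℓ i - 4 * d * r * ℓ i ^ 2 :=
        fun i => by ring
      simp only [h1, Finset.sum_sub_distrib, ← Finset.mul_sum, hsq, dotR, mul_one]
    rw [this]
    refine (Finset.abs_sum_le_sum_abs _ _).trans ?_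
    have h1 : ∀ i ∈ Finset.univ, |((y i : ℝ) - 4 * d * r * ℓ i) * ℓ i| ≤ (r + 1 : ℝ) := by
      intro i _
      rw [abs_mul]
      have := mul_le_mul (hi i) (hℓ i) (abs_nonneg _) (by positivity)
      linarith
    have := Finset.sum_le_card_nsmul _ _ _ h1
    simpa [mul_add] using this
  have hnr : nr y ≤ d * (4 * d * r + (r + 1)) := by
    have h1 : ∀ i ∈ Finset.univ, |(y i : ℝ)| ≤ (4 * d * r + (r + 1) : ℝ) := by
      intro i _
      have h3 := abs_le.1 (hi i)
      have h4 := abs_le.1 (hℓ i)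
      have h5 : (0 : ℝ) ≤ 4 * d * r := by positivity
      rw [abs_le]
      constructor <;> nlinarith
    have := Finset.sum_le_card_nsmul _ _ _ h1
    simpa [nr, mul_add] using this
  have h3 := abs_le.1 hdot
  have h4 : (d : ℝ) ≤ d * r := by nlinarith
  refine ⟨by linarith, by push_cast; linarith, hnr.trans ?_⟩
  push_cast
  nlinarith

lemma an_le_of_ae {d : ℕ} {P : Measure (Env d)} {η : ℝ} (hG : Good P η)
    {F : List (StepIdx d) → ℝ≥0∞} {B : Set (Env d)} (hB : MeasurableSet B) {c : ℝ≥0∞}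
    (h1 : ∀ ω, qw ω 0 F ≤ 1) (h : ∀ᵐ ω ∂P, ω ∉ B → qw ω 0 F ≤ c) : an P F ≤ P B + c := by
  have := hG.prob
  rw [← hG.lintegral_qw 0]
  calc _ ≤ ∫⁻ ω, B.indicator 1 ω + c ∂P := by
        refine lintegral_mono_ae ?_
        filter_upwards [h] with ω hω
        by_cases hωB : ω ∈ B
        · simp only [Set.indicator_of_mem hωB, Pi.one_apply]
          exact (h1 ω).trans le_self_add
        · exact (hω hωB).trans le_add_self
    _ = _ := by
        rw [lintegral_add_right _ measurable_const, lintegral_indicator_one hB]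
        simp

/-- The walk is unlikely to stay in a box for a long time. -/
lemma Good.an_stay_le {d : ℕ} (hd : 0 < d) {P : Measure (Env d)} {η : ℝ} (hG : Good P η)
    (hη1 : η ≤ 1) {ℓ : Fin d → ℝ} (h2 : norm2R ℓ = 1) {κ : ℝ} (hκ : 0 < κ) {R L N r m : ℕ}
    (hL : 0 < L) (hr : 1 ≤ r) (hR : 1 ≤ κ * R) (hRN : R ≤ N) (hLN : (L : ℝ) ≤ κ * N)
    (hbl : (2 * N + 1 : ℕ) ^ d * apr P (bl ℓ κ R) ≤ 1 / 4)
    (hcard : 4 * ((1 + m * ((R + L) * (2 * R + 1) ^ d)) * ((6 * d * r) * (2 * R + 1) ^ d)) <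
      (2 * r + 1) ^ d) {V j t : ℕ} (hj : (2 * V + 1) ^ d * j ≤ t) :
    an P (ind (stay (box d V : Set (Site d)) 0 t)) ≤
      ((2 * V + 1) ^ d : ℕ) * ((2 / 3) ^ m + 8 * apr P (bl ℓ κ L)) +
      ((2 * V + 1) ^ d : ℕ) * (1 - ENNReal.ofReal (η ^ (6 * d ^ 2 * r) / 8)) ^ j := by
  have := hG.prob
  have hℓ : ∀ i, |ℓ i| ≤ 1 := fun i => h2 ▸ abs_le_norm2R ℓ i
  set D := ahead ℓ r
  set Q := box d V
  have htr : P (trapped ℓ L D) ≤ (2 / 3) ^ m :=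
    hG.measure_trapped_le hd hℓ hκ hR hRN hLN D (b := d * r) (by positivity) (6 * d * r)
      (fun y hy => ⟨(dotR_ahead hd h2 hr hy).1, (dotR_ahead hd h2 hr hy).2.1⟩) hbl m
      (by rw [card_ahead]; exact hcard)
  let B : Set (Env d) := ⋃ x ∈ Q, ({ω | shift x ω ∈ trapped ℓ L D} ∪ {ω | 1 / 8 ≤ pr ω x (bl ℓ κ L)})
  have hm1 : ∀ x, MeasurableSet {ω : Env d | shift x ω ∈ trapped ℓ L D} :=
    fun x => measurable_shift x (measurableSet_trapped ℓ L D)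
  have hm2 : ∀ x, MeasurableSet {ω : Env d | 1 / 8 ≤ pr ω x (bl ℓ κ L)} :=
    fun x => measurableSet_le measurable_const (measurable_pr x _)
  have hBm : MeasurableSet B := Finset.measurableSet_biUnion _ fun x _ => (hm1 x).union (hm2 x)
  have hPB : P B ≤ ((2 * V + 1) ^ d : ℕ) * ((2 / 3) ^ m + 8 * apr P (bl ℓ κ L)) := by
    refine (measure_biUnion_finset_le _ _).trans ?_
    refine (Finset.sum_le_card_nsmul _ _ ((2 / 3) ^ m + 8 * apr P (bl ℓ κ L)) fun x _ => ?_).trans ?_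
    · refine (measure_union_le _ _).trans (add_le_add ?_ ?_)
      · have h3 := hG.inv x (ind (trapped ℓ L D))
          (measurable_one.indicator (measurableSet_trapped ℓ L D))
        have h4 : ∀ ω, ind (trapped ℓ L D) (shift x ω) =
            ({ω | shift x ω ∈ trapped ℓ L D} : Set (Env d)).indicator 1 ω := by
          intro ω
          by_cases hω : shift x ω ∈ trapped ℓ L D <;> simp [hω]
        simp only [h4] at h3
        rw [lintegral_indicator_one (hm1 x)] at h3
        rw [h3, ind, lintegral_indicator_one (measurableSet_trapped ℓ L D)]
        exact htr
      · have h3 := mul_meas_ge_le_lintegral (μ := P) (measurable_pr x (bl ℓ κ L)) (1 / 8)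
        rw [hG.lintegral_pr] at h3
        calc _ = 8 * (1 / 8 * P {ω | 1 / 8 ≤ pr ω x (bl ℓ κ L)}) := by
              rw [← mul_assoc, one_div, ENNReal.mul_inv_cancel (by norm_num) (by norm_num), one_mul]
          _ ≤ _ := by gcongr
    · rw [card_box, nsmul_eq_mul]
  refine (an_le_of_ae hG hBm ?_ ?_).trans (add_le_add_left hPB _)
  · intro ω
    refine le_trans (qw_mono ω 0 fun l => ?_) (pr_le_one ω 0 (stay Q 0 t))
    refine ind_mono fun hl => ⟨hl, fun k hk h => ?_⟩
    have h3 := h.1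
    simp only [List.length_take] at h3
    have h4 := hl.1
    omega
  · filter_upwards [hG.ell] with ω hω hωB
    have h3 : ∀ x ∈ Q, shift x ω ∉ trapped ℓ L D ∧ pr ω x (bl ℓ κ L) < 1 / 8 := by
      intro x hx
      constructor
      · intro h'
        exact hωB (Set.mem_iUnion₂.2 ⟨x, hx, Or.inl h'⟩)
      · by_contra! h'
        exact hωB (Set.mem_iUnion₂.2 ⟨x, hx, Or.inr h'⟩)
    rw [← card_box] at hj ⊢
    refine qs_stay_le ω Q 0 (fun x hx => ?_) hj
    have h4 := (h3 x hx).1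
    simp only [trapped, Set.mem_ofPred_eq, not_forall, not_le] at h4
    obtain ⟨y, hy, hlt⟩ := h4
    refine le_pr_esc hd hG.pos hω hℓ hκ (by exact_mod_cast hL) Q x y ?_ (fun z hz => (h3 z hz).2.le)
      (dotR_ahead hd h2 hr hy).2.2 hη1
    have h5 : pr (shift x ω) y (succT ℓ L y) = pr ω (x + y) (succT ℓ L y) := qw_shift x y ω _
    rw [← h5]
    exact hlt.le

/-! ### Choice of scales -/

lemma exists_scale {B : ℝ} (hB : 1 ≤ B) {D : ℕ} (hD : 1 ≤ D) (q₁ : ℕ) : ∃ t₀ : ℕ, 1 ≤ t₀ ∧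
    ∀ t : ℕ, t₀ ≤ t → ∃ q : ℕ, q₁ ≤ q ∧ 1 ≤ q ∧ Real.exp (B * (q : ℝ) ^ D) ≤ t ∧
      (t : ℝ) ≤ Real.exp (B * 2 ^ D * (q : ℝ) ^ D) := by
  set q₂ := max q₁ 1 with hq₂
  obtain ⟨t₁, ht₁⟩ := exists_nat_ge (Real.exp (B * (q₂ : ℝ) ^ D))
  refine ⟨max t₁ (max q₂ 1), by simp, fun t ht => ?_⟩
  have ht1 : t₁ ≤ t := (le_max_left _ _).trans ht
  have ht2 : q₂ ≤ t := (le_max_left _ _).trans ((le_max_right _ _).trans ht)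
  have ht3 : 1 ≤ t := (le_max_right _ _).trans ((le_max_right _ _).trans ht)
  classical
  set q := Nat.findGreatest (fun q : ℕ => Real.exp (B * (q : ℝ) ^ D) ≤ t) t with hq
  have hq₂P : Real.exp (B * (q₂ : ℝ) ^ D) ≤ t := ht₁.trans (by exact_mod_cast ht1)
  have hqP : Real.exp (B * (q : ℝ) ^ D) ≤ t :=
    Nat.findGreatest_spec (P := fun q : ℕ => Real.exp (B * (q : ℝ) ^ D) ≤ t) ht2 hq₂P
  have hle : q₂ ≤ q := Nat.le_findGreatest ht2 hq₂P
  have hq1 : 1 ≤ q := (le_max_right _ _).trans hle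
  refine ⟨q, (le_max_left _ _).trans hle, hq1, hqP, ?_⟩
  have hlt : q < t := by
    refine lt_of_le_of_ne (Nat.findGreatest_le t) fun h => ?_
    rw [h] at hqP
    have h1 : (t : ℝ) ≤ (t : ℝ) ^ D := le_self_pow₀ (by exact_mod_cast ht3) (by omega)
    have h2 : (t : ℝ) ^ D ≤ B * (t : ℝ) ^ D := le_mul_of_one_le_left (by positivity) hB
    have := Real.add_one_le_exp (B * (t : ℝ) ^ D)
    linarith
  have hnot : ¬ Real.exp (B * ((q + 1 : ℕ) : ℝ) ^ D) ≤ t :=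
    Nat.findGreatest_is_greatest (P := fun q : ℕ => Real.exp (B * (q : ℝ) ^ D) ≤ t)
      (Nat.lt_succ_self _) hlt
  refine (not_le.1 hnot).le.trans (Real.exp_le_exp.2 ?_)
  rw [mul_assoc, ← mul_pow]
  have : ((q + 1 : ℕ) : ℝ) ≤ 2 * q := by
    have : (1 : ℝ) ≤ q := by exact_mod_cast hq1
    push_cast; linarith
  gcongr

lemma card_scale_lt {d q : ℕ} (hd : 4 ≤ d) (hq : 72 * d * 9 ^ d < q) :
    4 * ((1 + q ^ (8 * d + 1) * ((q + q ^ (12 * d)) * (2 * q + 1) ^ d)) *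
      ((6 * d * q ^ (8 * d)) * (2 * q + 1) ^ d)) < (2 * q ^ (8 * d) + 1) ^ d := by
  have hq1 : 1 ≤ q := by omega
  have h1 : (2 * q + 1) ^ d ≤ 3 ^ d * q ^ d := by
    rw [← mul_pow]; exact Nat.pow_le_pow_left (by omega) d
  have h2 : q ≤ q ^ (12 * d) := Nat.le_self_pow (by omega) q
  have h3 : 1 ≤ 3 ^ d * q ^ (21 * d + 1) := Nat.one_le_iff_ne_zero.2 (by positivity)
  calc 4 * ((1 + q ^ (8 * d + 1) * ((q + q ^ (12 * d)) * (2 * q + 1) ^ d)) *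
      ((6 * d * q ^ (8 * d)) * (2 * q + 1) ^ d))
      ≤ 4 * ((3 ^ d * q ^ (21 * d + 1) + q ^ (8 * d + 1) *
        ((q ^ (12 * d) + q ^ (12 * d)) * (3 ^ d * q ^ d))) *
        ((6 * d * q ^ (8 * d)) * (3 ^ d * q ^ d))) := by gcongr
    _ = (72 * d * 9 ^ d) * q ^ (30 * d + 1) := by
        have : (9 : ℕ) ^ d = 3 ^ d * 3 ^ d := by rw [← mul_pow]; norm_num
        rw [this]; ring
    _ < q * q ^ (30 * d + 1) := by gcongr
    _ = q ^ (30 * d + 2) := by ring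
    _ ≤ q ^ (8 * d * d) := Nat.pow_le_pow_right hq1 (by nlinarith)
    _ = (q ^ (8 * d)) ^ d := by rw [← pow_mul]
    _ ≤ (2 * q ^ (8 * d) + 1) ^ d := Nat.pow_le_pow_left (by omega) d

lemma eventually_poly_le_exp (d a : ℕ) {D : ℕ} (hD : 1 ≤ D) :
    ∀ᶠ q : ℕ in atTop, (((2 * q ^ a + 1) ^ d : ℕ) : ℝ) ≤ Real.exp ((q : ℝ) ^ D) := by
  obtain ⟨C, hC, h⟩ := exists_pow_le_exp (a * d + 1) (c := 1) (γ := 1) one_pos one_pos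
  obtain ⟨q₀, hq₀⟩ := exists_nat_ge (3 ^ d * C)
  filter_upwards [eventually_ge_atTop q₀, eventually_ge_atTop 1] with q hq hq1
  have hq1' : (1 : ℝ) ≤ q := by exact_mod_cast hq1
  have h1 : (((2 * q ^ a + 1) ^ d : ℕ) : ℝ) ≤ 3 ^ d * (q : ℝ) ^ (a * d) := by
    have : (2 * q ^ a + 1) ^ d ≤ 3 ^ d * q ^ (a * d) := by
      rw [pow_mul, ← mul_pow]
      have : 1 ≤ q ^ a := Nat.one_le_pow _ _ hq1
      exact Nat.pow_le_pow_left (by omega) d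
    exact_mod_cast this
  have h2 := h q hq1'
  rw [Real.rpow_one, one_mul, pow_succ] at h2
  have h3 : Real.exp (q : ℝ) ≤ Real.exp ((q : ℝ) ^ D) :=
    Real.exp_le_exp.2 (le_self_pow₀ hq1' (by omega))
  have h4 : (3 : ℝ) ^ d * C ≤ q := hq₀.trans (by exact_mod_cast hq)
  have h5 : (q : ℝ) ^ (a * d) * q ≤ C * Real.exp ((q : ℝ) ^ D) := h2.trans (by gcongr)
  have hq0 : (0 : ℝ) < q := by linarith
  refine h1.trans ?_
  rw [← mul_le_mul_iff_left₀ hq0]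
  calc 3 ^ d * (q : ℝ) ^ (a * d) * q = 3 ^ d * ((q : ℝ) ^ (a * d) * q) := by ring
    _ ≤ 3 ^ d * (C * Real.exp ((q : ℝ) ^ D)) := by gcongr
    _ = 3 ^ d * C * Real.exp ((q : ℝ) ^ D) := by ring
    _ ≤ q * Real.exp ((q : ℝ) ^ D) := by gcongr
    _ = _ := mul_comm _ _

lemma natCast_mul_ofReal (n : ℕ) (x : ℝ) :
    (n : ℝ≥0∞) * ENNReal.ofReal x = ENNReal.ofReal (n * x) := by
  rw [ENNReal.ofReal_mul n.cast_nonneg, ENNReal.ofReal_natCast]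

lemma eventually_poly_mul_bl_le {d : ℕ} {P : Measure (Env d)} {ℓ₀ : Fin d → ℝ} {γ κ : ℝ}
    (hγ : 0 < γ) (hc : Cone P ℓ₀ γ κ) (a : ℕ) :
    ∀ᶠ q : ℕ in atTop, (2 * q ^ a + 1 : ℕ) ^ d * apr P (bl ℓ₀ κ q) ≤ 1 / 4 := by
  obtain ⟨-, -, C, c, hC, hc, hbl⟩ := hc
  obtain ⟨C', hC', h⟩ := exists_pow_le_exp (a * d + 1) hc hγ
  obtain ⟨q₀, hq₀⟩ := exists_nat_ge (4 * (3 ^ d * C * C'))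
  filter_upwards [eventually_ge_atTop q₀, eventually_ge_atTop 1] with q hq hq1
  have hq1' : (1 : ℝ) ≤ q := by exact_mod_cast hq1
  have h1 : (2 * q ^ a + 1) ^ d ≤ 3 ^ d * q ^ (a * d) := by
    rw [pow_mul, ← mul_pow]
    have : 1 ≤ q ^ a := Nat.one_le_pow _ _ hq1
    exact Nat.pow_le_pow_left (by omega) d
  have h2 := h q hq1'
  have h4 : 4 * ((3 : ℝ) ^ d * C * C') ≤ q := hq₀.trans (by exact_mod_cast hq)
  have hq0 : (0 : ℝ) < q := by linarith
  calc ((2 * q ^ a + 1 : ℕ) : ℝ≥0∞) ^ d * apr P (bl ℓ₀ κ q)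
      ≤ ((3 ^ d * q ^ (a * d) : ℕ) : ℝ≥0∞) *
        ENNReal.ofReal (C * Real.exp (-(c * (q : ℝ) ^ γ))) := by
        gcongr
        · exact_mod_cast h1
        · exact hbl q hq1'
    _ = ENNReal.ofReal (((3 ^ d * q ^ (a * d) : ℕ) : ℝ) *
        (C * Real.exp (-(c * (q : ℝ) ^ γ)))) := by
        rw [natCast_mul_ofReal]
    _ ≤ ENNReal.ofReal (1 / 4) := by
        apply ENNReal.ofReal_le_ofReal
        rw [Real.exp_neg]
        push_cast
        have he := Real.exp_pos (c * (q : ℝ) ^ γ)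
        rw [← div_eq_mul_inv, ← mul_div_assoc, div_le_iff₀ he, ← mul_le_mul_iff_left₀ hq0]
        calc 3 ^ d * (q : ℝ) ^ (a * d) * C * q = 3 ^ d * C * (q : ℝ) ^ (a * d + 1) := by ring
          _ ≤ 3 ^ d * C * (C' * Real.exp (c * (q : ℝ) ^ γ)) := by gcongr
          _ = (4 * (3 ^ d * C * C')) * (1 / 4 * Real.exp (c * (q : ℝ) ^ γ)) := by ring
          _ ≤ q * (1 / 4 * Real.exp (c * (q : ℝ) ^ γ)) := by gcongr
          _ = _ := mul_comm _ _
    _ = 1 / 4 := by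
        rw [ENNReal.ofReal_div_of_pos (by norm_num)]; simp

lemma eventually_mul_pow_le (M : ℝ) {c : ℝ} (hc : 0 < c) {a b : ℕ} (hab : a < b) :
    ∀ᶠ q : ℕ in atTop, M * (q : ℝ) ^ a ≤ c * (q : ℝ) ^ b := by
  obtain ⟨q₀, hq₀⟩ := exists_nat_ge (M / c)
  filter_upwards [eventually_ge_atTop q₀, eventually_ge_atTop 1] with q hq hq1
  have hq1' : (1 : ℝ) ≤ q := by exact_mod_cast hq1
  have h1 : M ≤ c * q := by
    have := hq₀.trans (show (q₀ : ℝ) ≤ q by exact_mod_cast hq)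
    rwa [div_le_iff₀ hc, mul_comm] at this
  calc M * (q : ℝ) ^ a ≤ c * q * (q : ℝ) ^ a := by gcongr
    _ = c * (q : ℝ) ^ (a + 1) := by ring
    _ ≤ c * (q : ℝ) ^ b := by gcongr; omega

lemma one_sub_ofReal_pow_le {x : ℝ} (hx : 0 ≤ x) (hx1 : x ≤ 1) (j : ℕ) :
    (1 - ENNReal.ofReal x) ^ j ≤ ENNReal.ofReal (Real.exp (-(x * j))) := by
  rw [← ENNReal.ofReal_one, ← ENNReal.ofReal_sub _ hx, ← ENNReal.ofReal_pow (by linarith)]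
  apply ENNReal.ofReal_le_ofReal
  rw [show -(x * j) = j * (-x) by ring, Real.exp_nat_mul]
  exact pow_le_pow_left₀ (by linarith) (by linarith [Real.add_one_le_exp (-x)]) j

lemma Good.le_one {d : ℕ} (hd : 0 < d) {P : Measure (Env d)} {η : ℝ} (hG : Good P η) : η ≤ 1 := by
  have := hG.prob
  obtain ⟨ω, hω⟩ := hG.ell.exists
  have h1 := hω 0 (⟨0, hd⟩, true)
  have h2 : (ω 0).1 (⟨0, hd⟩, true) ≤ ∑ s, (ω 0).1 s :=
    Finset.single_le_sum (fun s _ => (ω 0).2.1 s) (Finset.mem_univ _)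
  rw [(ω 0).2.2] at h2
  exact h1.trans h2

set_option maxHeartbeats 1000000 in
lemma Good.exists_scales {d : ℕ} (hd : 4 ≤ d) {P : Measure (Env d)} {η : ℝ} (hG : Good P η)
    {ℓ : Fin d → ℝ} (h2 : norm2R ℓ = 1) {κ : ℝ} (hcone : Cone P ℓ (3 / 4) κ) (k q₁ : ℕ) {θ : ℝ}
    (hθ : 0 < θ) (hθ1 : θ ≤ 1) : ∃ C : ℝ, 0 < C ∧ ∃ t₀ : ℕ, 1 ≤ t₀ ∧ ∀ t : ℕ, t₀ ≤ t →
      ∃ q : ℕ, q₁ ≤ q ∧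
        an P (ind (stay (box d (q ^ (21 * d)) : Set (Site d)) 0 t)) ≤
          ENNReal.ofReal (C / (t : ℝ) ^ k) ∧
        ((2 * t + 1) ^ d : ℕ) * apr P (bl ℓ κ (q ^ (12 * d) : ℕ)) ≤
          ENNReal.ofReal (C / (t : ℝ) ^ k) ∧
        (1 - ENNReal.ofReal θ) ^ q ^ (8 * d + 1) ≤ ENNReal.ofReal (C / (t : ℝ) ^ k) := by
  have hcone' := hcone
  obtain ⟨hκ, hκ1, C, c, hC, hc, hbl⟩ := hcone'
  have hη := hG.pos
  have hη1 := hG.le_one (by omega)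
  have hd' : 0 < d := by omega
  set D := 8 * d with hD
  set a : ℝ := 6 * (d : ℝ) ^ 2 * (-Real.log η) with ha
  have ha0 : 0 ≤ a := by
    have := Real.log_nonpos hη.le hη1
    have : 0 ≤ -Real.log η := by linarith
    positivity
  set B : ℝ := a + 3 with hB
  have hB1 : 1 ≤ B := by linarith
  set B' : ℝ := B * 2 ^ D with hB'
  have hB'1 : 1 ≤ B' := one_le_mul_of_one_le_of_one_le hB1 (one_le_pow₀ (by norm_num))
  set M : ℝ := (k + d + 2) * B' with hM
  have hM0 : 0 < M := by positivity
  obtain ⟨q₂, hq₂⟩ := eventually_atTop.1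
    ((eventually_poly_le_exp d (21 * d) (D := D) (by omega)).and
      ((eventually_poly_mul_bl_le (by norm_num) hcone (12 * d + 1)).and
        ((eventually_mul_pow_le M hc (a := D) (b := 9 * d) (by omega)).and
          ((eventually_mul_pow_le M hθ (a := D) (b := 8 * d + 1) (by omega)).and
            ((eventually_mul_pow_le M (c := 1 / 3) (by norm_num) (a := D) (b := 8 * d + 1)
              (by omega)).and
              ((eventually_gt_atTop (72 * d * 9 ^ d)).and
                ((tendsto_natCast_atTop_atTop (R := ℝ)).eventually_ge_atTop
                  (max (4 * M) (1 / κ)))))))))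
  obtain ⟨t₀, ht₀, hscale⟩ := exists_scale hB1 (D := D) (by omega) (max q₁ q₂)
  refine ⟨3 ^ d * C + 8 * C + 2, by positivity, t₀, ht₀, fun t ht => ?_⟩
  obtain ⟨q, hq, hq1, hqt, htq⟩ := hscale t ht
  obtain ⟨e1, e2, e3, e4, e5, e6, e7⟩ := hq₂ q ((le_max_right _ _).trans hq)
  refine ⟨q, (le_max_left _ _).trans hq, ?_⟩
  have hq1' : (1 : ℝ) ≤ q := by exact_mod_cast hq1
  have ht1 : (1 : ℝ) ≤ t := by exact_mod_cast ht₀.trans ht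
  set y : ℝ := (q : ℝ) ^ D with hy
  have htq : (t : ℝ) ≤ Real.exp (B' * y) := htq
  clear_value B' M
  have hqy : (q : ℝ) ≤ y := le_self_pow₀ hq1' (by omega)
  have hy1 : 1 ≤ y := hq1'.trans hqy
  have hyM : 4 * M ≤ y := (le_max_left _ _).trans (e7.trans hqy)
  have hκq : 1 ≤ κ * q := by
    have := (le_max_right _ _).trans e7
    rwa [div_le_iff₀ hκ, mul_comm] at this
  have hk : Real.exp (-(k * B' * y)) ≤ 1 / (t : ℝ) ^ k := by
    rw [Real.exp_neg, ← one_div]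
    apply one_div_le_one_div_of_le (by positivity)
    calc (t : ℝ) ^ k ≤ Real.exp (B' * y) ^ k := by gcongr
      _ = Real.exp (k * B' * y) := by rw [← Real.exp_nat_mul, mul_assoc]
  have hfin : ∀ A : ℝ, A ≤ 3 ^ d * C + 8 * C + 2 → 0 ≤ A →
      A * Real.exp (-(k * B' * y)) ≤ (3 ^ d * C + 8 * C + 2) / (t : ℝ) ^ k := by
    intro A hA hA0
    rw [div_eq_mul_one_div]
    gcongr
  have h3C : 0 < 3 ^ d * C := by positivity
  have hblL : apr P (bl ℓ κ (q ^ (12 * d) : ℕ)) ≤ ENNReal.ofReal (C * Real.exp (-(M * y))) := by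
    refine (hbl _ (by exact_mod_cast Nat.one_le_pow _ _ hq1)).trans (ENNReal.ofReal_le_ofReal ?_)
    have : (((q ^ (12 * d) : ℕ) : ℝ)) ^ (3 / 4 : ℝ) = (q : ℝ) ^ (9 * d) := by
      rw [Nat.cast_pow, ← Real.rpow_natCast, ← Real.rpow_mul (by positivity), ← Real.rpow_natCast]
      congr 1
      push_cast; ring
    rw [this]
    gcongr
  have hMy : M * y = k * B' * y + d * B' * y + 2 * B' * y := by rw [hM]; ring
  have hB'y : y ≤ B' * y := le_mul_of_one_le_left (by positivity) hB'1
  refine ⟨?_, ?_, ?_⟩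
  · set W : ℕ := (2 * q ^ (21 * d) + 1) ^ d with hW
    have hW0 : 0 < W := by positivity
    set j := t / W with hj
    have hcard := card_scale_lt hd e6
    have key := hG.an_stay_le hd' hη1 h2 hκ (R := q) (L := q ^ (12 * d)) (N := q ^ (12 * d + 1))
      (r := q ^ (8 * d)) (m := q ^ (8 * d + 1)) (by positivity) (Nat.one_le_pow _ _ hq1) hκq
      (Nat.le_self_pow (by omega) q) ?_ e2 hcard (V := q ^ (21 * d)) (j := j) (t := t)
      (Nat.mul_div_le t W)
    · refine key.trans ?_
      have hx : η ^ (6 * d ^ 2 * q ^ (8 * d)) = Real.exp (-(a * y)) := by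
        rw [← Real.exp_log (pow_pos hη _), Real.log_pow]
        congr 1
        rw [ha, hy, hD]; push_cast; ring
      rw [hx]
      have hexp1 : Real.exp (-(a * y)) ≤ 1 := Real.exp_le_one_iff.2 (by
        have : 0 ≤ a * y := by positivity
        linarith)
      have hxj : M * y ≤ Real.exp (-(a * y)) / 8 * j := by
        have hj1 : (t : ℝ) / W - 1 ≤ j := by
          have := Nat.lt_floor_add_one ((t : ℝ) / W)
          rw [Nat.floor_div_eq_div] at this
          linarith
        have h1 : Real.exp (B * y) / Real.exp y ≤ (t : ℝ) / W := by gcongr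
        rw [← Real.exp_sub] at h1
        have h2 : Real.exp (-(a * y)) * Real.exp (B * y - y) = Real.exp (2 * y) := by
          rw [← Real.exp_add]; congr 1; rw [hB]; ring
        have h3 := Real.quadratic_le_exp_of_nonneg (x := 2 * y) (by positivity)
        have h4 : Real.exp (-(a * y)) * (Real.exp (B * y - y) - 1) ≤ Real.exp (-(a * y)) * j := by
          gcongr; linarith
        nlinarith
      have hthird := one_sub_ofReal_pow_le (x := Real.exp (-(a * y)) / 8) (by positivity)
        (by linarith) j
      have hsnd : (2 / 3 : ℝ≥0∞) ^ q ^ (8 * d + 1) ≤ ENNReal.ofReal (Real.exp (-(M * y))) := by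
        have h1 : (2 / 3 : ℝ≥0∞) = 1 - ENNReal.ofReal (1 / 3) := by
          rw [← ENNReal.ofReal_one, ← ENNReal.ofReal_sub _ (by norm_num)]
          rw [← ENNReal.toReal_eq_toReal_iff' (by simp [ENNReal.div_eq_top]) (by simp)]
          norm_num
        rw [h1]
        refine (one_sub_ofReal_pow_le (by norm_num) (by norm_num) _).trans
          (ENNReal.ofReal_le_ofReal (Real.exp_le_exp.2 ?_))
        push_cast
        linarith
      calc (W : ℝ≥0∞) * ((2 / 3) ^ q ^ (8 * d + 1) + 8 * apr P (bl ℓ κ (q ^ (12 * d) : ℕ))) +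
            W * (1 - ENNReal.ofReal (Real.exp (-(a * y)) / 8)) ^ j
          ≤ W * (ENNReal.ofReal (Real.exp (-(M * y))) +
              (8 : ℕ) * ENNReal.ofReal (C * Real.exp (-(M * y)))) +
            W * ENNReal.ofReal (Real.exp (-(M * y))) := by
            gcongr
            · simp
            · exact hthird.trans (ENNReal.ofReal_le_ofReal (Real.exp_le_exp.2 (by linarith)))
        _ = ENNReal.ofReal (W * ((2 + 8 * C) * Real.exp (-(M * y)))) := by
            rw [natCast_mul_ofReal, ← ENNReal.ofReal_add (by positivity) (by positivity),
              natCast_mul_ofReal, natCast_mul_ofReal,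
              ← ENNReal.ofReal_add (by positivity) (by positivity)]
            congr 1; push_cast; ring
        _ ≤ ENNReal.ofReal ((3 ^ d * C + 8 * C + 2) / (t : ℝ) ^ k) := by
            apply ENNReal.ofReal_le_ofReal
            refine le_trans ?_ (hfin (2 + 8 * C) (by linarith) (by positivity))
            calc (W : ℝ) * ((2 + 8 * C) * Real.exp (-(M * y)))
                ≤ Real.exp y * ((2 + 8 * C) * Real.exp (-(M * y))) := by gcongr
              _ = (2 + 8 * C) * (Real.exp y * Real.exp (-(M * y))) := by ring
              _ ≤ (2 + 8 * C) * Real.exp (-(k * B' * y)) := by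
                  rw [← Real.exp_add]
                  gcongr
                  have : 0 ≤ d * B' * y := by positivity
                  linarith
    · push_cast
      calc (q : ℝ) ^ (12 * d) ≤ (κ * q) * (q : ℝ) ^ (12 * d) :=
            le_mul_of_one_le_left (by positivity) hκq
        _ = _ := by ring
  · calc ((2 * t + 1) ^ d : ℕ) * apr P (bl ℓ κ (q ^ (12 * d) : ℕ))
        ≤ ((2 * t + 1) ^ d : ℕ) * ENNReal.ofReal (C * Real.exp (-(M * y))) := by gcongr
      _ ≤ ENNReal.ofReal ((3 ^ d * C + 8 * C + 2) / (t : ℝ) ^ k) := by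
        rw [natCast_mul_ofReal]
        apply ENNReal.ofReal_le_ofReal
        refine le_trans ?_ (hfin (3 ^ d * C) (by linarith) (by positivity))
        have h1 : (((2 * t + 1) ^ d : ℕ) : ℝ) ≤ 3 ^ d * Real.exp (d * B' * y) := by
          calc (((2 * t + 1) ^ d : ℕ) : ℝ) = (2 * (t : ℝ) + 1) ^ d := by push_cast; ring
            _ ≤ (3 * (t : ℝ)) ^ d := by gcongr; linarith
            _ ≤ (3 * Real.exp (B' * y)) ^ d := by gcongr
            _ = _ := by rw [mul_pow, ← Real.exp_nat_mul, mul_assoc]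
        calc (((2 * t + 1) ^ d : ℕ) : ℝ) * (C * Real.exp (-(M * y)))
            ≤ 3 ^ d * Real.exp (d * B' * y) * (C * Real.exp (-(M * y))) := by gcongr
          _ = 3 ^ d * C * (Real.exp (d * B' * y) * Real.exp (-(M * y))) := by ring
          _ ≤ 3 ^ d * C * Real.exp (-(k * B' * y)) := by
              rw [← Real.exp_add]
              gcongr
              have : 0 ≤ B' * y := by positivity
              linarith
  · refine (one_sub_ofReal_pow_le hθ.le hθ1 _).trans (ENNReal.ofReal_le_ofReal ?_)
    refine le_trans ?_ (hfin 1 (by linarith) (by norm_num))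
    rw [one_mul]
    apply Real.exp_le_exp.2
    push_cast
    have : 0 ≤ B' * y := by positivity
    have : 0 ≤ d * B' * y := by positivity
    linarith

/-! ### Paths without cut times -/

/-- Paths reaching level at least `a`. -/
def up {d : ℕ} (ℓ : Fin d → ℝ) (a : ℝ) : Set (List (StepIdx d)) := {l | a ≤ dotR (disp l) ℓ}

/-- Paths ending at a level below `-a`. -/
def down {d : ℕ} (ℓ : Fin d → ℝ) (a : ℝ) : Set (List (StepIdx d)) := {l | dotR (disp l) ℓ < -a}

/-- The endpoint is a strict maximum of the level. -/
def Top {d : ℕ} (ℓ : Fin d → ℝ) (l : List (StepIdx d)) : Prop :=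
  ∀ k < l.length, dotR (disp (l.take k)) ℓ < dotR (disp l) ℓ

/-- The starting point is a minimum of the level. -/
def Pos {d : ℕ} (ℓ : Fin d → ℝ) (l : List (StepIdx d)) : Prop :=
  ∀ k ≤ l.length, 0 ≤ dotR (disp (l.take k)) ℓ

/-- Interior cut times. -/
def IsCut {d : ℕ} (ℓ : Fin d → ℝ) (l : List (StepIdx d)) (i : ℕ) : Prop :=
  0 < i ∧ i < l.length ∧ Top ℓ (l.take i) ∧ Pos ℓ (l.drop i)

/-- Paths without interior cut time. -/
def NoCut {d : ℕ} (ℓ : Fin d → ℝ) (l : List (StepIdx d)) : Prop := ∀ i, ¬ IsCut ℓ l i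

lemma disp_take_drop {d : ℕ} (l : List (StepIdx d)) (i k : ℕ) :
    disp ((l.drop i).take k) = disp (l.take (i + k)) - disp (l.take i) := by
  rw [List.take_drop, disp_drop_take l (by omega)]

lemma isCut_iff {d : ℕ} {ℓ : Fin d → ℝ} {l : List (StepIdx d)} {i : ℕ} :
    IsCut ℓ l i ↔ 0 < i ∧ i < l.length ∧
      (∀ k < i, dotR (disp (l.take k)) ℓ < dotR (disp (l.take i)) ℓ) ∧
      ∀ k, i ≤ k → k ≤ l.length → dotR (disp (l.take i)) ℓ ≤ dotR (disp (l.take k)) ℓ := by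
  unfold IsCut
  refine and_congr_right fun h0 => and_congr_right fun h1 => and_congr ?_ ?_
  · unfold Top
    rw [List.length_take, min_eq_left h1.le]
    refine forall₂_congr fun k hk => ?_
    rw [List.take_take, min_eq_left hk.le]
  · unfold Pos
    simp only [disp_take_drop, dotR_sub, List.length_drop, sub_nonneg]
    constructor
    · intro h k hik hk
      have := h (k - i) (by omega)
      rwa [show i + (k - i) = k by omega] at this
    · intro h k hk
      exact h _ (by omega) (by omega)

lemma apr_of_length {d : ℕ} {P : Measure (Env d)} {t : ℕ}
    {T : Set (List (StepIdx d))} (hT : ∀ l ∈ T, l.length = t) : apr P T = an P (ind T) := by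
  have : first T = T := by
    refine Set.Subset.antisymm (first_subset _) fun l hl => ⟨hl, fun k hk h => ?_⟩
    have h1 := hT _ h
    have h2 := hT _ hl
    rw [List.length_take] at h1
    omega
  rw [apr, this]

/-- Positive probability of never going below the starting level. -/
lemma Good.apr_down_zero_le {d : ℕ} {P : Measure (Env d)} {η : ℝ} (hG : Good P η)
    {ℓ : Fin d → ℝ} {e : StepIdx d} (he : 0 < dotR (stepVec e) ℓ) (k : ℕ) :
    apr P (down ℓ 0) + ENNReal.ofReal η ^ k ≤
      1 + ENNReal.ofReal η ^ k * apr P (down ℓ (k * dotR (stepVec e) ℓ)) := by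
  have := hG.prob
  set w : List (StepIdx d) := List.replicate k e with hw
  set a : ℝ := k * dotR (stepVec e) ℓ with ha
  have hdw : disp w = k • stepVec e := disp_replicate k e
  have hlw : w.length = k := by simp [hw]
  have hq : ∀ ω : Env d, pr ω 0 (down ℓ 0) + wt ω 0 w ≤
      1 + wt ω 0 w * pr ω (disp w) (down ℓ a) := by
    intro ω
    have h1 : qw ω 0 (fun l => ind (first (down ℓ 0)) l + ind {w} l) ≤
        qw ω 0 (fun l => 1 * ind {[]} l + ind (cat {w} fun _ => first (down ℓ a)) l) := by
      refine qw_compare ω 0 fun l => ?_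
      have hadd : ∀ F G : List (StepIdx d) → ℝ≥0∞, cnt (fun l => F l + G l) l = cnt F l + cnt G l :=
        fun F G => Finset.sum_add_distrib
      rw [hadd, hadd, cnt_ind_nil]
      have hw1 : cnt (ind {w}) l ≤ 1 := by
        have : first ({w} : Set (List (StepIdx d))) = {w} := by
          refine Set.Subset.antisymm (first_subset _) fun l hl => ⟨hl, fun j hj h => ?_⟩
          rw [Set.mem_singleton_iff] at hl h
          have := congrArg List.length (h.trans hl.symm)
          rw [List.length_take] at this
          omega
        rw [← this]
        exact cnt_first_le_one _ _
      have hd1 := cnt_first_le_one (down ℓ 0) l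
      by_cases h2 : ∃ i ≤ l.length, l.take i ∈ first (down ℓ 0)
      · by_cases h3 : ∃ j ≤ l.length, l.take j = w
        · obtain ⟨i, hi, hi'⟩ := h2
          obtain ⟨j, hj, hj'⟩ := h3
          have hjk : j = k := by
            have := congrArg List.length hj'
            rw [List.length_take, hlw] at this
            omega
          subst hjk
          have hij : j ≤ i := by
            by_contra! hlt
            have h4 := hi'.1
            have h5 : l.take i = List.replicate i e := by
              rw [show l.take i = (l.take j).take i by rw [List.take_take, min_eq_left hlt.le], hj',
                hw, List.take_replicate, min_eq_left hlt.le]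
            simp only [down, Set.mem_ofPred_eq] at h4
            rw [h5, disp_replicate, dotR_nsmul] at h4
            have : (0 : ℝ) ≤ i * dotR (stepVec e) ℓ := by positivity
            linarith
          have h6 : (l.drop j).take (i - j) ∈ down ℓ a := by
            have h4 := hi'.1
            simp only [down, Set.mem_ofPred_eq] at h4 ⊢
            rw [disp_take_drop, show j + (i - j) = i by omega, dotR_sub, hj', hdw, dotR_nsmul]
            linarith
          obtain ⟨m, hm, hm'⟩ := exists_take_mem_first h6
          have h7 : l.take (j + m) ∈ cat {w} fun _ => first (down ℓ a) := by
            refine ⟨j, by simp; omega, ?_, ?_⟩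
            · rw [List.take_take, min_eq_left (by omega), hj']; rfl
            · rwa [← List.take_drop]
          calc cnt (ind (first (down ℓ 0))) l + cnt (ind {w}) l ≤ 1 + 1 := add_le_add hd1 hw1
            _ ≤ _ := by
              gcongr
              exact (ind_of_mem h7).symm.le.trans (le_cnt _ (by omega))
        · have : cnt (ind {w}) l = 0 := by
            refine Finset.sum_eq_zero fun j hj => ind_of_notMem fun h => h3 ⟨j, ?_, h⟩
            rw [Finset.mem_range] at hj; omega
          rw [this, add_zero]
          exact hd1.trans le_self_add
      · have : cnt (ind (first (down ℓ 0))) l = 0 := by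
          refine Finset.sum_eq_zero fun j hj => ind_of_notMem fun h => h2 ⟨j, ?_, h⟩
          rw [Finset.mem_range] at hj; omega
        rw [this, zero_add]
        exact hw1.trans le_self_add
    rw [qw_add, qw_add, qw_ind_nil] at h1
    have h2 : qw ω 0 (ind {w}) = wt ω 0 w := by
      unfold qw
      rw [tsum_eq_single w]
      · simp
      · intro l hl; simp [hl]
    rw [h2] at h1
    refine h1.trans (add_le_add_right ((qs_cat_le ω 0 _ _).trans_eq ?_) _)
    rw [tsum_eq_single w]
    · simp [pr]
    · intro l hl; simp [hl]
  calc apr P (down ℓ 0) + ENNReal.ofReal η ^ k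
      = ∫⁻ ω, (pr ω 0 (down ℓ 0) + ENNReal.ofReal η ^ k) ∂P := by
        rw [lintegral_add_left (measurable_pr _ _), hG.lintegral_pr]; simp
    _ ≤ ∫⁻ ω, (1 + ENNReal.ofReal η ^ k * pr ω (disp w) (down ℓ a)) ∂P := by
        refine lintegral_mono_ae ?_
        filter_upwards [hG.ell] with ω hω
        have h1 : ENNReal.ofReal η ^ k ≤ wt ω 0 w := hlw ▸ pow_le_wt hω 0 w
        have h2 : wt ω 0 w ≤ 1 := wt_le_one _ _ _
        have h3 := pr_le_one ω (disp w) (down ℓ a)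
        have h4 := pr_le_one ω 0 (down ℓ 0)
        have h5 := hq ω
        obtain ⟨c, hc⟩ := exists_add_of_le h1
        have h6 : pr ω 0 (down ℓ 0) + ENNReal.ofReal η ^ k + c ≤
            1 + ENNReal.ofReal η ^ k * pr ω (disp w) (down ℓ a) + c := by
          calc pr ω 0 (down ℓ 0) + ENNReal.ofReal η ^ k + c
              = pr ω 0 (down ℓ 0) + wt ω 0 w := by rw [hc, add_assoc]
            _ ≤ 1 + wt ω 0 w * pr ω (disp w) (down ℓ a) := h5
            _ = 1 + ENNReal.ofReal η ^ k * pr ω (disp w) (down ℓ a) +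
                c * pr ω (disp w) (down ℓ a) := by rw [hc, add_mul, add_assoc]
            _ ≤ _ := by gcongr; exact mul_le_of_le_one_right' h3
        have hctop : c ≠ ⊤ := by
          rintro rfl
          simp only [add_top] at hc
          rw [hc] at h2
          simp at h2
        exact (ENNReal.add_le_add_iff_right hctop).1 h6
    _ = _ := by
        rw [lintegral_add_left measurable_const, lintegral_const_mul _ (measurable_pr _ _),
          hG.lintegral_pr]
        simp

lemma Good.exists_apr_down_le {d : ℕ} (hd : 0 < d) {P : Measure (Env d)} {η : ℝ} (hG : Good P η)
    {ℓ : Fin d → ℝ} (h2 : norm2R ℓ = 1) {γ κ : ℝ} (hγ : 0 < γ) (hc : Cone P ℓ γ κ) :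
    ∃ θ : ℝ, 0 < θ ∧ θ ≤ 1 ∧ apr P (down ℓ 0) ≤ 1 - ENNReal.ofReal θ := by
  have := hG.prob
  have hη := hG.pos
  have hη1 := hG.le_one hd
  have hℓ : ∀ i, |ℓ i| ≤ 1 := fun i => h2 ▸ abs_le_norm2R ℓ i
  obtain ⟨e, he⟩ := exists_step_pos h2
  obtain ⟨q, hq⟩ := (eventually_poly_mul_bl_le hγ hc 0).exists
  obtain ⟨k, hk⟩ := exists_nat_ge ((q : ℝ) / dotR (stepVec e) ℓ)
  rw [div_le_iff₀ he] at hk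
  have h1 : apr P (down ℓ (k * dotR (stepVec e) ℓ)) ≤ 1 / 4 := by
    refine le_trans ?_ hq
    refine (hG.apr_mono fun l hl => ?_).trans (le_mul_of_one_le_left' (a := apr P (bl ℓ κ q)) ?_)
    · simp only [down, bl, Set.mem_ofPred_eq] at hl ⊢
      have h3 := (abs_le.1 (abs_dotR_le hℓ (disp l))).1
      have h4 : 0 ≤ κ * nr (disp l) := mul_nonneg hc.1.le (nr_nonneg _)
      have h5 : (0 : ℝ) ≤ q := by positivity
      constructor <;> linarith
    · exact one_le_pow₀ (by simp)
  have h3 := hG.apr_down_zero_le he k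
  refine ⟨η ^ k / 2, by positivity, by linarith [pow_le_one₀ hη.le hη1 (n := k)], ?_⟩
  refine ENNReal.le_sub_of_add_le_right (by simp) ?_
  have h4 : ENNReal.ofReal η ^ k = ENNReal.ofReal (η ^ k / 2) + ENNReal.ofReal (η ^ k / 2) := by
    rw [← ENNReal.ofReal_add (by positivity) (by positivity), add_halves, ENNReal.ofReal_pow hη.le]
  have h5 : ENNReal.ofReal η ^ k * apr P (down ℓ (k * dotR (stepVec e) ℓ)) ≤
      ENNReal.ofReal (η ^ k / 2) := by
    calc _ ≤ ENNReal.ofReal η ^ k * (1 / 4) := by gcongr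
      _ ≤ ENNReal.ofReal η ^ k * (1 / 2) := by
        gcongr
        norm_num
      _ = _ := by
        rw [ENNReal.ofReal_div_of_pos (by norm_num), ENNReal.ofReal_pow hη.le, div_eq_mul_inv,
          div_eq_mul_inv, one_mul]
        simp
  have h6 := h3.trans (add_le_add_right h5 1)
  rw [h4, ← add_assoc] at h6
  exact (ENNReal.add_le_add_iff_right (by simp)).1 h6

lemma Good.an_cat_le {d : ℕ} {P : Measure (Env d)} {η : ℝ} (hG : Good P η)
    {T₁ T₂ : Set (List (StepIdx d))}
    (h : ∀ l₁ ∈ T₁, ∀ l₂ ∈ T₂, Disjoint (sites 0 l₁) (sites (disp l₁) l₂)) :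
    an P (ind (cat T₁ fun _ => T₂)) ≤ an P (ind T₁) * an P (ind T₂) := by
  calc an P (ind (cat T₁ fun _ => T₂))
      ≤ ∑' l : List (StepIdx d), ∑ i ∈ Finset.range (l.length + 1),
          (fun l₁ l₂ => aw P (l₁ ++ l₂) * (ind T₁ l₁ * ind T₂ l₂)) (l.take i) (l.drop i) := by
        refine ENNReal.tsum_le_tsum fun l => ?_
        simp only [List.take_append_drop, ← Finset.mul_sum]
        exact mul_le_mul_right (ind_cat_le T₁ (fun _ => T₂) l) _
    _ = ∑' l₁, ∑' l₂, aw P (l₁ ++ l₂) * (ind T₁ l₁ * ind T₂ l₂) :=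
        tsum_splits fun l₁ l₂ => aw P (l₁ ++ l₂) * (ind T₁ l₁ * ind T₂ l₂)
    _ = ∑' l₁, ∑' l₂, (aw P l₁ * ind T₁ l₁) * (aw P l₂ * ind T₂ l₂) := by
        refine tsum_congr fun l₁ => tsum_congr fun l₂ => ?_
        by_cases h₁ : l₁ ∈ T₁
        · by_cases h₂ : l₂ ∈ T₂
          · rw [hG.aw_append (h l₁ h₁ l₂ h₂)]; ring
          · simp [h₂]
        · simp [h₁]
    _ = _ := by
        simp only [ENNReal.tsum_mul_left, ENNReal.tsum_mul_right, an]

/-- Paths whose first `n` level blocks of height `b` (after the zeroth one) all backtrack. -/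
def fl {d : ℕ} (ℓ : Fin d → ℝ) (b : ℝ) : ℕ → Set (List (StepIdx d))
  | 0 => first (up ℓ b)
  | n + 1 => {l | l ∈ first (up ℓ ((n + 2) * b)) ∧
      ∃ k ≤ l.length, l.take k ∈ cat (fl ℓ b n) fun _ => first (down ℓ 0)}

lemma fl_subset {d : ℕ} (ℓ : Fin d → ℝ) (b : ℝ) (n : ℕ) : fl ℓ b n ⊆ first (up ℓ ((n + 1) * b)) := by
  cases n with
  | zero => simp [fl]
  | succ n =>
    intro l hl
    have := hl.1
    rw [show ((n + 1 : ℕ) : ℝ) + 1 = n + 2 by push_cast; ring]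
    exact this

lemma Good.an_fl_le {d : ℕ} {P : Measure (Env d)} {η : ℝ} (hG : Good P η) (ℓ : Fin d → ℝ) (b : ℝ)
    (n : ℕ) : an P (ind (fl ℓ b n)) ≤ apr P (down ℓ 0) ^ n := by
  induction n with
  | zero =>
    rw [pow_zero]
    exact hG.an_le_of_cnt_le fun l => cnt_first_le_one _ l
  | succ n ih =>
    have h1 : an P (ind (fl ℓ b (n + 1))) ≤
        an P (ind (cat (fl ℓ b n) fun _ => first (down ℓ 0))) := by
      refine hG.an_compare fun l => ?_
      by_cases h : ∃ j ≤ l.length, l.take j ∈ fl ℓ b (n + 1)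
      · obtain ⟨j, hj, -, k, hk, hk'⟩ := h
        rw [List.length_take, min_eq_left hj] at hk
        rw [List.take_take, min_eq_left hk] at hk'
        calc cnt (ind (fl ℓ b (n + 1))) l
            ≤ cnt (ind (first (up ℓ (((n + 1 : ℕ) + 1) * b)))) l :=
              Finset.sum_le_sum fun k _ => ind_mono fun h => fl_subset ℓ b (n + 1) h
          _ ≤ 1 := cnt_first_le_one _ l
          _ ≤ _ := (ind_of_mem hk').symm.le.trans (le_cnt _ (hk.trans hj))
      · have : cnt (ind (fl ℓ b (n + 1))) l = 0 := by
          refine Finset.sum_eq_zero fun j hj => ind_of_notMem fun h' => h ⟨j, ?_, h'⟩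
          rw [Finset.mem_range] at hj; omega
        rw [this]; exact zero_le
    refine h1.trans ((hG.an_cat_le fun l₁ h₁ l₂ h₂ => ?_).trans ?_)
    · rw [Set.disjoint_left]
      rintro y ⟨i, hi, rfl⟩ ⟨j, hj, hij⟩
      have h3 := fl_subset ℓ b n h₁
      have h4 := h3.1
      have h5 := h3.2 i hi
      have h6 := h₂.2 j hj
      simp only [up, down, Set.mem_ofPred_eq, neg_zero] at h4 h5 h6
      rw [zero_add] at hij
      rw [hij, dotR_add] at h5
      linarith
    · rw [pow_succ]
      exact mul_le_mul_left ih _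

lemma exists_take_mem_fl {d : ℕ} {ℓ : Fin d → ℝ} (hℓ : ∀ i, |ℓ i| ≤ 1) {κ L : ℝ} (hκ : 0 ≤ κ)
    (hL : 0 ≤ L) {l : List (StepIdx d)} (hreg : l ∈ reg ℓ κ L) (hcut : NoCut ℓ l) {n K : ℕ}
    (hK : K ≤ l.length) (hup : ((n : ℝ) + 1) * (L + 2) ≤ dotR (disp (l.take K)) ℓ) (m : ℕ)
    (hm : m ≤ n) : ∃ i ≤ l.length, l.take i ∈ fl ℓ (L + 2) m := by
  have hreach : ∀ m : ℕ, m ≤ n → ∃ j ≤ l.length, l.take j ∈ first (up ℓ (((m : ℝ) + 1) * (L + 2))) := by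
    intro m hm
    have h1 : l.take K ∈ up ℓ (((m : ℝ) + 1) * (L + 2)) := by
      simp only [up, Set.mem_ofPred_eq]
      refine le_trans ?_ hup
      have : (m : ℝ) ≤ n := by exact_mod_cast hm
      gcongr
    obtain ⟨j, hj, hj'⟩ := exists_take_mem_first h1
    exact ⟨j, hj.trans hK, hj'⟩
  induction m with
  | zero => simpa [fl] using hreach 0 (Nat.zero_le _)
  | succ m ih =>
    obtain ⟨i, hi, hi'⟩ := ih (by omega)
    obtain ⟨j, hj, hj'⟩ := hreach (m + 1) hm
    have hfi := fl_subset ℓ _ m hi'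
    have hle : ∀ k < i, dotR (disp (l.take k)) ℓ < (m + 1) * (L + 2) := by
      intro k hk
      have := hfi.2 k (by simp; omega)
      rw [List.take_take, min_eq_left hk.le] at this
      simpa [up] using this
    have hge : (m + 1) * (L + 2) ≤ dotR (disp (l.take i)) ℓ := hfi.1
    have hi0 : 0 < i := by
      rcases Nat.eq_zero_or_pos i with h | h
      · subst h
        simp only [List.take_zero, disp_nil, dotR_zero] at hge
        have : (0 : ℝ) < (m + 1) * (L + 2) := by positivity
        linarith
      · exact h
    have hlei : dotR (disp (l.take i)) ℓ ≤ (m + 1) * (L + 2) + 1 := by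
      obtain ⟨i', rfl⟩ : ∃ i', i = i' + 1 := ⟨i - 1, by omega⟩
      have h1 := hle i' (by omega)
      rw [List.take_succ_eq_append_getElem (by omega), disp_append, dotR_add]
      have h2 := (abs_le.1 (abs_dotR_le hℓ (disp [l[i']]))).2
      have h3 : nr (disp [l[i']]) ≤ 1 := by simpa using nr_disp_le [l[i']]
      linarith
    have hgej : ((m : ℝ) + 2) * (L + 2) ≤ dotR (disp (l.take j)) ℓ := by
      have := hj'.1
      simp only [up, Set.mem_ofPred_eq] at this
      push_cast at this
      linarith
    have hij : i < j := by
      by_contra! h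
      rcases h.lt_or_eq with h | h
      · have := hle j h
        nlinarith
      · subst h
        nlinarith
    have hnot := hcut i
    rw [isCut_iff] at hnot
    push Not at hnot
    obtain ⟨k, hik, hk, hlt⟩ := hnot hi0 (by omega) (fun k hk => (hle k hk).trans_le hge)
    have hkj : k < j := by
      by_contra! h
      have h3 := (abs_le.1 (abs_dotR_le hℓ (disp (l.take k) - disp (l.take j)))).1
      have h4 := nr_nonneg (disp (l.take k) - disp (l.take j))
      rw [dotR_sub] at h3
      rcases reg_piece hreg h hk with h1 | h1
      · nlinarith
      · rw [dotR_sub] at h1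
        have := mul_nonneg hκ h4
        nlinarith
    have h6 : (l.drop i).take (k - i) ∈ down ℓ 0 := by
      simp only [down, Set.mem_ofPred_eq]
      rw [disp_take_drop, show i + (k - i) = k by omega, dotR_sub]
      linarith
    obtain ⟨r, hr, hr'⟩ := exists_take_mem_first h6
    refine ⟨j, hj, ?_, i + r, by simp; omega, i, by simp; omega, ?_, ?_⟩
    · have : ((m + 1 : ℕ) : ℝ) + 1 = m + 2 := by push_cast; ring
      rwa [this] at hj'
    · rwa [List.take_take, List.take_take, min_eq_left (by omega), min_eq_left (by omega)]
    · change List.drop i ((l.take j).take (i + r)) ∈ first (down ℓ 0)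
      rwa [List.take_take, min_eq_left (by omega), ← List.take_drop]

lemma Good.an_length_le_one {d : ℕ} {P : Measure (Env d)} {η : ℝ} (hG : Good P η) {t : ℕ}
    {T : Set (List (StepIdx d))} (hT : ∀ l ∈ T, l.length = t) : an P (ind T) ≤ 1 := by
  rw [← apr_of_length hT]
  exact hG.apr_le_one T

lemma Good.an_noCut_le {d : ℕ} {P : Measure (Env d)} {η : ℝ} (hG : Good P η)
    {ℓ : Fin d → ℝ} (hℓ : ∀ i, |ℓ i| ≤ 1) {κ : ℝ} (hκ : 0 < κ) {L V n : ℕ} (hLV : L ≤ V)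
    (hn : ((n : ℝ) + 1) * (L + 2) ≤ κ * V) (t : ℕ) :
    an P (ind {l | l.length = t ∧ NoCut ℓ l}) ≤
      an P (ind (stay (box d V : Set (Site d)) 0 t)) +
      ((2 * t + 1) ^ d : ℕ) * apr P (bl ℓ κ L) + apr P (down ℓ 0) ^ n := by
  set T₂ : Set (List (StepIdx d)) := {l | l.length = t ∧ l ∉ reg ℓ κ L} with hT₂
  have h2 : apr P T₂ ≤ ((2 * t + 1) ^ d : ℕ) * apr P (bl ℓ κ L) := by
    rw [← card_box]
    refine hG.apr_le_card_mul (box d t) (fun _ => bl ℓ κ L) _ (fun _ _ => le_rfl) ?_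
    rintro l ⟨hl, hreg⟩
    simp only [reg, viol, Set.mem_ofPred_eq, not_forall, not_not] at hreg
    obtain ⟨k, hk, i, hi, hbl⟩ := hreg
    rw [List.length_take, min_eq_left hk] at hi
    have hhit : l.take i ∈ hit {disp (l.take i)} := rfl
    obtain ⟨j, hj, hj'⟩ := exists_take_mem_first hhit
    refine ⟨disp (l.take i), mem_box_of_nr_le ((nr_disp_le _).trans ?_), j, k, by omega, hk, hj', ?_⟩
    · rw [← hl]
      exact_mod_cast (List.length_take_le' _ _)
    · have h3 : disp (l.take j) = disp (l.take i) := hj'.1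
      simp only [bl, Set.mem_ofPred_eq] at hbl ⊢
      rwa [disp_drop_take l (by omega), h3, ← disp_drop_take l hi]
  calc an P (ind {l | l.length = t ∧ NoCut ℓ l})
      = apr P {l | l.length = t ∧ NoCut ℓ l} := (apr_of_length fun l hl => hl.1).symm
    _ ≤ apr P (stay (box d V : Set (Site d)) 0 t ∪ T₂) + apr P (fl ℓ (L + 2) n) := by
        refine hG.apr_union_le fun l hl => ?_
        by_cases hst : l ∈ stay (box d V : Set (Site d)) 0 t
        · exact Or.inl ⟨l.length, le_rfl, by rw [List.take_length]; exact Or.inl hst⟩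
        by_cases hreg : l ∈ reg ℓ κ L
        · right
          simp only [stay, Set.mem_ofPred_eq, hl.1, true_and, not_forall] at hst
          obtain ⟨K, hK, hout⟩ := hst
          rw [zero_add, Finset.mem_coe] at hout
          have hnr : (V : ℝ) < nr (disp (l.take K)) := by
            by_contra! h
            exact hout (mem_box_of_nr_le h)
          rcases reg_piece hreg (Nat.zero_le K) (by rw [hl.1]; exact hK) with h | h
          · simp only [List.take_zero, disp_nil, sub_zero] at h
            have : (L : ℝ) ≤ V := by exact_mod_cast hLV
            linarith
          · simp only [List.take_zero, disp_nil, sub_zero] at h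
            refine exists_take_mem_fl hℓ hκ.le (by positivity) hreg hl.2 (K := K)
              (by rw [hl.1]; exact hK) (hn.trans ?_) n le_rfl
            refine le_trans ?_ h
            gcongr
        · exact Or.inl ⟨l.length, le_rfl, by rw [List.take_length]; exact Or.inr ⟨hl.1, hreg⟩⟩
    _ ≤ apr P (stay (box d V : Set (Site d)) 0 t) + apr P T₂ + apr P (down ℓ 0) ^ n := by
        gcongr
        · refine hG.apr_union_le fun l hl => ?_
          rcases hl with hl | hl
          · exact Or.inl ⟨l.length, le_rfl, by rwa [List.take_length]⟩
          · exact Or.inr ⟨l.length, le_rfl, by rwa [List.take_length]⟩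
        · refine le_trans ?_ (hG.an_fl_le ℓ (L + 2) n)
          exact ENNReal.tsum_le_tsum fun l =>
            mul_le_mul_right (ind_mono fun h => first_subset _ h) _
    _ ≤ _ := by
        rw [apr_of_length (T := stay (box d V : Set (Site d)) 0 t) (t := t) fun l hl => hl.1]
        gcongr

/-- The probability of having no cut time decays faster than any polynomial. -/
theorem Good.exists_noCut_le {d : ℕ} (hd : 4 ≤ d) {P : Measure (Env d)} {η : ℝ} (hG : Good P η)
    {ℓ : Fin d → ℝ} (h2 : norm2R ℓ = 1) {κ : ℝ} (hcone : Cone P ℓ (3 / 4) κ) (k : ℕ) :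
    ∃ C : ℝ, 0 < C ∧ ∀ t : ℕ, 1 ≤ t →
      an P (ind {l | l.length = t ∧ NoCut ℓ l}) ≤ ENNReal.ofReal (C / (t : ℝ) ^ k) := by
  have hℓ : ∀ i, |ℓ i| ≤ 1 := fun i => h2 ▸ abs_le_norm2R ℓ i
  obtain ⟨θ, hθ, hθ1, hdown⟩ := hG.exists_apr_down_le (by omega) h2 (by norm_num) hcone
  have hκ := hcone.1
  obtain ⟨q₁, hq₁⟩ := exists_nat_ge (6 / κ)
  obtain ⟨C, hC, t₀, ht₀, h⟩ := hG.exists_scales hd h2 hcone k (max q₁ 1) hθ hθ1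
  refine ⟨3 * C + (t₀ : ℝ) ^ k, by positivity, fun t ht => ?_⟩
  have ht' : (0 : ℝ) < t := by exact_mod_cast ht
  rcases lt_or_ge t t₀ with hlt | hge
  · refine (hG.an_length_le_one (t := t) fun l hl => hl.1).trans ?_
    rw [← ENNReal.ofReal_one]
    apply ENNReal.ofReal_le_ofReal
    rw [le_div_iff₀ (by positivity), one_mul]
    have : (t : ℝ) ≤ t₀ := by exact_mod_cast hlt.le
    have : (t : ℝ) ^ k ≤ (t₀ : ℝ) ^ k := by gcongr
    linarith
  · obtain ⟨q, hq, e1, e2, e3⟩ := h t hge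
    have hq1 : 1 ≤ q := (le_max_right _ _).trans hq
    have hq1' : (1 : ℝ) ≤ q := by exact_mod_cast hq1
    have h6 : 6 ≤ κ * q := by
      have h7 : 6 / κ ≤ q := hq₁.trans (by exact_mod_cast (le_max_left _ _).trans hq)
      rwa [div_le_iff₀ hκ, mul_comm] at h7
    refine (hG.an_noCut_le hℓ hκ (L := q ^ (12 * d)) (V := q ^ (21 * d)) (n := q ^ (8 * d + 1))
      (Nat.pow_le_pow_right hq1 (by omega)) ?_ t).trans ?_
    · push_cast
      have a1 : (1 : ℝ) ≤ (q : ℝ) ^ (8 * d + 1) := one_le_pow₀ hq1'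
      have a2 : (1 : ℝ) ≤ (q : ℝ) ^ (12 * d) := one_le_pow₀ hq1'
      calc ((q : ℝ) ^ (8 * d + 1) + 1) * ((q : ℝ) ^ (12 * d) + 2)
          ≤ (2 * (q : ℝ) ^ (8 * d + 1)) * (3 * (q : ℝ) ^ (12 * d)) := by
            gcongr <;> linarith
        _ = 6 * (q : ℝ) ^ (20 * d + 1) := by ring
        _ ≤ κ * q * (q : ℝ) ^ (20 * d + 1) := by gcongr
        _ = κ * (q : ℝ) ^ (20 * d + 2) := by ring
        _ ≤ κ * (q : ℝ) ^ (21 * d) := by gcongr; omega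
    · calc _ ≤ ENNReal.ofReal (C / (t : ℝ) ^ k) + ENNReal.ofReal (C / (t : ℝ) ^ k) +
            ENNReal.ofReal (C / (t : ℝ) ^ k) := by
            gcongr
            exact (pow_le_pow_left' hdown _).trans e3
        _ = ENNReal.ofReal (3 * C / (t : ℝ) ^ k) := by
            rw [← ENNReal.ofReal_add (by positivity) (by positivity),
              ← ENNReal.ofReal_add (by positivity) (by positivity)]
            congr 1; ring
        _ ≤ _ := by
            apply ENNReal.ofReal_le_ofReal
            gcongr
            have : (0 : ℝ) < (t₀ : ℝ) ^ k := by positivity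
            linarith

/-- The `ℓ¹` norm of an element of the group algebra. -/
def n1 {G : Type*} (a : AddMonoidAlgebra ℝ G) : ℝ := a.coeff.sum fun _ r => |r|

lemma n1_eq_sum {G : Type*} (a : AddMonoidAlgebra ℝ G) {s : Finset G} (h : a.coeff.support ⊆ s) :
    n1 a = ∑ x ∈ s, |a.coeff x| :=
  Finsupp.sum_of_support_subset _ h _ (by simp)

lemma n1_nonneg {G : Type*} (a : AddMonoidAlgebra ℝ G) : 0 ≤ n1 a :=
  Finset.sum_nonneg fun _ _ => abs_nonneg _

lemma sum_abs_le_n1 {G : Type*} (a : AddMonoidAlgebra ℝ G) (s : Finset G) :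
    ∑ x ∈ s, |a.coeff x| ≤ n1 a := by
  classical
  rw [n1_eq_sum a (Finset.subset_union_right (s₁ := s))]
  exact Finset.sum_le_sum_of_subset_of_nonneg Finset.subset_union_left fun _ _ _ => abs_nonneg _

@[simp] lemma n1_zero {G : Type*} : n1 (0 : AddMonoidAlgebra ℝ G) = 0 := by simp [n1]

lemma n1_add_le {G : Type*} (a b : AddMonoidAlgebra ℝ G) : n1 (a + b) ≤ n1 a + n1 b := by
  classical
  set s := (a + b).coeff.support ∪ (a.coeff.support ∪ b.coeff.support) with hs
  rw [n1_eq_sum (a + b) (s := s) (by rw [hs]; exact Finset.subset_union_left),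
    n1_eq_sum a (s := s) (by
      rw [hs]; exact Finset.subset_union_left.trans Finset.subset_union_right),
    n1_eq_sum b (s := s) (by
      rw [hs]; exact Finset.subset_union_right.trans Finset.subset_union_right),
    ← Finset.sum_add_distrib]
  refine Finset.sum_le_sum fun x _ => ?_
  rw [AddMonoidAlgebra.coeff_add, Finsupp.add_apply]
  exact abs_add_le _ _

@[simp] lemma n1_neg {G : Type*} (a : AddMonoidAlgebra ℝ G) : n1 (-a) = n1 a := by
  classical
  set s := (-a).coeff.support ∪ a.coeff.support with hs
  rw [n1_eq_sum (-a) (s := s) (by rw [hs]; exact Finset.subset_union_left),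
    n1_eq_sum a (s := s) (by rw [hs]; exact Finset.subset_union_right)]
  simp

lemma n1_sum_le {G ι : Type*} (s : Finset ι) (f : ι → AddMonoidAlgebra ℝ G) :
    n1 (∑ i ∈ s, f i) ≤ ∑ i ∈ s, n1 (f i) := by
  classical
  induction s using Finset.induction_on with
  | empty => simp
  | insert i s hi ih =>
    rw [Finset.sum_insert hi, Finset.sum_insert hi]
    exact (n1_add_le _ _).trans (by linarith)

@[simp] lemma n1_single {G : Type*} (x : G) (r : ℝ) :
    n1 (AddMonoidAlgebra.single x r) = |r| := by
  simp [n1]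

lemma eq_sum_single {G : Type*} (a : AddMonoidAlgebra ℝ G) :
    a = ∑ x ∈ a.coeff.support, AddMonoidAlgebra.single x (a.coeff x) :=
  (AddMonoidAlgebra.sum_coeff_single a).symm

lemma n1_mul_le {G : Type*} [AddCommMonoid G] (a b : AddMonoidAlgebra ℝ G) :
    n1 (a * b) ≤ n1 a * n1 b := by
  conv_lhs => rw [eq_sum_single a, eq_sum_single b, Finset.sum_mul_sum]
  refine (n1_sum_le _ _).trans ?_
  rw [n1, n1, Finsupp.sum, Finsupp.sum, Finset.sum_mul_sum]
  refine Finset.sum_le_sum fun x _ => (n1_sum_le _ _).trans (Finset.sum_le_sum fun y _ => ?_)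
  rw [AddMonoidAlgebra.single_mul_single, n1_single, abs_mul]

/-- Truncated weighted `ℓ¹` norm of a power series over the group algebra. -/
def wnm {G : Type*} [AddCommGroup G] (w : ℕ → ℝ) (n : ℕ)
    (φ : PowerSeries (AddMonoidAlgebra ℝ G)) : ℝ :=
  ∑ t ∈ Finset.range (n + 1), w t * n1 (PowerSeries.coeff t φ)

/-- Truncated `ℓ¹` norm of a power series over the group algebra. -/
def nn {G : Type*} [AddCommGroup G] (n : ℕ) (φ : PowerSeries (AddMonoidAlgebra ℝ G)) : ℝ :=
  wnm (fun _ => 1) n φ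

section
variable {G : Type*} [AddCommGroup G]

lemma nn_eq (n : ℕ) (φ : PowerSeries (AddMonoidAlgebra ℝ G)) :
    nn n φ = ∑ t ∈ Finset.range (n + 1), n1 (PowerSeries.coeff t φ) := by
  simp [nn, wnm]

lemma wnm_nonneg {w : ℕ → ℝ} (hw : ∀ t, 0 ≤ w t) (n : ℕ) (φ : PowerSeries (AddMonoidAlgebra ℝ G)) :
    0 ≤ wnm w n φ :=
  Finset.sum_nonneg fun t _ => mul_nonneg (hw t) (n1_nonneg _)

lemma wnm_mono {w : ℕ → ℝ} (hw : ∀ t, 0 ≤ w t) {m n : ℕ} (h : m ≤ n)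
    (φ : PowerSeries (AddMonoidAlgebra ℝ G)) : wnm w m φ ≤ wnm w n φ :=
  Finset.sum_le_sum_of_subset_of_nonneg (Finset.range_mono (by omega))
    fun t _ _ => mul_nonneg (hw t) (n1_nonneg _)

lemma wnm_add_le {w : ℕ → ℝ} (hw : ∀ t, 0 ≤ w t) (n : ℕ)
    (φ ψ : PowerSeries (AddMonoidAlgebra ℝ G)) : wnm w n (φ + ψ) ≤ wnm w n φ + wnm w n ψ := by
  rw [wnm, wnm, wnm, ← Finset.sum_add_distrib]
  refine Finset.sum_le_sum fun t _ => ?_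
  rw [← mul_add, map_add]
  exact mul_le_mul_of_nonneg_left (n1_add_le _ _) (hw t)

lemma wnm_neg (w : ℕ → ℝ) (n : ℕ) (φ : PowerSeries (AddMonoidAlgebra ℝ G)) :
    wnm w n (-φ) = wnm w n φ := by
  simp [wnm]

lemma wnm_sum_le {w : ℕ → ℝ} (hw : ∀ t, 0 ≤ w t) (n : ℕ) {ι : Type*} (s : Finset ι)
    (φ : ι → PowerSeries (AddMonoidAlgebra ℝ G)) :
    wnm w n (∑ i ∈ s, φ i) ≤ ∑ i ∈ s, wnm w n (φ i) := by
  classical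
  induction s using Finset.induction_on with
  | empty => simp [wnm]
  | insert i s hi ih =>
    rw [Finset.sum_insert hi, Finset.sum_insert hi]
    exact (wnm_add_le hw _ _ _).trans (by linarith)

lemma sum_antidiagonal_le_sum_product {n : ℕ} {F : ℕ × ℕ → ℝ} (hF : ∀ p, 0 ≤ F p) :
    ∑ t ∈ Finset.range (n + 1), ∑ p ∈ Finset.HasAntidiagonal.antidiagonal t, F p ≤
      ∑ p ∈ Finset.range (n + 1) ×ˢ Finset.range (n + 1), F p := by
  rw [← Finset.sum_biUnion]
  · refine Finset.sum_le_sum_of_subset_of_nonneg (fun p hp => ?_) fun p _ _ => hF p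
    simp only [Finset.mem_biUnion, Finset.mem_range, Finset.HasAntidiagonal.mem_antidiagonal,
      Finset.mem_product] at hp ⊢
    obtain ⟨t, ht, h⟩ := hp
    omega
  · intro s _ t _ hst
    rw [Function.onFun, Finset.disjoint_left]
    intro p hp hq
    rw [Finset.HasAntidiagonal.mem_antidiagonal] at hp hq
    exact hst (hp.symm.trans hq)

lemma wnm_mul_le {w : ℕ → ℝ} (hw : ∀ t, 0 ≤ w t) (hw' : ∀ s t, w (s + t) ≤ w s * w t) (n : ℕ)
    (φ ψ : PowerSeries (AddMonoidAlgebra ℝ G)) : wnm w n (φ * ψ) ≤ wnm w n φ * wnm w n ψ := by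
  have hF : ∀ p : ℕ × ℕ, 0 ≤ w p.1 * n1 (PowerSeries.coeff p.1 φ) *
      (w p.2 * n1 (PowerSeries.coeff p.2 ψ)) := fun p =>
    mul_nonneg (mul_nonneg (hw _) (n1_nonneg _)) (mul_nonneg (hw _) (n1_nonneg _))
  refine le_trans ?_ ((sum_antidiagonal_le_sum_product (n := n) hF).trans ?_)
  · rw [wnm]
    refine Finset.sum_le_sum fun t _ => ?_
    rw [PowerSeries.coeff_mul]
    refine (mul_le_mul_of_nonneg_left (n1_sum_le _ _) (hw t)).trans ?_
    rw [Finset.mul_sum]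
    refine Finset.sum_le_sum fun p hp => ?_
    rw [Finset.HasAntidiagonal.mem_antidiagonal] at hp
    rw [← hp]
    calc w (p.1 + p.2) * n1 (PowerSeries.coeff p.1 φ * PowerSeries.coeff p.2 ψ)
        ≤ (w p.1 * w p.2) * (n1 (PowerSeries.coeff p.1 φ) * n1 (PowerSeries.coeff p.2 ψ)) :=
          mul_le_mul (hw' _ _) (n1_mul_le _ _) (n1_nonneg _) (mul_nonneg (hw _) (hw _))
      _ = _ := by ring
  · rw [wnm, wnm, Finset.sum_product, Finset.sum_mul_sum]

lemma nn_nonneg (n : ℕ) (φ : PowerSeries (AddMonoidAlgebra ℝ G)) : 0 ≤ nn n φ :=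
  wnm_nonneg (fun _ => zero_le_one) n φ

lemma nn_mono {m n : ℕ} (h : m ≤ n) (φ : PowerSeries (AddMonoidAlgebra ℝ G)) :
    nn m φ ≤ nn n φ := wnm_mono (fun _ => zero_le_one) h φ

lemma nn_add_le (n : ℕ) (φ ψ : PowerSeries (AddMonoidAlgebra ℝ G)) :
    nn n (φ + ψ) ≤ nn n φ + nn n ψ := wnm_add_le (fun _ => zero_le_one) n φ ψ

lemma nn_neg (n : ℕ) (φ : PowerSeries (AddMonoidAlgebra ℝ G)) : nn n (-φ) = nn n φ :=
  wnm_neg _ n φ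

lemma nn_sub_le (n : ℕ) (φ ψ : PowerSeries (AddMonoidAlgebra ℝ G)) :
    nn n (φ - ψ) ≤ nn n φ + nn n ψ := by
  rw [sub_eq_add_neg, ← nn_neg n ψ]
  exact nn_add_le _ _ _

lemma nn_mul_le (n : ℕ) (φ ψ : PowerSeries (AddMonoidAlgebra ℝ G)) :
    nn n (φ * ψ) ≤ nn n φ * nn n ψ :=
  wnm_mul_le (fun _ => zero_le_one) (fun _ _ => by norm_num) n φ ψ

lemma nn_sum_le (n : ℕ) {ι : Type*} (s : Finset ι) (φ : ι → PowerSeries (AddMonoidAlgebra ℝ G)) :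
    nn n (∑ i ∈ s, φ i) ≤ ∑ i ∈ s, nn n (φ i) := wnm_sum_le (fun _ => zero_le_one) n s φ

/-- Monomials `r · δ_x · X^t`. -/
def mon (x : G) (t : ℕ) (r : ℝ) : PowerSeries (AddMonoidAlgebra ℝ G) :=
  PowerSeries.monomial t (AddMonoidAlgebra.single x r)

lemma mon_mul_mon (x y : G) (s t : ℕ) (r q : ℝ) :
    mon x s r * mon y t q = mon (x + y) (s + t) (r * q) := by
  rw [mon, mon, mon, PowerSeries.monomial_mul_monomial, AddMonoidAlgebra.single_mul_single]

lemma one_eq_mon : (1 : PowerSeries (AddMonoidAlgebra ℝ G)) = mon 0 0 1 := by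
  rw [mon, ← AddMonoidAlgebra.one_def, PowerSeries.monomial_zero_eq_C_apply, map_one]

lemma mon_pow (x : G) (t k : ℕ) (r : ℝ) : mon x t r ^ k = mon (k • x) (k * t) (r ^ k) := by
  induction k with
  | zero => simp [one_eq_mon]
  | succ k ih => rw [pow_succ, ih, mon_mul_mon, succ_nsmul, Nat.succ_mul, pow_succ]

lemma coeff_mon (x : G) (t m : ℕ) (r : ℝ) : PowerSeries.coeff m (mon x t r) =
    if m = t then AddMonoidAlgebra.single x r else 0 := by
  rw [mon, PowerSeries.coeff_monomial]

lemma wnm_mon_le {w : ℕ → ℝ} (hw : ∀ t, 0 ≤ w t) (n : ℕ) (x : G) (t : ℕ) (r : ℝ) :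
    wnm w n (mon x t r) ≤ w t * |r| := by
  rw [wnm]
  calc ∑ m ∈ Finset.range (n + 1), w m * n1 (PowerSeries.coeff m (mon x t r))
      = ∑ m ∈ Finset.range (n + 1), if m = t then w t * |r| else 0 := by
        refine Finset.sum_congr rfl fun m _ => ?_
        rw [coeff_mon]
        split_ifs with h <;> simp [h]
    _ ≤ _ := by
        rw [Finset.sum_ite_eq']
        split_ifs
        · exact le_rfl
        · exact mul_nonneg (hw t) (abs_nonneg r)

lemma nn_mon_le (n : ℕ) (x : G) (t : ℕ) (r : ℝ) : nn n (mon x t r) ≤ |r| := by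
  simpa [nn] using wnm_mon_le (fun _ => zero_le_one) n x t r

lemma nn_one_le (n : ℕ) : nn n (1 : PowerSeries (AddMonoidAlgebra ℝ G)) ≤ 1 := by
  rw [one_eq_mon]
  simpa using nn_mon_le n (0 : G) 0 1

/-- Dividing by a monomial of weight one costs only a shift of the truncation. -/
lemma nn_le_nn_mon_mul (n : ℕ) (x : G) (t : ℕ) (φ : PowerSeries (AddMonoidAlgebra ℝ G)) :
    nn n φ ≤ nn (n + t) (mon x t 1 * φ) := by
  have key : ∀ m, n1 (PowerSeries.coeff m φ) ≤ n1 (PowerSeries.coeff (m + t) (mon x t 1 * φ)) := by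
    intro m
    have h1 : mon x t 1 * φ = PowerSeries.C (AddMonoidAlgebra.single x 1) *
        (PowerSeries.X ^ t * φ) := by
      rw [← mul_assoc, mon]
      congr 1
      ext1 k
      rw [PowerSeries.coeff_monomial, PowerSeries.coeff_C_mul, PowerSeries.coeff_X_pow]
      split_ifs <;> simp
    have h2 : PowerSeries.coeff m φ = AddMonoidAlgebra.single (-x) 1 *
        PowerSeries.coeff (m + t) (mon x t 1 * φ) := by
      rw [h1, PowerSeries.coeff_C_mul, PowerSeries.coeff_X_pow_mul, ← mul_assoc,
        AddMonoidAlgebra.single_mul_single]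
      simp [← AddMonoidAlgebra.one_def]
    calc n1 (PowerSeries.coeff m φ) ≤ n1 (AddMonoidAlgebra.single (-x) (1 : ℝ)) *
        n1 (PowerSeries.coeff (m + t) (mon x t 1 * φ)) := by
          conv_lhs => rw [h2]
          exact n1_mul_le _ _
      _ = _ := by simp
  rw [nn_eq, nn_eq]
  calc ∑ m ∈ Finset.range (n + 1), n1 (PowerSeries.coeff m φ)
      ≤ ∑ m ∈ Finset.range (n + 1), n1 (PowerSeries.coeff (m + t) (mon x t 1 * φ)) :=
        Finset.sum_le_sum fun m _ => key m
    _ = ∑ m ∈ (Finset.range (n + 1)).map (addRightEmbedding t),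
          n1 (PowerSeries.coeff m (mon x t 1 * φ)) := by
        rw [Finset.sum_map]; rfl
    _ ≤ _ := by
        refine Finset.sum_le_sum_of_subset_of_nonneg (fun m hm => ?_) fun m _ _ => n1_nonneg _
        simp only [Finset.mem_map, Finset.mem_range, addRightEmbedding_apply] at hm ⊢
        obtain ⟨k, hk, rfl⟩ := hm
        omega

lemma n1_coeff_mul_le {n : ℕ} {φ ψ : PowerSeries (AddMonoidAlgebra ℝ G)} {M : ℝ}
    (h : ∀ s ≤ n, n1 (PowerSeries.coeff s ψ) ≤ M) :
    n1 (PowerSeries.coeff n (φ * ψ)) ≤ nn n φ * M := by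
  rw [PowerSeries.coeff_mul, Finset.Nat.sum_antidiagonal_eq_sum_range_succ_mk, nn_eq,
    Finset.sum_mul]
  refine (n1_sum_le _ _).trans (Finset.sum_le_sum fun t _ => (n1_mul_le _ _).trans ?_)
  exact mul_le_mul_of_nonneg_left (h _ (Nat.sub_le _ _)) (n1_nonneg _)

lemma mul_n1_coeff_le_wnm {w : ℕ → ℝ} (hw : ∀ t, 0 ≤ w t) (n : ℕ)
    (φ : PowerSeries (AddMonoidAlgebra ℝ G)) : w n * n1 (PowerSeries.coeff n φ) ≤ wnm w n φ :=
  Finset.single_le_sum (f := fun t => w t * n1 (PowerSeries.coeff t φ))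
    (fun t _ => mul_nonneg (hw t) (n1_nonneg _)) (Finset.self_mem_range_succ n)

end

/-- The finite set of step sequences of length `n`. -/
def words (d n : ℕ) : Finset (List (StepIdx d)) := (List.finite_length_eq (StepIdx d) n).toFinset

@[simp] lemma mem_words {d n : ℕ} {l : List (StepIdx d)} : l ∈ words d n ↔ l.length = n := by
  simp [words]

/-- The generating series of a weighted family of step sequences: `X` marks the length and the
group algebra marks the displacement. -/
def gs {d : ℕ} (w : List (StepIdx d) → ℝ) : PowerSeries (AddMonoidAlgebra ℝ (Site d)) :=
  PowerSeries.mk fun n => ∑ l ∈ words d n, AddMonoidAlgebra.single (disp l) (w l)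

/-- Convolution of weights with respect to concatenation. -/
def conv {d : ℕ} (w v : List (StepIdx d) → ℝ) (l : List (StepIdx d)) : ℝ :=
  ∑ i ∈ Finset.range (l.length + 1), w (l.take i) * v (l.drop i)

section
variable {d : ℕ}

lemma coeff_gs (w : List (StepIdx d) → ℝ) (n : ℕ) : PowerSeries.coeff n (gs w) =
    ∑ l ∈ words d n, AddMonoidAlgebra.single (disp l) (w l) := by
  rw [gs, PowerSeries.coeff_mk]

lemma gs_add (w v : List (StepIdx d) → ℝ) : gs (fun l => w l + v l) = gs w + gs v := by
  ext1 n
  rw [map_add, coeff_gs, coeff_gs, coeff_gs, ← Finset.sum_add_distrib]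
  exact Finset.sum_congr rfl fun l _ => AddMonoidAlgebra.single_add _ _ _

lemma gs_single (l : List (StepIdx d)) (r : ℝ) :
    gs (fun l' => if l' = l then r else 0) = mon (disp l) l.length r := by
  ext1 n
  rw [coeff_gs, coeff_mon]
  split_ifs with h
  · rw [Finset.sum_eq_single l]
    · simp
    · intro l' _ hl'
      simp [hl']
    · intro hl
      exact absurd (mem_words.2 h.symm) hl
  · refine Finset.sum_eq_zero fun l' hl' => ?_
    rw [if_neg, AddMonoidAlgebra.single_zero]
    rintro rfl
    exact h (mem_words.1 hl').symm

lemma sum_words_take_drop {M : Type*} [AddCommMonoid M] {i n : ℕ} (hi' : i ≤ n)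
    (F : List (StepIdx d) → List (StepIdx d) → M) :
    ∑ l ∈ words d n, F (l.take i) (l.drop i) =
      ∑ l₁ ∈ words d i, ∑ l₂ ∈ words d (n - i), F l₁ l₂ := by
  rw [← Finset.sum_product']
  refine Finset.sum_nbij' (fun l => (l.take i, l.drop i)) (fun p => p.1 ++ p.2) ?_ ?_ ?_ ?_ ?_
  · intro l hl
    rw [mem_words] at hl
    simp [hl, hi']
  · intro p hp
    rw [Finset.mem_product, mem_words, mem_words] at hp
    rw [mem_words, List.length_append, hp.1, hp.2]
    omega
  · intro l _
    exact List.take_append_drop i l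
  · intro p hp
    rw [Finset.mem_product, mem_words, mem_words] at hp
    rw [← hp.1, List.take_left', List.drop_left'] <;> rfl
  · intro l _
    rfl

lemma gs_conv (w v : List (StepIdx d) → ℝ) : gs (conv w v) = gs w * gs v := by
  ext1 n
  rw [PowerSeries.coeff_mul, Finset.Nat.sum_antidiagonal_eq_sum_range_succ_mk, coeff_gs]
  have h1 : ∀ l ∈ words d n, AddMonoidAlgebra.single (disp l) (conv w v l) =
      ∑ i ∈ Finset.range (n + 1), AddMonoidAlgebra.single (disp l)
        (w (l.take i) * v (l.drop i)) := by
    intro l hl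
    rw [conv, mem_words.1 hl]
    exact map_sum (AddMonoidAlgebra.singleAddHom (disp l)) _ _
  rw [Finset.sum_congr rfl h1, Finset.sum_comm]
  refine Finset.sum_congr rfl fun i hi => ?_
  have hi' : i ≤ n := by
    rw [Finset.mem_range] at hi
    omega
  rw [coeff_gs, coeff_gs, Finset.sum_mul_sum, ← sum_words_take_drop hi' fun l₁ l₂ =>
    AddMonoidAlgebra.single (disp l₁) (w l₁) * AddMonoidAlgebra.single (disp l₂) (v l₂)]
  refine Finset.sum_congr rfl fun l _ => ?_
  rw [AddMonoidAlgebra.single_mul_single, disp_take_add_drop]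

lemma n1_coeff_gs_le (w : List (StepIdx d) → ℝ) (n : ℕ) :
    n1 (PowerSeries.coeff n (gs w)) ≤ ∑ l ∈ words d n, |w l| := by
  rw [coeff_gs]
  refine (n1_sum_le _ _).trans (Finset.sum_le_sum fun l _ => ?_)
  rw [n1_single]

/-- Total weight of the step sequences of length `n`. -/
def tot (w : List (StepIdx d) → ℝ) (n : ℕ) : ℝ := ∑ l ∈ words d n, w l

lemma tot_nonneg {w : List (StepIdx d) → ℝ} (hw : ∀ l, 0 ≤ w l) (n : ℕ) : 0 ≤ tot w n :=
  Finset.sum_nonneg fun l _ => hw l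

lemma n1_coeff_gs_le_tot {w : List (StepIdx d) → ℝ} (hw : ∀ l, 0 ≤ w l) (n : ℕ) :
    n1 (PowerSeries.coeff n (gs w)) ≤ tot w n :=
  (n1_coeff_gs_le w n).trans (Finset.sum_le_sum fun l _ => (abs_of_nonneg (hw l)).le)

lemma nn_gs_le {w : List (StepIdx d) → ℝ} (hw : ∀ l, 0 ≤ w l) (n : ℕ) :
    nn n (gs w) ≤ ∑ t ∈ Finset.range (n + 1), tot w t := by
  rw [nn_eq]
  exact Finset.sum_le_sum fun t _ => n1_coeff_gs_le_tot hw t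

lemma tot_conv (w v : List (StepIdx d) → ℝ) (n : ℕ) :
    tot (conv w v) n = ∑ i ∈ Finset.range (n + 1), tot w i * tot v (n - i) := by
  rw [tot]
  have h1 : ∀ l ∈ words d n, conv w v l =
      ∑ i ∈ Finset.range (n + 1), w (l.take i) * v (l.drop i) := by
    intro l hl
    rw [conv, mem_words.1 hl]
  rw [Finset.sum_congr rfl h1, Finset.sum_comm]
  refine Finset.sum_congr rfl fun i hi => ?_
  have hi' : i ≤ n := by
    rw [Finset.mem_range] at hi
    omega
  rw [tot, tot, Finset.sum_mul_sum, ← sum_words_take_drop hi' fun l₁ l₂ => w l₁ * v l₂]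

open Classical in
/-- Annealed weight of a step sequence, restricted to the class `Q`. -/
def aq (P : Measure (Env d)) (Q : List (StepIdx d) → Prop) (l : List (StepIdx d)) : ℝ :=
  if Q l then (aw P l).toReal else 0

lemma aq_nonneg (P : Measure (Env d)) (Q : List (StepIdx d) → Prop) (l : List (StepIdx d)) :
    0 ≤ aq P Q l := by
  rw [aq]
  split_ifs
  · exact ENNReal.toReal_nonneg
  · exact le_rfl

variable {P : Measure (Env d)} {η : ℝ}

lemma Good.aw_ne_top (hG : Good P η) (l : List (StepIdx d)) : aw P l ≠ ∞ := by
  have := hG.prob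
  refine ne_top_of_le_ne_top ENNReal.one_ne_top ?_
  calc aw P l ≤ ∫⁻ _, 1 ∂P := lintegral_mono fun ω => wt_le_one ω 0 l
    _ = 1 := by simp

lemma Good.pow_le_aw (hG : Good P η) (l : List (StepIdx d)) :
    ENNReal.ofReal η ^ l.length ≤ aw P l := by
  have := hG.prob
  calc ENNReal.ofReal η ^ l.length = ∫⁻ _, ENNReal.ofReal η ^ l.length ∂P := by simp
    _ ≤ aw P l := by
      refine lintegral_mono_ae ?_
      filter_upwards [hG.ell] with ω hω
      exact pow_le_wt hω 0 l

lemma Good.pow_le_toReal_aw (hG : Good P η) (l : List (StepIdx d)) :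
    η ^ l.length ≤ (aw P l).toReal := by
  have h := ENNReal.toReal_mono (hG.aw_ne_top l) (hG.pow_le_aw l)
  rwa [ENNReal.toReal_pow, ENNReal.toReal_ofReal hG.pos.le] at h

lemma Good.ofReal_tot_aq (hG : Good P η) (Q : List (StepIdx d) → Prop) (n : ℕ) :
    ENNReal.ofReal (tot (aq P Q) n) = an P (ind {l | l.length = n ∧ Q l}) := by
  rw [tot, ENNReal.ofReal_sum_of_nonneg fun l _ => aq_nonneg P Q l, an,
    tsum_eq_sum (s := words d n)]
  · refine Finset.sum_congr rfl fun l hl => ?_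
    rw [aq]
    split_ifs with h
    · rw [ind_of_mem (by exact ⟨mem_words.1 hl, h⟩), ENNReal.ofReal_toReal (hG.aw_ne_top l),
        mul_one]
    · rw [ind_of_notMem (by exact fun h' => h h'.2)]
      simp
  · intro l hl
    rw [ind_of_notMem (by exact fun h' => hl (mem_words.2 h'.1)), mul_zero]

lemma Good.tot_aq_le_one (hG : Good P η) (Q : List (StepIdx d) → Prop) (n : ℕ) :
    tot (aq P Q) n ≤ 1 := by
  have h : ENNReal.ofReal (tot (aq P Q) n) ≤ ENNReal.ofReal 1 := by
    rw [hG.ofReal_tot_aq, ENNReal.ofReal_one]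
    exact hG.an_length_le_one fun l hl => hl.1
  exact (ENNReal.ofReal_le_ofReal_iff zero_le_one).1 h

/-- Splitting a step sequence at its first cut. -/
lemma Good.aq_eq_add_conv (hG : Good P η) (ℓ : Fin d → ℝ) (Q : List (StepIdx d) → Prop)
    (hQ : ∀ l i, IsCut ℓ l i → (Q l ↔ Q (l.take i))) (l : List (StepIdx d)) :
    aq P Q l = aq P (fun l => NoCut ℓ l ∧ Q l) l +
      conv (aq P fun l => (Top ℓ l ∧ NoCut ℓ l ∧ l ≠ []) ∧ Q l)
        (aq P fun l => Pos ℓ l ∧ l ≠ []) l := by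
  classical
  have hcut : ∀ i, Top ℓ (l.take i) → l.take i ≠ [] → Pos ℓ (l.drop i) → l.drop i ≠ [] →
      IsCut ℓ l i := by
    intro i h1 h2 h3 h4
    refine ⟨?_, ?_, h1, h3⟩
    · rcases Nat.eq_zero_or_pos i with h | h
      · exact absurd (by simp [h]) h2
      · exact h
    · by_contra h
      exact h4 (List.drop_eq_nil_of_le (by omega))
  have hzero : (¬ Q l ∨ NoCut ℓ l) →
      conv (aq P fun l => (Top ℓ l ∧ NoCut ℓ l ∧ l ≠ []) ∧ Q l)
        (aq P fun l => Pos ℓ l ∧ l ≠ []) l = 0 := by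
    intro h
    refine Finset.sum_eq_zero fun i _ => ?_
    rw [aq, aq]
    split_ifs with h1 h2
    · exfalso
      have hc := hcut i h1.1.1 h1.1.2.2 h2.1 h2.2
      rcases h with h | h
      · exact h ((hQ l i hc).2 h1.2)
      · exact h i hc
    all_goals simp
  by_cases hq : Q l
  · by_cases hn : NoCut ℓ l
    · rw [hzero (Or.inr hn), aq, aq, if_pos hq, if_pos ⟨hn, hq⟩, add_zero]
    · have hex : ∃ i, IsCut ℓ l i := by
        simpa [NoCut] using hn
      set i := Nat.find hex with hi
      have hic : IsCut ℓ l i := Nat.find_spec hex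
      have hmin : ∀ j < i, ¬ IsCut ℓ l j := fun j hj => Nat.find_min hex hj
      clear_value i
      have hic' := isCut_iff.1 hic
      have hlt : (l.take i).length = i := by
        rw [List.length_take]
        omega
      have hnc : NoCut ℓ (l.take i) := by
        intro j hj
        rw [isCut_iff, hlt] at hj
        obtain ⟨hj0, hji, hj1, hj2⟩ := hj
        refine hmin j hji (isCut_iff.2 ⟨hj0, by omega, fun k hk => ?_, fun k hk hkl => ?_⟩)
        · have := hj1 k hk
          rwa [List.take_take, List.take_take, min_eq_left (by omega),
            min_eq_left (by omega)] at this
        · have h2 := hj2 (min k i) (by omega) (by omega)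
          rw [List.take_take, List.take_take, min_eq_left (by omega),
            min_eq_left (by omega)] at h2
          rcases le_total k i with h | h
          · rwa [min_eq_left h] at h2
          · rw [min_eq_right h] at h2
            exact h2.trans (hic'.2.2.2 k h hkl)
      rw [aq, aq, if_pos hq, if_neg (fun h => hn h.1), zero_add, conv,
        Finset.sum_eq_single i]
      · have hne1 : l.take i ≠ [] := by
          intro h
          rw [h, List.length_nil] at hlt
          exact absurd hic.1 (by omega)
        have hne2 : l.drop i ≠ [] := by
          intro h
          have := List.drop_eq_nil_iff.1 h
          exact absurd hic.2.1 (by omega)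
        rw [aq, aq, if_pos ⟨⟨hic.2.2.1, hnc, hne1⟩, (hQ l i hic).1 hq⟩,
          if_pos ⟨hic.2.2.2, hne2⟩, ← ENNReal.toReal_mul, ← hG.aw_append,
          List.take_append_drop]
        rw [Set.disjoint_left]
        rintro y ⟨j, hj, rfl⟩ ⟨k, hk, hy⟩
        have h1 := hic.2.2.1 j hj
        have h2 := hic.2.2.2 k hk.le
        rw [zero_add] at hy
        rw [hy, dotR_add] at h1
        linarith
      · intro j _ hji
        rw [aq, aq]
        split_ifs with h1 h2
        · exfalso
          have hc := hcut j h1.1.1 h1.1.2.2 h2.1 h2.2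
          have hlt' : i < j := by
            rcases lt_trichotomy i j with h | h | h
            · exact h
            · exact absurd h.symm hji
            · exact absurd hc (hmin j h)
          refine h1.1.2.1 i (isCut_iff.2 ?_)
          have hlj : (l.take j).length = j := by
            rw [List.length_take]
            have := hc.2.1
            omega
          have hjl := hc.2.1
          rw [hlj]
          refine ⟨hic.1, hlt', fun k hk => ?_, fun k hk hkj => ?_⟩
          · rw [List.take_take, List.take_take, min_eq_left (by omega), min_eq_left (by omega)]
            exact hic'.2.2.1 k hk
          · rw [List.take_take, List.take_take, min_eq_left (by omega), min_eq_left (by omega)]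
            exact hic'.2.2.2 k hk (by omega)
        all_goals simp
      · intro h
        exfalso
        rw [Finset.mem_range] at h
        have := hic.2.1
        omega
  · rw [hzero (Or.inl hq), aq, aq, if_neg hq, if_neg (fun h => hq h.2), add_zero]

lemma Good.gs_aq_eq (hG : Good P η) (ℓ : Fin d → ℝ) (Q : List (StepIdx d) → Prop)
    (hQ : ∀ l i, IsCut ℓ l i → (Q l ↔ Q (l.take i))) :
    gs (aq P Q) = gs (aq P fun l => NoCut ℓ l ∧ Q l) +
      gs (aq P fun l => (Top ℓ l ∧ NoCut ℓ l ∧ l ≠ []) ∧ Q l) *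
        gs (aq P fun l => Pos ℓ l ∧ l ≠ []) := by
  rw [← gs_conv, ← gs_add]
  congr 1
  funext l
  exact hG.aq_eq_add_conv ℓ Q hQ l

lemma pos_and_ne_nil_of_isCut {ℓ : Fin d → ℝ} (l : List (StepIdx d)) (i : ℕ) (h : IsCut ℓ l i) :
    (Pos ℓ l ∧ l ≠ []) ↔ (Pos ℓ (l.take i) ∧ l.take i ≠ []) := by
  have hi := isCut_iff.1 h
  have hlt : (l.take i).length = i := by
    rw [List.length_take]
    omega
  have hne1 : l.take i ≠ [] := by
    intro h'
    rw [h', List.length_nil] at hlt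
    omega
  have hne2 : l ≠ [] := by
    rintro rfl
    exact hne1 (by simp)
  refine ⟨fun hp => ⟨fun k hk => ?_, hne1⟩, fun hp => ⟨fun k hk => ?_, hne2⟩⟩
  · rw [List.take_take, min_eq_left (by omega)]
    exact hp.1 k (by omega)
  · rcases le_total k i with hki | hki
    · have := hp.1 k (by omega)
      rwa [List.take_take, min_eq_left hki] at this
    · have h1 := hp.1 i (by omega)
      rw [List.take_take, min_self] at h1
      exact h1.trans (hi.2.2.2 k hki hk)

end

/-- All polynomial moments in time of the power series are finite. -/
def Mom {G : Type*} [AddCommGroup G] (φ : PowerSeries (AddMonoidAlgebra ℝ G)) : Prop :=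
  ∀ k : ℕ, ∃ C : ℝ, ∀ n, wnm (fun t => (1 + (t : ℝ)) ^ k) n φ ≤ C

lemma polyWeight_nonneg (k t : ℕ) : 0 ≤ (1 + (t : ℝ)) ^ k := by positivity

lemma polyWeight_add_le (k s t : ℕ) :
    (1 + ((s + t : ℕ) : ℝ)) ^ k ≤ (1 + (s : ℝ)) ^ k * (1 + (t : ℝ)) ^ k := by
  rw [← mul_pow]
  have : 0 ≤ (s : ℝ) * t := by positivity
  refine pow_le_pow_left₀ (by positivity) ?_ k
  push_cast
  nlinarith

section
variable {G : Type*} [AddCommGroup G] {φ ψ : PowerSeries (AddMonoidAlgebra ℝ G)}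

lemma Mom.mul (hφ : Mom φ) (hψ : Mom ψ) : Mom (φ * ψ) := by
  intro k
  obtain ⟨C, hC⟩ := hφ k
  obtain ⟨D, hD⟩ := hψ k
  refine ⟨C * D, fun n => (wnm_mul_le (polyWeight_nonneg k) (polyWeight_add_le k) n _ _).trans ?_⟩
  exact mul_le_mul (hC n) (hD n) (wnm_nonneg (polyWeight_nonneg k) n ψ)
    ((wnm_nonneg (polyWeight_nonneg k) n φ).trans (hC n))

lemma Mom.add (hφ : Mom φ) (hψ : Mom ψ) : Mom (φ + ψ) := by
  intro k
  obtain ⟨C, hC⟩ := hφ k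
  obtain ⟨D, hD⟩ := hψ k
  exact ⟨C + D, fun n => (wnm_add_le (polyWeight_nonneg k) n _ _).trans
    (add_le_add (hC n) (hD n))⟩

lemma Mom.sub (hφ : Mom φ) (hψ : Mom ψ) : Mom (φ - ψ) := by
  rw [sub_eq_add_neg]
  refine hφ.add fun k => ?_
  obtain ⟨D, hD⟩ := hψ k
  exact ⟨D, fun n => (wnm_neg _ n ψ).trans_le (hD n)⟩

lemma mom_mon (x : G) (t : ℕ) (r : ℝ) : Mom (mon x t r) := fun k =>
  ⟨_, fun n => wnm_mon_le (polyWeight_nonneg k) n x t r⟩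

lemma mom_one : Mom (1 : PowerSeries (AddMonoidAlgebra ℝ G)) := by
  rw [one_eq_mon]
  exact mom_mon _ _ _

lemma Mom.exists_nn_le (hφ : Mom φ) : ∃ C : ℝ, 0 < C ∧ ∀ n, nn n φ ≤ C := by
  obtain ⟨C, hC⟩ := hφ 0
  have h : ∀ n, nn n φ ≤ C := fun n => by simpa [nn] using hC n
  exact ⟨max C 1, by positivity, fun n => (h n).trans (le_max_left _ _)⟩

end

/-- A sub-Markovian renewal inequality with bounded, nonzero solution forces total mass at
most one. -/
lemma sum_le_one_of_renewal {B U : ℕ → ℝ} (hB : ∀ t, 0 ≤ B t) (hU : ∀ t, 0 ≤ U t)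
    (hU1 : ∀ t, U t ≤ 1) (hpos : 0 < U 1)
    (h : ∀ m, ∑ i ∈ Finset.range (m + 1), B i * U (m - i) ≤ U m) (n : ℕ) :
    ∑ t ∈ Finset.range (n + 1), B t ≤ 1 := by
  set W := ∑ t ∈ Finset.range (n + 1), B t with hW
  have hW0 : 0 ≤ W := Finset.sum_nonneg fun t _ => hB t
  set H : ℕ → ℝ := fun m => ∑ t ∈ Finset.range (m + 1), U t with hH
  have hstep : ∀ m, W * H m ≤ H (m + n) := by
    intro m
    calc W * H m = ∑ p ∈ Finset.range (n + 1) ×ˢ Finset.range (m + 1), B p.1 * U p.2 := by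
          rw [hW, hH, Finset.sum_product, Finset.sum_mul_sum]
      _ ≤ ∑ p ∈ (Finset.range (m + n + 1)).biUnion
            Finset.HasAntidiagonal.antidiagonal, B p.1 * U p.2 := by
          refine Finset.sum_le_sum_of_subset_of_nonneg (fun p hp => ?_) fun p _ _ =>
            mul_nonneg (hB _) (hU _)
          simp only [Finset.mem_biUnion, Finset.mem_range,
            Finset.HasAntidiagonal.mem_antidiagonal, Finset.mem_product] at hp ⊢
          exact ⟨p.1 + p.2, by omega, rfl⟩
      _ = ∑ t ∈ Finset.range (m + n + 1), ∑ p ∈ Finset.HasAntidiagonal.antidiagonal t,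
            B p.1 * U p.2 := by
          refine Finset.sum_biUnion ?_
          intro s _ t _ hst
          rw [Function.onFun, Finset.disjoint_left]
          intro p hp hq
          rw [Finset.HasAntidiagonal.mem_antidiagonal] at hp hq
          exact hst (hp.symm.trans hq)
      _ ≤ H (m + n) := by
          refine Finset.sum_le_sum fun t _ => ?_
          rw [Finset.Nat.sum_antidiagonal_eq_sum_range_succ_mk]
          exact h t
  have hpow : ∀ k : ℕ, W ^ k * H 1 ≤ H (1 + k * n) := by
    intro k
    induction k with
    | zero => simp
    | succ k ih =>
      calc W ^ (k + 1) * H 1 = W * (W ^ k * H 1) := by ring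
        _ ≤ W * H (1 + k * n) := mul_le_mul_of_nonneg_left ih hW0
        _ ≤ H (1 + k * n + n) := hstep _
        _ = _ := by congr 1; ring
  have hHle : ∀ m, H m ≤ m + 1 := by
    intro m
    calc H m ≤ ∑ t ∈ Finset.range (m + 1), (1 : ℝ) := Finset.sum_le_sum fun t _ => hU1 t
      _ = m + 1 := by simp
  have hH1 : 0 < H 1 := by
    have h1 : H 1 = U 0 + U 1 := by simp [hH, Finset.sum_range_succ]
    rw [h1]
    exact add_pos_of_nonneg_of_pos (hU 0) hpos
  by_contra hcon
  push Not at hcon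
  have h0 := tendsto_pow_const_div_const_pow_of_one_lt 0 hcon
  have h1 := tendsto_pow_const_div_const_pow_of_one_lt 1 hcon
  have h2 := (h1.const_mul (n : ℝ)).add (h0.const_mul 2)
  simp only [pow_zero, pow_one, mul_zero, add_zero] at h2
  obtain ⟨k, hk⟩ := (h2.eventually (gt_mem_nhds hH1)).exists
  have hWk : 0 < W ^ k := pow_pos (by linarith) k
  have h3 := (hpow k).trans (hHle _)
  rw [mul_one_div, mul_div_assoc', ← add_div, div_lt_iff₀ hWk] at hk
  push_cast at h3
  nlinarith

section
variable {d : ℕ} {P : Measure (Env d)} {η : ℝ}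

lemma tot_le_tot_of_imp {Q R : List (StepIdx d) → Prop} (h : ∀ l, Q l → R l) (n : ℕ) :
    tot (aq P Q) n ≤ tot (aq P R) n := by
  refine Finset.sum_le_sum fun l _ => ?_
  by_cases hQ : Q l
  · rw [aq, aq, if_pos hQ, if_pos (h l hQ)]
  · rw [aq, if_neg hQ]
    exact aq_nonneg P R l

lemma Good.mom_of_noCut (hd : 4 ≤ d) (hG : Good P η) {ℓ : Fin d → ℝ} {κ : ℝ}
    (h2 : norm2R ℓ = 1) (hcone : Cone P ℓ (3 / 4) κ) {Q : List (StepIdx d) → Prop}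
    (hQ : ∀ l, Q l → NoCut ℓ l) : Mom (gs (aq P Q)) := by
  intro k
  obtain ⟨C, hC, hCt⟩ := hG.exists_noCut_le hd h2 hcone (k + 2)
  have hterm : ∀ t : ℕ, (1 + (t : ℝ)) ^ k * n1 (PowerSeries.coeff t (gs (aq P Q))) ≤
      (C * 2 ^ (k + 2) + 1) * (1 / ((t + 1 : ℕ) : ℝ) ^ 2) := by
    intro t
    have h1 : n1 (PowerSeries.coeff t (gs (aq P Q))) ≤ tot (aq P (NoCut ℓ)) t :=
      (n1_coeff_gs_le_tot (aq_nonneg P Q) t).trans (tot_le_tot_of_imp hQ t)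
    rcases Nat.eq_zero_or_pos t with rfl | ht
    · have h3 := hG.tot_aq_le_one (NoCut ℓ) 0
      have : 0 < C * 2 ^ (k + 2) := by positivity
      simp only [Nat.cast_zero, add_zero, one_pow, one_mul, zero_add, Nat.cast_one, div_one,
        mul_one]
      linarith
    · have h3 : tot (aq P (NoCut ℓ)) t ≤ C / (t : ℝ) ^ (k + 2) := by
        have := hCt t ht
        rw [← hG.ofReal_tot_aq] at this
        exact (ENNReal.ofReal_le_ofReal_iff (by positivity)).1 this
      have ht' : (1 : ℝ) ≤ t := by exact_mod_cast ht
      have h4 : (1 + (t : ℝ)) ^ (k + 2) ≤ 2 ^ (k + 2) * (t : ℝ) ^ (k + 2) := by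
        rw [← mul_pow]
        exact pow_le_pow_left₀ (by positivity) (by linarith) _
      calc (1 + (t : ℝ)) ^ k * n1 (PowerSeries.coeff t (gs (aq P Q)))
          ≤ (1 + (t : ℝ)) ^ k * (C / (t : ℝ) ^ (k + 2)) :=
            mul_le_mul_of_nonneg_left (h1.trans h3) (by positivity)
        _ = (1 + (t : ℝ)) ^ (k + 2) * C / (t : ℝ) ^ (k + 2) * (1 / (1 + (t : ℝ)) ^ 2) := by
            field_simp
            ring
        _ ≤ (C * 2 ^ (k + 2)) * (1 / (1 + (t : ℝ)) ^ 2) := by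
            refine mul_le_mul_of_nonneg_right ?_ (by positivity)
            rw [div_le_iff₀ (by positivity)]
            nlinarith
        _ ≤ (C * 2 ^ (k + 2) + 1) * (1 / ((t + 1 : ℕ) : ℝ) ^ 2) := by
            push_cast
            rw [add_comm (t : ℝ) 1]
            exact mul_le_mul_of_nonneg_right (by linarith) (by positivity)
  have hsum : Summable fun t : ℕ => (C * 2 ^ (k + 2) + 1) * (1 / ((t + 1 : ℕ) : ℝ) ^ 2) :=
    (((summable_nat_add_iff 1).2 (Real.summable_one_div_nat_pow.2 one_lt_two))).mul_left _
  refine ⟨_, fun n => (Finset.sum_le_sum fun t _ => hterm t).trans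
    (hsum.sum_le_tsum _ fun t _ => ?_)⟩
  positivity

/-- The class of step sequences between two consecutive cuts. -/
def Blk (ℓ : Fin d → ℝ) (l : List (StepIdx d)) : Prop :=
  (Top ℓ l ∧ NoCut ℓ l ∧ l ≠ []) ∧ Pos ℓ l ∧ l ≠ []

lemma blk_singleton {ℓ : Fin d → ℝ} {e : StepIdx d} (he : 0 < dotR (stepVec e) ℓ) :
    Blk ℓ [e] := by
  refine ⟨⟨fun k hk => ?_, fun i hi => ?_, by simp⟩, fun k hk => ?_, by simp⟩
  · have : k = 0 := by simpa using hk
    subst this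
    simpa [dotR_zero] using he
  · have h1 := hi.1
    have h2 : i < 1 := by simpa using hi.2.1
    omega
  · have : k ≤ 1 := by simpa using hk
    interval_cases k <;> simp [dotR_zero, he.le]

/-- The reversed step. -/
def rev (s : StepIdx d) : StepIdx d := (s.1, !s.2)

@[simp] lemma stepVec_rev (s : StepIdx d) : stepVec (rev s) = -stepVec s := by
  funext j
  obtain ⟨i, b⟩ := s
  cases b <;> simp [stepVec, rev] <;> split_ifs <;> simp

lemma blk_four {ℓ : Fin d → ℝ} {e s : StepIdx d} (he : 0 < dotR (stepVec e) ℓ)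
    (hs : 0 ≤ dotR (stepVec s) ℓ) : Blk ℓ [s, rev s, s, e] := by
  refine ⟨⟨fun k hk => ?_, fun i hi => ?_, by simp⟩, fun k hk => ?_, by simp⟩
  · have : k < 4 := by simpa using hk
    interval_cases k <;> simp [dotR_zero, dotR_add] <;> linarith
  · rw [isCut_iff] at hi
    obtain ⟨h1, h2, h3, h4⟩ := hi
    have h2' : i < 4 := by simpa using h2
    interval_cases i
    · have h5 := h3 0 (by norm_num)
      have h6 := h4 2 (by norm_num) (by simp)
      simp [dotR_zero] at h5 h6
      linarith
    · have h5 := h3 0 (by norm_num)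
      simp [dotR_zero] at h5
    · have h5 := h3 1 (by norm_num)
      simp at h5
  · have : k ≤ 4 := by simpa using hk
    interval_cases k <;> simp [dotR_zero, dotR_add] <;> linarith

lemma blk_six {ℓ : Fin d → ℝ} {e : StepIdx d} (he : 0 < dotR (stepVec e) ℓ) :
    Blk ℓ [e, rev e, e, rev e, e, e] := by
  refine ⟨⟨fun k hk => ?_, fun i hi => ?_, by simp⟩, fun k hk => ?_, by simp⟩
  · have : k < 6 := by simpa using hk
    interval_cases k <;> simp [dotR_zero, dotR_add] <;> linarith
  · rw [isCut_iff] at hi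
    obtain ⟨h1, h2, h3, h4⟩ := hi
    have h2' : i < 6 := by simpa using h2
    interval_cases i
    · have h6 := h4 2 (by norm_num) (by simp)
      simp [dotR_zero] at h6
      linarith
    · have h5 := h3 0 (by norm_num)
      simp [dotR_zero] at h5
    · have h5 := h3 1 (by norm_num)
      simp at h5
    · have h5 := h3 0 (by norm_num)
      simp [dotR_zero] at h5
    · have h5 := h3 1 (by norm_num)
      simp at h5
  · have : k ≤ 6 := by simpa using hk
    interval_cases k <;> simp [dotR_zero, dotR_add] <;> linarith

lemma Good.gs_pos_eq (hG : Good P η) (ℓ : Fin d → ℝ) :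
    gs (aq P fun l => Pos ℓ l ∧ l ≠ []) = gs (aq P fun l => NoCut ℓ l ∧ Pos ℓ l ∧ l ≠ []) +
      gs (aq P (Blk ℓ)) * gs (aq P fun l => Pos ℓ l ∧ l ≠ []) :=
  hG.gs_aq_eq ℓ _ fun l i h => pos_and_ne_nil_of_isCut l i h

lemma Good.sum_tot_blk_le_one (hG : Good P η) {ℓ : Fin d → ℝ} {e : StepIdx d}
    (he : 0 < dotR (stepVec e) ℓ) (n : ℕ) :
    ∑ t ∈ Finset.range (n + 1), tot (aq P (Blk ℓ)) t ≤ 1 := by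
  refine sum_le_one_of_renewal (U := tot (aq P fun l => Pos ℓ l ∧ l ≠ []))
    (fun t => tot_nonneg (aq_nonneg P _) t) (fun t => tot_nonneg (aq_nonneg P _) t)
    (fun t => hG.tot_aq_le_one _ t) ?_ (fun m => ?_) n
  · have h1 : aq P (fun l => Pos ℓ l ∧ l ≠ []) [e] ≤ tot (aq P fun l => Pos ℓ l ∧ l ≠ []) 1 :=
      Finset.single_le_sum (fun l _ => aq_nonneg P _ l) (mem_words.2 rfl)
    refine lt_of_lt_of_le ?_ h1
    rw [aq, if_pos (blk_singleton he).2]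
    exact lt_of_lt_of_le (pow_pos hG.pos _) (hG.pow_le_toReal_aw [e])
  · rw [← tot_conv]
    refine Finset.sum_le_sum fun l _ => ?_
    rw [hG.aq_eq_add_conv ℓ (fun l => Pos ℓ l ∧ l ≠ [])
      (fun l i h => pos_and_ne_nil_of_isCut l i h) l]
    exact le_add_of_nonneg_left (aq_nonneg P _ l)

lemma Good.nn_blk_le_one (hG : Good P η) {ℓ : Fin d → ℝ} {e : StepIdx d}
    (he : 0 < dotR (stepVec e) ℓ) (n : ℕ) : nn n (gs (aq P (Blk ℓ))) ≤ 1 :=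
  (nn_gs_le (aq_nonneg P _) n).trans (hG.sum_tot_blk_le_one he n)

/-- `b` is a sub-probability series charging the two monomials `δ_x X^s` and `δ_y X^t`. -/
def Splits {G : Type*} [AddCommGroup G] (b : PowerSeries (AddMonoidAlgebra ℝ G)) (x : G) (s : ℕ)
    (y : G) (t : ℕ) : Prop :=
  ∃ c : ℝ, 0 < c ∧ ∃ r, b = mon x s c + mon y t c + r ∧ ∀ n, nn n r ≤ 1 - 2 * c

lemma Good.splits_blk (hG : Good P η) {ℓ : Fin d → ℝ} {e : StepIdx d}
    (he : 0 < dotR (stepVec e) ℓ) {l₁ l₂ : List (StepIdx d)} (h₁ : Blk ℓ l₁) (h₂ : Blk ℓ l₂)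
    (hne : l₁ ≠ l₂) :
    Splits (gs (aq P (Blk ℓ))) (disp l₁) l₁.length (disp l₂) l₂.length := by
  set c := min (η ^ l₁.length) (η ^ l₂.length) with hc
  have hc0 : 0 < c := lt_min (pow_pos hG.pos _) (pow_pos hG.pos _)
  set w : List (StepIdx d) → ℝ := fun l => aq P (Blk ℓ) l -
    ((if l = l₁ then c else 0) + if l = l₂ then c else 0) with hw
  have hw0 : ∀ l, 0 ≤ w l := by
    intro l
    rw [hw]
    simp only
    by_cases hl1 : l = l₁
    · subst hl1
      rw [if_pos rfl, if_neg hne, aq, if_pos h₁]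
      have := hG.pow_le_toReal_aw l
      have := min_le_left (η ^ l.length) (η ^ l₂.length)
      linarith
    · by_cases hl2 : l = l₂
      · subst hl2
        rw [if_pos rfl, if_neg hl1, aq, if_pos h₂]
        have := hG.pow_le_toReal_aw l
        have := min_le_right (η ^ l₁.length) (η ^ l.length)
        linarith
      · rw [if_neg hl1, if_neg hl2]
        have := aq_nonneg P (Blk ℓ) l
        linarith
  refine ⟨c, hc0, gs w, ?_, fun n => ?_⟩
  · rw [← gs_single, ← gs_single, ← gs_add, ← gs_add]
    congr 1
    funext l
    rw [hw]
    ring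
  · set m := max n (max l₁.length l₂.length) with hm
    have hsingle : ∀ l' : List (StepIdx d), l'.length ≤ m →
        ∑ t ∈ Finset.range (m + 1), tot (fun l => if l = l' then c else 0) t = c := by
      intro l' hl'
      rw [Finset.sum_eq_single l'.length]
      · rw [tot, Finset.sum_ite_eq', if_pos (mem_words.2 rfl)]
      · intro t _ ht
        rw [tot, Finset.sum_ite_eq', if_neg]
        exact fun h => ht (mem_words.1 h).symm
      · intro h
        exact absurd (Finset.mem_range.2 (by omega)) h
    calc nn n (gs w) ≤ nn m (gs w) := nn_mono (le_max_left _ _) _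
      _ ≤ ∑ t ∈ Finset.range (m + 1), tot w t := nn_gs_le hw0 m
      _ = ∑ t ∈ Finset.range (m + 1), (tot (aq P (Blk ℓ)) t -
          (tot (fun l => if l = l₁ then c else 0) t +
            tot (fun l => if l = l₂ then c else 0) t)) := by
          refine Finset.sum_congr rfl fun t _ => ?_
          simp only [tot, hw, Finset.sum_sub_distrib, Finset.sum_add_distrib]
      _ = ∑ t ∈ Finset.range (m + 1), tot (aq P (Blk ℓ)) t - (c + c) := by
          rw [Finset.sum_sub_distrib, Finset.sum_add_distrib, hsingle l₁ (by omega),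
            hsingle l₂ (by omega)]
      _ ≤ 1 - 2 * c := by
          have := hG.sum_tot_blk_le_one he m
          linarith

end

lemma sum_choose_mul_sq (m : ℕ) :
    ∑ i ∈ Finset.range (m + 1), (m.choose i : ℝ) * (2 * i - m) ^ 2 = (m : ℝ) * 2 ^ m := by
  have h := congrArg (Polynomial.eval (1 / 2 : ℝ)) (bernsteinPolynomial.variance ℝ m)
  simp only [Polynomial.eval_finsetSum, Polynomial.eval_mul, Polynomial.eval_pow,
    Polynomial.eval_sub, nsmul_eq_mul, Polynomial.eval_natCast, Polynomial.eval_X,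
    Polynomial.eval_one, bernsteinPolynomial] at h
  have h2 : ∀ i ∈ Finset.range (m + 1), (m.choose i : ℝ) * (2 * i - m) ^ 2 =
      4 * 2 ^ m * (((m : ℝ) * (1 / 2) - i) ^ 2 * (m.choose i * (1 / 2) ^ i *
        (1 - 1 / 2) ^ (m - i))) := by
    intro i hi
    have him : i ≤ m := by
      rw [Finset.mem_range] at hi
      omega
    have h3 : (1 / 2 : ℝ) ^ i * (1 - 1 / 2) ^ (m - i) * 2 ^ m = 1 := by
      rw [show (1 - 1 / 2 : ℝ) = 1 / 2 by norm_num, ← pow_add,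
        Nat.add_sub_cancel' him, ← mul_pow]
      norm_num
    linear_combination -((m.choose i : ℝ) * (2 * i - m) ^ 2) * h3
  rw [Finset.sum_congr rfl h2, ← Finset.mul_sum, h]
  ring

lemma sum_choose_mul_abs_le (m : ℕ) :
    ∑ i ∈ Finset.range (m + 1), (m.choose i : ℝ) * |2 * (i : ℝ) - m| ≤ 2 ^ m * √m := by
  rcases Nat.eq_zero_or_pos m with rfl | hm
  · simp
  have hs : 0 < √(m : ℝ) := Real.sqrt_pos.2 (by exact_mod_cast hm)
  have hss : √(m : ℝ) * √m = m := Real.mul_self_sqrt (by positivity)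
  have h1 : ∀ i ∈ Finset.range (m + 1), (m.choose i : ℝ) * |2 * (i : ℝ) - m| ≤
      1 / (2 * √m) * ((m.choose i : ℝ) * (2 * i - m) ^ 2) + √m / 2 * m.choose i := by
    intro i _
    have h2 : |2 * (i : ℝ) - m| ≤ 1 / (2 * √m) * (2 * i - m) ^ 2 + √m / 2 := by
      rw [← sq_abs (2 * (i : ℝ) - m), ← sub_nonneg]
      have : 1 / (2 * √m) * |2 * (i : ℝ) - m| ^ 2 + √m / 2 - |2 * (i : ℝ) - m| =
          1 / (2 * √m) * (|2 * (i : ℝ) - m| - √m) ^ 2 := by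
        field_simp
        ring
      rw [this]
      positivity
    have h3 : (0 : ℝ) ≤ m.choose i := by positivity
    nlinarith [mul_le_mul_of_nonneg_left h2 h3]
  refine (Finset.sum_le_sum h1).trans (le_of_eq ?_)
  rw [Finset.sum_add_distrib, ← Finset.mul_sum, ← Finset.mul_sum, sum_choose_mul_sq,
    ← Nat.cast_sum, Nat.sum_range_choose]
  push_cast
  field_simp
  rw [sq, hss]
  ring

lemma sub_mul_add_pow_eq {R : Type*} [CommRing R] (a b : R) (j : ℕ) :
    (j + 1) • ((a - b) * (a + b) ^ j) = ∑ i ∈ Finset.range (j + 2),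
      (((j + 1).choose i : ℤ) * (2 * i - (j + 1 : ℕ))) • (a ^ i * b ^ (j + 1 - i)) := by
  have h1 : (j + 1) • (a * (a + b) ^ j) = ∑ i ∈ Finset.range (j + 2),
      (((j + 1).choose i : ℤ) * i) • (a ^ i * b ^ (j + 1 - i)) := by
    rw [Finset.sum_range_succ', add_pow, Finset.mul_sum, Finset.smul_sum]
    simp only [Nat.cast_zero, mul_zero, zero_smul, add_zero]
    refine Finset.sum_congr rfl fun i _ => ?_
    have h := Nat.add_one_mul_choose_eq j i
    rw [show j + 1 - (i + 1) = j - i by omega, nsmul_eq_mul, zsmul_eq_mul]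
    have h' : ((j + 1 : ℕ) : R) * (j.choose i : R) = ((j + 1).choose (i + 1) : R) * ((i + 1 : ℕ) : R) := by
      exact_mod_cast congrArg (Nat.cast (R := R)) h
    push_cast at h' ⊢
    linear_combination (a ^ (i + 1) * b ^ (j - i)) * h'
  have h2 : (j + 1) • (b * (a + b) ^ j) = ∑ i ∈ Finset.range (j + 2),
      (((j + 1).choose i : ℤ) * ((j + 1 : ℕ) - i)) • (a ^ i * b ^ (j + 1 - i)) := by
    rw [Finset.sum_range_succ, add_pow, Finset.mul_sum, Finset.smul_sum]
    simp only [sub_self, mul_zero, zero_smul, add_zero]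
    refine Finset.sum_congr rfl fun i hi => ?_
    rw [Finset.mem_range] at hi
    have h := Nat.choose_mul_succ_eq j i
    have h' : (j.choose i : R) * ((j + 1 : ℕ) : R) =
        ((j + 1).choose i : R) * ((j + 1 - i : ℕ) : R) := by
      exact_mod_cast congrArg (Nat.cast (R := R)) h
    rw [Nat.cast_sub (by omega)] at h'
    rw [show j + 1 - i = (j - i) + 1 by omega, nsmul_eq_mul, zsmul_eq_mul]
    push_cast at h' ⊢
    linear_combination (a ^ i * b ^ (j - i + 1)) * h'
  rw [sub_mul, smul_sub, h1, h2, ← Finset.sum_sub_distrib]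
  refine Finset.sum_congr rfl fun i _ => ?_
  rw [← sub_smul]
  congr 1
  ring

section
variable {G : Type*} [AddCommGroup G]

lemma nn_zsmul (n : ℕ) (z : ℤ) (φ : PowerSeries (AddMonoidAlgebra ℝ G)) :
    nn n (z • φ) = |(z : ℝ)| * nn n φ := by
  have h : ∀ a : AddMonoidAlgebra ℝ G, n1 (z • a) = |(z : ℝ)| * n1 a := by
    intro a
    classical
    set s := (z • a).coeff.support ∪ a.coeff.support with hs
    rw [n1_eq_sum (z • a) (s := s) (by rw [hs]; exact Finset.subset_union_left),
      n1_eq_sum a (s := s) (by rw [hs]; exact Finset.subset_union_right), Finset.mul_sum]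
    refine Finset.sum_congr rfl fun x _ => ?_
    rw [AddMonoidAlgebra.coeff_smul, Finsupp.smul_apply, zsmul_eq_mul, abs_mul]
  rw [nn_eq, nn_eq, Finset.mul_sum]
  refine Finset.sum_congr rfl fun t _ => ?_
  rw [map_zsmul, h]

lemma nn_pow_le (n k : ℕ) (φ : PowerSeries (AddMonoidAlgebra ℝ G)) :
    nn n (φ ^ k) ≤ nn n φ ^ k := by
  induction k with
  | zero => simpa using nn_one_le n
  | succ k ih =>
    rw [pow_succ, pow_succ]
    exact (nn_mul_le _ _ _).trans (mul_le_mul_of_nonneg_right ih (nn_nonneg _ _))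

lemma nn_sub_mul_add_pow_le (n j : ℕ) (x y : G) (s t : ℕ) :
    nn n ((mon x s 1 - mon y t 1) * (mon x s 1 + mon y t 1) ^ j) ≤
      2 ^ j * (2 / √((j : ℝ) + 1)) := by
  have h1 := congrArg (nn n) (sub_mul_add_pow_eq (mon x s 1) (mon y t 1) j)
  rw [← natCast_zsmul, nn_zsmul] at h1
  have h2 : nn n (∑ i ∈ Finset.range (j + 2),
      (((j + 1).choose i : ℤ) * (2 * i - (j + 1 : ℕ))) • (mon x s 1 ^ i * mon y t 1 ^ (j + 1 - i)))
      ≤ 2 ^ (j + 1) * √((j + 1 : ℕ) : ℝ) := by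
    refine (nn_sum_le _ _ _).trans (le_trans ?_ (sum_choose_mul_abs_le (j + 1)))
    refine Finset.sum_le_sum fun i _ => ?_
    rw [nn_zsmul, mon_pow, mon_pow, mon_mul_mon]
    refine (mul_le_mul_of_nonneg_left (nn_mon_le _ _ _ _) (abs_nonneg _)).trans (le_of_eq ?_)
    push_cast
    rw [abs_mul, Nat.abs_cast]
    simp
  rw [← h1] at h2
  push_cast at h2
  have hj : (0 : ℝ) < j + 1 := by positivity
  have hs : 0 < √((j : ℝ) + 1) := Real.sqrt_pos.2 hj
  have hss : √((j : ℝ) + 1) * √((j : ℝ) + 1) = j + 1 := Real.mul_self_sqrt hj.le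
  rw [abs_of_pos hj] at h2
  rw [mul_div_assoc', le_div_iff₀ hs]
  refine le_of_mul_le_mul_right ?_ hs
  calc _ = (j + 1) * nn n ((mon x s 1 - mon y t 1) * (mon x s 1 + mon y t 1) ^ j) := by
        rw [mul_assoc, hss, mul_comm]
    _ ≤ _ := h2.trans (by rw [pow_succ])

/-- Multiplication by `u` gains a factor `K^{-1/2}` against the `K`-th power of `b`. -/
def Small (b u : PowerSeries (AddMonoidAlgebra ℝ G)) : Prop :=
  ∃ C : ℝ, 0 ≤ C ∧ ∀ K n : ℕ, nn n (u * b ^ K) ≤ C / √((K : ℝ) + 1)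

lemma sum_choose_mul_div_le {q : ℝ} (hq : 0 < q) (hq1 : q ≤ 1) (K : ℕ) :
    ∑ j ∈ Finset.range (K + 1), (K.choose j : ℝ) * q ^ j * (1 - q) ^ (K - j) * (1 / ((j : ℝ) + 1)) ≤
      1 / (q * (K + 1)) := by
  have h1 : ∀ j ∈ Finset.range (K + 1),
      (K.choose j : ℝ) * q ^ j * (1 - q) ^ (K - j) * (1 / ((j : ℝ) + 1)) =
      1 / (q * (K + 1)) * (q ^ (j + 1) * (1 - q) ^ (K + 1 - (j + 1)) *
        ((K + 1).choose (j + 1) : ℝ)) := by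
    intro j _
    have h : ((K + 1 : ℕ) : ℝ) * (K.choose j : ℝ) = ((K + 1).choose (j + 1) : ℝ) * ((j + 1 : ℕ) : ℝ) := by
      exact_mod_cast Nat.add_one_mul_choose_eq K j
    push_cast at h
    rw [show K + 1 - (j + 1) = K - j by omega, pow_succ]
    field_simp
    linear_combination ((1 - q) ^ (K - j)) * h
  rw [Finset.sum_congr rfl h1, ← Finset.mul_sum]
  refine mul_le_of_le_one_right (by positivity) ?_
  have h2 : ∑ i ∈ Finset.range (K + 2), q ^ i * (1 - q) ^ (K + 1 - i) * ((K + 1).choose i : ℝ) = 1 := by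
    rw [← add_pow]
    simp
  rw [Finset.sum_range_succ'] at h2
  have h3 : 0 ≤ q ^ 0 * (1 - q) ^ (K + 1 - 0) * ((K + 1).choose 0 : ℝ) := by
    have : 0 ≤ 1 - q := by linarith
    positivity
  linarith

lemma small_of_splits {b : PowerSeries (AddMonoidAlgebra ℝ G)} {x y : G} {s t : ℕ}
    (h : Splits b x s y t) : Small b (mon x s 1 - mon y t 1) := by
  obtain ⟨c, hc, r, hb, hr⟩ := h
  set q := 2 * c with hq
  have hq0 : 0 < q := by positivity
  have hq1 : q ≤ 1 := by
    have := (nn_nonneg 0 r).trans (hr 0)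
    linarith
  refine ⟨1 / q + 1, by positivity, fun K n => ?_⟩
  set σ := √((K : ℝ) + 1) with hσ
  have hK : (0 : ℝ) < K + 1 := by positivity
  have hσ0 : 0 < σ := Real.sqrt_pos.2 hK
  have hσσ : σ * σ = K + 1 := Real.mul_self_sqrt hK.le
  have hb' : b = mon 0 0 c * (mon x s 1 + mon y t 1) + r := by
    rw [hb, mul_add, mon_mul_mon, mon_mul_mon]
    simp
  have hexp : (mon x s 1 - mon y t 1) * b ^ K = ∑ j ∈ Finset.range (K + 1),
      (K.choose j : ℤ) • (mon 0 0 (c ^ j) * (((mon x s 1 - mon y t 1) *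
        (mon x s 1 + mon y t 1) ^ j) * r ^ (K - j))) := by
    rw [hb', add_pow, Finset.mul_sum]
    refine Finset.sum_congr rfl fun j _ => ?_
    have : mon (0 : G) 0 c ^ j = mon 0 0 (c ^ j) := by simp [mon_pow]
    rw [mul_pow, this, zsmul_eq_mul]
    push_cast
    ring
  have hterm : ∀ j ∈ Finset.range (K + 1), nn n ((K.choose j : ℤ) • (mon 0 0 (c ^ j) *
      (((mon x s 1 - mon y t 1) * (mon x s 1 + mon y t 1) ^ j) * r ^ (K - j)))) ≤
      σ * ((K.choose j : ℝ) * q ^ j * (1 - q) ^ (K - j) * (1 / ((j : ℝ) + 1))) +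
        1 / σ * (q ^ j * (1 - q) ^ (K - j) * K.choose j) := by
    intro j _
    have hj : (0 : ℝ) < j + 1 := by positivity
    have hs : 0 < √((j : ℝ) + 1) := Real.sqrt_pos.2 hj
    have hss : √((j : ℝ) + 1) ^ 2 = j + 1 := Real.sq_sqrt hj.le
    have hamgm : 2 / √((j : ℝ) + 1) ≤ σ * (1 / ((j : ℝ) + 1)) + 1 / σ := by
      have haux : ∀ τ : ℝ, 0 < τ → 2 / τ ≤ σ * (1 / τ ^ 2) + 1 / σ := by
        intro τ hτ
        rw [← sub_nonneg]
        have : σ * (1 / τ ^ 2) + 1 / σ - 2 / τ = (σ - τ) ^ 2 / (σ * τ ^ 2) := by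
          field_simp
          ring
        rw [this]
        positivity
      simpa only [hss] using haux _ hs
    have h1q : 0 ≤ 1 - q := by linarith
    rw [nn_zsmul]
    push_cast
    rw [Nat.abs_cast]
    calc (K.choose j : ℝ) * nn n (mon 0 0 (c ^ j) *
          (((mon x s 1 - mon y t 1) * (mon x s 1 + mon y t 1) ^ j) * r ^ (K - j)))
        ≤ (K.choose j : ℝ) * (c ^ j * ((2 ^ j * (2 / √((j : ℝ) + 1))) * (1 - q) ^ (K - j))) := by
          refine mul_le_mul_of_nonneg_left ?_ (by positivity)
          refine (nn_mul_le _ _ _).trans (mul_le_mul ?_ ?_ (nn_nonneg _ _) (by positivity))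
          · exact (nn_mon_le _ _ _ _).trans (abs_of_nonneg (by positivity)).le
          · refine (nn_mul_le _ _ _).trans (mul_le_mul (nn_sub_mul_add_pow_le _ _ _ _ _ _) ?_
              (nn_nonneg _ _) (by positivity))
            exact (nn_pow_le _ _ _).trans (pow_le_pow_left₀ (nn_nonneg _ _) (hr n) _)
      _ = ((K.choose j : ℝ) * q ^ j * (1 - q) ^ (K - j)) * (2 / √((j : ℝ) + 1)) := by
          rw [hq, mul_pow]
          ring
      _ ≤ ((K.choose j : ℝ) * q ^ j * (1 - q) ^ (K - j)) *
          (σ * (1 / ((j : ℝ) + 1)) + 1 / σ) := mul_le_mul_of_nonneg_left hamgm (by positivity)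
      _ = _ := by ring
  rw [hexp]
  refine (nn_sum_le _ _ _).trans ((Finset.sum_le_sum hterm).trans ?_)
  rw [Finset.sum_add_distrib, ← Finset.mul_sum, ← Finset.mul_sum, ← add_pow]
  calc _ ≤ σ * (1 / (q * (K + 1))) + 1 / σ * (q + (1 - q)) ^ K := by
        have := mul_le_mul_of_nonneg_left (sum_choose_mul_div_le hq0 hq1 K) hσ0.le
        linarith
    _ = (1 / q + 1) / σ := by
        rw [← hσσ]
        simp only [add_sub_cancel, one_pow]
        field_simp

variable {b u v : PowerSeries (AddMonoidAlgebra ℝ G)}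

lemma Small.sub (hu : Small b u) (hv : Small b v) : Small b (u - v) := by
  obtain ⟨C, hC, h⟩ := hu
  obtain ⟨D, hD, h'⟩ := hv
  refine ⟨C + D, by positivity, fun K n => ?_⟩
  rw [sub_mul, add_div]
  exact (nn_sub_le _ _ _).trans (add_le_add (h K n) (h' K n))

lemma Small.mul_left (hu : Small b u) (hv : Mom v) : Small b (v * u) := by
  obtain ⟨C, hC, h⟩ := hu
  obtain ⟨D, hD, h'⟩ := hv.exists_nn_le
  refine ⟨D * C, by positivity, fun K n => ?_⟩
  rw [mul_assoc, mul_div_assoc]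
  exact (nn_mul_le _ _ _).trans (mul_le_mul (h' n) (h K n) (nn_nonneg _ _) hD.le)

lemma Small.add (hu : Small b u) (hv : Small b v) : Small b (u + v) := by
  obtain ⟨C, hC, h⟩ := hu
  obtain ⟨D, hD, h'⟩ := hv
  refine ⟨C + D, by positivity, fun K n => ?_⟩
  rw [add_mul, add_div]
  exact (nn_add_le _ _ _).trans (add_le_add (h K n) (h' K n))

lemma Small.of_mon_mul {x : G} {t : ℕ} (h : Small b (mon x t 1 * u)) : Small b u := by
  obtain ⟨C, hC, h⟩ := h
  refine ⟨C, hC, fun K n => (nn_le_nn_mon_mul n x t _).trans ?_⟩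
  rw [← mul_assoc]
  exact h K _

end

section
variable {d : ℕ} {P : Measure (Env d)} {η : ℝ}

lemma Good.small_one_sub_sq (hG : Good P η) {ℓ : Fin d → ℝ} {e : StepIdx d}
    (he : 0 < dotR (stepVec e) ℓ) : Small (gs (aq P (Blk ℓ))) (1 - mon 0 2 1) := by
  have h := small_of_splits (hG.splits_blk he (blk_four he he.le) (blk_six he)
    (by simp))
  refine Small.of_mon_mul (x := stepVec e + stepVec e) (t := 4) ?_
  rw [mul_sub, mul_one, mon_mul_mon]
  simpa using h

lemma Good.small_one_sub_step (hG : Good P η) {ℓ : Fin d → ℝ} {e : StepIdx d}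
    (he : 0 < dotR (stepVec e) ℓ) (s : StepIdx d) :
    Small (gs (aq P (Blk ℓ))) (1 - mon (stepVec s) 1 1) := by
  have hsq := hG.small_one_sub_sq he
  have hpos : ∀ s : StepIdx d, 0 ≤ dotR (stepVec s) ℓ →
      Small (gs (aq P (Blk ℓ))) (1 - mon (stepVec s) 1 1) := by
    intro s hs
    have h := small_of_splits (hG.splits_blk he (blk_singleton he) (blk_four he hs)
      (by simp))
    have h3 : Small (gs (aq P (Blk ℓ))) (1 - mon (stepVec s) 3 1) := by
      refine Small.of_mon_mul (x := stepVec e) (t := 1) ?_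
      rw [mul_sub, mul_one, mon_mul_mon]
      simpa [add_comm (stepVec e)] using h
    have h4 : (1 : PowerSeries (AddMonoidAlgebra ℝ (Site d))) - mon (stepVec s) 1 1 =
        (1 - mon (stepVec s) 3 1) - mon (stepVec s) 1 1 * (1 - mon 0 2 1) := by
      rw [mul_sub, mul_one, mon_mul_mon]
      simp only [add_zero, mul_one]
      ring
    rw [h4]
    exact h3.sub (hsq.mul_left (mom_mon _ _ _))
  rcases le_total 0 (dotR (stepVec s) ℓ) with hs | hs
  · exact hpos s hs
  · have h := hpos (rev s) (by
      rw [stepVec_rev, dotR_neg]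
      linarith)
    refine Small.of_mon_mul (x := stepVec (rev s)) (t := 1) ?_
    have h4 : mon (stepVec (rev s)) 1 1 * (1 - mon (stepVec s) 1 1) =
        (1 - mon 0 2 1) - (1 - mon (stepVec (rev s)) 1 1) := by
      rw [mul_sub, mul_one, mon_mul_mon]
      simp
    rw [h4]
    exact hsq.sub h

lemma Good.small_one_sub_two_steps (hG : Good P η) {ℓ : Fin d → ℝ} {e : StepIdx d}
    (he : 0 < dotR (stepVec e) ℓ) (s s' : StepIdx d) :
    Small (gs (aq P (Blk ℓ))) (1 - mon (stepVec s + stepVec s') 0 1) := by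
  refine Small.of_mon_mul (x := 0) (t := 2) ?_
  have h4 : mon (0 : Site d) 2 1 * (1 - mon (stepVec s + stepVec s') 0 1) =
      ((1 - mon (stepVec s) 1 1) + mon (stepVec s) 1 1 * (1 - mon (stepVec s') 1 1)) -
        (1 - mon 0 2 1) := by
    rw [mul_sub, mul_one, mon_mul_mon, mul_sub, mul_one, mon_mul_mon]
    simp only [zero_add, mul_one, add_zero]
    ring
  rw [h4]
  exact ((hG.small_one_sub_step he s).add
    ((hG.small_one_sub_step he s').mul_left (mom_mon _ _ _))).sub (hG.small_one_sub_sq he)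

end

section
variable {G : Type*} [AddCommGroup G]

lemma exists_nn_prod_mul_pow_le {b : PowerSeries (AddMonoidAlgebra ℝ G)}
    (us : List (PowerSeries (AddMonoidAlgebra ℝ G))) (hus : ∀ u ∈ us, Small b u) :
    ∃ C : ℝ, 0 < C ∧ ∀ K n : ℕ, nn n (us.prod * b ^ (us.length * K)) ≤
      C / √((K : ℝ) + 1) ^ us.length := by
  induction us with
  | nil => exact ⟨1, one_pos, fun K n => by simpa using nn_one_le n⟩
  | cons u us ih =>
    obtain ⟨C, hC, h⟩ := ih fun v hv => hus v (List.mem_cons_of_mem u hv)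
    obtain ⟨D, hD, h'⟩ := hus u List.mem_cons_self
    refine ⟨(D + 1) * C, by positivity, fun K n => ?_⟩
    have hs : 0 < √((K : ℝ) + 1) := Real.sqrt_pos.2 (by positivity)
    have heq : (u :: us).prod * b ^ ((u :: us).length * K) =
        (u * b ^ K) * (us.prod * b ^ (us.length * K)) := by
      rw [List.prod_cons, List.length_cons, Nat.succ_mul, pow_add]
      ring
    rw [heq, List.length_cons, pow_succ']
    calc _ ≤ (D / √((K : ℝ) + 1)) * (C / √((K : ℝ) + 1) ^ us.length) :=
          (nn_mul_le _ _ _).trans (mul_le_mul (h' K n) (h K n) (nn_nonneg _ _) (by positivity))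
      _ = D * C / (√((K : ℝ) + 1) * √((K : ℝ) + 1) ^ us.length) := by
          rw [div_mul_div_comm]
      _ ≤ _ := by
          refine div_le_div_of_nonneg_right ?_ (by positivity)
          nlinarith

lemma mom_list_prod (us : List (PowerSeries (AddMonoidAlgebra ℝ G))) (hus : ∀ u ∈ us, Mom u) :
    Mom us.prod := by
  induction us with
  | nil => exact mom_one
  | cons u us ih =>
    rw [List.prod_cons]
    exact (hus u List.mem_cons_self).mul (ih fun v hv => hus v (List.mem_cons_of_mem u hv))

/-- For moderate `t` a slowly growing exponential weight is dominated by a polynomial one. -/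
lemma exp_weight_le {n Q t : ℕ} (hn : 1 ≤ n) (hlog : (Q : ℝ) * Real.log n ≤ √n) (ht : t ≤ n) :
    Real.exp (Q * Real.log n / n * t) ≤ 3 * (1 + (t : ℝ)) ^ (2 * Q) := by
  have hn0 : (0 : ℝ) < n := by exact_mod_cast hn
  have hL : 0 ≤ Real.log (n : ℝ) := Real.log_natCast_nonneg n
  have hone : (1 : ℝ) ≤ (1 + (t : ℝ)) ^ (2 * Q) :=
    one_le_pow₀ (by linarith [(Nat.cast_nonneg t : (0 : ℝ) ≤ t)])
  rcases le_total ((t : ℝ)) (√n) with h | h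
  · have h1 : Q * Real.log n / n * t ≤ 1 := by
      rw [div_mul_eq_mul_div, div_le_one hn0]
      calc Q * Real.log n * t ≤ √n * √n := mul_le_mul hlog h (by positivity) (by positivity)
        _ = n := Real.mul_self_sqrt hn0.le
    have h2 : Real.exp 1 < 3 := Real.exp_one_lt_three
    have h3 := Real.exp_le_exp.2 h1
    linarith
  · have h1 : Q * Real.log n / n * t ≤ Q * Real.log n := by
      rw [div_mul_eq_mul_div, div_le_iff₀ hn0]
      refine mul_le_mul_of_nonneg_left (by exact_mod_cast ht) (by positivity)
    have h2 : Real.exp (Q * Real.log n) = (n : ℝ) ^ Q := by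
      rw [← Real.log_pow, Real.exp_log (by positivity)]
    have h3 : (n : ℝ) ≤ (1 + (t : ℝ)) ^ 2 := by
      have h4 : (n : ℝ) ≤ (t : ℝ) ^ 2 := by
        rw [← Real.sq_sqrt hn0.le]
        exact pow_le_pow_left₀ (by positivity) h 2
      nlinarith [(Nat.cast_nonneg t : (0 : ℝ) ≤ t)]
    calc Real.exp (Q * Real.log n / n * t) ≤ (n : ℝ) ^ Q := h2 ▸ Real.exp_le_exp.2 h1
      _ ≤ (1 + (t : ℝ)) ^ (2 * Q) := by
          rw [pow_mul]
          exact pow_le_pow_left₀ hn0.le h3 Q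
      _ ≤ _ := by linarith

lemma exp_weight_le_one_add {n Q t : ℕ} (hn : 1 ≤ n) (hlog : (Q : ℝ) * Real.log n ≤ √n)
    (ht : t ≤ n) : Real.exp (Q * Real.log n / n * t) ≤
      1 + 3 * (Q * Real.log n / n) * (1 + (t : ℝ)) ^ (2 * Q + 1) := by
  set lam := Q * Real.log n / n with hlam
  have hL : 0 ≤ Real.log (n : ℝ) := Real.log_natCast_nonneg n
  have hlam0 : 0 ≤ lam := by positivity
  have h1 := exp_weight_le hn hlog ht
  have h2 : Real.exp (lam * t) ≤ 1 + lam * t * Real.exp (lam * t) := by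
    have h3 := Real.add_one_le_exp (-(lam * t))
    have h4 : Real.exp (-(lam * t)) * Real.exp (lam * t) = 1 := by
      rw [← Real.exp_add]
      simp
    nlinarith [Real.exp_pos (lam * t)]
  refine h2.trans (add_le_add_right ?_ 1)
  calc lam * t * Real.exp (lam * t) ≤ lam * (1 + t) * (3 * (1 + (t : ℝ)) ^ (2 * Q)) :=
        mul_le_mul (mul_le_mul_of_nonneg_left (by linarith) hlam0) h1 (Real.exp_pos _).le
          (by positivity)
    _ = _ := by ring

lemma Mom.exists_wnm_exp_le {φ : PowerSeries (AddMonoidAlgebra ℝ G)} (hφ : Mom φ) (Q : ℕ) :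
    ∃ C : ℝ, 0 < C ∧ ∀ n : ℕ, 1 ≤ n → (Q : ℝ) * Real.log n ≤ √n →
      wnm (fun t => Real.exp (Q * Real.log n / n * t)) n φ ≤ C := by
  obtain ⟨C, hC⟩ := hφ (2 * Q)
  have hC0 : 0 ≤ C := (wnm_nonneg (polyWeight_nonneg _) 0 φ).trans (hC 0)
  refine ⟨3 * C + 1, by positivity, fun n hn hlog => ?_⟩
  calc wnm (fun t => Real.exp (Q * Real.log n / n * t)) n φ
      ≤ ∑ t ∈ Finset.range (n + 1), 3 * ((1 + (t : ℝ)) ^ (2 * Q) *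
        n1 (PowerSeries.coeff t φ)) := by
        refine Finset.sum_le_sum fun t ht => ?_
        rw [Finset.mem_range] at ht
        rw [← mul_assoc]
        exact mul_le_mul_of_nonneg_right (exp_weight_le hn hlog (by omega)) (n1_nonneg _)
    _ = 3 * wnm (fun t => (1 + (t : ℝ)) ^ (2 * Q)) n φ := by
        rw [wnm, Finset.mul_sum]
    _ ≤ _ := by linarith [hC n]

lemma Mom.exists_wnm_exp_le_one_add {b : PowerSeries (AddMonoidAlgebra ℝ G)} (hb : Mom b)
    (hb1 : ∀ n, nn n b ≤ 1) (Q : ℕ) :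
    ∃ S : ℝ, 1 ≤ S ∧ ∀ n : ℕ, 1 ≤ n → (Q : ℝ) * Real.log n ≤ √n →
      wnm (fun t => Real.exp (Q * Real.log n / n * t)) n b ≤
        1 + 3 * (Q * Real.log n / n) * S := by
  obtain ⟨C, hC⟩ := hb (2 * Q + 1)
  refine ⟨max C 1, le_max_right _ _, fun n hn hlog => ?_⟩
  have hL : 0 ≤ Real.log (n : ℝ) := Real.log_natCast_nonneg n
  set lam := Q * Real.log n / n with hlam
  have hlam0 : 0 ≤ lam := by positivity
  calc wnm (fun t => Real.exp (lam * t)) n b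
      ≤ ∑ t ∈ Finset.range (n + 1), (n1 (PowerSeries.coeff t b) + 3 * lam *
        ((1 + (t : ℝ)) ^ (2 * Q + 1) * n1 (PowerSeries.coeff t b))) := by
        refine Finset.sum_le_sum fun t ht => ?_
        rw [Finset.mem_range] at ht
        refine (mul_le_mul_of_nonneg_right (exp_weight_le_one_add hn hlog (by omega))
          (n1_nonneg _)).trans (le_of_eq ?_)
        ring
    _ = nn n b + 3 * lam * wnm (fun t => (1 + (t : ℝ)) ^ (2 * Q + 1)) n b := by
        rw [Finset.sum_add_distrib, ← Finset.mul_sum, nn_eq, wnm]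
    _ ≤ 1 + 3 * lam * max C 1 := by
        refine add_le_add (hb1 n) (mul_le_mul_of_nonneg_left ((hC n).trans (le_max_left _ _))
          (by positivity))

lemma exists_forall_mul_log_le (Q : ℕ) :
    ∃ n₀ : ℕ, 1 ≤ n₀ ∧ ∀ n : ℕ, n₀ ≤ n → (Q : ℝ) * Real.log n ≤ √n := by
  have h := (isLittleO_log_rpow_atTop (r := 1 / 2) (by norm_num)).bound
    (c := 1 / ((Q : ℝ) + 1)) (by positivity)
  have h' := tendsto_natCast_atTop_atTop (R := ℝ) |>.eventually h
  obtain ⟨n₀, hn₀⟩ := eventually_atTop.1 h'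
  refine ⟨max n₀ 1, le_max_right _ _, fun n hn => ?_⟩
  have h1 := hn₀ n ((le_max_left _ _).trans hn)
  have hL : 0 ≤ Real.log (n : ℝ) := Real.log_natCast_nonneg n
  rw [Real.norm_of_nonneg hL, Real.norm_of_nonneg (by positivity), ← Real.sqrt_eq_rpow,
    div_mul_eq_mul_div, one_mul, le_div_iff₀ (by positivity)] at h1
  nlinarith

/-- Truncation error in the iterated renewal equation. -/
lemma exists_renewal_error_le {b : PowerSeries (AddMonoidAlgebra ℝ G)}
    {U N f g : PowerSeries (AddMonoidAlgebra ℝ G)} (hU : Mom U) (hN : Mom N) (hf : Mom f)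
    (hg : Mom g) (hb : Mom b) (hb1 : ∀ n, nn n b ≤ 1) (m : ℕ) :
    ∃ S A : ℝ, ∃ n₀ : ℕ, 1 ≤ S ∧ 0 < A ∧ ∀ n K : ℕ, n₀ ≤ n → 1 ≤ n → 12 * S * K ≤ n →
      n1 (PowerSeries.coeff n (U * (N + f * g * ∑ k ∈ Finset.range K, b ^ k))) ≤
        A / √(n : ℝ) ^ m := by
  set r := m + 1 with hr
  obtain ⟨CU, hCU, hU'⟩ := hU.exists_wnm_exp_le (4 * r)
  obtain ⟨CN, hCN, hN'⟩ := hN.exists_wnm_exp_le (4 * r)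
  obtain ⟨Cf, hCf, hf'⟩ := hf.exists_wnm_exp_le (4 * r)
  obtain ⟨Cg, hCg, hg'⟩ := hg.exists_wnm_exp_le (4 * r)
  obtain ⟨S, hS, hb'⟩ := hb.exists_wnm_exp_le_one_add hb1 (4 * r)
  obtain ⟨n₀, _, hlog⟩ := exists_forall_mul_log_le (4 * r)
  refine ⟨S, CU * (CN + Cf * Cg), n₀, hS, by positivity, fun n K hn hn1 hK => ?_⟩
  have hlogn := hlog n hn
  specialize hU' n hn1 hlogn
  specialize hN' n hn1 hlogn
  specialize hf' n hn1 hlogn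
  specialize hg' n hn1 hlogn
  specialize hb' n hn1 hlogn
  have hL : 0 ≤ Real.log (n : ℝ) := Real.log_natCast_nonneg n
  have hn0 : (0 : ℝ) < n := by exact_mod_cast hn1
  have hn1' : (1 : ℝ) ≤ n := by exact_mod_cast hn1
  set lam := ((4 * r : ℕ) : ℝ) * Real.log n / n with hlam
  have hlam0 : 0 ≤ lam := by positivity
  have hlamn : lam * n = 4 * (r * Real.log n) := by
    rw [hlam]
    push_cast
    field_simp
  set w : ℕ → ℝ := fun t => Real.exp (lam * t) with hw
  have hw0 : ∀ t, 0 ≤ w t := fun t => (Real.exp_pos _).le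
  have hwm : ∀ s t, w (s + t) ≤ w s * w t := by
    intro s t
    rw [hw]
    simp only
    rw [← Real.exp_add]
    push_cast
    rw [mul_add]
  have hwn : w n = (n : ℝ) ^ (4 * r) := by
    rw [hw]
    simp only
    rw [hlamn, show (4 : ℝ) * (r * Real.log n) = ((4 * r : ℕ) : ℝ) * Real.log n by push_cast; ring,
      ← Real.log_pow, Real.exp_log (by positivity)]
  have hKn : (K : ℝ) ≤ n := by
    have : (K : ℝ) ≤ 12 * S * K := le_mul_of_one_le_left (by positivity) (by linarith)
    linarith
  have hpowb : ∀ k, wnm w n (b ^ k) ≤ (1 + 3 * lam * S) ^ k := by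
    intro k
    induction k with
    | zero =>
      rw [pow_zero, pow_zero, one_eq_mon]
      refine (wnm_mon_le hw0 n 0 0 1).trans ?_
      simp [hw]
    | succ k ih =>
      rw [pow_succ, pow_succ]
      exact (wnm_mul_le hw0 hwm n _ _).trans (mul_le_mul ih hb' (wnm_nonneg hw0 n b)
        (by positivity))
  have hpowK : (1 + 3 * lam * S) ^ K ≤ (n : ℝ) ^ r := by
    calc (1 + 3 * lam * S) ^ K ≤ Real.exp (3 * lam * S) ^ K := by
          refine pow_le_pow_left₀ (by positivity) ?_ K
          linarith [Real.add_one_le_exp (3 * lam * S)]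
      _ = Real.exp (K * (3 * lam * S)) := by rw [← Real.exp_nat_mul]
      _ ≤ Real.exp (r * Real.log n) := by
          refine Real.exp_le_exp.2 ?_
          have : 4 * (K * (3 * lam * S)) ≤ lam * n := by
            calc 4 * (K * (3 * lam * S)) = lam * (12 * S * K) := by ring
              _ ≤ lam * n := mul_le_mul_of_nonneg_left hK hlam0
          linarith
      _ = (n : ℝ) ^ r := by rw [← Real.log_pow, Real.exp_log (by positivity)]
  have hsum : wnm w n (∑ k ∈ Finset.range K, b ^ k) ≤ (n : ℝ) ^ (r + 1) := by
    calc wnm w n (∑ k ∈ Finset.range K, b ^ k) ≤ ∑ k ∈ Finset.range K, wnm w n (b ^ k) :=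
          wnm_sum_le hw0 n _ _
      _ ≤ ∑ k ∈ Finset.range K, (n : ℝ) ^ r := by
          refine Finset.sum_le_sum fun k hk => (hpowb k).trans (le_trans ?_ hpowK)
          rw [Finset.mem_range] at hk
          refine pow_le_pow_right₀ ?_ hk.le
          have : 0 ≤ 3 * lam * S := by positivity
          linarith
      _ = K * (n : ℝ) ^ r := by simp
      _ ≤ _ := by
          rw [pow_succ' (n : ℝ) r]
          exact mul_le_mul_of_nonneg_right hKn (by positivity)
  have hone : (1 : ℝ) ≤ (n : ℝ) ^ (r + 1) := one_le_pow₀ hn1'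
  have htotal : wnm w n (U * (N + f * g * ∑ k ∈ Finset.range K, b ^ k)) ≤
      CU * (CN + Cf * Cg) * (n : ℝ) ^ (r + 1) := by
    rw [mul_assoc CU]
    refine (wnm_mul_le hw0 hwm n _ _).trans (mul_le_mul hU' ?_ (wnm_nonneg hw0 n _) hCU.le)
    refine (wnm_add_le hw0 n _ _).trans ?_
    rw [add_mul]
    refine add_le_add (hN'.trans (le_mul_of_one_le_right hCN.le hone)) ?_
    refine (wnm_mul_le hw0 hwm n _ _).trans (mul_le_mul ?_ hsum (wnm_nonneg hw0 n _)
      (by positivity))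
    exact (wnm_mul_le hw0 hwm n _ _).trans (mul_le_mul hf' hg' (wnm_nonneg hw0 n _) hCf.le)
  have hfinal := (mul_n1_coeff_le_wnm hw0 n _).trans htotal
  rw [hwn] at hfinal
  have hsq : √(n : ℝ) ^ m ≤ (n : ℝ) ^ (3 * m + 2) := by
    have h1 : √(n : ℝ) ≤ n := by
      rw [Real.sqrt_le_left hn0.le]
      nlinarith
    calc √(n : ℝ) ^ m ≤ (n : ℝ) ^ m := pow_le_pow_left₀ (by positivity) h1 m
      _ ≤ _ := pow_le_pow_right₀ hn1' (by omega)
  have hs0 : 0 < √(n : ℝ) ^ m := pow_pos (Real.sqrt_pos.2 hn0) m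
  rw [le_div_iff₀ hs0]
  refine le_trans (mul_le_mul_of_nonneg_left hsq (n1_nonneg _)) ?_
  refine le_of_mul_le_mul_right ?_ (pow_pos hn0 (r + 1))
  calc _ = (n : ℝ) ^ (4 * r) *
        n1 (PowerSeries.coeff n (U * (N + f * g * ∑ k ∈ Finset.range K, b ^ k))) := by
        rw [mul_assoc, ← pow_add, mul_comm, show 3 * m + 2 + (r + 1) = 4 * r by omega]
    _ ≤ _ := hfinal

/-- Local limit bound: every small factor gains `n^{-1/2}` in `ℓ¹`. -/
theorem exists_n1_coeff_le {p N f g b q : PowerSeries (AddMonoidAlgebra ℝ G)}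
    (hp : p = N + f * q) (hq : q = g + b * q) (hp1 : ∀ n, n1 (PowerSeries.coeff n p) ≤ 1)
    (hq1 : ∀ n, n1 (PowerSeries.coeff n q) ≤ 1) (hN : Mom N) (hf : Mom f) (hg : Mom g)
    (hb : Mom b) (hb1 : ∀ n, nn n b ≤ 1)
    (us : List (PowerSeries (AddMonoidAlgebra ℝ G))) (hus : ∀ u ∈ us, Small b u)
    (husm : ∀ u ∈ us, Mom u) :
    ∃ C : ℝ, 0 < C ∧ ∀ n : ℕ, 1 ≤ n →
      n1 (PowerSeries.coeff n (us.prod * p)) ≤ C / √(n : ℝ) ^ us.length := by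
  set m := us.length with hm
  have hU := mom_list_prod us husm
  obtain ⟨S, A, n₀, hS, hA, herr⟩ := exists_renewal_error_le hU hN hf hg hb hb1 m
  obtain ⟨C₁, hC₁, hmain⟩ := exists_nn_prod_mul_pow_le us hus
  obtain ⟨Cf, hCf, hf'⟩ := hf.exists_nn_le
  obtain ⟨CU, hCU, hU'⟩ := hU.exists_nn_le
  set D := 12 * S * (m + 1) with hD
  have hD0 : 0 < D := by positivity
  refine ⟨A + Cf * (C₁ * √D ^ m) + CU * √(n₀ : ℝ) ^ m, by positivity, fun n hn => ?_⟩
  have hn0 : (0 : ℝ) < n := by exact_mod_cast hn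
  have hs0 : 0 < √(n : ℝ) ^ m := pow_pos (Real.sqrt_pos.2 hn0) m
  rcases le_total n₀ n with hnn | hnn
  · set K₀ := ⌊(n : ℝ) / D⌋₊ with hK₀
    have hK₀1 : (K₀ : ℝ) ≤ n / D := Nat.floor_le (by positivity)
    have hK₀2 : (n : ℝ) / D ≤ K₀ + 1 := (Nat.lt_floor_add_one _).le
    have hK : 12 * S * ((m * K₀ : ℕ) : ℝ) ≤ n := by
      rw [le_div_iff₀ hD0, hD] at hK₀1
      push_cast
      have : 0 ≤ (K₀ : ℝ) * (12 * S) := by positivity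
      nlinarith
    have hiter : ∀ K, q = g * ∑ k ∈ Finset.range K, b ^ k + b ^ K * q := by
      intro K
      induction K with
      | zero => simp
      | succ K ih =>
        rw [Finset.sum_range_succ, pow_succ]
        linear_combination ih + b ^ K * hq
    have hdec : us.prod * p = us.prod * (N + f * g * ∑ k ∈ Finset.range (m * K₀), b ^ k) +
        (f * (us.prod * b ^ (m * K₀))) * q := by
      linear_combination us.prod * hp + us.prod * f * hiter (m * K₀)
    rw [hdec, map_add]
    have h1 := herr n (m * K₀) hnn hn hK
    have h2 : n1 (PowerSeries.coeff n ((f * (us.prod * b ^ (m * K₀))) * q)) ≤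
        Cf * (C₁ * √D ^ m) / √(n : ℝ) ^ m := by
      refine (n1_coeff_mul_le fun s _ => hq1 s).trans ?_
      rw [mul_one]
      refine (nn_mul_le _ _ _).trans ?_
      rw [mul_div_assoc]
      refine mul_le_mul (hf' n) ((hmain K₀ n).trans ?_) (nn_nonneg _ _) hCf.le
      have h3 : √(n : ℝ) ≤ √D * √((K₀ : ℝ) + 1) := by
        rw [← Real.sqrt_mul hD0.le]
        refine Real.sqrt_le_sqrt ?_
        rw [div_le_iff₀ hD0] at hK₀2
        linarith
      rw [div_le_div_iff₀ (by positivity) hs0, mul_assoc, ← mul_pow]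
      exact mul_le_mul_of_nonneg_left (pow_le_pow_left₀ (by positivity) h3 m) hC₁.le
    refine (n1_add_le _ _).trans ?_
    rw [add_div, add_div]
    have h3 : 0 ≤ CU * √(n₀ : ℝ) ^ m / √(n : ℝ) ^ m := by positivity
    linarith
  · have h1 : n1 (PowerSeries.coeff n (us.prod * p)) ≤ CU := by
      refine (n1_coeff_mul_le fun s _ => hp1 s).trans ?_
      rw [mul_one]
      exact hU' n
    have h2 : √(n : ℝ) ^ m ≤ √(n₀ : ℝ) ^ m :=
      pow_le_pow_left₀ (by positivity) (Real.sqrt_le_sqrt (by exact_mod_cast hnn)) m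
    rw [le_div_iff₀ hs0]
    have h3 : 0 ≤ A + Cf * (C₁ * √D ^ m) := by positivity
    have h4 : n1 (PowerSeries.coeff n (us.prod * p)) * √(n : ℝ) ^ m ≤ CU * √(n₀ : ℝ) ^ m :=
      mul_le_mul h1 h2 hs0.le hCU.le
    linarith

end

section
variable {G : Type*} [AddCommGroup G]

lemma mon_zero_eq_C (x : G) (r : ℝ) :
    mon x 0 r = PowerSeries.C (AddMonoidAlgebra.single x r) := by
  rw [mon, PowerSeries.monomial_zero_eq_C_apply]

lemma coeff_single_one_mul (v : G) (a : AddMonoidAlgebra ℝ G) (x : G) :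
    (AddMonoidAlgebra.single v (1 : ℝ) * a).coeff x = a.coeff (x - v) := by
  rw [AddMonoidAlgebra.coeff_single_mul_eq_mul_coeff (m₂ := x - v) (H := by
    intro m _
    rw [eq_sub_iff_add_eq, add_comm]), one_mul]

lemma coeff_one_sub_single_mul (v : G) (a : AddMonoidAlgebra ℝ G) (x : G) :
    ((1 - AddMonoidAlgebra.single v (1 : ℝ)) * a).coeff x = a.coeff x - a.coeff (x - v) := by
  rw [sub_mul, one_mul, AddMonoidAlgebra.coeff_sub, Finsupp.sub_apply, coeff_single_one_mul]

lemma n1_single_one_mul_le (v : G) (a : AddMonoidAlgebra ℝ G) :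
    n1 (AddMonoidAlgebra.single v (1 : ℝ) * a) ≤ n1 a := by
  refine (n1_mul_le _ _).trans (le_of_eq ?_)
  simp

/-- A finitely supported function is recovered from its differences along a ray. -/
lemma exists_coeff_eq_sum_one_sub_single_mul {v : G} (hv : Function.Injective fun k : ℕ => k • v)
    (a : AddMonoidAlgebra ℝ G) (x : G) : ∃ M : ℕ, a.coeff x = ∑ k ∈ Finset.range M,
      ((1 - AddMonoidAlgebra.single v (1 : ℝ)) * a).coeff (x - k • v) := by
  have hinj : Function.Injective fun k : ℕ => x - k • v :=
    fun i j h => hv (sub_right_injective h)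
  obtain ⟨_, ⟨M, rfl⟩, hM⟩ :=
    (Set.infinite_range_of_injective hinj).exists_notMem_finset a.coeff.support
  refine ⟨M, ?_⟩
  have h0 : a.coeff (x - M • v) = 0 := by simpa using hM
  have h1 : ∀ k : ℕ, ((1 - AddMonoidAlgebra.single v (1 : ℝ)) * a).coeff (x - k • v) =
      a.coeff (x - k • v) - a.coeff (x - (k + 1) • v) := by
    intro k
    rw [coeff_one_sub_single_mul, add_smul, one_smul, sub_sub]
  simp only [h1]
  rw [Finset.sum_range_sub' fun k => a.coeff (x - k • v), h0]
  simp

end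

section
variable {d : ℕ}

/-- The sup norm is controlled by the `ℓ¹` norm of the mixed differences: version with the
differences taken in the coordinates of `J`. -/
lemma abs_coeff_le_sum_prod_one_sub_single {v : Fin d → Site d} (hv : ∀ j, v j j = 2)
    (hv' : ∀ j i, i ≠ j → v j i = 0) (J : Finset (Fin d)) :
    ∀ (a : AddMonoidAlgebra ℝ (Site d)) (x : Site d) (s : Finset (Site d)),
      ((∏ j ∈ J, (1 - AddMonoidAlgebra.single (v j) (1 : ℝ))) * a).coeff.support ⊆ s →
      |a.coeff x| ≤ ∑ y ∈ s, if ∀ i ∉ J, y i = x i then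
        |((∏ j ∈ J, (1 - AddMonoidAlgebra.single (v j) (1 : ℝ))) * a).coeff y| else 0 := by
  classical
  induction J using Finset.induction_on with
  | empty =>
    intro a x s hs
    simp only [Finset.prod_empty, one_mul, Finset.notMem_empty, not_false_eq_true,
      forall_const] at hs ⊢
    by_cases hx : x ∈ s
    · refine le_trans (le_of_eq ?_) (Finset.single_le_sum (f := fun y => if ∀ i, y i = x i then
        |a.coeff y| else 0) (fun y _ => by split_ifs <;> simp) hx)
      simp
    · have : a.coeff x = 0 := by
        by_contra h
        exact hx (hs (Finsupp.mem_support_iff.2 h))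
      rw [this, abs_zero]
      exact Finset.sum_nonneg fun y _ => by split_ifs <;> simp
  | insert j J hj ih =>
    intro a x s hs
    rw [Finset.prod_insert hj, mul_comm (1 - _) (∏ j ∈ J, _), mul_assoc] at hs ⊢
    set a' := (1 - AddMonoidAlgebra.single (v j) (1 : ℝ)) * a with ha'
    set b := (∏ j ∈ J, (1 - AddMonoidAlgebra.single (v j) (1 : ℝ))) * a' with hb
    have hinj : Function.Injective fun k : ℕ => k • v j := by
      intro k k' h
      have h2 := congrFun h j
      simp only [Pi.smul_apply, hv, nsmul_eq_mul] at h2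
      omega
    obtain ⟨M, hM⟩ := exists_coeff_eq_sum_one_sub_single_mul hinj a x
    rw [hM]
    refine (Finset.abs_sum_le_sum_abs _ _).trans ((Finset.sum_le_sum fun k _ =>
      ih a' (x - k • v j) s hs).trans ?_)
    rw [Finset.sum_comm]
    refine Finset.sum_le_sum fun y _ => ?_
    by_cases hex : ∃ k : ℕ, ∀ i ∉ J, y i = (x - k • v j) i
    · obtain ⟨k, hk⟩ := hex
      have hy : ∀ i ∉ insert j J, y i = x i := by
        intro i hi
        rw [Finset.mem_insert, not_or] at hi
        simpa [hv' j i hi.1] using hk i hi.2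
      rw [if_pos hy]
      have huniq : ∀ k', (∀ i ∉ J, y i = (x - k' • v j) i) → k' = k := by
        intro k' hk'
        have h1 := hk j hj
        have h2 := hk' j hj
        rw [Pi.sub_apply, Pi.smul_apply, hv, nsmul_eq_mul] at h1 h2
        omega
      calc ∑ k' ∈ Finset.range M, (if ∀ i ∉ J, y i = (x - k' • v j) i then |b.coeff y| else 0)
          ≤ ∑ k' ∈ Finset.range M, (if k' = k then |b.coeff y| else 0) := by
            refine Finset.sum_le_sum fun k' _ => ?_
            split_ifs with h1 h2
            · exact le_rfl
            · exact absurd (huniq k' h1) h2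
            · exact abs_nonneg _
            · exact le_rfl
        _ ≤ |b.coeff y| := by
            rw [Finset.sum_ite_eq']
            split_ifs
            · exact le_rfl
            · exact abs_nonneg _
    · push Not at hex
      rw [Finset.sum_eq_zero]
      · split_ifs <;> simp
      · intro k _
        rw [if_neg]
        push Not
        exact hex k

lemma abs_coeff_le_n1_prod_one_sub_single {v : Fin d → Site d} (hv : ∀ j, v j j = 2)
    (hv' : ∀ j i, i ≠ j → v j i = 0) (a : AddMonoidAlgebra ℝ (Site d)) (x : Site d) :
    |a.coeff x| ≤ n1 ((∏ j, (1 - AddMonoidAlgebra.single (v j) (1 : ℝ))) * a) := by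
  refine (abs_coeff_le_sum_prod_one_sub_single hv hv' Finset.univ a x _ subset_rfl).trans ?_
  rw [n1_eq_sum _ subset_rfl]
  refine Finset.sum_le_sum fun y _ => ?_
  split_ifs
  · exact le_rfl
  · exact abs_nonneg _

/-- The generating series of the annealed one-point functions. -/
def walkSeries (P : Measure (Env d)) : PowerSeries (AddMonoidAlgebra ℝ (Site d)) :=
  gs (aq P fun _ => True)

variable {P : Measure (Env d)} {η : ℝ}

lemma Good.toReal_ann_eval (hG : Good P η) {Pq : Env d → Site d → Measure (Path d)}
    (hPq : IsQuenchedFamily Pq) (n : ℕ) (x y : Site d) :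
    (ann P Pq x {f | f n = y}).toReal =
      (PowerSeries.coeff n (walkSeries P)).coeff (y - x) := by
  classical
  rw [ann_eval hG hPq, ← hG.ofReal_tot_aq, tot, ENNReal.toReal_ofReal
    (Finset.sum_nonneg fun l _ => aq_nonneg P (fun l => disp l = y - x) l), walkSeries, coeff_gs,
    AddMonoidAlgebra.coeff_sum, Finsupp.finsetSum_apply]
  refine Finset.sum_congr rfl fun l _ => ?_
  by_cases h : disp l = y - x <;> simp [aq, h]

lemma coeff_walkSeries_nonneg (P : Measure (Env d)) (n : ℕ) (x : Site d) :
    0 ≤ (PowerSeries.coeff n (walkSeries P)).coeff x := by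
  classical
  rw [walkSeries, coeff_gs, AddMonoidAlgebra.coeff_sum, Finsupp.finsetSum_apply]
  refine Finset.sum_nonneg fun l _ => ?_
  rw [AddMonoidAlgebra.coeff_single, Finsupp.single_apply]
  split_ifs
  · exact aq_nonneg P _ l
  · exact le_rfl

lemma disp_parity (l : List (StepIdx d)) : (∑ i, disp l i + (l.length : ℤ)) % 2 = 0 := by
  induction l with
  | nil => simp
  | cons s l ih =>
    have hs : ∑ i, stepVec s i = if s.2 then 1 else -1 := by
      simp [stepVec]
    rw [disp_cons]
    simp only [Pi.add_apply, Finset.sum_add_distrib, hs, List.length_cons]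
    split_ifs <;> push_cast <;> omega

lemma coeff_walkSeries_eq_zero {n : ℕ} {x : Site d} (h : (∑ i, x i + (n : ℤ)) % 2 ≠ 0) :
    (PowerSeries.coeff n (walkSeries P)).coeff x = 0 := by
  classical
  rw [walkSeries, coeff_gs, AddMonoidAlgebra.coeff_sum, Finsupp.finsetSum_apply]
  refine Finset.sum_eq_zero fun l hl => ?_
  rw [AddMonoidAlgebra.coeff_single, Finsupp.single_apply, if_neg]
  rintro rfl
  rw [mem_words] at hl
  subst hl
  exact h (disp_parity l)

/-- The series whose multiplication takes a discrete derivative of the walk. -/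
def IsDiff (u : PowerSeries (AddMonoidAlgebra ℝ (Site d))) : Prop :=
  (∃ s, u = 1 - mon (stepVec s) 1 1) ∨ ∃ s s', u = 1 - mon (stepVec s + stepVec s') 0 1

/-- Every discrete derivative of the annealed one-point function gains a factor `n^{-1/2}`. -/
theorem Good.exists_n1_diff_walkSeries_le (hd : 4 ≤ d) (hG : Good P η) {ℓ : Fin d → ℝ} {κ : ℝ}
    (h2 : norm2R ℓ = 1) (hcone : Cone P ℓ (3 / 4) κ)
    (us : List (PowerSeries (AddMonoidAlgebra ℝ (Site d)))) (hus : ∀ u ∈ us, IsDiff u) :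
    ∃ C : ℝ, 0 < C ∧ ∀ n : ℕ, 1 ≤ n →
      n1 (PowerSeries.coeff n (us.prod * walkSeries P)) ≤ C / √(n : ℝ) ^ us.length := by
  obtain ⟨e, he⟩ := exists_step_pos h2
  have hle : ∀ (Q : List (StepIdx d) → Prop) n, n1 (PowerSeries.coeff n (gs (aq P Q))) ≤ 1 :=
    fun Q n => (n1_coeff_gs_le_tot (aq_nonneg P Q) n).trans (hG.tot_aq_le_one Q n)
  refine exists_n1_coeff_le (hG.gs_aq_eq ℓ (fun _ => True) fun _ _ _ => Iff.rfl)
    (hG.gs_pos_eq ℓ) (hle _) (hle _) (hG.mom_of_noCut hd h2 hcone fun l h => h.1)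
    (hG.mom_of_noCut hd h2 hcone fun l h => h.1.2.1)
    (hG.mom_of_noCut hd h2 hcone fun l h => h.1)
    (hG.mom_of_noCut hd h2 hcone fun l h => h.1.2.1) (hG.nn_blk_le_one he) us ?_ ?_
  · intro u hu
    rcases hus u hu with ⟨s, rfl⟩ | ⟨s, s', rfl⟩
    · exact hG.small_one_sub_step he s
    · exact hG.small_one_sub_two_steps he s s'
  · intro u hu
    rcases hus u hu with ⟨s, rfl⟩ | ⟨s, s', rfl⟩ <;> exact mom_one.sub (mom_mon _ _ _)

/-- The double step in direction `j`. -/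
def dbl (j : Fin d) : Site d := stepVec (j, true) + stepVec (j, true)

/-- The mixed difference operator in all coordinates. -/
def mixedDiff (d : ℕ) : List (PowerSeries (AddMonoidAlgebra ℝ (Site d))) :=
  List.ofFn fun j => 1 - mon (dbl j) 0 1

lemma isDiff_of_mem_mixedDiff {u : PowerSeries (AddMonoidAlgebra ℝ (Site d))}
    (hu : u ∈ mixedDiff d) : IsDiff u := by
  obtain ⟨j, rfl⟩ := (List.mem_ofFn' _ _).1 hu
  exact Or.inr ⟨_, _, rfl⟩

lemma abs_coeff_le_n1_mixedDiff (φ : PowerSeries (AddMonoidAlgebra ℝ (Site d))) (n : ℕ)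
    (x : Site d) : |(PowerSeries.coeff n φ).coeff x| ≤
      n1 (PowerSeries.coeff n ((mixedDiff d).prod * φ)) := by
  have h : (mixedDiff d).prod =
      PowerSeries.C (∏ j, (1 - AddMonoidAlgebra.single (dbl j) (1 : ℝ))) := by
    rw [mixedDiff, List.prod_ofFn, map_prod]
    refine Finset.prod_congr rfl fun j _ => ?_
    rw [mon_zero_eq_C, map_sub, map_one]
  rw [h, PowerSeries.coeff_C_mul]
  refine abs_coeff_le_n1_prod_one_sub_single (v := dbl) (fun j => ?_) (fun j i hij => ?_) _ x
  · simp [dbl, stepVec]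
  · simp [dbl, stepVec, hij]

/-- The space-time difference of the walk along one step. -/
lemma coeff_succ_one_sub_step_mul (s : StepIdx d)
    (φ : PowerSeries (AddMonoidAlgebra ℝ (Site d))) (n : ℕ) (x : Site d) :
    (PowerSeries.coeff (n + 1) ((1 - mon (stepVec s) 1 1) * φ)).coeff x =
      (PowerSeries.coeff (n + 1) φ).coeff x - (PowerSeries.coeff n φ).coeff (x - stepVec s) := by
  have hm : mon (stepVec s) 1 1 = PowerSeries.C (AddMonoidAlgebra.single (stepVec s) (1 : ℝ)) *
      PowerSeries.X := by
    rw [mon, PowerSeries.monomial_eq_mk]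
    ext1 m
    rw [PowerSeries.coeff_mk, PowerSeries.coeff_C_mul, PowerSeries.coeff_X]
    split_ifs <;> simp
  rw [sub_mul, one_mul, map_sub, AddMonoidAlgebra.coeff_sub, Finsupp.sub_apply, hm, mul_assoc,
    PowerSeries.coeff_C_mul, PowerSeries.coeff_succ_X_mul, coeff_single_one_mul]

end

section
variable {d : ℕ} {P : Measure (Env d)} {η : ℝ}

lemma div_sqrt_pow_eq (C : ℝ) {x : ℝ} (hx : 0 ≤ x) (m : ℕ) :
    C / √x ^ m = C * x ^ (-(m : ℝ) / 2) := by
  rw [div_eq_mul_inv, neg_div, Real.rpow_neg hx, Real.sqrt_eq_rpow, ← Real.rpow_natCast,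
    ← Real.rpow_mul hx]
  congr 3
  ring

lemma exists_stepVec_eq_of_norm1 {v : Site d} (h : norm1 v = 1) : ∃ s, v = stepVec s := by
  obtain ⟨l, hl, hlen⟩ := exists_disp_eq v
  have h1 : nr v = 1 := by
    have h2 : nr v = ((norm1 v : ℤ) : ℝ) := by simp [nr, norm1]
    rw [h2, h]
    norm_num
  rw [h1] at hlen
  obtain ⟨s, rfl⟩ := List.length_eq_one_iff.1 (by exact_mod_cast hlen : l.length = 1)
  exact ⟨s, by simpa using hl.symm⟩

lemma Good.exists_coeff_walkSeries_le (hd : 4 ≤ d) (hG : Good P η) {ℓ : Fin d → ℝ} {κ : ℝ}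
    (h2 : norm2R ℓ = 1) (hcone : Cone P ℓ (3 / 4) κ) : ∃ C : ℝ, 0 < C ∧ ∀ n : ℕ, 1 ≤ n →
      ∀ x : Site d, (PowerSeries.coeff n (walkSeries P)).coeff x ≤ C / √(n : ℝ) ^ d := by
  obtain ⟨C, hC, hle⟩ := hG.exists_n1_diff_walkSeries_le hd h2 hcone (mixedDiff d)
    fun u hu => isDiff_of_mem_mixedDiff hu
  refine ⟨C, hC, fun n hn x => (le_abs_self _).trans
    ((abs_coeff_le_n1_mixedDiff _ n x).trans ((hle n hn).trans (le_of_eq ?_)))⟩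
  simp [mixedDiff]

lemma Good.exists_abs_coeff_succ_sub_le (hd : 4 ≤ d) (hG : Good P η) {ℓ : Fin d → ℝ} {κ : ℝ}
    (h2 : norm2R ℓ = 1) (hcone : Cone P ℓ (3 / 4) κ) : ∃ C : ℝ, 0 < C ∧ ∀ n : ℕ, 1 ≤ n →
      ∀ (x : Site d) (s : StepIdx d), |(PowerSeries.coeff n (walkSeries P)).coeff x -
        (PowerSeries.coeff (n + 1) (walkSeries P)).coeff (x + stepVec s)| ≤
          C / √(n : ℝ) ^ (d + 1) := by
  have h : ∀ s : StepIdx d, ∃ C : ℝ, 0 < C ∧ ∀ n : ℕ, 1 ≤ n →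
      n1 (PowerSeries.coeff n (((mixedDiff d) ++ [1 - mon (stepVec s) 1 1]).prod *
        walkSeries P)) ≤ C / √(n : ℝ) ^ (d + 1) := by
    intro s
    obtain ⟨C, hC, hle⟩ := hG.exists_n1_diff_walkSeries_le hd h2 hcone
      ((mixedDiff d) ++ [1 - mon (stepVec s) 1 1]) (by
        intro u hu
        rw [List.mem_append, List.mem_singleton] at hu
        rcases hu with hu | hu
        · exact isDiff_of_mem_mixedDiff hu
        · exact Or.inl ⟨s, hu⟩)
    refine ⟨C, hC, fun n hn => (hle n hn).trans (le_of_eq ?_)⟩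
    simp [mixedDiff]
  choose C hC hle using h
  have hsum : ∀ s, C s ≤ ∑ s, C s := fun s =>
    Finset.single_le_sum (fun s _ => (hC s).le) (Finset.mem_univ s)
  have hs0 : 0 ≤ ∑ s, C s := Finset.sum_nonneg fun s _ => (hC s).le
  refine ⟨∑ s, C s + 1, by linarith, fun n hn x s => ?_⟩
  have hn0 : (0 : ℝ) < n := by exact_mod_cast hn
  have h1 := coeff_succ_one_sub_step_mul s (walkSeries P) n (x + stepVec s)
  rw [add_sub_cancel_right] at h1
  rw [abs_sub_comm, ← h1]
  refine (abs_coeff_le_n1_mixedDiff _ _ _).trans ?_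
  rw [← mul_assoc]
  have h3 := hle s (n + 1) (by omega)
  rw [List.prod_append, List.prod_singleton] at h3
  refine h3.trans ?_
  refine div_le_div₀ (by linarith) (by linarith [hsum s]) (pow_pos (Real.sqrt_pos.2 hn0) _) ?_
  refine pow_le_pow_left₀ (Real.sqrt_nonneg _) (Real.sqrt_le_sqrt ?_) _
  push_cast
  linarith

/-- Differences of the one-point function along even displacements, in `ℓ¹`. -/
lemma n1_one_sub_single_disp_mul_le {a : AddMonoidAlgebra ℝ (Site d)} {D : ℝ} (hD : 0 ≤ D)
    (h : ∀ s s' : StepIdx d,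
      n1 ((1 - AddMonoidAlgebra.single (stepVec s + stepVec s') (1 : ℝ)) * a) ≤ D) :
    ∀ l : List (StepIdx d), Even l.length →
      n1 ((1 - AddMonoidAlgebra.single (disp l) (1 : ℝ)) * a) ≤ l.length * D
  | [], _ => by
    rw [disp_nil, ← AddMonoidAlgebra.one_def, sub_self, zero_mul, n1_zero]
    simp
  | [s], hl => by simp at hl
  | s :: s' :: l, hl => by
    have hl' : Even l.length := by
      simp only [List.length_cons] at hl
      rw [Nat.even_iff] at hl ⊢
      omega
    have ih := n1_one_sub_single_disp_mul_le hD h l hl'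
    have heq : (1 - AddMonoidAlgebra.single (disp (s :: s' :: l)) (1 : ℝ)) * a =
        (1 - AddMonoidAlgebra.single (stepVec s + stepVec s') (1 : ℝ)) * a +
        AddMonoidAlgebra.single (stepVec s + stepVec s') (1 : ℝ) *
          ((1 - AddMonoidAlgebra.single (disp l) (1 : ℝ)) * a) := by
      have h1 : AddMonoidAlgebra.single (disp (s :: s' :: l)) (1 : ℝ) =
          AddMonoidAlgebra.single (stepVec s + stepVec s') (1 : ℝ) *
            AddMonoidAlgebra.single (disp l) (1 : ℝ) := by
        rw [AddMonoidAlgebra.single_mul_single, mul_one, disp_cons, disp_cons, add_assoc]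
      rw [h1]
      ring
    rw [heq]
    refine (n1_add_le _ _).trans ((add_le_add (h s s')
      ((n1_single_one_mul_le _ _).trans ih)).trans ?_)
    simp only [List.length_cons]
    push_cast
    linarith

lemma Good.exists_n1_one_sub_single_le (hd : 4 ≤ d) (hG : Good P η) {ℓ : Fin d → ℝ} {κ : ℝ}
    (h2 : norm2R ℓ = 1) (hcone : Cone P ℓ (3 / 4) κ) : ∃ D : ℝ, 0 < D ∧ ∀ n : ℕ, 1 ≤ n →
      ∀ v : Site d, (∑ i, v i) % 2 = 0 →
        n1 ((1 - AddMonoidAlgebra.single v (1 : ℝ)) * PowerSeries.coeff n (walkSeries P)) ≤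
          nr v * (D / √(n : ℝ)) := by
  have h : ∀ s s' : StepIdx d, ∃ C : ℝ, 0 < C ∧ ∀ n : ℕ, 1 ≤ n →
      n1 ((1 - AddMonoidAlgebra.single (stepVec s + stepVec s') (1 : ℝ)) *
        PowerSeries.coeff n (walkSeries P)) ≤ C / √(n : ℝ) := by
    intro s s'
    obtain ⟨C, hC, hle⟩ := hG.exists_n1_diff_walkSeries_le hd h2 hcone
      [1 - mon (stepVec s + stepVec s') 0 1] (by
        intro u hu
        rw [List.mem_singleton] at hu
        exact Or.inr ⟨s, s', hu⟩)
    refine ⟨C, hC, fun n hn => ?_⟩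
    have h3 := hle n hn
    rwa [List.prod_singleton, mon_zero_eq_C, ← map_one PowerSeries.C, ← map_sub,
      PowerSeries.coeff_C_mul, List.length_singleton, pow_one] at h3
  choose C hC hle using h
  have hs0 : 0 ≤ ∑ s, ∑ s', C s s' :=
    Finset.sum_nonneg fun s _ => Finset.sum_nonneg fun s' _ => (hC s s').le
  refine ⟨∑ s, ∑ s', C s s' + 1, by linarith, fun n hn v hv => ?_⟩
  obtain ⟨l, rfl, hlen⟩ := exists_disp_eq v
  rw [← hlen]
  refine n1_one_sub_single_disp_mul_le (by positivity) (fun s s' => ?_) l ?_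
  · refine (hle s s' n hn).trans (div_le_div_of_nonneg_right ?_ (Real.sqrt_nonneg _))
    have h4 : C s s' ≤ ∑ s', C s s' :=
      Finset.single_le_sum (fun s' _ => (hC s s').le) (Finset.mem_univ s')
    have h5 : ∑ s', C s s' ≤ ∑ s, ∑ s', C s s' :=
      Finset.single_le_sum (f := fun s => ∑ s', C s s')
        (fun s _ => Finset.sum_nonneg fun s' _ => (hC s s').le) (Finset.mem_univ s)
    linarith
  · have := disp_parity l
    rw [Nat.even_iff]
    omega

/-- The oscillation of a parity-supported function on a cube is bounded by its differences. -/
lemma iSup_cubeF_sub_le {n L : ℕ} {f : Site d → ℝ} (hf : ∀ x, 0 ≤ f x)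
    (hpar : ∀ x, (∑ i, x i + (n : ℤ)) % 2 ≠ 0 → f x = 0) {a x : Site d} (hx : x ∈ cubeF a L)
    (hxn : (∑ i, x i + (n : ℤ)) % 2 = 0) :
    (⨆ y ∈ cubeF a L, f y) - f x ≤
      ∑ v ∈ box d L with (∑ i, v i) % 2 = 0, |f x - f (x - v)| := by
  have hg : 0 ≤ ∑ v ∈ box d L with (∑ i, v i) % 2 = 0, |f x - f (x - v)| :=
    Finset.sum_nonneg fun _ _ => abs_nonneg _
  rw [sub_le_iff_le_add]
  refine Real.iSup_le (fun y => Real.iSup_le (fun hy => ?_) (add_nonneg hg (hf x)))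
    (add_nonneg hg (hf x))
  by_cases hyn : (∑ i, y i + (n : ℤ)) % 2 = 0
  · have hmem : x - y ∈ (box d L).filter fun v => (∑ i, v i) % 2 = 0 := by
      rw [Finset.mem_filter]
      constructor
      · rw [box, Fintype.mem_piFinset]
        intro i
        rw [cubeF, Fintype.mem_piFinset] at hx hy
        have h1 := Finset.mem_Ico.1 (hx i)
        have h2 := Finset.mem_Ico.1 (hy i)
        rw [Finset.mem_Icc, Pi.sub_apply]
        omega
      · simp only [Pi.sub_apply, Finset.sum_sub_distrib]
        omega
    have h1 := Finset.single_le_sum (f := fun v => |f x - f (x - v)|)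
      (fun _ _ => abs_nonneg _) hmem
    simp only [sub_sub_cancel] at h1
    linarith [neg_abs_le (f x - f y)]
  · rw [hpar y hyn]
    exact add_nonneg hg (hf x)

/-- Total oscillation of the one-point function over the cubes of a partition. -/
lemma tsum_oscillation_le {n L : ℕ} {D : ℝ} (hD : 0 ≤ D) (p : AddMonoidAlgebra ℝ (Site d))
    (hp : ∀ x, 0 ≤ p.coeff x) (hpar : ∀ x, (∑ i, x i + (n : ℤ)) % 2 ≠ 0 → p.coeff x = 0)
    (hdiff : ∀ v : Site d, (∑ i, v i) % 2 = 0 →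
      n1 ((1 - AddMonoidAlgebra.single v (1 : ℝ)) * p) ≤ nr v * D)
    {S : Set (Site d)} (hS : IsCubePartition L S) :
    (∑' a : S, ∑ x ∈ cubeF (a : Site d) L, (if (∑ i, x i + (n : ℤ)) % 2 = 0 then
      (⨆ y ∈ cubeF (a : Site d) L, p.coeff y) - p.coeff x else 0)) ≤
      (2 * L + 1) ^ d * (d * L * D) := by
  classical
  refine tsum_le_of_sum_le' (by positivity) fun F => ?_
  have hterm : ∀ a : S, ∀ x ∈ cubeF (a : Site d) L,
      (if (∑ i, x i + (n : ℤ)) % 2 = 0 then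
        (⨆ y ∈ cubeF (a : Site d) L, p.coeff y) - p.coeff x else 0) ≤
      ∑ v ∈ box d L with (∑ i, v i) % 2 = 0, |p.coeff x - p.coeff (x - v)| := by
    intro a x hx
    split_ifs with h
    · exact iSup_cubeF_sub_le hp hpar hx h
    · exact Finset.sum_nonneg fun _ _ => abs_nonneg _
  have hdisj : Set.PairwiseDisjoint (F : Set S) fun a : S => cubeF (a : Site d) L := by
    intro a _ b _ hab
    have h := hS.2 a a.2 b b.2 fun h => hab (Subtype.ext h)
    have hc : ∀ a : Site d, (cubeF a L : Set (Site d)) = cube a L := by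
      intro a
      ext x
      simp [cubeF, cube]
    rw [Function.onFun, ← Finset.disjoint_coe, hc, hc]
    exact h
  calc _ ≤ ∑ a ∈ F, ∑ x ∈ cubeF (a : Site d) L,
        ∑ v ∈ box d L with (∑ i, v i) % 2 = 0, |p.coeff x - p.coeff (x - v)| :=
        Finset.sum_le_sum fun a _ => Finset.sum_le_sum fun x hx => hterm a x hx
    _ = ∑ v ∈ box d L with (∑ i, v i) % 2 = 0,
        ∑ x ∈ F.biUnion fun a : S => cubeF (a : Site d) L, |p.coeff x - p.coeff (x - v)| := by
        rw [← Finset.sum_biUnion hdisj, Finset.sum_comm]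
    _ ≤ ∑ v ∈ box d L with (∑ i, v i) % 2 = 0, d * L * D := by
        refine Finset.sum_le_sum fun v hv => ?_
        rw [Finset.mem_filter] at hv
        simp only [← coeff_one_sub_single_mul]
        refine (sum_abs_le_n1 _ _).trans ((hdiff v hv.2).trans ?_)
        refine mul_le_mul_of_nonneg_right ?_ hD
        refine (Finset.sum_le_card_nsmul _ _ (L : ℝ) fun i _ => mem_box.1 hv.1 i).trans ?_
        simp
    _ ≤ ∑ v ∈ box d L, d * L * D :=
        Finset.sum_le_sum_of_subset_of_nonneg (Finset.filter_subset _ _) fun _ _ _ => by positivity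
    _ = _ := by
        rw [Finset.sum_const, card_box, nsmul_eq_mul]
        push_cast
        ring

end

/-- Annealed estimates for a fixed time: pointwise bound, spatial and
temporal derivative bounds, and the averaged bound over a partition into cubes of
side length `n^ε`. -/
theorem statement13 (d : ℕ) (hd : 4 ≤ d)
    (P : Measure (Env d)) [IsProbabilityMeasure P]
    (Pq : Env d → Site d → Measure (Path d)) (hPq : IsQuenchedFamily Pq)
    (hUE : UniformlyElliptic P) (hIID : IsIID P) (hCond : CondP P Pq) :
    (∃ C : ℝ, 0 < C ∧ ∃ n₀ : ℕ, ∀ n : ℕ, n₀ ≤ n → ∀ x y z w : Site d,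
      norm1 (x - y) = 1 → norm1 (z - w) = 1 →
      (ann P Pq z {p : Path d | p n = x}).toReal ≤ C * (n : ℝ) ^ (-(d : ℝ) / 2) ∧
      |(ann P Pq z {p : Path d | p n = x}).toReal -
        (ann P Pq z {p : Path d | p (n + 1) = y}).toReal|
        ≤ C * (n : ℝ) ^ (-((d : ℝ) + 1) / 2) ∧
      |(ann P Pq z {p : Path d | p n = x}).toReal -
        (ann P Pq w {p : Path d | p (n + 1) = x}).toReal|
        ≤ C * (n : ℝ) ^ (-((d : ℝ) + 1) / 2)) ∧
    ∀ ε : ℝ, 0 < ε → ∃ C : ℝ, 0 < C ∧ ∀ n : ℕ, ∀ S : Set (Site d),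
      IsCubePartition ⌈(n : ℝ) ^ ε⌉₊ S →
      (∑' a : S, ∑ x ∈ cubeF (a : Site d) ⌈(n : ℝ) ^ ε⌉₊,
        (if (∑ i, x i + (n : ℤ)) % 2 = 0 then
          (⨆ y ∈ cubeF (a : Site d) ⌈(n : ℝ) ^ ε⌉₊,
            (ann P Pq 0 {p : Path d | p n = y}).toReal) -
            (ann P Pq 0 {p : Path d | p n = x}).toReal
        else 0))
        ≤ C * (n : ℝ) ^ (-(1 : ℝ) / 2 + 3 * (d : ℝ) * ε) := by
  have hd0 : 0 < d := by omega
  obtain ⟨η, hG⟩ := good_of_isIID hIID hUE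
  obtain ⟨γ, hγ, -, ℓ, h2, hT⟩ := hCond
  obtain ⟨κ₀, hcone₀⟩ := cone_of_tg hd0 hG hγ (tg_of_condTAt hG hPq h2 hT)
  obtain ⟨κ, hcone⟩ := cone_improve hd0 hG h2 hγ hcone₀
  constructor
  · obtain ⟨C, hC, hle⟩ := hG.exists_coeff_walkSeries_le hd h2 hcone
    obtain ⟨D, hD, hdiff⟩ := hG.exists_abs_coeff_succ_sub_le hd h2 hcone
    refine ⟨C + D, by positivity, 1, fun n hn x y z w hxy hzw => ?_⟩
    have hn0 : (0 : ℝ) ≤ n := n.cast_nonneg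
    have hdiff' : ∀ (u : Site d) s, |(PowerSeries.coeff n (walkSeries P)).coeff u -
        (PowerSeries.coeff (n + 1) (walkSeries P)).coeff (u + stepVec s)| ≤
        (C + D) * (n : ℝ) ^ (-((d : ℝ) + 1) / 2) := by
      intro u s
      refine (hdiff n hn u s).trans ?_
      rw [div_sqrt_pow_eq _ hn0]
      push_cast
      exact mul_le_mul_of_nonneg_right (by linarith) (by positivity)
    rw [hG.toReal_ann_eval hPq, hG.toReal_ann_eval hPq, hG.toReal_ann_eval hPq]
    refine ⟨?_, ?_, ?_⟩
    · refine (hle n hn _).trans ?_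
      rw [div_sqrt_pow_eq _ hn0]
      exact mul_le_mul_of_nonneg_right (by linarith) (by positivity)
    · obtain ⟨s, hs⟩ := exists_stepVec_eq_of_norm1 (v := y - x) (by
        rw [← hxy, norm1, norm1]
        exact Finset.sum_congr rfl fun i _ => abs_sub_comm _ _)
      have h := hdiff' (x - z) s
      rwa [← hs, add_comm (x - z), sub_add_sub_cancel] at h
    · obtain ⟨s, hs⟩ := exists_stepVec_eq_of_norm1 hzw
      have h := hdiff' (x - z) s
      rwa [← hs, sub_add_sub_cancel] at h
  · intro ε hε
    obtain ⟨D, hD, hdiff⟩ := hG.exists_n1_one_sub_single_le hd h2 hcone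
    refine ⟨6 ^ d * (d * 2 * D), by positivity, fun n S hS => ?_⟩
    simp only [hG.toReal_ann_eval hPq, sub_zero]
    rcases Nat.eq_zero_or_pos n with rfl | hn
    · exfalso
      obtain ⟨a, -, ha⟩ := hS.1 0
      have h := ha ⟨0, hd0⟩
      simp only [Nat.cast_zero, Real.zero_rpow hε.ne', Nat.ceil_zero] at h
      omega
    have hn1 : (1 : ℝ) ≤ n := by exact_mod_cast hn
    have hn0 : (0 : ℝ) < n := by linarith
    have hpow : (1 : ℝ) ≤ (n : ℝ) ^ ε := Real.one_le_rpow hn1 hε.le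
    refine (tsum_oscillation_le (D := D / √(n : ℝ)) (by positivity) _
      (coeff_walkSeries_nonneg P n) (fun x hx => coeff_walkSeries_eq_zero hx)
      (hdiff n hn) hS).trans ?_
    set L := ⌈(n : ℝ) ^ ε⌉₊ with hL
    have hL2 : (L : ℝ) ≤ 2 * (n : ℝ) ^ ε := by
      have := Nat.ceil_lt_add_one (by positivity : (0 : ℝ) ≤ (n : ℝ) ^ ε)
      linarith
    have hL1 : (1 : ℝ) ≤ L := hpow.trans (Nat.le_ceil _)
    have hsq : D / √(n : ℝ) = D * (n : ℝ) ^ (-(1 : ℝ) / 2) := by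
      have := div_sqrt_pow_eq D hn0.le 1
      simpa using this
    calc (2 * (L : ℝ) + 1) ^ d * (d * L * (D / √(n : ℝ)))
        ≤ (6 * (n : ℝ) ^ ε) ^ d * (d * (2 * (n : ℝ) ^ ε) * (D / √(n : ℝ))) := by
          gcongr
          linarith
      _ = 6 ^ d * (d * 2 * D) * ((n : ℝ) ^ (-(1 : ℝ) / 2) * ((n : ℝ) ^ ε) ^ (d + 1)) := by
          rw [hsq]
          ring
      _ ≤ _ := by
          refine mul_le_mul_of_nonneg_left ?_ (by positivity)
          rw [Real.rpow_add hn0, ← Real.rpow_natCast, ← Real.rpow_mul hn0.le]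
          refine mul_le_mul_of_nonneg_left (Real.rpow_le_rpow_of_exponent_le hn1 ?_)
            (by positivity)
          have h4 : (4 : ℝ) ≤ d := by exact_mod_cast hd
          push_cast
          nlinarith

end RWRE
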